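/- Let $d \ge 2$, $s \in \left(\frac{d}{2d-1}, 1\right)$, and let $(q,r), (\tilde q, \tilde r) \in [2,\infty]^2$ satisfy $\frac{2s}{q} = d\left(\frac{1}{2} - \frac{1}{r}\right)$ and $\frac{2s}{\tilde q} = d\left(\frac{1}{2} - \frac{1}{\tilde r}\right)$. There is a constant $C$ (depending on $d, s, q, r, \tilde q, \tilde r$) such that for every continuous compactly supported map $F : \mathbb{R} \to \mathcal{S}(\mathbb{R}^d)$ with $F(t,\cdot)$ radial for each $t$: $\left\| \int_0^t e^{-i(t-t')(-\Delta)^s} F(t')\, dt' \right\|_{L^q_t L^r_x(\mathbb{R} \times \mathbb{R}^d)} \le C\, \|F\|_{L^{\tilde q'}_t L^{\tilde r'}_x(\mathbb{R} \times \mathbb{R}^d)}$, where $\tilde q', \tilde r'$ are the conjugate exponents ($\frac{1}{\tilde q} + \frac{1}{\tilde q'} = 1$, $\frac{1}{\tilde r} + \frac{1}{\tilde r'} = 1$). -/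

import Mathlib

open MeasureTheory Complex
open scoped ENNReal BigOperators RealInnerProductSpace

noncomputable section

abbrev Ed (d : ℕ) := EuclideanSpace ℝ (Fin d)

/-- Fourier transform with convention `(𝓕 f) ξ = ∫ e^{-i x·ξ} f x dx`. -/
def FT {d : ℕ} (f : Ed d → ℂ) (ξ : Ed d) : ℂ :=
  ∫ x : Ed d, Complex.exp (-Complex.I * ((⟪x, ξ⟫ : ℝ) : ℂ)) * f x

/-- Inverse Fourier transform `(2π)^{-d} ∫ e^{i x·ξ} g ξ dξ`. -/
def FTinv {d : ℕ} (g : Ed d → ℂ) (x : Ed d) : ℂ :=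
  (((2 * Real.pi) ^ (-(d : ℝ)) : ℝ) : ℂ) *
    ∫ ξ : Ed d, Complex.exp (Complex.I * ((⟪x, ξ⟫ : ℝ) : ℂ)) * g ξ

/-- Fractional Schrödinger propagator `e^{-it(-Δ)^s}`. -/
def fprop {d : ℕ} (s t : ℝ) (f : Ed d → ℂ) : Ed d → ℂ :=
  FTinv (fun ξ => Complex.exp (-Complex.I * (t : ℂ) * ((‖ξ‖ ^ (2 * s) : ℝ) : ℂ)) * FT f ξ)

/-- Fractional derivative `D^σ = (-Δ)^{σ/2}`, the Fourier multiplier `|ξ|^σ`. -/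
def fracD {d : ℕ} (σ : ℝ) (f : Ed d → ℂ) : Ed d → ℂ :=
  FTinv (fun ξ => ((‖ξ‖ ^ σ : ℝ) : ℂ) * FT f ξ)

/-- `(-Δ)^{β/2} e^{-it(-Δ)^s}`. -/
def fracDProp {d : ℕ} (β s t : ℝ) (f : Ed d → ℂ) : Ed d → ℂ :=
  FTinv (fun ξ => ((‖ξ‖ ^ β : ℝ) : ℂ) *
    Complex.exp (-Complex.I * (t : ℂ) * ((‖ξ‖ ^ (2 * s) : ℝ) : ℂ)) * FT f ξ)

/-- Resolvent `(-Δ + λ)⁻¹`. -/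
def resolv {d : ℕ} (lam : ℝ) (f : Ed d → ℂ) : Ed d → ℂ :=
  FTinv (fun ξ => FT f ξ / ((‖ξ‖ ^ 2 + lam : ℝ) : ℂ))

/-- Resolvent-regularization `u_λ = √(sin(πs)/π) (-Δ+λ)⁻¹ u`. -/
def reg {d : ℕ} (s lam : ℝ) (f : Ed d → ℂ) : Ed d → ℂ :=
  fun x => ((Real.sqrt (Real.sin (Real.pi * s) / Real.pi) : ℝ) : ℂ) * resolv lam f x

/-- A function is radial if its value depends only on `|x|`. -/
def IsRadial {d : ℕ} (f : Ed d → ℂ) : Prop :=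
  ∀ x y : Ed d, ‖x‖ = ‖y‖ → f x = f y

/-- Homogeneous Sobolev norm `‖f‖_{Ḣ^s} = (2π)^{-d/2} ‖ |ξ|^s 𝓕f ‖_{L²}`. -/
def HdotNorm {d : ℕ} (s : ℝ) (f : Ed d → ℂ) : ℝ :=
  (2 * Real.pi) ^ (-(d : ℝ) / 2) *
    (eLpNorm (fun ξ : Ed d => ((‖ξ‖ ^ s : ℝ) : ℂ) * FT f ξ) 2 volume).toReal

/-- Inhomogeneous Sobolev norm `‖f‖_{H^s}² = ‖f‖_{L²}² + ‖f‖_{Ḣ^s}²`. -/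
def HNorm {d : ℕ} (s : ℝ) (f : Ed d → ℂ) : ℝ :=
  Real.sqrt ((eLpNorm f 2 volume).toReal ^ 2 + HdotNorm s f ^ 2)

/-- Mixed space-time norm `L^q_t L^r_x (ℝ × ℝ^d)`. -/
def mixedNorm {d : ℕ} (q r : ℝ≥0∞) (F : ℝ → Ed d → ℂ) : ℝ≥0∞ :=
  eLpNorm (fun t => (eLpNorm (F t) r volume).toReal) q volume

/-- Partial derivative `∂_j` of a complex-valued function. -/
def pd {d : ℕ} (j : Fin d) (f : Ed d → ℂ) (x : Ed d) : ℂ :=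
  fderiv ℝ f x (EuclideanSpace.single j 1)

/-- Partial derivative `∂_j` of a real-valued function. -/
def pdR {d : ℕ} (j : Fin d) (f : Ed d → ℝ) (x : Ed d) : ℝ :=
  fderiv ℝ f x (EuclideanSpace.single j 1)

/-- Laplacian of a real-valued function. -/
def lapR {d : ℕ} (f : Ed d → ℝ) : Ed d → ℝ :=
  fun x => ∑ j : Fin d, pdR j (pdR j f) x

/-- Rescaling `χ_R(x) = χ(x/R)`. -/
def chiR {d : ℕ} (χ : Ed d → ℝ) (R : ℝ) : Ed d → ℝ :=
  fun x => χ (R⁻¹ • x)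


/-- Squared `H^{1/2}` norm `(2π)^{-d} ∫ (1+|ξ|²)^{1/2} |𝓕u(ξ)|² dξ`. -/
def H12sq {d : ℕ} (f : Ed d → ℂ) : ℝ :=
  (2 * Real.pi) ^ (-(d : ℝ)) * ∫ ξ : Ed d, (1 + ‖ξ‖ ^ 2) ^ ((1 : ℝ)/2) * ‖FT f ξ‖ ^ 2


/-! ### A smooth dyadic partition of the half-line -/

/-- A smooth cutoff equal to `1` on `(-∞, 1]` and to `0` on `[2, ∞)`. -/
def lowCut (x : ℝ) : ℝ := Real.smoothTransition (2 - x)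

/-- A smooth bump supported in `[1/2, 2]` whose dyadic dilates sum to `1` on `(0, ∞)`. -/
def dyBump (x : ℝ) : ℝ := lowCut x - lowCut (2 * x)

theorem lowCut_antitone : Antitone lowCut := fun _ _ h =>
  Real.smoothTransition.monotone (by linarith)

theorem lowCut_nonneg (x : ℝ) : 0 ≤ lowCut x := Real.smoothTransition.nonneg _

theorem lowCut_le_one (x : ℝ) : lowCut x ≤ 1 := Real.smoothTransition.le_one _

theorem lowCut_of_le {x : ℝ} (h : x ≤ 1) : lowCut x = 1 :=
  Real.smoothTransition.one_of_one_le (by linarith)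

theorem lowCut_of_ge {x : ℝ} (h : 2 ≤ x) : lowCut x = 0 :=
  Real.smoothTransition.zero_of_nonpos (by linarith)

theorem contDiff_dyBump : ContDiff ℝ (⊤ : ℕ∞) dyBump := by
  unfold dyBump lowCut
  exact (Real.smoothTransition.contDiff.comp (by fun_prop)).sub
    (Real.smoothTransition.contDiff.comp (by fun_prop))

theorem dyBump_of_le {x : ℝ} (h : x ≤ 1 / 2) : dyBump x = 0 := by
  rw [dyBump, lowCut_of_le (by linarith), lowCut_of_le (by linarith), sub_self]

theorem dyBump_of_ge {x : ℝ} (h : 2 ≤ x) : dyBump x = 0 := by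
  rw [dyBump, lowCut_of_ge (by linarith), lowCut_of_ge (by linarith), sub_self]

theorem dyBump_nonneg (x : ℝ) : 0 ≤ dyBump x := by
  rcases le_total x (1 / 2) with h | h
  · rw [dyBump_of_le h]
  · exact sub_nonneg.2 (lowCut_antitone (by linarith))

theorem dyBump_le_one (x : ℝ) : dyBump x ≤ 1 := by
  have h1 := lowCut_le_one x
  have h2 := lowCut_nonneg (2 * x)
  unfold dyBump
  linarith

theorem continuous_dyBump : Continuous dyBump := contDiff_dyBump.continuous

theorem dyBump_ne_zero {x : ℝ} (h : dyBump x ≠ 0) : 1 / 2 < x ∧ x < 2 :=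
  ⟨lt_of_not_ge fun h' => h (dyBump_of_le h'), lt_of_not_ge fun h' => h (dyBump_of_ge h')⟩

theorem hasCompactSupport_dyBump : HasCompactSupport dyBump :=
  HasCompactSupport.intro (isCompact_Icc (a := (1 / 2 : ℝ)) (b := 2)) fun x hx => by
    by_contra h
    exact hx ⟨(dyBump_ne_zero h).1.le, (dyBump_ne_zero h).2.le⟩

theorem sum_dyBump (L : ℕ) (x : ℝ) :
    ∑ n ∈ Finset.Icc (-(L : ℤ)) L, dyBump ((2 : ℝ) ^ (-n) * x) =
      lowCut ((2 : ℝ) ^ (-(L : ℤ)) * x) - lowCut ((2 : ℝ) ^ ((L : ℤ) + 1) * x) := by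
  induction L with
  | zero => simp [dyBump]
  | succ L ih =>
    have hI : Finset.Icc (-((L + 1 : ℕ) : ℤ)) ((L + 1 : ℕ) : ℤ) =
        insert (-((L : ℤ) + 1)) (insert ((L : ℤ) + 1) (Finset.Icc (-(L : ℤ)) L)) := by
      ext n
      simp only [Finset.mem_Icc, Finset.mem_insert]
      push_cast
      omega
    rw [hI, Finset.sum_insert, Finset.sum_insert, ih]
    · unfold dyBump
      have h1 : 2 * ((2 : ℝ) ^ (-((L : ℤ) + 1)) * x) = (2 : ℝ) ^ (-(L : ℤ)) * x := by
        rw [← mul_assoc]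
        congr 1
        rw [show (-(L : ℤ)) = 1 + (-((L : ℤ) + 1)) by ring, zpow_add₀ (by norm_num)]
        simp
      have h2 : 2 * ((2 : ℝ) ^ (-(-((L : ℤ) + 1))) * x) = (2 : ℝ) ^ ((L : ℤ) + 1 + 1) * x := by
        rw [← mul_assoc]
        congr 1
        rw [neg_neg, zpow_add₀ two_ne_zero ((L : ℤ) + 1) 1, zpow_one, mul_comm]
      rw [h1, h2]
      push_cast
      rw [neg_neg]
      ring
    · simp
    · simp only [Finset.mem_insert, Finset.mem_Icc]
      omega

theorem sum_dyBump_le_one (L : ℕ) (x : ℝ) :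
    ∑ n ∈ Finset.Icc (-(L : ℤ)) L, dyBump ((2 : ℝ) ^ (-n) * x) ≤ 1 := by
  rw [sum_dyBump]
  have h1 := lowCut_le_one ((2 : ℝ) ^ (-(L : ℤ)) * x)
  have h2 := lowCut_nonneg ((2 : ℝ) ^ ((L : ℤ) + 1) * x)
  linarith

theorem sum_dyBump_nonneg (L : ℕ) (x : ℝ) :
    0 ≤ ∑ n ∈ Finset.Icc (-(L : ℤ)) L, dyBump ((2 : ℝ) ^ (-n) * x) :=
  Finset.sum_nonneg fun _ _ => dyBump_nonneg _

theorem sum_dyBump_of_nonpos (L : ℕ) {x : ℝ} (hx : x ≤ 0) :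
    ∑ n ∈ Finset.Icc (-(L : ℤ)) L, dyBump ((2 : ℝ) ^ (-n) * x) = 0 := by
  refine Finset.sum_eq_zero fun n _ => dyBump_of_le ?_
  have : (2 : ℝ) ^ (-n) * x ≤ 0 := mul_nonpos_of_nonneg_of_nonpos (by positivity) hx
  linarith

theorem eventually_sum_dyBump_eq_one {x : ℝ} (hx : 0 < x) :
    ∀ᶠ L : ℕ in Filter.atTop,
      ∑ n ∈ Finset.Icc (-(L : ℤ)) L, dyBump ((2 : ℝ) ^ (-n) * x) = 1 := by
  have ht : Filter.Tendsto (fun L : ℕ => (2 : ℝ) ^ L) Filter.atTop Filter.atTop :=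
    tendsto_pow_atTop_atTop_of_one_lt (by norm_num)
  filter_upwards [ht.eventually_ge_atTop x, ht.eventually_ge_atTop (1 / x)] with L h1 h2
  rw [sum_dyBump, lowCut_of_le, lowCut_of_ge, sub_zero]
  · rw [zpow_add₀ (by norm_num), zpow_natCast, zpow_one]
    rw [div_le_iff₀ hx] at h2
    linarith
  · rw [zpow_neg, zpow_natCast, inv_mul_le_iff₀ (by positivity)]
    linarith

theorem exists_fourier_dyBump :
    ∃ ψ : ℝ → ℂ, Integrable ψ ∧
      ∀ t : ℝ, (dyBump t : ℂ) = ∫ τ, ψ τ * Complex.exp (I * ((2 * Real.pi * τ * t : ℝ) : ℂ)) := by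
  have hc : HasCompactSupport (fun x => (dyBump x : ℂ)) :=
    hasCompactSupport_dyBump.comp_left (g := fun x : ℝ => (x : ℂ)) (by simp)
  have hd : ContDiff ℝ (⊤ : ℕ∞) (fun x => (dyBump x : ℂ)) :=
    Complex.ofRealCLM.contDiff.comp contDiff_dyBump
  let f : SchwartzMap ℝ ℂ := hc.toSchwartzMap hd
  refine ⟨FourierTransform.fourier f, (FourierTransform.fourier f).integrable, fun t => ?_⟩
  have h : FourierTransformInv.fourierInv (FourierTransform.fourier f) t = f t := by
    rw [FourierTransform.fourierInv_fourier_eq]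
  rw [show (dyBump t : ℂ) = f t from rfl, ← h, SchwartzMap.fourierInv_coe, Real.fourierInv_eq']
  refine integral_congr_ae (Filter.Eventually.of_forall fun τ => ?_)
  simp only [smul_eq_mul]
  rw [mul_comm]
  congr 2
  simp
  ring

/-! ### Oscillatory integrals -/

/-- First derivative test with a monotone phase derivative and a `C¹` amplitude. -/
theorem norm_oscillatory_le_of_deriv_ge {α β η G G₁ : ℝ} {p p' p'' : ℝ → ℝ} {g g' : ℝ → ℂ}
    (hαβ : α ≤ β) (hη : 0 < η)
    (hp : ∀ x ∈ Set.Icc α β, HasDerivAt p (p' x) x)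
    (hp' : ∀ x ∈ Set.Icc α β, HasDerivAt p' (p'' x) x)
    (hp''c : ContinuousOn p'' (Set.Icc α β))
    (hp''0 : ∀ x ∈ Set.Icc α β, 0 ≤ p'' x)
    (hge : ∀ x ∈ Set.Icc α β, η ≤ p' x)
    (hg : ∀ x ∈ Set.Icc α β, HasDerivAt g (g' x) x)
    (hg'c : ContinuousOn g' (Set.Icc α β))
    (hG : ∀ x ∈ Set.Icc α β, ‖g x‖ ≤ G)
    (hG₁ : ∀ x ∈ Set.Icc α β, ‖g' x‖ ≤ G₁) :
    ‖∫ x in α..β, g x * Complex.exp (I * (p x : ℂ))‖ ≤ (3 * G + G₁ * (β - α)) / η := by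
  have hI : Set.uIcc α β = Set.Icc α β := Set.uIcc_of_le hαβ
  have hpos : ∀ x ∈ Set.Icc α β, 0 < p' x := fun x hx => hη.trans_le (hge x hx)
  have hαm : α ∈ Set.Icc α β := ⟨le_rfl, hαβ⟩
  have hβm : β ∈ Set.Icc α β := ⟨hαβ, le_rfl⟩
  have hG0 : 0 ≤ G := (norm_nonneg _).trans (hG α hαm)
  have hG₁0 : 0 ≤ G₁ := (norm_nonneg _).trans (hG₁ α hαm)
  have hpc : ContinuousOn p (Set.Icc α β) := fun x hx => (hp x hx).continuousAt.continuousWithinAt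
  have hp'c : ContinuousOn p' (Set.Icc α β) :=
    fun x hx => (hp' x hx).continuousAt.continuousWithinAt
  have hgc : ContinuousOn g (Set.Icc α β) := fun x hx => (hg x hx).continuousAt.continuousWithinAt
  have hec : ContinuousOn (fun x => Complex.exp (I * (p x : ℂ))) (Set.Icc α β) :=
    (continuousOn_const.mul (Complex.continuous_ofReal.comp_continuousOn hpc)).cexp
  have hp'C : ContinuousOn (fun x => (p' x : ℂ)) (Set.Icc α β) :=
    Complex.continuous_ofReal.comp_continuousOn hp'c
  have hp''C : ContinuousOn (fun x => (p'' x : ℂ)) (Set.Icc α β) :=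
    Complex.continuous_ofReal.comp_continuousOn hp''c
  have hne : ∀ x ∈ Set.Icc α β, (p' x : ℂ) ≠ 0 := fun x hx =>
    Complex.ofReal_ne_zero.2 (hpos x hx).ne'
  let H : ℝ → ℂ := fun x => g x * Complex.exp (I * (p x : ℂ)) / (I * (p' x : ℂ))
  let K : ℝ → ℂ := fun x =>
    Complex.exp (I * (p x : ℂ)) * (g' x * (p' x : ℂ) - g x * (p'' x : ℂ)) / (I * (p' x : ℂ) ^ 2)
  have hH : ∀ x ∈ Set.uIcc α β,
      HasDerivAt H (g x * Complex.exp (I * (p x : ℂ)) + K x) x := by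
    intro x hx
    rw [hI] at hx
    have h1 : HasDerivAt (fun x => Complex.exp (I * (p x : ℂ)))
        (Complex.exp (I * (p x : ℂ)) * (I * (p' x : ℂ))) x :=
      ((hp x hx).ofReal_comp.const_mul I).cexp
    have h2 : HasDerivAt (fun x => I * (p' x : ℂ)) (I * (p'' x : ℂ)) x :=
      (hp' x hx).ofReal_comp.const_mul I
    have hnx := hne x hx
    refine (((hg x hx).fun_mul h1).fun_div h2 (mul_ne_zero I_ne_zero hnx)).congr_deriv ?_
    rw [show K x = Complex.exp (I * (p x : ℂ)) * (g' x * (p' x : ℂ) - g x * (p'' x : ℂ)) /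
      (I * (p' x : ℂ) ^ 2) from rfl]
    field_simp
    ring_nf
  have hKc : ContinuousOn K (Set.Icc α β) :=
    (hec.mul ((hg'c.mul hp'C).sub (hgc.mul hp''C))).div
      (continuousOn_const.mul (hp'C.pow 2))
      fun x hx => mul_ne_zero I_ne_zero (pow_ne_zero 2 (hne x hx))
  have hKi : IntervalIntegrable K volume α β := ContinuousOn.intervalIntegrable (by rwa [hI])
  have hfi : IntervalIntegrable (fun x => g x * Complex.exp (I * (p x : ℂ))) volume α β :=
    ContinuousOn.intervalIntegrable (by rw [hI]; exact hgc.mul hec)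
  have hFTC := intervalIntegral.integral_eq_sub_of_hasDerivAt hH (hfi.add hKi)
  rw [intervalIntegral.integral_add hfi hKi] at hFTC
  have hnH : ∀ x ∈ Set.Icc α β, ‖H x‖ ≤ G / η := by
    intro x hx
    simp only [H, norm_div, norm_mul, norm_I, one_mul, Complex.norm_real]
    rw [mul_comm I, Complex.norm_exp_ofReal_mul_I, mul_one, Real.norm_eq_abs,
      abs_of_pos (hpos x hx)]
    exact div_le_div₀ hG0 (hG x hx) hη (hge x hx)
  have hrd : ∀ x ∈ Set.uIcc α β,
      HasDerivAt (fun x => G₁ / η * x + G * (-(p' x)⁻¹)) (G₁ / η + G * (p'' x / (p' x) ^ 2)) x := by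
    intro x hx
    rw [hI] at hx
    have h1 : HasDerivAt (fun x => -(p' x)⁻¹) (p'' x / (p' x) ^ 2) x :=
      ((hp' x hx).fun_inv (hpos x hx).ne').fun_neg.congr_deriv (by rw [neg_div, neg_neg])
    exact (((hasDerivAt_id x).const_mul (G₁ / η)).fun_add (h1.const_mul G)).congr_deriv (by simp)
  have hbc : ContinuousOn (fun x => G₁ / η + G * (p'' x / (p' x) ^ 2)) (Set.Icc α β) :=
    continuousOn_const.add (continuousOn_const.mul
      (hp''c.div (hp'c.pow 2) fun x hx => pow_ne_zero 2 (hpos x hx).ne'))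
  have hbi : IntervalIntegrable (fun x => G₁ / η + G * (p'' x / (p' x) ^ 2)) volume α β :=
    ContinuousOn.intervalIntegrable (by rwa [hI])
  have hKle : ‖∫ x in α..β, K x‖ ≤ ∫ x in α..β, (G₁ / η + G * (p'' x / (p' x) ^ 2)) := by
    refine intervalIntegral.norm_integral_le_of_norm_le hαβ
      (Filter.Eventually.of_forall fun x hx => ?_) hbi
    have hx : x ∈ Set.Icc α β := ⟨hx.1.le, hx.2⟩
    have hpx := hpos x hx
    simp only [K, norm_div, norm_mul, norm_I, one_mul, norm_pow, Complex.norm_real]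
    rw [mul_comm I, Complex.norm_exp_ofReal_mul_I, one_mul, Real.norm_eq_abs, abs_of_pos hpx]
    have h1 : ‖g' x * (p' x : ℂ) - g x * (p'' x : ℂ)‖ ≤ G₁ * p' x + G * p'' x := by
      refine (norm_sub_le _ _).trans ?_
      simp only [norm_mul, Complex.norm_real, Real.norm_eq_abs, abs_of_pos hpx,
        abs_of_nonneg (hp''0 x hx)]
      exact add_le_add (mul_le_mul_of_nonneg_right (hG₁ x hx) hpx.le)
        (mul_le_mul_of_nonneg_right (hG x hx) (hp''0 x hx))
    refine (div_le_div_of_nonneg_right h1 (by positivity)).trans ?_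
    rw [add_div]
    refine add_le_add ?_ (le_of_eq (by ring))
    rw [show G₁ * p' x / p' x ^ 2 = G₁ / p' x by field_simp]
    exact div_le_div_of_nonneg_left hG₁0 hη (hge x hx)
  rw [intervalIntegral.integral_eq_sub_of_hasDerivAt hrd hbi] at hKle
  have h4 : (p' α)⁻¹ ≤ η⁻¹ := inv_anti₀ hη (hge α hαm)
  have h5 : 0 ≤ (p' β)⁻¹ := (inv_pos.2 (hpos β hβm)).le
  have h6 : (∫ x in α..β, g x * Complex.exp (I * (p x : ℂ))) = H β - H α - ∫ x in α..β, K x := by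
    rw [← hFTC]; ring
  rw [h6]
  refine (norm_sub_le _ _).trans ((add_le_add (norm_sub_le _ _) hKle).trans ?_)
  have h7 := hnH α hαm
  have h8 := hnH β hβm
  have h9 : G * ((p' α)⁻¹ - (p' β)⁻¹) ≤ G * η⁻¹ := mul_le_mul_of_nonneg_left (by linarith) hG0
  have h10 : (3 * G + G₁ * (β - α)) / η = G / η + G / η + (G₁ / η * β - G₁ / η * α + G * η⁻¹) := by
    field_simp
    ring
  rw [h10]
  nlinarith

/-- One half of the second derivative test, on an interval starting at the critical point. -/
theorem norm_oscillatory_le_of_deriv_ge_mul {α β ν G G₁ : ℝ} {p p' p'' : ℝ → ℝ} {g g' : ℝ → ℂ}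
    (hαβ : α ≤ β) (hν : 0 < ν)
    (hp : ∀ x ∈ Set.Icc α β, HasDerivAt p (p' x) x)
    (hp' : ∀ x ∈ Set.Icc α β, HasDerivAt p' (p'' x) x)
    (hp''c : ContinuousOn p'' (Set.Icc α β))
    (hp''0 : ∀ x ∈ Set.Icc α β, 0 ≤ p'' x)
    (hge : ∀ x ∈ Set.Icc α β, ν * (x - α) ≤ p' x)
    (hg : ∀ x ∈ Set.Icc α β, HasDerivAt g (g' x) x)
    (hg'c : ContinuousOn g' (Set.Icc α β))
    (hG : ∀ x ∈ Set.Icc α β, ‖g x‖ ≤ G)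
    (hG₁ : ∀ x ∈ Set.Icc α β, ‖g' x‖ ≤ G₁) :
    ‖∫ x in α..β, g x * Complex.exp (I * (p x : ℂ))‖ ≤ (4 * G + G₁ * (β - α)) / √ν := by
  have hαm : α ∈ Set.Icc α β := ⟨le_rfl, hαβ⟩
  have hG0 : 0 ≤ G := (norm_nonneg _).trans (hG α hαm)
  have hG₁0 : 0 ≤ G₁ := (norm_nonneg _).trans (hG₁ α hαm)
  have hs : 0 < √ν := Real.sqrt_pos.2 hν
  have hcont : ContinuousOn (fun x => g x * Complex.exp (I * (p x : ℂ))) (Set.Icc α β) :=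
    fun x hx => ((hg x hx).continuousAt.mul ((continuousAt_const.mul
      (Complex.continuous_ofReal.continuousAt.comp (hp x
        hx).continuousAt)).cexp)).continuousWithinAt
  have hnorm : ∀ x ∈ Set.Icc α β, ‖g x * Complex.exp (I * (p x : ℂ))‖ ≤ G := by
    intro x hx
    rw [norm_mul, mul_comm I, Complex.norm_exp_ofReal_mul_I, mul_one]
    exact hG x hx
  have hV : 0 ≤ G₁ * (β - α) := mul_nonneg hG₁0 (by linarith)
  rcases le_total β (α + 1 / √ν) with h | h
  · have h1 := intervalIntegral.norm_integral_le_of_norm_le_const (a := α) (b := β) (C := G)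
      (f := fun x => g x * Complex.exp (I * (p x : ℂ))) fun x hx => by
        rw [Set.uIoc_of_le hαβ] at hx
        exact hnorm x ⟨hx.1.le, hx.2⟩
    refine h1.trans ?_
    rw [abs_of_nonneg (by linarith), le_div_iff₀ hs]
    have h2 : (β - α) * √ν ≤ 1 := by
      rw [← le_div_iff₀ hs]; linarith
    nlinarith
  · set c := α + 1 / √ν with hc
    have hαc : α ≤ c := by rw [hc]; have : 0 < 1 / √ν := by positivity
                           linarith
    have hsub : Set.Icc c β ⊆ Set.Icc α β := Set.Icc_subset_Icc_left hαc
    have hi1 : IntervalIntegrable (fun x => g x * Complex.exp (I * (p x : ℂ))) volume α c :=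
      ContinuousOn.intervalIntegrable (hcont.mono (by
        rw [Set.uIcc_of_le hαc]; exact Set.Icc_subset_Icc_right h))
    have hi2 : IntervalIntegrable (fun x => g x * Complex.exp (I * (p x : ℂ))) volume c β :=
      ContinuousOn.intervalIntegrable (hcont.mono (by rw [Set.uIcc_of_le h]; exact hsub))
    rw [← intervalIntegral.integral_add_adjacent_intervals hi1 hi2]
    have h1 := intervalIntegral.norm_integral_le_of_norm_le_const (a := α) (b := c) (C := G)
      (f := fun x => g x * Complex.exp (I * (p x : ℂ))) fun x hx => by
        rw [Set.uIoc_of_le hαc] at hx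
        exact hnorm x ⟨hx.1.le, hx.2.trans h⟩
    have h2 := norm_oscillatory_le_of_deriv_ge (η := √ν) h hs (fun x hx => hp x (hsub hx))
      (fun x hx => hp' x (hsub hx)) (hp''c.mono hsub) (fun x hx => hp''0 x (hsub hx))
      (fun x hx => by
        refine le_trans ?_ (hge x (hsub hx))
        have : 1 / √ν ≤ x - α := by have := hx.1; rw [hc] at this; linarith
        calc √ν = ν * (1 / √ν) := by
              rw [mul_one_div, eq_div_iff hs.ne', Real.mul_self_sqrt hν.le]
          _ ≤ ν * (x - α) := mul_le_mul_of_nonneg_left this hν.le)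
      (fun x hx => hg x (hsub hx)) (hg'c.mono hsub) (fun x hx => hG x (hsub hx))
      (fun x hx => hG₁ x (hsub hx))
    refine (norm_add_le _ _).trans ((add_le_add h1 h2).trans ?_)
    rw [abs_of_nonneg (by linarith), show c - α = 1 / √ν by rw [hc]; ring, mul_one_div, ← add_div]
    refine div_le_div_of_nonneg_right ?_ hs.le
    nlinarith

/-- The second derivative test with a `C¹` amplitude. -/
theorem norm_oscillatory_le_of_deriv2_ge {α β ν G G₁ : ℝ} {p p' p'' : ℝ → ℝ} {g g' : ℝ → ℂ}
    (hαβ : α ≤ β) (hν : 0 < ν)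
    (hp : ∀ x ∈ Set.Icc α β, HasDerivAt p (p' x) x)
    (hp' : ∀ x ∈ Set.Icc α β, HasDerivAt p' (p'' x) x)
    (hp''c : ContinuousOn p'' (Set.Icc α β))
    (hge : ∀ x ∈ Set.Icc α β, ν ≤ p'' x)
    (hg : ∀ x ∈ Set.Icc α β, HasDerivAt g (g' x) x)
    (hg'c : ContinuousOn g' (Set.Icc α β))
    (hG : ∀ x ∈ Set.Icc α β, ‖g x‖ ≤ G)
    (hG₁ : ∀ x ∈ Set.Icc α β, ‖g' x‖ ≤ G₁) :
    ‖∫ x in α..β, g x * Complex.exp (I * (p x : ℂ))‖ ≤ (8 * G + 2 * G₁ * (β - α)) / √ν := by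
  have hαm : α ∈ Set.Icc α β := ⟨le_rfl, hαβ⟩
  have hβm : β ∈ Set.Icc α β := ⟨hαβ, le_rfl⟩
  have hG₁0 : 0 ≤ G₁ := (norm_nonneg _).trans (hG₁ α hαm)
  have hs : 0 < √ν := Real.sqrt_pos.2 hν
  have hp'c : ContinuousOn p' (Set.Icc α β) :=
    fun x hx => (hp' x hx).continuousAt.continuousWithinAt
  have hp''0 : ∀ x ∈ Set.Icc α β, 0 ≤ p'' x := fun x hx => hν.le.trans (hge x hx)
  have hslope : ∀ x ∈ Set.Icc α β, ∀ y ∈ Set.Icc α β, x ≤ y → ν * (y - x) ≤ p' y - p' x := by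
    refine (convex_Icc α β).mul_sub_le_image_sub_of_le_deriv hp'c
      (fun x hx => (hp' x (interior_subset hx)).differentiableAt.differentiableWithinAt)
      fun x hx => ?_
    rw [(hp' x (interior_subset hx)).deriv]
    exact hge x (interior_subset hx)
  obtain ⟨c, hcm, hcr, hcl⟩ : ∃ c ∈ Set.Icc α β,
      (c = β ∨ ∀ x ∈ Set.Icc c β, ν * (x - c) ≤ p' x) ∧
      (c = α ∨ ∀ x ∈ Set.Icc α c, ν * (c - x) ≤ -p' x) := by
    rcases le_total 0 (p' α) with h0 | h0
    · refine ⟨α, hαm, Or.inr fun x hx => ?_, Or.inl rfl⟩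
      have := hslope α hαm x hx hx.1
      linarith
    rcases le_total (p' β) 0 with h1 | h1
    · refine ⟨β, hβm, Or.inl rfl, Or.inr fun x hx => ?_⟩
      have := hslope x hx β hβm hx.2
      linarith
    obtain ⟨c, hcm, hc⟩ := intermediate_value_Icc hαβ hp'c ⟨h0, h1⟩
    refine ⟨c, hcm, Or.inr fun x hx => ?_, Or.inr fun x hx => ?_⟩
    · have := hslope c hcm x ⟨hcm.1.trans hx.1, hx.2⟩ hx.1
      linarith
    · have := hslope x ⟨hx.1, hx.2.trans hcm.2⟩ c hcm hx.2
      linarith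
  have hG0 : 0 ≤ G := (norm_nonneg _).trans (hG α hαm)
  have hcont : ContinuousOn (fun x => g x * Complex.exp (I * (p x : ℂ))) (Set.Icc α β) :=
    fun x hx => ((hg x hx).continuousAt.mul ((continuousAt_const.mul
      (Complex.continuous_ofReal.continuousAt.comp (hp x
        hx).continuousAt)).cexp)).continuousWithinAt
  have hsr : Set.Icc c β ⊆ Set.Icc α β := Set.Icc_subset_Icc_left hcm.1
  have hsl : Set.Icc α c ⊆ Set.Icc α β := Set.Icc_subset_Icc_right hcm.2
  have hi1 : IntervalIntegrable (fun x => g x * Complex.exp (I * (p x : ℂ))) volume α c :=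
    ContinuousOn.intervalIntegrable (hcont.mono (by rwa [Set.uIcc_of_le hcm.1]))
  have hi2 : IntervalIntegrable (fun x => g x * Complex.exp (I * (p x : ℂ))) volume c β :=
    ContinuousOn.intervalIntegrable (hcont.mono (by rwa [Set.uIcc_of_le hcm.2]))
  rw [← intervalIntegral.integral_add_adjacent_intervals hi1 hi2]
  have hR : ‖∫ x in c..β, g x * Complex.exp (I * (p x : ℂ))‖ ≤ (4 * G + G₁ * (β - α)) / √ν := by
    rcases hcr with rfl | hcr
    · rw [intervalIntegral.integral_same, norm_zero]
      exact div_nonneg (add_nonneg (by linarith) (mul_nonneg hG₁0 (by linarith))) hs.le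
    refine (norm_oscillatory_le_of_deriv_ge_mul hcm.2 hν (fun x hx => hp x (hsr hx))
      (fun x hx => hp' x (hsr hx)) (hp''c.mono hsr) (fun x hx => hp''0 x (hsr hx)) hcr
      (fun x hx => hg x (hsr hx)) (hg'c.mono hsr) (fun x hx => hG x (hsr hx))
      (fun x hx => hG₁ x (hsr hx))).trans ?_
    have := hcm.1
    gcongr
  have hL : ‖∫ x in α..c, g x * Complex.exp (I * (p x : ℂ))‖ ≤ (4 * G + G₁ * (β - α)) / √ν := by
    rcases hcl with rfl | hcl
    · rw [intervalIntegral.integral_same, norm_zero]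
      exact div_nonneg (add_nonneg (by linarith) (mul_nonneg hG₁0 (by linarith))) hs.le
    have hneg : ∀ x ∈ Set.Icc (-c) (-α), -x ∈ Set.Icc α β := fun x hx =>
      ⟨by linarith [hx.2], by linarith [hx.1, hcm.2]⟩
    have hmaps : Set.MapsTo (fun x : ℝ => -x) (Set.Icc (-c) (-α)) (Set.Icc α β) := hneg
    have h := norm_oscillatory_le_of_deriv_ge_mul (p := fun x => p (-x)) (p' := fun x => -p' (-x))
      (p'' := fun x => p'' (-x)) (g := fun x => g (-x)) (g' := fun x => -g' (-x))
      (neg_le_neg hcm.1) hν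
      (fun x hx => by
        exact ((hp (-x) (hneg x hx)).scomp x (hasDerivAt_neg x)).congr_deriv (by simp))
      (fun x hx => by
        exact ((hp' (-x) (hneg x hx)).scomp x (hasDerivAt_neg x)).fun_neg.congr_deriv (by simp))
      (hp''c.comp continuous_neg.continuousOn hmaps) (fun x hx => hp''0 _ (hneg x hx))
      (fun x hx => by
        have := hcl (-x) ⟨by linarith [hx.2], by linarith [hx.1]⟩
        rwa [show x - -c = c - -x by ring])
      (fun x hx => by
        exact ((hg (-x) (hneg x hx)).scomp x (hasDerivAt_neg x)).congr_deriv (by simp))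
      (hg'c.comp continuous_neg.continuousOn hmaps).neg (fun x hx => hG _ (hneg x hx))
      (fun x hx => by rw [norm_neg]; exact hG₁ _ (hneg x hx))
    rw [intervalIntegral.integral_comp_neg (fun x => g x * Complex.exp (I * (p x : ℂ))), neg_neg,
      neg_neg] at h
    refine h.trans ?_
    have := hcm.2
    rw [show -α - -c = c - α by ring]
    gcongr
  refine (norm_add_le _ _).trans ((add_le_add hL hR).trans (le_of_eq ?_))
  rw [← add_div]
  ring


/-! ### Non-stationary phase for the phase `-t λ^a + λ u` -/

/-- The oscillating factor `e^{i(-t λ^a + λ u)}`. -/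
def oscFac (a t u x : ℝ) : ℂ := Complex.exp (I * ((-t * x ^ a + x * u : ℝ) : ℂ))

theorem norm_oscFac (a t u x : ℝ) : ‖oscFac a t u x‖ = 1 := by
  rw [oscFac, mul_comm, Complex.norm_exp_ofReal_mul_I]

theorem continuous_oscFac {a : ℝ} (ha : 0 ≤ a) (t u : ℝ) : Continuous (oscFac a t u) := by
  unfold oscFac
  have : Continuous fun x : ℝ => x ^ a := Real.continuous_rpow_const ha
  fun_prop

theorem hasDerivAt_oscFac {a : ℝ} (t u : ℝ) {x : ℝ} (hx : 0 < x) :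
    HasDerivAt (oscFac a t u)
      (oscFac a t u x * (I * ((-t * (a * x ^ (a - 1)) + u : ℝ) : ℂ))) x := by
  have h1 : HasDerivAt (fun x : ℝ => -t * x ^ a + x * u) (-t * (a * x ^ (a - 1)) + u) x :=
    (((Real.hasDerivAt_rpow_const (Or.inl hx.ne')).const_mul (-t)).fun_add
      ((hasDerivAt_id x).mul_const u)).congr_deriv (by simp)
  exact (h1.ofReal_comp.const_mul I).cexp

theorem exists_nonstationary_le {a : ℝ} (ha : 0 < a) (N : ℕ) :
    ∀ (c M : ℝ) (ψ : ℝ → ℂ), 0 < c → ContDiff ℝ (⊤ : ℕ∞) ψ → (∀ x ≤ c, ψ x = 0) →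
      (∀ x, M ≤ x → ψ x = 0) →
      ∃ C : ℝ, 0 ≤ C ∧ ∀ t u : ℝ,
        |t| ^ N * ‖∫ x, ψ x * oscFac a t u x‖ ≤ C * (1 + |u|) ^ N := by
  induction N with
  | zero =>
    intro c M ψ hc hψ h0 hM
    refine ⟨∫ x, ‖ψ x‖, integral_nonneg fun _ => norm_nonneg _, fun t u => ?_⟩
    simp only [pow_zero, one_mul, mul_one]
    refine (norm_integral_le_integral_norm _).trans (le_of_eq ?_)
    simp only [norm_mul, norm_oscFac, mul_one]
  | succ N ih =>
    intro c M ψ hc hψ h0 hM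
    set ψ₁ : ℝ → ℂ := fun x => ψ x * ((a * x ^ (a - 1) : ℝ) : ℂ)⁻¹ with hψ₁
    have h10 : ∀ x ≤ c, ψ₁ x = 0 := fun x hx => by simp [hψ₁, h0 x hx]
    have h1M : ∀ x, M ≤ x → ψ₁ x = 0 := fun x hx => by simp [hψ₁, hM x hx]
    have h1s : ContDiff ℝ (⊤ : ℕ∞) ψ₁ := by
      rw [contDiff_iff_contDiffAt]
      intro x
      rcases lt_or_ge x c with hx | hx
      · refine (contDiffAt_const (c := (0 : ℂ))).congr_of_eventuallyEq ?_
        filter_upwards [Iio_mem_nhds hx] with y hy using h10 y (le_of_lt hy)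
      · have hx0 : 0 < x := hc.trans_le hx
        refine hψ.contDiffAt.mul (ContDiffAt.inv ?_ ?_)
        · exact Complex.ofRealCLM.contDiff.contDiffAt.comp x
            (contDiffAt_const.mul (Real.contDiffAt_rpow_const_of_ne hx0.ne'))
        · exact Complex.ofReal_ne_zero.2 (mul_pos ha (Real.rpow_pos_of_pos hx0 _)).ne'
    have hcs : HasCompactSupport ψ₁ := by
      refine HasCompactSupport.intro (isCompact_Icc (a := c) (b := M)) fun x hx => ?_
      by_contra hne
      refine hx ⟨?_, ?_⟩
      · by_contra hh; exact hne (h10 x (not_le.1 hh).le)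
      · by_contra hh; exact hne (h1M x (not_le.1 hh).le)
    have hcs0 : HasCompactSupport ψ := by
      refine HasCompactSupport.intro (isCompact_Icc (a := c) (b := M)) fun x hx => ?_
      by_contra hne
      refine hx ⟨?_, ?_⟩
      · by_contra hh; exact hne (h0 x (not_le.1 hh).le)
      · by_contra hh; exact hne (hM x (not_le.1 hh).le)
    have hds : ContDiff ℝ (⊤ : ℕ∞) (deriv ψ₁) :=
      (contDiff_infty_iff_deriv.1 h1s).2
    have hd0 : ∀ x ≤ c / 2, deriv ψ₁ x = 0 := by
      intro x hx
      have : ψ₁ =ᶠ[nhds x] fun _ => 0 := by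
        filter_upwards [Iio_mem_nhds (show x < c by linarith)] with y hy using h10 y (le_of_lt hy)
      rw [this.deriv_eq, deriv_const]
    have hdM : ∀ x, M + 1 ≤ x → deriv ψ₁ x = 0 := by
      intro x hx
      have : ψ₁ =ᶠ[nhds x] fun _ => 0 := by
        filter_upwards [Ioi_mem_nhds (show M < x by linarith)] with y hy using h1M y (le_of_lt hy)
      rw [this.deriv_eq, deriv_const]
    obtain ⟨C₁, hC₁, hb₁⟩ := ih c M ψ₁ hc h1s h10 h1M
    obtain ⟨C₂, hC₂, hb₂⟩ := ih (c / 2) (M + 1) (deriv ψ₁) (by linarith) hds hd0 hdM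
    refine ⟨C₁ + C₂, by linarith, fun t u => ?_⟩
    have hInt : ∀ g : ℝ → ℂ, Continuous g → HasCompactSupport g →
        Integrable (fun x => g x * oscFac a t u x) := fun g hg hgs =>
      (hg.mul (continuous_oscFac ha.le t u)).integrable_of_hasCompactSupport hgs.mul_right
    have hi1 := hInt ψ₁ h1s.continuous hcs
    have hi2 := hInt (deriv ψ₁) hds.continuous hcs.deriv
    have hi3 := hInt ψ hψ.continuous hcs0
    have hder : ∀ x, HasDerivAt (fun x => ψ₁ x * oscFac a t u x)
        (deriv ψ₁ x * oscFac a t u x + (I * u) * (ψ₁ x * oscFac a t u x)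
          - (I * t) * (ψ x * oscFac a t u x)) x := by
      intro x
      rcases lt_or_ge x c with hx | hx
      · have : (fun x => ψ₁ x * oscFac a t u x) =ᶠ[nhds x] fun _ => 0 := by
          filter_upwards [Iio_mem_nhds hx] with y hy
          rw [h10 y (le_of_lt hy), zero_mul]
        have h2 : ψ₁ =ᶠ[nhds x] fun _ => 0 := by
          filter_upwards [Iio_mem_nhds hx] with y hy using h10 y (le_of_lt hy)
        refine ((hasDerivAt_const x (0 : ℂ)).congr_of_eventuallyEq this).congr_deriv ?_
        rw [h2.deriv_eq, h10 x hx.le, h0 x hx.le]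
        simp
      · have hx0 : 0 < x := hc.trans_le hx
        have hd := (h1s.differentiable (by simp)).differentiableAt (x := x) |>.hasDerivAt
        refine (hd.mul (hasDerivAt_oscFac t u hx0)).congr_deriv ?_
        have hne : ((a * x ^ (a - 1) : ℝ) : ℂ) ≠ 0 :=
          Complex.ofReal_ne_zero.2 (mul_pos ha (Real.rpow_pos_of_pos hx0 _)).ne'
        have hψe : ψ x = ψ₁ x * ((a * x ^ (a - 1) : ℝ) : ℂ) := by
          rw [hψ₁]; simp only; rw [mul_assoc, inv_mul_cancel₀ hne, mul_one]
        rw [hψe]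
        push_cast
        ring
    have hz := integral_eq_zero_of_hasDerivAt_of_integrable hder
      ((hi2.add (hi1.const_mul _)).sub (hi3.const_mul _)) hi1
    have hi12 : Integrable fun x => deriv ψ₁ x * oscFac a t u x +
        (I * u) * (ψ₁ x * oscFac a t u x) := hi2.add (hi1.const_mul _)
    rw [integral_sub hi12 (hi3.const_mul _),
      integral_add hi2 (hi1.const_mul _), integral_const_mul, integral_const_mul, sub_eq_zero] at hz
    have hn : |t| * ‖∫ x, ψ x * oscFac a t u x‖ ≤
        ‖∫ x, deriv ψ₁ x * oscFac a t u x‖ + |u| * ‖∫ x, ψ₁ x * oscFac a t u x‖ := by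
      have := congrArg norm hz
      rw [norm_mul, norm_mul, norm_I, one_mul, Complex.norm_real, Real.norm_eq_abs] at this
      rw [← this]
      refine (norm_add_le _ _).trans (le_of_eq ?_)
      rw [norm_mul, norm_mul, norm_I, one_mul, Complex.norm_real, Real.norm_eq_abs]
    have hA := hb₁ t u
    have hB := hb₂ t u
    have hu := abs_nonneg u
    have hpw : 0 ≤ (1 + |u|) ^ N := by positivity
    calc |t| ^ (N + 1) * ‖∫ x, ψ x * oscFac a t u x‖
        = |t| ^ N * (|t| * ‖∫ x, ψ x * oscFac a t u x‖) := by ring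
      _ ≤ |t| ^ N * (‖∫ x, deriv ψ₁ x * oscFac a t u x‖
            + |u| * ‖∫ x, ψ₁ x * oscFac a t u x‖) := by gcongr
      _ = |t| ^ N * ‖∫ x, deriv ψ₁ x * oscFac a t u x‖
            + |u| * (|t| ^ N * ‖∫ x, ψ₁ x * oscFac a t u x‖) := by ring
      _ ≤ C₂ * (1 + |u|) ^ N + |u| * (C₁ * (1 + |u|) ^ N) := by gcongr
      _ ≤ (C₁ + C₂) * (1 + |u|) ^ (N + 1) := by
          rw [pow_succ]
          nlinarith [mul_nonneg hC₁ hpw, mul_nonneg hC₂ hpw,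
            mul_nonneg (mul_nonneg hC₂ hpw) hu]


/-! ### The spherical function -/

section Spherical

variable {d : ℕ}

/-- Direction of a vector. -/
def sphDir (x : Ed d) : Ed d := ‖x‖⁻¹ • x

/-- The uniform probability measure on the unit ball. -/
def ballMeas (d : ℕ) : Measure (Ed d) :=
  (volume (Metric.ball (0 : Ed d) 1))⁻¹ • volume.restrict (Metric.ball (0 : Ed d) 1)

instance isProbabilityMeasure_ballMeas : IsProbabilityMeasure (ballMeas d) := by
  constructor
  rw [ballMeas, Measure.smul_apply, Measure.restrict_apply_univ, smul_eq_mul]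
  exact ENNReal.inv_mul_cancel (Metric.measure_ball_pos _ _ one_pos).ne' measure_ball_lt_top.ne

theorem measurable_sphDir : Measurable (sphDir : Ed d → Ed d) := by
  unfold sphDir
  fun_prop

theorem norm_sphDir_le (x : Ed d) : ‖sphDir x‖ ≤ 1 := by
  rw [sphDir, norm_smul, norm_inv, norm_norm]
  exact inv_mul_le_one

theorem norm_sphDir {x : Ed d} (hx : x ≠ 0) : ‖sphDir x‖ = 1 := by
  rw [sphDir, norm_smul, norm_inv, norm_norm, inv_mul_cancel₀ (norm_ne_zero_iff.2 hx)]

theorem ballMeas_ae_ne_zero [NeZero d] : ∀ᵐ x ∂ballMeas d, x ≠ 0 := by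
  have : Nonempty (Fin d) := ⟨0⟩
  have h : ∀ᵐ x : Ed d, x ≠ 0 := by
    simp [ae_iff]
  exact Measure.ae_smul_measure (ae_restrict_of_ae h) _

/-- The average of the plane waves over the sphere. -/
def sphPsi (y : Ed d) : ℂ := ∫ x, Complex.exp (-I * ((⟪y, sphDir x⟫ : ℝ) : ℂ)) ∂ballMeas d

theorem measurePreserving_ballMeas (U : Ed d ≃ₗᵢ[ℝ] Ed d) :
    MeasurePreserving U (ballMeas d) (ballMeas d) := by
  have h := (U.measurePreserving).restrict_preimage (s := Metric.ball (0 : Ed d) 1)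
    Metric.isOpen_ball.measurableSet
  rw [U.preimage_ball, map_zero] at h
  exact h.smul_measure _

theorem sphDir_map (U : Ed d ≃ₗᵢ[ℝ] Ed d) (x : Ed d) : sphDir (U x) = U (sphDir x) := by
  rw [sphDir, sphDir, U.norm_map, map_smul]

theorem sphPsi_map (U : Ed d ≃ₗᵢ[ℝ] Ed d) (y : Ed d) : sphPsi (U y) = sphPsi y := by
  have := (measurePreserving_ballMeas U).integral_comp U.toHomeomorph.measurableEmbedding
    (fun x => Complex.exp (-I * ((⟪U y, sphDir x⟫ : ℝ) : ℂ)))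
  rw [sphPsi, ← this, sphPsi]
  simp only [sphDir_map, LinearIsometryEquiv.inner_map_map]

theorem exists_isometry_of_norm_eq {y z : Ed d} (h : ‖y‖ = ‖z‖) : ∃ U : Ed d ≃ₗᵢ[ℝ] Ed d, U y = z :=
  ⟨_, Submodule.reflection_sub h⟩

theorem sphPsi_eq_of_norm_eq {y z : Ed d} (h : ‖y‖ = ‖z‖) : sphPsi y = sphPsi z := by
  obtain ⟨U, rfl⟩ := exists_isometry_of_norm_eq h
  exact (sphPsi_map U y).symm

theorem FT_eq_of_norm_eq {f : Ed d → ℂ} (hf : IsRadial f) {y z : Ed d} (h : ‖y‖ = ‖z‖) :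
    FT f y = FT f z := by
  obtain ⟨U, rfl⟩ := exists_isometry_of_norm_eq h
  have := U.measurePreserving.integral_comp U.toHomeomorph.measurableEmbedding
    (fun x => Complex.exp (-I * ((⟪x, U y⟫ : ℝ) : ℂ)) * f x)
  rw [FT, FT, ← this]
  congr 1
  ext x
  rw [LinearIsometryEquiv.inner_map_map, hf (U x) x (U.norm_map x)]

/-- The first coordinate of the direction. -/
def sphCoord [NeZero d] (x : Ed d) : ℝ := sphDir x 0

theorem measurable_sphCoord [NeZero d] : Measurable (sphCoord : Ed d → ℝ) := by
  have h : Continuous fun y : Ed d => y 0 := by fun_prop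
  exact h.measurable.comp measurable_sphDir

theorem abs_sphCoord_le [NeZero d] (x : Ed d) : |sphCoord x| ≤ 1 :=
  (PiLp.norm_apply_le (sphDir x) 0).trans (norm_sphDir_le x)

/-- The spherical function: the Fourier transform of the uniform measure on the sphere. -/
def sphFun (d : ℕ) [NeZero d] (r : ℝ) : ℂ :=
  ∫ x, Complex.exp (-I * ((r * sphCoord x : ℝ) : ℂ)) ∂ballMeas d

theorem sphPsi_eq_sphFun [NeZero d] (y : Ed d) : sphPsi y = sphFun d ‖y‖ := by
  rw [sphPsi_eq_of_norm_eq (z := EuclideanSpace.single (0 : Fin d) ‖y‖) (by simp), sphPsi, sphFun]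
  simp [sphCoord, EuclideanSpace.inner_single_left]

theorem norm_exp_negI_mul (x : ℝ) : ‖Complex.exp (-I * (x : ℂ))‖ = 1 := by
  rw [show -I * (x : ℂ) = ((-x : ℝ) : ℂ) * I by push_cast; ring, Complex.norm_exp_ofReal_mul_I]

theorem norm_sphFun_le [NeZero d] (r : ℝ) : ‖sphFun d r‖ ≤ 1 := by
  refine (norm_integral_le_integral_norm _).trans (le_of_eq ?_)
  simp only [norm_exp_negI_mul, integral_const, probReal_univ, smul_eq_mul, mul_one]

/-- The Fourier transform of a radial function through the spherical function. -/
theorem FT_eq_integral_sphFun [NeZero d] {f : Ed d → ℂ} (hf : IsRadial f) (hfi : Integrable f)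
    (ξ : Ed d) : FT f ξ = ∫ x, f x * sphFun d (‖x‖ * ‖ξ‖) := by
  have h1 : FT f ξ = ∫ y, FT f (‖ξ‖ • sphDir y) ∂ballMeas d := by
    rw [← mul_one (FT f ξ), ← Complex.ofReal_one, ← probReal_univ (μ := ballMeas d), mul_comm,
      ← Complex.real_smul, ← integral_const]
    refine integral_congr_ae ?_
    filter_upwards [ballMeas_ae_ne_zero] with y hy
    refine FT_eq_of_norm_eq hf ?_
    rw [norm_smul, norm_sphDir hy, norm_norm, mul_one]
  rw [h1]
  simp only [FT]
  rw [integral_integral_swap]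
  · congr 1
    ext x
    rw [integral_mul_const, mul_comm]
    congr 1
    have : sphFun d (‖x‖ * ‖ξ‖) = sphPsi (‖ξ‖ • x) := by
      rw [sphPsi_eq_sphFun, norm_smul, norm_norm, mul_comm]
    rw [this, sphPsi]
    simp only [inner_smul_left, inner_smul_right]
    simp
  · have hm : AEStronglyMeasurable (fun p : Ed d × Ed d =>
        Complex.exp (-I * ((⟪p.2, ‖ξ‖ • sphDir p.1⟫ : ℝ) : ℂ))) ((ballMeas d).prod volume) := by
      have := measurable_sphDir (d := d)
      apply Measurable.aestronglyMeasurable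
      fun_prop
    have hF : Integrable (fun p : Ed d × Ed d => f p.2) ((ballMeas d).prod volume) :=
      hfi.comp_snd _
    refine hF.mono (hm.mul hF.aestronglyMeasurable) (Filter.Eventually.of_forall fun p => ?_)
    simp only [Function.uncurry]
    rw [norm_mul, norm_exp_negI_mul, one_mul]

end Spherical


section SphericalODE

variable {d : ℕ}

theorem hasDerivAt_integral_of_bdd {X : Type*} [MeasurableSpace X] {μ : Measure X}
    [IsFiniteMeasure μ] {F F' : ℝ → X → ℂ} {C D : ℝ} (hFm : ∀ θ, Measurable (F θ))
    (hF'm : ∀ θ, Measurable (F' θ)) (hF : ∀ θ x, ‖F θ x‖ ≤ D)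
    (hd : ∀ θ x, HasDerivAt (fun θ => F θ x) (F' θ x) θ) (hC : ∀ θ x, ‖F' θ x‖ ≤ C) (θ : ℝ) :
    HasDerivAt (fun θ => ∫ x, F θ x ∂μ) (∫ x, F' θ x ∂μ) θ :=
  (hasDerivAt_integral_of_dominated_loc_of_deriv_le (bound := fun _ => C) Filter.univ_mem
    (Filter.Eventually.of_forall fun θ => (hFm θ).aestronglyMeasurable)
    ((integrable_const D).mono' (hFm θ).aestronglyMeasurable
      (Filter.Eventually.of_forall fun x => hF θ x))
    (hF'm θ).aestronglyMeasurable (Filter.Eventually.of_forall fun x θ _ => hC θ x)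
    (integrable_const C) (Filter.Eventually.of_forall fun x θ _ => hd θ x)).2

/-- Derivatives of the spherical function. -/
def sphMom (d : ℕ) [NeZero d] (n : ℕ) (r : ℝ) : ℂ :=
  ∫ x, (-I * (sphCoord x : ℂ)) ^ n * Complex.exp (-I * ((r * sphCoord x : ℝ) : ℂ)) ∂ballMeas d

theorem sphMom_zero [NeZero d] (r : ℝ) : sphMom d 0 r = sphFun d r := by
  simp [sphMom, sphFun]

theorem norm_sphMom_integrand_le [NeZero d] (n : ℕ) (r : ℝ) (x : Ed d) :
    ‖(-I * (sphCoord x : ℂ)) ^ n * Complex.exp (-I * ((r * sphCoord x : ℝ) : ℂ))‖ ≤ 1 := by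
  rw [norm_mul, norm_exp_negI_mul, mul_one, norm_pow, norm_mul, norm_neg, norm_I, one_mul,
    Complex.norm_real]
  exact pow_le_one₀ (norm_nonneg _) (abs_sphCoord_le x)

theorem measurable_sphMom_integrand [NeZero d] (n : ℕ) (r : ℝ) : Measurable fun x : Ed d =>
    (-I * (sphCoord x : ℂ)) ^ n * Complex.exp (-I * ((r * sphCoord x : ℝ) : ℂ)) := by
  have := measurable_sphCoord (d := d)
  fun_prop

theorem integrable_sphMom_integrand [NeZero d] (n : ℕ) (r : ℝ) : Integrable (fun x : Ed d =>
    (-I * (sphCoord x : ℂ)) ^ n * Complex.exp (-I * ((r * sphCoord x : ℝ) : ℂ))) (ballMeas d) :=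
  (integrable_const (1 : ℝ)).mono' (measurable_sphMom_integrand n r).aestronglyMeasurable
    (Filter.Eventually.of_forall fun x => norm_sphMom_integrand_le n r x)

theorem hasDerivAt_sphMom [NeZero d] (n : ℕ) (r : ℝ) :
    HasDerivAt (sphMom d n) (sphMom d (n + 1) r) r := by
  refine hasDerivAt_integral_of_bdd (C := 1) (D := 1) (measurable_sphMom_integrand n)
    (measurable_sphMom_integrand (n + 1)) (norm_sphMom_integrand_le n) (fun r x => ?_)
    (norm_sphMom_integrand_le (n + 1)) r
  have h1 : HasDerivAt (fun r : ℝ => r * sphCoord x) (sphCoord x) r := by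
    simpa using (hasDerivAt_id r).mul_const (sphCoord x)
  refine ((h1.ofReal_comp.const_mul (-I)).cexp.const_mul _).congr_deriv ?_
  ring

/-- Invariance under rotations in a coordinate plane. -/
theorem sphMom_rotation [NeZero d] (r : ℝ) {j : Fin d} (hj : j ≠ 0) :
    ∫ x, (((r * (sphDir x j)) ^ 2 : ℝ) : ℂ) * Complex.exp (-I * ((r * sphCoord x : ℝ) : ℂ))
      ∂ballMeas d = -(r : ℂ) * sphMom d 1 r := by
  have hmj : Measurable fun x : Ed d => sphDir x j := by
    have h : Continuous fun y : Ed d => y j := by fun_prop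
    exact h.measurable.comp measurable_sphDir
  have hbj : ∀ x : Ed d, |sphDir x j| ≤ 1 := fun x =>
    (PiLp.norm_apply_le (sphDir x) j).trans (norm_sphDir_le x)
  have hm0 := measurable_sphCoord (d := d)
  let P : ℝ → Ed d → ℝ := fun θ x => r * (Real.cos θ * sphCoord x + Real.sin θ * sphDir x j)
  let P' : ℝ → Ed d → ℝ := fun θ x => r * (-Real.sin θ * sphCoord x + Real.cos θ * sphDir x j)
  have hPb : ∀ θ x, |P θ x| ≤ 2 * |r| := by
    intro θ x
    simp only [P]
    rw [abs_mul, mul_comm]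
    refine mul_le_mul_of_nonneg_right ((abs_add_le _ _).trans ?_) (abs_nonneg r)
    rw [abs_mul, abs_mul]
    have h1 := mul_le_mul (Real.abs_cos_le_one θ) (abs_sphCoord_le x) (abs_nonneg _) zero_le_one
    have h2 := mul_le_mul (Real.abs_sin_le_one θ) (hbj x) (abs_nonneg _) zero_le_one
    linarith
  have hP'b : ∀ θ x, |P' θ x| ≤ 2 * |r| := by
    intro θ x
    simp only [P']
    rw [abs_mul, mul_comm]
    refine mul_le_mul_of_nonneg_right ((abs_add_le _ _).trans ?_) (abs_nonneg r)
    rw [abs_mul, abs_mul, abs_neg]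
    have h1 := mul_le_mul (Real.abs_sin_le_one θ) (abs_sphCoord_le x) (abs_nonneg _) zero_le_one
    have h2 := mul_le_mul (Real.abs_cos_le_one θ) (hbj x) (abs_nonneg _) zero_le_one
    linarith
  have hPm : ∀ θ, Measurable (P θ) := fun θ => by simp only [P]; fun_prop
  have hP'm : ∀ θ, Measurable (P' θ) := fun θ => by simp only [P']; fun_prop
  have hPd : ∀ θ x, HasDerivAt (fun θ => P θ x) (P' θ x) θ := fun θ x =>
    (((Real.hasDerivAt_cos θ).mul_const _).add ((Real.hasDerivAt_sin θ).mul_const _)).const_mul r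
  have hP'd : ∀ θ x, HasDerivAt (fun θ => P' θ x) (-P θ x) θ := fun θ x =>
    (((((Real.hasDerivAt_sin θ).neg).mul_const (sphCoord x)).add
      ((Real.hasDerivAt_cos θ).mul_const (sphDir x j))).const_mul r).congr_deriv
      (by simp only [P]; ring)
  let E : ℝ → Ed d → ℂ := fun θ x => Complex.exp (-I * (P θ x : ℂ))
  have hEm : ∀ θ, Measurable (E θ) := fun θ => by have := hPm θ; simp only [E]; fun_prop
  have hE1 : ∀ θ x, ‖E θ x‖ = 1 := fun θ x => norm_exp_negI_mul _
  have hEd : ∀ θ x, HasDerivAt (fun θ => E θ x) (E θ x * (-I * (P' θ x : ℂ))) θ := fun θ x =>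
    ((hPd θ x).ofReal_comp.const_mul (-I)).cexp
  let E₁ : ℝ → Ed d → ℂ := fun θ x => E θ x * (-I * (P' θ x : ℂ))
  let E₂ : ℝ → Ed d → ℂ := fun θ x =>
    E θ x * (-I * (P' θ x : ℂ)) * (-I * (P' θ x : ℂ)) + E θ x * (-I * ((-P θ x : ℝ) : ℂ))
  have hE₁d : ∀ θ x, HasDerivAt (fun θ => E₁ θ x) (E₂ θ x) θ := fun θ x =>
    (hEd θ x).mul ((hP'd θ x).ofReal_comp.const_mul (-I))
  have hE₁m : ∀ θ, Measurable (E₁ θ) := fun θ => by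
    have := hEm θ; have := hP'm θ; simp only [E₁]; fun_prop
  have hE₂m : ∀ θ, Measurable (E₂ θ) := fun θ => by
    have := hEm θ; have := hP'm θ; have := hPm θ; simp only [E₂]; fun_prop
  have hE₁b : ∀ θ x, ‖E₁ θ x‖ ≤ 2 * |r| := fun θ x => by
    simp only [E₁]
    rw [norm_mul, hE1, one_mul, norm_mul, norm_neg, norm_I, one_mul, Complex.norm_real]
    exact hP'b θ x
  have hE₂b : ∀ θ x, ‖E₂ θ x‖ ≤ 2 * |r| * (2 * |r|) + 2 * |r| := fun θ x => by
    refine (norm_add_le _ _).trans (add_le_add ?_ ?_)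
    · rw [norm_mul]
      refine mul_le_mul (hE₁b θ x) ?_ (norm_nonneg _) (by positivity)
      rw [norm_mul, norm_neg, norm_I, one_mul, Complex.norm_real]
      exact hP'b θ x
    · rw [norm_mul, hE1, one_mul, norm_mul, norm_neg, norm_I, one_mul, Complex.norm_real, norm_neg]
      exact hPb θ x
  have hd0 : ∀ θ, HasDerivAt (fun θ => ∫ x, E θ x ∂ballMeas d) (∫ x, E₁ θ x ∂ballMeas d) θ :=
    hasDerivAt_integral_of_bdd hEm hE₁m (fun θ x => (hE1 θ x).le) hEd hE₁b
  have hd1 : ∀ θ, HasDerivAt (fun θ => ∫ x, E₁ θ x ∂ballMeas d) (∫ x, E₂ θ x ∂ballMeas d) θ :=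
    hasDerivAt_integral_of_bdd hE₁m hE₂m hE₁b hE₁d hE₂b
  have hconst : ∀ θ, ∫ x, E θ x ∂ballMeas d = ∫ x, E 0 x ∂ballMeas d := by
    have key : ∀ θ, ∫ x, E θ x ∂ballMeas d =
        sphPsi (r • (EuclideanSpace.single (0 : Fin d) (Real.cos θ)
          + EuclideanSpace.single j (Real.sin θ))) := by
      intro θ
      rw [sphPsi]
      simp only [E, P, inner_smul_left, inner_add_left, EuclideanSpace.inner_single_left]
      simp [sphCoord]
    intro θ
    rw [key, key]
    refine sphPsi_eq_of_norm_eq ?_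
    rw [norm_smul, norm_smul]
    congr 1
    have hn : ∀ b c : ℝ, ‖EuclideanSpace.single (0 : Fin d) b + EuclideanSpace.single j c‖ ^ 2
        = b ^ 2 + c ^ 2 := by
      intro b c
      rw [norm_add_sq_real, EuclideanSpace.inner_single_left]
      simp [hj.symm]
    rw [← sq_eq_sq₀ (norm_nonneg _) (norm_nonneg _), hn, hn, Real.cos_zero, Real.sin_zero]
    linarith [Real.sin_sq_add_cos_sq θ]
  have hz1 : ∀ θ, ∫ x, E₁ θ x ∂ballMeas d = 0 := by
    intro θ
    refine (hd0 θ).unique ?_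
    simp only [hconst]
    exact hasDerivAt_const θ _
  have hz2 : ∫ x, E₂ 0 x ∂ballMeas d = 0 := by
    refine (hd1 0).unique ?_
    simp only [hz1]
    exact hasDerivAt_const _ _
  have hE₂0 : ∀ x, E₂ 0 x = -(r : ℂ) * ((-I * (sphCoord x : ℂ)) ^ 1 *
      Complex.exp (-I * ((r * sphCoord x : ℝ) : ℂ))) -
      (((r * (sphDir x j)) ^ 2 : ℝ) : ℂ) * Complex.exp (-I * ((r * sphCoord x : ℝ) : ℂ)) := by
    intro x
    simp only [E₂, E, P, P', Real.cos_zero, Real.sin_zero]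
    push_cast
    ring_nf
    rw [I_sq]
    ring
  simp only [hE₂0] at hz2
  have hInt : Integrable (fun x : Ed d => (((r * (sphDir x j)) ^ 2 : ℝ) : ℂ) *
      Complex.exp (-I * ((r * sphCoord x : ℝ) : ℂ))) (ballMeas d) := by
    refine (integrable_const (|r| ^ 2)).mono' ?_ (Filter.Eventually.of_forall fun x => ?_)
    · apply Measurable.aestronglyMeasurable
      fun_prop
    · rw [norm_mul, norm_exp_negI_mul, mul_one, Complex.norm_real, norm_pow, Real.norm_eq_abs,
        abs_mul]
      gcongr
      exact mul_le_of_le_one_right (abs_nonneg _) (hbj x)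
  rw [integral_sub ((integrable_sphMom_integrand 1 r).const_mul _) hInt, integral_const_mul,
    sub_eq_zero] at hz2
  exact hz2.symm

theorem sphMom_ode [NeZero d] {r : ℝ} (hr : r ≠ 0) :
    (r : ℂ) * (sphMom d 0 r + sphMom d 2 r) = -((d : ℂ) - 1) * sphMom d 1 r := by
  have hsum : ∑ j ∈ Finset.univ.erase (0 : Fin d),
      ∫ x, (((r * (sphDir x j)) ^ 2 : ℝ) : ℂ) * Complex.exp (-I * ((r * sphCoord x : ℝ) : ℂ))
      ∂ballMeas d = -((d : ℂ) - 1) * (r * sphMom d 1 r) := by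
    rw [Finset.sum_congr rfl fun j hj => sphMom_rotation r (Finset.ne_of_mem_erase hj)]
    rw [Finset.sum_const, Finset.card_erase_of_mem (Finset.mem_univ _), Finset.card_univ,
      Fintype.card_fin, nsmul_eq_mul, Nat.cast_sub (NeZero.one_le), Nat.cast_one]
    ring
  have hmj : ∀ j, Measurable fun x : Ed d => sphDir x j := fun j => by
    have h : Continuous fun y : Ed d => y j := by fun_prop
    exact h.measurable.comp measurable_sphDir
  have hbj : ∀ j, ∀ x : Ed d, |sphDir x j| ≤ 1 := fun j x =>
    (PiLp.norm_apply_le (sphDir x) j).trans (norm_sphDir_le x)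
  have hm0 := measurable_sphCoord (d := d)
  rw [← integral_finsetSum] at hsum
  · have h1 : ∫ x, ∑ j ∈ Finset.univ.erase (0 : Fin d), (((r * (sphDir x j)) ^ 2 : ℝ) : ℂ) *
        Complex.exp (-I * ((r * sphCoord x : ℝ) : ℂ)) ∂ballMeas d =
        (r : ℂ) ^ 2 * (sphMom d 0 r + sphMom d 2 r) := by
      rw [sphMom, sphMom, ← integral_add (integrable_sphMom_integrand 0 r)
        (integrable_sphMom_integrand 2 r), ← integral_const_mul]
      refine integral_congr_ae ?_
      filter_upwards [ballMeas_ae_ne_zero] with x hx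
      have hn := norm_sphDir hx
      rw [EuclideanSpace.norm_eq, Real.sqrt_eq_one,
        ← Finset.add_sum_erase _ _ (Finset.mem_univ (0 : Fin d))] at hn
      simp only [Real.norm_eq_abs, sq_abs] at hn
      rw [← Finset.sum_mul, ← Complex.ofReal_sum]
      simp only [mul_pow]
      rw [← Finset.mul_sum, show ∑ i ∈ Finset.univ.erase (0 : Fin d), sphDir x i ^ 2
        = 1 - sphCoord x ^ 2 from by rw [sphCoord]; linarith]
      push_cast
      rw [neg_sq, I_sq]
      ring
    rw [h1] at hsum
    have hr' : (r : ℂ) ≠ 0 := Complex.ofReal_ne_zero.2 hr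
    apply mul_left_cancel₀ hr'
    rw [← mul_assoc, ← pow_two, hsum]
    ring
  · intro j _
    refine (integrable_const (|r| ^ 2)).mono' ?_ (Filter.Eventually.of_forall fun x => ?_)
    · have := hmj j
      apply Measurable.aestronglyMeasurable
      fun_prop
    · rw [norm_mul, norm_exp_negI_mul, mul_one, Complex.norm_real, norm_pow, Real.norm_eq_abs,
        abs_mul]
      gcongr
      exact mul_le_of_le_one_right (abs_nonneg _) (hbj j x)

end SphericalODE


/-! ### Asymptotics of the spherical function -/

/-- Bound on solutions of `w₂ = -(1 - c / r²) w`, where `w₂` is the second derivative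
of `w`, away from the origin. -/
theorem exists_bound_of_bessel_ode {c : ℝ} {w w' : ℝ → ℂ}
    (hw : ∀ r, 0 < r → HasDerivAt w (w' r) r)
    (hw' : ∀ r, 0 < r → HasDerivAt w' (-(((1 - c / r ^ 2 : ℝ) : ℂ) * w r)) r) :
    ∃ C : ℝ, 0 ≤ C ∧ ∀ r, 1 / 4 ≤ r → ‖w r‖ ≤ C ∧ ‖w' r‖ ≤ C := by
  let E : ℝ → ℝ := fun r => (‖w r‖ ^ 2 + ‖w' r‖ ^ 2) * Real.exp (|c| / r)
  let E' : ℝ → ℝ := fun r => (2 * (c / r ^ 2) * ⟪w' r, w r⟫) * Real.exp (|c| / r)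
    + (‖w r‖ ^ 2 + ‖w' r‖ ^ 2) * (Real.exp (|c| / r) * (-|c| / r ^ 2))
  have hE : ∀ r, 0 < r → HasDerivAt E (E' r) r := by
    intro r hr
    have h1 := (hw r hr).norm_sq
    have h2 := (hw' r hr).norm_sq
    have h3 : HasDerivAt (fun r => Real.exp (|c| / r)) (Real.exp (|c| / r) * (-|c| / r ^ 2)) r := by
      refine HasDerivAt.exp ?_
      refine ((hasDerivAt_inv hr.ne').const_mul |c|).congr_deriv ?_
      ring
    refine ((h1.fun_add h2).mul h3).congr_deriv ?_
    have h4 : ⟪w' r, -(((1 - c / r ^ 2 : ℝ) : ℂ) * w r)⟫ = -((1 - c / r ^ 2) * ⟪w' r, w r⟫) := by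
      rw [inner_neg_right, ← Complex.real_smul, inner_smul_right]
    rw [h4, real_inner_comm (w' r) (w r)]
    simp only [E']
    ring
  have hE'0 : ∀ r, 0 < r → E' r ≤ 0 := by
    intro r hr
    have h1 := abs_real_inner_le_norm (w' r) (w r)
    have h2 : 2 * (c / r ^ 2) * ⟪w' r, w r⟫ ≤ |c| / r ^ 2 * (‖w r‖ ^ 2 + ‖w' r‖ ^ 2) := by
      have : 2 * (c * ⟪w' r, w r⟫) ≤ |c| * (‖w r‖ ^ 2 + ‖w' r‖ ^ 2) := by
        have h3 : c * ⟪w' r, w r⟫ ≤ |c| * (‖w' r‖ * ‖w r‖) := by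
          refine (le_abs_self _).trans ?_
          rw [abs_mul]
          exact mul_le_mul_of_nonneg_left h1 (abs_nonneg c)
        nlinarith [mul_nonneg (abs_nonneg c) (sq_nonneg (‖w' r‖ - ‖w r‖))]
      rw [show 2 * (c / r ^ 2) * ⟪w' r, w r⟫ = 2 * (c * ⟪w' r, w r⟫) / r ^ 2 by ring,
        div_mul_eq_mul_div]
      gcongr
    have h4 := mul_le_mul_of_nonneg_right h2 (Real.exp_pos (|c| / r)).le
    have h5 : E' r = 2 * (c / r ^ 2) * ⟪w' r, w r⟫ * Real.exp (|c| / r)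
        - |c| / r ^ 2 * (‖w r‖ ^ 2 + ‖w' r‖ ^ 2) * Real.exp (|c| / r) := by
      simp only [E']; ring
    linarith
  have hanti : AntitoneOn E (Set.Ici (1 / 4)) := by
    refine antitoneOn_of_deriv_nonpos (convex_Ici _) ?_ ?_ ?_
    · exact fun r hr => (hE r (by have : (1:ℝ)/4 ≤ r := hr; linarith)).continuousAt
        |>.continuousWithinAt
    · intro r hr
      rw [interior_Ici] at hr
      exact (hE r (by have : (1:ℝ)/4 < r := hr; linarith)).differentiableAt.differentiableWithinAt
    · intro r hr
      rw [interior_Ici] at hr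
      have : 0 < r := by have : (1:ℝ)/4 < r := hr; linarith
      rw [(hE r this).deriv]
      exact hE'0 r this
  refine ⟨√(E (1 / 4)), Real.sqrt_nonneg _, fun r hr => ?_⟩
  have h1 : E r ≤ E (1 / 4) := hanti (Set.mem_Ici.2 le_rfl) hr hr
  have hr0 : 0 < r := by linarith
  have h2 : 1 ≤ Real.exp (|c| / r) := Real.one_le_exp (by positivity)
  have h3 : ‖w r‖ ^ 2 + ‖w' r‖ ^ 2 ≤ E r := le_mul_of_one_le_right (by positivity) h2
  constructor
  · refine Real.le_sqrt_of_sq_le ?_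
    nlinarith [sq_nonneg ‖w' r‖]
  · refine Real.le_sqrt_of_sq_le ?_
    nlinarith [sq_nonneg ‖w r‖]

theorem norm_exp_I_mul (x : ℝ) : ‖Complex.exp (I * (x : ℂ))‖ = 1 := by
  rw [mul_comm, Complex.norm_exp_ofReal_mul_I]

/-- Oscillatory expansion of the spherical function. -/
theorem exists_sphFun_expansion (d : ℕ) [NeZero d] :
    ∃ (A B A' B' : ℝ → ℂ) (C : ℝ), 0 ≤ C ∧
      (∀ r, 0 < r → HasDerivAt A (A' r) r) ∧ (∀ r, 0 < r → HasDerivAt B (B' r) r) ∧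
      ContinuousOn A' (Set.Ioi 0) ∧ ContinuousOn B' (Set.Ioi 0) ∧
      (∀ r, 1 / 4 ≤ r → ‖A r‖ ≤ C ∧ ‖B r‖ ≤ C ∧ ‖A' r‖ ≤ C / r ∧ ‖B' r‖ ≤ C / r) ∧
      ∀ r, 0 < r → sphFun d r = ((r ^ (-(((d : ℝ) - 1) / 2)) : ℝ) : ℂ) *
        (Complex.exp (I * (r : ℂ)) * A r + Complex.exp (-I * (r : ℂ)) * B r) := by
  set m : ℝ := ((d : ℝ) - 1) / 2 with hm
  set c : ℝ := m * (m - 1) with hc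
  let w : ℝ → ℂ := fun r => ((r ^ m : ℝ) : ℂ) * sphMom d 0 r
  let w' : ℝ → ℂ := fun r => ((m * r ^ (m - 1) : ℝ) : ℂ) * sphMom d 0 r
    + ((r ^ m : ℝ) : ℂ) * sphMom d 1 r
  have hpow : ∀ (p r : ℝ), 0 < r →
      HasDerivAt (fun r : ℝ => ((r ^ p : ℝ) : ℂ)) ((p * r ^ (p - 1) : ℝ) : ℂ) r := fun p r hr =>
    (Real.hasDerivAt_rpow_const (Or.inl hr.ne')).ofReal_comp
  have hw : ∀ r, 0 < r → HasDerivAt w (w' r) r := fun r hr =>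
    (hpow m r hr).mul (hasDerivAt_sphMom 0 r)
  have hw' : ∀ r, 0 < r → HasDerivAt w' (-(((1 - c / r ^ 2 : ℝ) : ℂ) * w r)) r := by
    intro r hr
    have h1 : HasDerivAt (fun r : ℝ => ((m * r ^ (m - 1) : ℝ) : ℂ))
        ((m * ((m - 1) * r ^ (m - 1 - 1)) : ℝ) : ℂ) r :=
      ((Real.hasDerivAt_rpow_const (Or.inl hr.ne')).const_mul m).ofReal_comp
    refine ((h1.mul (hasDerivAt_sphMom 0 r)).add
      ((hpow m r hr).mul (hasDerivAt_sphMom 1 r))).congr_deriv ?_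
    have hode := sphMom_ode (d := d) hr.ne'
    have hrC : (r : ℂ) ≠ 0 := Complex.ofReal_ne_zero.2 hr.ne'
    have hd2 : (d : ℂ) - 1 = 2 * (m : ℂ) := by rw [hm]; push_cast; ring
    rw [hd2] at hode
    have h2 : sphMom d 2 r = -sphMom d 0 r - 2 * (m : ℂ) / r * sphMom d 1 r := by
      field_simp
      linear_combination hode
    have e1 : r ^ (m - 1) = r ^ m / r := by rw [Real.rpow_sub hr, Real.rpow_one]
    have e2 : r ^ (m - 1 - 1) = r ^ m / r ^ 2 := by
      rw [Real.rpow_sub hr, Real.rpow_sub hr, Real.rpow_one, div_div, pow_two]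
    simp only [w, e1, e2, h2, hc]
    push_cast
    field_simp
    ring
  obtain ⟨C, hC0, hC⟩ := exists_bound_of_bessel_ode hw hw'
  let A : ℝ → ℂ := fun r => Complex.exp (-I * (r : ℂ)) * ((w r - I * w' r) / 2)
  let B : ℝ → ℂ := fun r => Complex.exp (I * (r : ℂ)) * ((w r + I * w' r) / 2)
  let A' : ℝ → ℂ := fun r => Complex.exp (-I * (r : ℂ)) * (-I / 2 * ((c / r ^ 2 : ℝ) : ℂ) * w r)
  let B' : ℝ → ℂ := fun r => Complex.exp (I * (r : ℂ)) * (I / 2 * ((c / r ^ 2 : ℝ) : ℂ) * w r)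
  have hid : ∀ r : ℝ, HasDerivAt (fun r : ℝ => (r : ℂ)) 1 r := fun r =>
    (hasDerivAt_id r).ofReal_comp
  have hwc : ContinuousOn w (Set.Ioi 0) := fun r hr => (hw r hr).continuousAt.continuousWithinAt
  have hcc : ContinuousOn (fun r : ℝ => ((c / r ^ 2 : ℝ) : ℂ)) (Set.Ioi 0) := by
    refine Complex.continuous_ofReal.comp_continuousOn (continuousOn_const.div (by fun_prop) ?_)
    intro r hr
    exact pow_ne_zero 2 (ne_of_gt hr)
  have hnA : ∀ r, 1 / 4 ≤ r → ‖(w r - I * w' r) / 2‖ ≤ C := by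
    intro r hr
    have := norm_sub_le (w r) (I * w' r)
    rw [norm_mul I, norm_I, one_mul] at this
    rw [norm_div, Complex.norm_ofNat]
    have := (hC r hr).1
    have := (hC r hr).2
    linarith
  have hnB : ∀ r, 1 / 4 ≤ r → ‖(w r + I * w' r) / 2‖ ≤ C := by
    intro r hr
    have := norm_add_le (w r) (I * w' r)
    rw [norm_mul I, norm_I, one_mul] at this
    rw [norm_div, Complex.norm_ofNat]
    have := (hC r hr).1
    have := (hC r hr).2
    linarith
  have hdec : ∀ r, 1 / 4 ≤ r → 1 / 2 * (|c| / r ^ 2) * ‖w r‖ ≤ (C + 2 * |c| * C) / r := by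
    intro r hr
    have hr0 : 0 < r := by linarith
    rw [le_div_iff₀ hr0]
    have h1 : 1 / r ≤ 4 := by rw [div_le_iff₀ hr0]; linarith
    calc 1 / 2 * (|c| / r ^ 2) * ‖w r‖ * r = 1 / 2 * |c| * (1 / r) * ‖w r‖ := by
          field_simp
      _ ≤ 1 / 2 * |c| * 4 * C := by
          have := (hC r hr).1
          gcongr
      _ ≤ _ := by nlinarith
  have hcle : C ≤ C + 2 * |c| * C := by nlinarith [mul_nonneg (abs_nonneg c) hC0]
  refine ⟨A, B, A', B', C + 2 * |c| * C, by positivity, fun r hr => ?_, fun r hr => ?_, ?_, ?_,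
    fun r hr => ⟨?_, ?_, ?_, ?_⟩, fun r hr => ?_⟩
  · refine ((((hid r).const_mul (-I)).cexp).mul
      (((hw r hr).sub ((hw' r hr).const_mul I)).div_const 2)).congr_deriv ?_
    simp only [A', Pi.sub_apply]
    push_cast
    linear_combination (Complex.exp (-I * r) * w' r / 2) * I_sq
  · refine ((((hid r).const_mul I).cexp).mul
      (((hw r hr).add ((hw' r hr).const_mul I)).div_const 2)).congr_deriv ?_
    simp only [B', Pi.add_apply]
    push_cast
    linear_combination (Complex.exp (I * r) * w' r / 2) * I_sq
  · exact (Continuous.continuousOn (by fun_prop)).mul ((continuousOn_const.mul hcc).mul hwc)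
  · exact (Continuous.continuousOn (by fun_prop)).mul ((continuousOn_const.mul hcc).mul hwc)
  · simp only [A]
    rw [norm_mul, norm_exp_negI_mul, one_mul]
    exact (hnA r hr).trans hcle
  · simp only [B]
    rw [norm_mul, norm_exp_I_mul, one_mul]
    exact (hnB r hr).trans hcle
  · simp only [A']
    rw [norm_mul, norm_exp_negI_mul, one_mul]
    refine le_trans (le_of_eq ?_) (hdec r hr)
    rw [norm_mul, norm_mul, Complex.norm_real, norm_div, norm_neg, norm_I, Complex.norm_ofNat,
      norm_div, norm_pow, Real.norm_eq_abs, Real.norm_eq_abs, sq_abs]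
  · simp only [B']
    rw [norm_mul, norm_exp_I_mul, one_mul]
    refine le_trans (le_of_eq ?_) (hdec r hr)
    rw [norm_mul, norm_mul, Complex.norm_real, norm_div, norm_I, Complex.norm_ofNat,
      norm_div, norm_pow, Real.norm_eq_abs, Real.norm_eq_abs, sq_abs]
  · have h1 : Complex.exp (I * (r : ℂ)) * Complex.exp (-I * (r : ℂ)) = 1 := by
      rw [← Complex.exp_add]; simp
    have h2 : Complex.exp (I * (r : ℂ)) * A r + Complex.exp (-I * (r : ℂ)) * B r = w r := by
      simp only [A, B]
      linear_combination (w r) * h1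
    rw [h2]
    simp only [w]
    rw [← mul_assoc, ← Complex.ofReal_mul, ← Real.rpow_add hr, neg_add_cancel, Real.rpow_zero,
      Complex.ofReal_one, one_mul, sphMom_zero]


/-! ### The dyadic radial kernel -/

theorem exists_vdc_le {a : ℝ} (ha1 : 1 < a) (ha2 : a < 2) {A₁ A₂ A₁' A₂' : ℝ → ℂ} {C : ℝ}
    (hC : 0 ≤ C)
    (hA₁ : ∀ r, 0 < r → HasDerivAt A₁ (A₁' r) r) (hA₂ : ∀ r, 0 < r → HasDerivAt A₂ (A₂' r) r)
    (hc₁ : ContinuousOn A₁' (Set.Ioi 0)) (hc₂ : ContinuousOn A₂' (Set.Ioi 0))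
    (hb₁ : ∀ r, 1 / 4 ≤ r → ‖A₁ r‖ ≤ C ∧ ‖A₁' r‖ ≤ C / r)
    (hb₂ : ∀ r, 1 / 4 ≤ r → ‖A₂ r‖ ≤ C ∧ ‖A₂' r‖ ≤ C / r) :
    ∃ K : ℝ, 0 ≤ K ∧ ∀ (t u ρ σ : ℝ), 1 ≤ ρ → 1 ≤ σ →
      ‖∫ x in (1 / 2 : ℝ)..2, (dyBump x : ℂ) * A₁ (ρ * x) * (starRingEnd ℂ) (A₂ (σ * x))
        * oscFac a t u x‖ ≤ K ∧
      √|t| * ‖∫ x in (1 / 2 : ℝ)..2, (dyBump x : ℂ) * A₁ (ρ * x) * (starRingEnd ℂ) (A₂ (σ * x))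
        * oscFac a t u x‖ ≤ K := by
  obtain ⟨D, hD⟩ := (isCompact_Icc (a := (1 / 2 : ℝ)) (b := 2)).exists_bound_of_continuousOn
    (contDiff_dyBump.continuous_deriv (by simp)).continuousOn
  have hD0 : 0 ≤ D := (norm_nonneg _).trans (hD 1 (by constructor <;> norm_num))
  set G₁ : ℝ := D * C * C + 2 * C * C + 2 * C * C with hG₁
  have hG₁0 : 0 ≤ G₁ := by positivity
  set ν₀ : ℝ := a * (a - 1) * 2 ^ (a - 2) with hν₀
  have hν₀p : 0 < ν₀ := by
    have : (0:ℝ) < 2 ^ (a - 2) := by positivity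
    have h1 : 0 < a - 1 := by linarith
    positivity
  set V : ℝ := (8 * (C * C) + 2 * G₁ * (2 - 1 / 2)) with hV
  have hV0 : 0 ≤ V := by rw [hV]; nlinarith [mul_nonneg hC hC]
  refine ⟨C * C * |2 - 1 / 2| + V / √ν₀, by positivity, fun t u ρ σ hρ hσ => ?_⟩
  set g : ℝ → ℂ := fun x => (dyBump x : ℂ) * A₁ (ρ * x) * (starRingEnd ℂ) (A₂ (σ * x)) with hg
  set g' : ℝ → ℂ := fun x =>
    (((deriv dyBump x : ℝ) : ℂ) * A₁ (ρ * x) + dyBump x * (ρ * A₁' (ρ * x)))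
      * (starRingEnd ℂ) (A₂ (σ * x))
    + dyBump x * A₁ (ρ * x) * (starRingEnd ℂ) (σ * A₂' (σ * x)) with hg'
  have hx0 : ∀ x ∈ Set.Icc (1 / 2 : ℝ) 2, 0 < x := fun x hx => by linarith [hx.1]
  have hge : ∀ c : ℝ, 1 ≤ c → ∀ x ∈ Set.Icc (1 / 2 : ℝ) 2, 1 / 2 ≤ c * x := fun c hc x hx => by
    nlinarith [hx.1]
  have hgd : ∀ x ∈ Set.Icc (1 / 2 : ℝ) 2, HasDerivAt g (g' x) x := by
    intro x hx
    have hρx : 0 < ρ * x := by linarith [hge ρ hρ x hx]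
    have hσx : 0 < σ * x := by linarith [hge σ hσ x hx]
    have h0 : HasDerivAt (fun x => (dyBump x : ℂ)) ((deriv dyBump x : ℝ) : ℂ) x :=
      ((contDiff_dyBump.differentiable (by simp)) x).hasDerivAt.ofReal_comp
    have hlin : ∀ c : ℝ, HasDerivAt (fun x : ℝ => c * x) c x := fun c => by
      simpa using (hasDerivAt_id x).const_mul c
    have h1 : HasDerivAt (fun x => A₁ (ρ * x)) (ρ * A₁' (ρ * x)) x :=
      ((hA₁ _ hρx).scomp x (hlin ρ)).congr_deriv (by rw [Complex.real_smul])
    have h2 : HasDerivAt (fun x => A₂ (σ * x)) (σ * A₂' (σ * x)) x :=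
      ((hA₂ _ hσx).scomp x (hlin σ)).congr_deriv (by rw [Complex.real_smul])
    exact (h0.mul h1).mul h2.star
  have hmaps : ∀ c : ℝ, 1 ≤ c →
      Set.MapsTo (fun x => c * x) (Set.Icc (1 / 2 : ℝ) 2) (Set.Ioi 0) := fun c hc x hx => by
    have := hge c hc x hx
    exact Set.mem_Ioi.2 (by linarith)
  have hgc' : ContinuousOn g' (Set.Icc (1 / 2) 2) := by
    have c1 : ContinuousOn A₁ (Set.Ioi 0) := fun r hr => (hA₁ r hr).continuousAt.continuousWithinAt
    have c2 : ContinuousOn A₂ (Set.Ioi 0) := fun r hr => (hA₂ r hr).continuousAt.continuousWithinAt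
    have l : ∀ c : ℝ, ContinuousOn (fun x : ℝ => c * x) (Set.Icc (1 / 2 : ℝ) 2) := fun c => by
      fun_prop
    have k1 := c1.comp (l ρ) (hmaps ρ hρ)
    have k2 := c2.comp (l σ) (hmaps σ hσ)
    have k3 := hc₁.comp (l ρ) (hmaps ρ hρ)
    have k4 := hc₂.comp (l σ) (hmaps σ hσ)
    have k5 : ContinuousOn (fun x => ((deriv dyBump x : ℝ) : ℂ)) (Set.Icc (1 / 2 : ℝ) 2) :=
      (Complex.continuous_ofReal.comp
        (contDiff_dyBump.continuous_deriv (by simp))).continuousOn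
    have k6 : ContinuousOn (fun x => (dyBump x : ℂ)) (Set.Icc (1 / 2 : ℝ) 2) :=
      (Complex.continuous_ofReal.comp continuous_dyBump).continuousOn
    exact (((k5.mul k1).add (k6.mul (continuousOn_const.mul k3))).mul
      (Complex.continuous_conj.comp_continuousOn k2)).add
      ((k6.mul k1).mul (Complex.continuous_conj.comp_continuousOn (continuousOn_const.mul k4)))
  have hbump : ∀ x, ‖(dyBump x : ℂ)‖ ≤ 1 := fun x => by
    rw [Complex.norm_real, Real.norm_eq_abs, abs_of_nonneg (dyBump_nonneg x)]
    exact dyBump_le_one x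
  have hgb : ∀ x ∈ Set.Icc (1 / 2 : ℝ) 2, ‖g x‖ ≤ C * C := by
    intro x hx
    have e1 := (hb₁ (ρ * x) (by linarith [hge ρ hρ x hx])).1
    have e2 := (hb₂ (σ * x) (by linarith [hge σ hσ x hx])).1
    simp only [hg]
    rw [norm_mul, norm_mul, RCLike.norm_conj]
    calc ‖(dyBump x : ℂ)‖ * ‖A₁ (ρ * x)‖ * ‖A₂ (σ * x)‖ ≤ 1 * C * C := by
          gcongr; exact hbump x
      _ = C * C := by ring
  have hscal : ∀ c : ℝ, 1 ≤ c → ∀ x ∈ Set.Icc (1 / 2 : ℝ) 2, ∀ A : ℂ, ‖A‖ ≤ C / (c * x) →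
      ‖(c : ℂ) * A‖ ≤ 2 * C := by
    intro c hc x hx A hA
    rw [norm_mul, Complex.norm_real, Real.norm_eq_abs, abs_of_pos (by linarith)]
    calc c * ‖A‖ ≤ c * (C / (c * x)) := by gcongr
      _ = C / x := by have := hx0 x hx; field_simp
      _ ≤ 2 * C := by
          rw [div_le_iff₀ (hx0 x hx)]
          nlinarith [hx.1]
  have hgb' : ∀ x ∈ Set.Icc (1 / 2 : ℝ) 2, ‖g' x‖ ≤ G₁ := by
    intro x hx
    have e1 := (hb₁ (ρ * x) (by linarith [hge ρ hρ x hx]))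
    have e2 := (hb₂ (σ * x) (by linarith [hge σ hσ x hx]))
    have f1 := hscal ρ hρ x hx _ e1.2
    have f2 := hscal σ hσ x hx _ e2.2
    have f3 : ‖((deriv dyBump x : ℝ) : ℂ)‖ ≤ D := by rw [Complex.norm_real]; exact hD x hx
    simp only [hg']
    refine (norm_add_le _ _).trans ?_
    rw [norm_mul, norm_mul _ ((starRingEnd ℂ) _), norm_mul _ (A₁ _), RCLike.norm_conj,
      RCLike.norm_conj]
    have f4 : ‖((deriv dyBump x : ℝ) : ℂ) * A₁ (ρ * x) + dyBump x * (ρ * A₁' (ρ * x))‖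
        ≤ D * C + 1 * (2 * C) := by
      refine (norm_add_le _ _).trans ?_
      rw [norm_mul, norm_mul (dyBump x : ℂ)]
      gcongr
      · exact e1.1
      · exact hbump x
    calc _ ≤ (D * C + 1 * (2 * C)) * C + 1 * C * (2 * C) := by
          gcongr
          · exact e2.1
          · exact hbump x
          · exact e1.1
      _ = G₁ := by rw [hG₁]; ring
  have hosc : ∀ x, ‖oscFac a t u x‖ = 1 := norm_oscFac a t u
  have hI1 : ‖∫ x in (1 / 2 : ℝ)..2, g x * oscFac a t u x‖ ≤ C * C * |2 - 1 / 2| := by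
    refine intervalIntegral.norm_integral_le_of_norm_le_const fun x hx => ?_
    rw [Set.uIoc_of_le (by norm_num)] at hx
    rw [norm_mul, hosc, mul_one]
    exact hgb x ⟨hx.1.le, hx.2⟩
  have hVs : 0 ≤ V / √ν₀ := by positivity
  have hCC : 0 ≤ C * C * |(2 : ℝ) - 1 / 2| := by positivity
  refine ⟨hI1.trans (by linarith), ?_⟩
  rcases eq_or_ne t 0 with rfl | ht
  · simp only [abs_zero, Real.sqrt_zero, zero_mul]
    linarith
  have ht' : 0 < |t| := abs_pos.2 ht
  suffices h : ‖∫ x in (1 / 2 : ℝ)..2, g x * oscFac a t u x‖ ≤ V / √(|t| * ν₀) by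
    rw [Real.sqrt_mul ht'.le] at h
    have hst : 0 < √|t| := Real.sqrt_pos.2 ht'
    calc √|t| * ‖∫ x in (1 / 2 : ℝ)..2, g x * oscFac a t u x‖
        ≤ √|t| * (V / (√|t| * √ν₀)) := by gcongr
      _ = V / √ν₀ := by field_simp
      _ ≤ _ := by linarith
  -- phase `ε (-t x^a + x u)` with the sign `ε` chosen to make it convex
  have hphase : ∀ ε : ℝ, ε * (-t) = |t| → ∀ (h h' : ℝ → ℂ),
      (∀ x ∈ Set.Icc (1 / 2 : ℝ) 2, HasDerivAt h (h' x) x) →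
      ContinuousOn h' (Set.Icc (1 / 2) 2) → (∀ x ∈ Set.Icc (1 / 2 : ℝ) 2, ‖h x‖ ≤ C * C) →
      (∀ x ∈ Set.Icc (1 / 2 : ℝ) 2, ‖h' x‖ ≤ G₁) →
      ‖∫ x in (1 / 2 : ℝ)..2, h x * Complex.exp (I * ((ε * (-t * x ^ a + x * u) : ℝ) : ℂ))‖
        ≤ V / √(|t| * ν₀) := by
    intro ε hε h h' hh hhc hhb hhb'
    refine norm_oscillatory_le_of_deriv2_ge (p := fun x => ε * (-t * x ^ a + x * u))
      (p' := fun x => ε * (-t * (a * x ^ (a - 1)) + u))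
      (p'' := fun x => |t| * (a * ((a - 1) * x ^ (a - 2)))) (by norm_num) (by positivity)
      (fun x hx => ?_) (fun x hx => ?_) ?_ (fun x hx => ?_) hh hhc hhb hhb'
    · exact ((((Real.hasDerivAt_rpow_const (Or.inl (hx0 x hx).ne')).const_mul (-t)).fun_add
        ((hasDerivAt_id x).mul_const u)).const_mul ε).congr_deriv (by simp)
    · refine (((((Real.hasDerivAt_rpow_const (p := a - 1)
        (Or.inl (hx0 x hx).ne')).const_mul a).const_mul (-t)).fun_add
        (hasDerivAt_const x u)).const_mul ε).congr_deriv ?_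
      rw [← hε, show a - 1 - 1 = a - 2 by ring]
      ring
    · refine continuousOn_const.mul (continuousOn_const.mul (continuousOn_const.mul ?_))
      exact continuousOn_id.rpow_const fun x hx => Or.inl (hx0 x hx).ne'
    · rw [hν₀, mul_assoc]
      have h1 : (2 : ℝ) ^ (a - 2) ≤ x ^ (a - 2) :=
        Real.rpow_le_rpow_of_nonpos (hx0 x hx) hx.2 (by linarith)
      have h2 : 0 ≤ a - 1 := by linarith
      gcongr
  rcases lt_or_gt_of_ne ht with hneg | hpos
  · have := hphase 1 (by rw [abs_of_neg hneg, one_mul]) g g' hgd hgc' hgb hgb'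
    simpa only [one_mul, oscFac] using this
  · have := hphase (-1) (by rw [abs_of_pos hpos]; ring) (fun x => (starRingEnd ℂ) (g x))
      (fun x => (starRingEnd ℂ) (g' x)) (fun x hx => (hgd x hx).star)
      (Complex.continuous_conj.comp_continuousOn hgc')
      (fun x hx => by rw [RCLike.norm_conj]; exact hgb x hx)
      (fun x hx => by rw [RCLike.norm_conj]; exact hgb' x hx)
    rw [← RCLike.norm_conj, ← intervalIntegral.intervalIntegral_conj] at this
    have e : ∀ x, (starRingEnd ℂ) ((starRingEnd ℂ) (g x) *
        Complex.exp (I * ((-1 * (-t * x ^ a + x * u) : ℝ) : ℂ))) = g x * oscFac a t u x := by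
      intro x
      rw [oscFac, map_mul, Complex.conj_conj, ← Complex.exp_conj, map_mul, conj_I,
        Complex.conj_ofReal]
      congr 2
      push_cast
      ring
    simp only [e] at this
    exact this


section RadialKernel

variable (d : ℕ)

theorem continuous_bumpPow : Continuous fun x : ℝ => ((dyBump x * x ^ (d - 1) : ℝ) : ℂ) := by
  have := continuous_dyBump
  fun_prop

theorem hasCompactSupport_bumpPow :
    HasCompactSupport fun x : ℝ => ((dyBump x * x ^ (d - 1) : ℝ) : ℂ) := by
  refine hasCompactSupport_dyBump.mono fun x hx => ?_
  rw [Function.mem_support] at hx ⊢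
  exact fun h => hx (by rw [h]; simp)

theorem integrable_bumpPow :
    Integrable fun x : ℝ => ((dyBump x * x ^ (d - 1) : ℝ) : ℂ) :=
  (continuous_bumpPow d).integrable_of_hasCompactSupport (hasCompactSupport_bumpPow d)

variable [NeZero d]

/-- The kernel of the propagator localized to unit frequencies, on radial functions. -/
def radKer (a t ρ σ : ℝ) : ℂ :=
  ∫ ξ : Ed d, (dyBump ‖ξ‖ : ℂ) * Complex.exp (-I * ((t * ‖ξ‖ ^ a : ℝ) : ℂ)) *
    (sphFun d (ρ * ‖ξ‖) * (starRingEnd ℂ) (sphFun d (σ * ‖ξ‖)))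

theorem continuous_sphFun : Continuous (sphFun d) := by
  have : sphFun d = sphMom d 0 := by ext r; exact (sphMom_zero r).symm
  rw [this]
  exact continuous_iff_continuousAt.2 fun r => (hasDerivAt_sphMom 0 r).continuousAt

/-- The one-dimensional form of the kernel, up to the constant. -/
def radKerLine (a t ρ σ : ℝ) : ℂ :=
  ∫ x : ℝ, ((dyBump x * x ^ (d - 1) : ℝ) : ℂ) * oscFac a t 0 x *
    (sphFun d (ρ * x) * (starRingEnd ℂ) (sphFun d (σ * x)))

theorem radKer_eq (a t ρ σ : ℝ) :
    radKer d a t ρ σ = ((d * volume.real (Metric.ball (0 : Ed d) 1) : ℝ) : ℂ)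
      * radKerLine d a t ρ σ := by
  have : Nonempty (Fin d) := ⟨0⟩
  have h := integral_fun_norm_addHaar (volume : Measure (Ed d)) (fun x : ℝ =>
    (dyBump x : ℂ) * Complex.exp (-I * ((t * x ^ a : ℝ) : ℂ)) *
      (sphFun d (ρ * x) * (starRingEnd ℂ) (sphFun d (σ * x))))
  rw [radKer, h, finrank_euclideanSpace, Fintype.card_fin, nsmul_eq_mul, Complex.real_smul,
    Complex.ofReal_mul, Complex.ofReal_natCast, mul_assoc]
  congr 2
  rw [radKerLine, ← integral_indicator measurableSet_Ioi]
  congr 1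
  ext x
  by_cases hx : x ∈ Set.Ioi (0 : ℝ)
  · rw [Set.indicator_of_mem hx, Complex.real_smul, oscFac]
    rw [show -I * ((t * x ^ a : ℝ) : ℂ) = I * ((-t * x ^ a + x * 0 : ℝ) : ℂ) by push_cast; ring]
    push_cast
    ring
  · rw [Set.indicator_of_notMem hx, dyBump_of_le (by
      have : x ≤ 0 := not_lt.1 hx
      linarith)]
    simp

theorem norm_radKerLine_le (a t ρ σ : ℝ) :
    ‖radKerLine d a t ρ σ‖ ≤ ∫ x : ℝ, ‖((dyBump x * x ^ (d - 1) : ℝ) : ℂ)‖ := by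
  refine norm_integral_le_of_norm_le (integrable_bumpPow d).norm
    (Filter.Eventually.of_forall fun x => ?_)
  rw [norm_mul, norm_mul, norm_oscFac, mul_one, norm_mul, RCLike.norm_conj]
  refine mul_le_of_le_one_right (norm_nonneg _) ?_
  exact mul_le_one₀ (norm_sphFun_le _) (norm_nonneg _) (norm_sphFun_le _)

theorem exists_radKerLine_nonstationary {a : ℝ} (ha : 0 < a) (N : ℕ) :
    ∃ K : ℝ, 0 ≤ K ∧ ∀ t ρ σ : ℝ, 0 ≤ ρ → 0 ≤ σ →
      |t| ^ N * ‖radKerLine d a t ρ σ‖ ≤ K * (1 + ρ + σ) ^ N := by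
  have hs : ContDiff ℝ (⊤ : ℕ∞) fun x : ℝ => ((dyBump x * x ^ (d - 1) : ℝ) : ℂ) :=
    Complex.ofRealCLM.contDiff.comp (contDiff_dyBump.mul (contDiff_id.pow _))
  obtain ⟨K, hK, hb⟩ := exists_nonstationary_le ha N (1 / 2) 2 _ (by norm_num) hs
    (fun x hx => by rw [dyBump_of_le hx]; simp) (fun x hx => by rw [dyBump_of_ge hx]; simp)
  refine ⟨K, hK, fun t ρ σ hρ hσ => ?_⟩
  set ψ : ℝ → ℂ := fun x => ((dyBump x * x ^ (d - 1) : ℝ) : ℂ) with hψ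
  let P : Measure (Ed d × Ed d) := (ballMeas d).prod (ballMeas d)
  let u : Ed d × Ed d → ℝ := fun p => -ρ * sphCoord p.1 + σ * sphCoord p.2
  have hm0 := measurable_sphCoord (d := d)
  have hu : Measurable u := by simp only [u]; fun_prop
  have hub : ∀ p, |u p| ≤ ρ + σ := by
    intro p
    refine (abs_add_le _ _).trans ?_
    rw [abs_mul, abs_mul, abs_neg, abs_of_nonneg hρ, abs_of_nonneg hσ]
    have h1 := mul_le_of_le_one_right hρ (abs_sphCoord_le p.1)
    have h2 := mul_le_of_le_one_right hσ (abs_sphCoord_le p.2)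
    linarith
  have hprod : ∀ x : ℝ, oscFac a t 0 x * (sphFun d (ρ * x) * (starRingEnd ℂ) (sphFun d (σ * x)))
      = ∫ p, oscFac a t (u p) x ∂P := by
    intro x
    rw [sphFun, sphFun, ← integral_conj, ← integral_prod_mul, ← integral_const_mul]
    congr 1
    ext p
    rw [oscFac, oscFac, ← Complex.exp_conj, ← Complex.exp_add, ← Complex.exp_add]
    congr 1
    simp only [u, map_mul, map_neg, conj_I, Complex.conj_ofReal]
    push_cast
    ring
  have heq : radKerLine d a t ρ σ = ∫ p, (∫ x, ψ x * oscFac a t (u p) x) ∂P := by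
    rw [radKerLine, integral_integral_swap]
    · congr 1
      ext x
      rw [mul_assoc, hprod, integral_const_mul]
    · have hψi : Integrable (fun q : (Ed d × Ed d) × ℝ => ψ q.2) (P.prod volume) :=
        (integrable_bumpPow d).comp_snd P
      have hm : Measurable fun q : (Ed d × Ed d) × ℝ => oscFac a t (u q.1) q.2 := by
        unfold oscFac
        fun_prop
      refine hψi.mono (hψi.aestronglyMeasurable.mul hm.aestronglyMeasurable)
        (Filter.Eventually.of_forall fun q => ?_)
      simp only [Function.uncurry]
      rw [norm_mul, norm_oscFac, mul_one]
  rw [heq]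
  have hnn : 0 ≤ |t| ^ N := by positivity
  have : ∀ p, ‖((|t| ^ N : ℝ) : ℂ) * ∫ x, ψ x * oscFac a t (u p) x‖ ≤ K * (1 + ρ + σ) ^ N := by
    intro p
    rw [norm_mul, Complex.norm_real, Real.norm_eq_abs, abs_of_nonneg hnn]
    refine (hb t (u p)).trans ?_
    have := hub p
    have h2 : 1 + |u p| ≤ 1 + ρ + σ := by linarith
    gcongr
  have h3 := norm_integral_le_of_norm_le_const (μ := P) (Filter.Eventually.of_forall this)
  rwa [integral_const_mul, norm_mul, Complex.norm_real, Real.norm_eq_abs, abs_of_nonneg hnn,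
    probReal_univ, mul_one] at h3

theorem exists_radKerLine_dispersive {a : ℝ} (ha1 : 1 < a) (ha2 : a < 2) :
    ∃ K : ℝ, 0 ≤ K ∧ ∀ t ρ σ : ℝ, 1 ≤ ρ → 1 ≤ σ →
      ‖radKerLine d a t ρ σ‖ ≤ K * (ρ * σ) ^ (-(((d : ℝ) - 1) / 2)) ∧
      √|t| * ‖radKerLine d a t ρ σ‖ ≤ K * (ρ * σ) ^ (-(((d : ℝ) - 1) / 2)) := by
  obtain ⟨A, B, A', B', C, hC, hA, hB, hA'c, hB'c, hb, hexp⟩ := exists_sphFun_expansion d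
  have hbA : ∀ r, 1 / 4 ≤ r → ‖A r‖ ≤ C ∧ ‖A' r‖ ≤ C / r := fun r hr =>
    ⟨(hb r hr).1, (hb r hr).2.2.1⟩
  have hbB : ∀ r, 1 / 4 ≤ r → ‖B r‖ ≤ C ∧ ‖B' r‖ ≤ C / r := fun r hr =>
    ⟨(hb r hr).2.1, (hb r hr).2.2.2⟩
  obtain ⟨K₁, hK₁, h₁⟩ := exists_vdc_le ha1 ha2 hC hA hA hA'c hA'c hbA hbA
  obtain ⟨K₂, hK₂, h₂⟩ := exists_vdc_le ha1 ha2 hC hA hB hA'c hB'c hbA hbB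
  obtain ⟨K₃, hK₃, h₃⟩ := exists_vdc_le ha1 ha2 hC hB hA hB'c hA'c hbB hbA
  obtain ⟨K₄, hK₄, h₄⟩ := exists_vdc_le ha1 ha2 hC hB hB hB'c hB'c hbB hbB
  refine ⟨K₁ + K₂ + K₃ + K₄, by positivity, fun t ρ σ hρ hσ => ?_⟩
  set m : ℝ := ((d : ℝ) - 1) / 2 with hm
  let T : (ℝ → ℂ) → (ℝ → ℂ) → ℝ → ℝ → ℂ := fun A₁ A₂ u x =>
    (dyBump x : ℂ) * A₁ (ρ * x) * (starRingEnd ℂ) (A₂ (σ * x)) * oscFac a t u x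
  have hρ0 : 0 < ρ := by linarith
  have hσ0 : 0 < σ := by linarith
  have hTi : ∀ A₁ A₂ : ℝ → ℂ, ContinuousOn A₁ (Set.Ioi 0) → ContinuousOn A₂ (Set.Ioi 0) → ∀ u,
      IntervalIntegrable (T A₁ A₂ u) volume (1 / 2) 2 := by
    intro A₁ A₂ c₁ c₂ u
    refine ContinuousOn.intervalIntegrable ?_
    rw [Set.uIcc_of_le (by norm_num)]
    have hmaps : ∀ c : ℝ, 0 < c →
        Set.MapsTo (fun x => c * x) (Set.Icc (1 / 2 : ℝ) 2) (Set.Ioi 0) := fun c hc x hx =>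
      mul_pos hc (by linarith [hx.1])
    have l : ∀ c : ℝ, ContinuousOn (fun x : ℝ => c * x) (Set.Icc (1 / 2 : ℝ) 2) := fun c => by
      fun_prop
    exact (((Complex.continuous_ofReal.comp continuous_dyBump).continuousOn.mul
      (c₁.comp (l ρ) (hmaps ρ hρ0))).mul
      (Complex.continuous_conj.comp_continuousOn (c₂.comp (l σ) (hmaps σ hσ0)))).mul
      (continuous_oscFac (by linarith) t u).continuousOn
  have cA : ContinuousOn A (Set.Ioi 0) := fun r hr => (hA r hr).continuousAt.continuousWithinAt
  have cB : ContinuousOn B (Set.Ioi 0) := fun r hr => (hB r hr).continuousAt.continuousWithinAt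
  have hdec : radKerLine d a t ρ σ = (((ρ * σ) ^ (-m) : ℝ) : ℂ) *
      ((∫ x in (1 / 2 : ℝ)..2, T A A (ρ - σ) x) + (∫ x in (1 / 2 : ℝ)..2, T A B (ρ + σ) x)
        + (∫ x in (1 / 2 : ℝ)..2, T B A (-ρ - σ) x) + ∫ x in (1 / 2 : ℝ)..2, T B B (-ρ + σ) x) := by
    rw [← intervalIntegral.integral_add (hTi A A cA cA _) (hTi A B cA cB _),
      ← intervalIntegral.integral_add ((hTi A A cA cA _).add (hTi A B cA cB _)) (hTi B A cB cA _),
      ← intervalIntegral.integral_add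
        (((hTi A A cA cA _).add (hTi A B cA cB _)).add (hTi B A cB cA _)) (hTi B B cB cB _),
      ← intervalIntegral.integral_const_mul, intervalIntegral.integral_of_le (by norm_num),
      radKerLine, ← integral_indicator measurableSet_Ioc]
    congr 1
    ext x
    by_cases hx : x ∈ Set.Ioc (1 / 2 : ℝ) 2
    · rw [Set.indicator_of_mem hx]
      have hx0 : 0 < x := by linarith [hx.1]
      rw [hexp _ (mul_pos hρ0 hx0), hexp _ (mul_pos hσ0 hx0)]
      have e1 : x ^ (d - 1) * ((ρ * x) ^ (-m) * (σ * x) ^ (-m)) = (ρ * σ) ^ (-m) := by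
        rw [Real.mul_rpow hρ0.le hx0.le, Real.mul_rpow hσ0.le hx0.le, Real.mul_rpow hρ0.le hσ0.le]
        have e2 : x ^ (d - 1) * (x ^ (-m) * x ^ (-m)) = 1 := by
          rw [← Real.rpow_add hx0, ← Real.rpow_natCast, ← Real.rpow_add hx0,
            Nat.cast_sub NeZero.one_le, hm]
          convert Real.rpow_zero x using 2
          push_cast
          ring
        linear_combination (ρ ^ (-m) * σ ^ (-m)) * e2
      rw [← e1]
      have ho : ∀ u, oscFac a t u x = oscFac a t 0 x * Complex.exp (I * ((x * u : ℝ) : ℂ)) := by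
        intro u
        rw [oscFac, oscFac, ← Complex.exp_add]
        congr 1
        push_cast
        ring
      simp only [T]
      rw [ho (ρ - σ), ho (ρ + σ), ho (-ρ - σ), ho (-ρ + σ)]
      simp only [map_mul, map_add, ← Complex.exp_conj, map_neg, conj_I, Complex.conj_ofReal]
      have x1 : Complex.exp (I * ((x * (ρ - σ) : ℝ) : ℂ)) =
          Complex.exp (I * ((ρ * x : ℝ) : ℂ)) * Complex.exp (-I * ((σ * x : ℝ) : ℂ)) := by
        rw [← Complex.exp_add]; congr 1; push_cast; ring
      have x2 : Complex.exp (I * ((x * (ρ + σ) : ℝ) : ℂ)) =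
          Complex.exp (I * ((ρ * x : ℝ) : ℂ)) * Complex.exp (I * ((σ * x : ℝ) : ℂ)) := by
        rw [← Complex.exp_add]; congr 1; push_cast; ring
      have x3 : Complex.exp (I * ((x * (-ρ - σ) : ℝ) : ℂ)) =
          Complex.exp (-I * ((ρ * x : ℝ) : ℂ)) * Complex.exp (-I * ((σ * x : ℝ) : ℂ)) := by
        rw [← Complex.exp_add]; congr 1; push_cast; ring
      have x4 : Complex.exp (I * ((x * (-ρ + σ) : ℝ) : ℂ)) =
          Complex.exp (-I * ((ρ * x : ℝ) : ℂ)) * Complex.exp (I * ((σ * x : ℝ) : ℂ)) := by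
        rw [← Complex.exp_add]; congr 1; push_cast; ring
      rw [x1, x2, x3, x4, neg_neg]
      simp only [Complex.ofReal_mul, Complex.ofReal_pow]
      ring
    · rw [Set.indicator_of_notMem hx]
      have : dyBump x = 0 := by
        by_contra hne
        have := dyBump_ne_zero hne
        exact hx ⟨this.1, this.2.le⟩
      simp [this]
  have hpos : 0 ≤ (ρ * σ) ^ (-m) := by positivity
  have hn : ‖radKerLine d a t ρ σ‖ = (ρ * σ) ^ (-m) *
      ‖(∫ x in (1 / 2 : ℝ)..2, T A A (ρ - σ) x) + (∫ x in (1 / 2 : ℝ)..2, T A B (ρ + σ) x)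
        + (∫ x in (1 / 2 : ℝ)..2, T B A (-ρ - σ) x)
        + ∫ x in (1 / 2 : ℝ)..2, T B B (-ρ + σ) x‖ := by
    rw [hdec, norm_mul, Complex.norm_real, Real.norm_eq_abs, abs_of_nonneg hpos]
  have g1 := h₁ t (ρ - σ) ρ σ hρ hσ
  have g2 := h₂ t (ρ + σ) ρ σ hρ hσ
  have g3 := h₃ t (-ρ - σ) ρ σ hρ hσ
  have g4 := h₄ t (-ρ + σ) ρ σ hρ hσ
  have hst := Real.sqrt_nonneg |t|
  constructor
  · rw [hn, mul_comm]
    refine mul_le_mul_of_nonneg_right ?_ hpos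
    refine (norm_add₄_le).trans ?_
    exact add_le_add (add_le_add (add_le_add g1.1 g2.1) g3.1) g4.1
  · rw [hn, mul_left_comm, mul_comm]
    refine mul_le_mul_of_nonneg_right ?_ hpos
    refine (mul_le_mul_of_nonneg_left norm_add₄_le hst).trans ?_
    rw [mul_add, mul_add, mul_add]
    exact add_le_add (add_le_add (add_le_add g1.2 g2.2) g3.2) g4.2

end RadialKernel


section RadialKernelBounds

variable (d : ℕ) [NeZero d]

theorem one_add_abs_rpow_mul_le {B k M t : ℝ} (hB : 0 ≤ B) (hk : 0 ≤ k) (h0 : k ≤ M)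
    (h1 : 1 ≤ |t| → |t| ^ B * k ≤ M) : k ≤ 2 ^ B * M * (1 + |t|) ^ (-B) := by
  have ht := abs_nonneg t
  have hp : 0 < (1 + |t|) ^ B := by positivity
  have h2 : (0 : ℝ) < 2 ^ B := by positivity
  rw [Real.rpow_neg (by positivity), ← div_eq_mul_inv, le_div_iff₀ hp]
  rcases le_total |t| 1 with h | h
  · have : (1 + |t|) ^ B ≤ 2 ^ B := Real.rpow_le_rpow (by positivity) (by linarith) hB
    nlinarith [mul_le_mul h0 this hp.le (hk.trans h0)]
  · have : (1 + |t|) ^ B ≤ 2 ^ B * |t| ^ B := by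
      rw [← Real.mul_rpow (by norm_num) ht]
      exact Real.rpow_le_rpow (by positivity) (by linarith) hB
    calc k * (1 + |t|) ^ B ≤ k * (2 ^ B * |t| ^ B) := by gcongr
      _ = 2 ^ B * (|t| ^ B * k) := by ring
      _ ≤ 2 ^ B * M := by gcongr; exact h1 h

theorem exists_radKer_bounds {a : ℝ} (ha1 : 1 < a) (ha2 : a < 2) (N : ℕ) :
    ∃ K : ℝ, 0 < K ∧ ∀ t ρ σ : ℝ, 0 ≤ ρ → 0 ≤ σ →
      ‖radKer d a t ρ σ‖ ≤ K ∧ |t| ^ N * ‖radKer d a t ρ σ‖ ≤ K * (1 + ρ + σ) ^ N ∧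
      (1 ≤ ρ → 1 ≤ σ → ‖radKer d a t ρ σ‖ ≤ K * (ρ * σ) ^ (-(((d : ℝ) - 1) / 2)) ∧
        √|t| * ‖radKer d a t ρ σ‖ ≤ K * (ρ * σ) ^ (-(((d : ℝ) - 1) / 2))) := by
  obtain ⟨K₁, hK₁, h₁⟩ := exists_radKerLine_nonstationary d (zero_lt_one.trans ha1) N
  obtain ⟨K₂, hK₂, h₂⟩ := exists_radKerLine_dispersive d ha1 ha2
  set K₃ := ∫ x : ℝ, ‖((dyBump x * x ^ (d - 1) : ℝ) : ℂ)‖ with hK₃d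
  have hK₃ : 0 ≤ K₃ := integral_nonneg fun _ => norm_nonneg _
  set c : ℝ := d * volume.real (Metric.ball (0 : Ed d) 1)
  have hc : 0 ≤ c := by positivity
  have hn : ∀ t ρ σ, ‖radKer d a t ρ σ‖ = c * ‖radKerLine d a t ρ σ‖ := fun t ρ σ => by
    rw [radKer_eq, norm_mul, Complex.norm_real, Real.norm_eq_abs, abs_of_nonneg hc]
  have hle : ∀ {u v K' : ℝ}, u ≤ K' * v → K' ≤ K₁ + K₂ + K₃ → 0 ≤ v →
      c * u ≤ (c * (K₁ + K₂ + K₃) + 1) * v := by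
    intro u v K' h1 h2 hv
    calc c * u ≤ c * (K' * v) := by gcongr
      _ ≤ c * ((K₁ + K₂ + K₃) * v) := by gcongr
      _ ≤ _ := by linarith
  refine ⟨c * (K₁ + K₂ + K₃) + 1, by positivity, fun t ρ σ hρ hσ => ⟨?_, ?_, fun h1 h2 => ⟨?_, ?_⟩⟩⟩
  · rw [hn]
    have := hle (u := ‖radKerLine d a t ρ σ‖) (v := 1) (K' := K₃)
      (by rw [mul_one]; exact norm_radKerLine_le d a t ρ σ) (by linarith) (by norm_num)
    linarith
  · rw [hn, mul_left_comm]
    exact hle (h₁ t ρ σ hρ hσ) (by linarith) (by positivity)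
  · rw [hn]
    exact hle (h₂ t ρ σ h1 h2).1 (by linarith) (by positivity)
  · rw [hn, mul_left_comm]
    exact hle (h₂ t ρ σ h1 h2).2 (by linarith) (by positivity)

theorem exists_radKer_le_sq {a : ℝ} (ha1 : 1 < a) (ha2 : a < 2) :
    ∃ K : ℝ, 0 < K ∧ ∀ t ρ σ : ℝ, 0 ≤ ρ → 0 ≤ σ →
      ‖radKer d a t ρ σ‖ ≤ K * (1 + ρ + σ) ^ 2 * (1 + |t|) ^ (-2 : ℝ) := by
  obtain ⟨K, hK, h⟩ := exists_radKer_bounds d ha1 ha2 2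
  refine ⟨2 ^ (2 : ℝ) * K, by positivity, fun t ρ σ hρ hσ => ?_⟩
  obtain ⟨h1, h2, -⟩ := h t ρ σ hρ hσ
  have h3 : K ≤ K * (1 + ρ + σ) ^ 2 := le_mul_of_one_le_right hK.le (by nlinarith)
  rw [mul_assoc (2 ^ (2 : ℝ))]
  refine one_add_abs_rpow_mul_le (by norm_num) (norm_nonneg _) (h1.trans h3) fun _ => ?_
  rw [Real.rpow_two]
  exact h2

theorem exists_radKer_decay (hd : 2 ≤ d) {a : ℝ} (ha1 : 1 < a) (ha2 : a < 2)
    (had : 2 * (d : ℝ) / (2 * d - 1) < a) :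
    ∃ A B K : ℝ, 0 < A ∧ 1 < a / d * B ∧ 0 < K ∧ ∀ t x ρ σ : ℝ, 1 ≤ x → x ≤ ρ → ρ ≤ 2 * x →
      x ≤ σ → σ ≤ 2 * x → ‖radKer d a t ρ σ‖ ≤ K * x ^ (-A) * (1 + |t|) ^ (-B) := by
  have hd' : (2 : ℝ) ≤ d := by exact_mod_cast hd
  have had' : d / a - 1 / 2 < (d : ℝ) - 1 := by
    rw [div_lt_iff₀ (by linarith)] at had
    rw [sub_lt_iff_lt_add, div_lt_iff₀ (by linarith)]
    nlinarith
  obtain ⟨ν, hν1, hν2⟩ := exists_between had'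
  have hda : 1 < d / a := by rw [one_lt_div (by linarith)]; linarith
  have hν0 : 0 < ν := by linarith
  -- choose `N` large
  obtain ⟨N, hN⟩ := exists_nat_gt (max ν (max (ν / 2 / (ν - (d / a - 1 / 2)))
    (ν * (d - 1) / (d - 1 - ν))))
  have hN1 : ν < N := (le_max_left _ _).trans_lt hN
  have hN2 : ν / 2 / (ν - (d / a - 1 / 2)) < N :=
    ((le_max_left _ _).trans (le_max_right _ _)).trans_lt hN
  have hN3 : ν * (d - 1) / (d - 1 - ν) < N :=
    ((le_max_right _ _).trans (le_max_right _ _)).trans_lt hN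
  have hN0 : (0 : ℝ) < N := hν0.trans hN1
  rw [div_lt_iff₀ (by linarith)] at hN2 hN3
  set η : ℝ := ν / N with hη
  have hηN : η * N = ν := by rw [hη]; field_simp
  have hη0 : 0 < η := by positivity
  have hη1 : η < 1 := by rw [hη, div_lt_one hN0]; exact hN1
  obtain ⟨K, hK, h⟩ := exists_radKer_bounds d ha1 ha2 N
  set A : ℝ := (d - 1) * (1 - η) - ν with hA
  set B : ℝ := (1 - η) / 2 + ν with hB
  have hA0 : 0 < A := by
    have : ν * (d - 1) < N * (d - 1 - ν) := hN3
    have h5 : A * N = N * (d - 1 - ν) - ν * (d - 1) := by rw [hA]; linear_combination -(d - 1) * hηN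
    exact pos_of_mul_pos_left (by linarith) hN0.le
  have hB0 : d / a < B := by
    have h5 : (B - d / a) * N = N * (ν - (d / a - 1 / 2)) - ν / 2 := by
      rw [hB]; linear_combination -(1 / 2) * hηN
    have : 0 < B - d / a := pos_of_mul_pos_left (by linarith) hN0.le
    linarith
  refine ⟨A, B, 2 ^ B * (K * 5 ^ ν), hA0, ?_, by positivity, ?_⟩
  · rw [div_lt_iff₀ (by linarith)] at hB0
    rw [div_mul_eq_mul_div, one_lt_div (by linarith)]
    linarith
  intro t x ρ σ hx h1 h2 h3 h4
  have hx0 : 0 < x := by linarith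
  obtain ⟨-, g2, g3⟩ := h t ρ σ (by linarith) (by linarith)
  obtain ⟨g3, g4⟩ := g3 (by linarith) (by linarith)
  set k := ‖radKer d a t ρ σ‖
  have hk : 0 ≤ k := norm_nonneg _
  have hρσ : (ρ * σ) ^ (-(((d : ℝ) - 1) / 2)) ≤ x ^ (-((d : ℝ) - 1)) := by
    calc (ρ * σ) ^ (-(((d : ℝ) - 1) / 2)) ≤ (x ^ (2 : ℝ)) ^ (-(((d : ℝ) - 1) / 2)) := by
          refine Real.rpow_le_rpow_of_nonpos (by positivity) ?_ (by linarith)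
          rw [Real.rpow_two]; nlinarith
      _ = x ^ (-((d : ℝ) - 1)) := by
          rw [← Real.rpow_mul hx0.le]; congr 1; ring
  have h5 : (1 : ℝ) ≤ 5 ^ ν := Real.one_le_rpow (by norm_num) hν0.le
  rw [show 2 ^ B * (K * 5 ^ ν) * x ^ (-A) = 2 ^ B * (K * 5 ^ ν * x ^ (-A)) by ring]
  refine one_add_abs_rpow_mul_le (by linarith) hk ?_ fun ht => ?_
  · calc k ≤ K * x ^ (-((d : ℝ) - 1)) := g3.trans (by gcongr)
      _ ≤ K * 1 * x ^ (-A) := by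
        rw [mul_one]
        gcongr 1
        refine Real.rpow_le_rpow_of_exponent_le hx ?_
        rw [hA]; nlinarith
      _ ≤ _ := by gcongr
  · have ht0 : 0 < |t| := by linarith
    have e1 : |t| ^ ((1 : ℝ) / 2) * k ≤ K * x ^ (-((d : ℝ) - 1)) := by
      rw [← Real.sqrt_eq_rpow]; exact g4.trans (by gcongr)
    have e2 : |t| ^ (N : ℝ) * k ≤ K * (5 * x) ^ (N : ℝ) := by
      rw [Real.rpow_natCast, Real.rpow_natCast]
      exact g2.trans (mul_le_mul_of_nonneg_left
        (pow_le_pow_left₀ (by linarith) (by linarith) _) hK.le)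
    have e3 : (|t| ^ ((1 : ℝ) / 2) * k) ^ (1 - η) * (|t| ^ (N : ℝ) * k) ^ η ≤
        (K * x ^ (-((d : ℝ) - 1))) ^ (1 - η) * (K * (5 * x) ^ (N : ℝ)) ^ η := by
      have : 0 ≤ 1 - η := by linarith
      gcongr
    have k1 : ∀ k : ℝ, 0 ≤ k → k ^ (1 - η) * k ^ η = k := fun k hk => by
      rw [← Real.rpow_add_of_nonneg hk (by linarith) hη0.le]; simp
    have e4 : (|t| ^ ((1 : ℝ) / 2) * k) ^ (1 - η) * (|t| ^ (N : ℝ) * k) ^ η = |t| ^ B * k := by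
      rw [Real.mul_rpow (by positivity) hk, Real.mul_rpow (by positivity) hk,
        ← Real.rpow_mul ht0.le, ← Real.rpow_mul ht0.le, mul_mul_mul_comm, k1 k hk,
        ← Real.rpow_add ht0]
      congr 2
      rw [hB]; linear_combination hηN
    have e5 : (K * x ^ (-((d : ℝ) - 1))) ^ (1 - η) * (K * (5 * x) ^ (N : ℝ)) ^ η
        = K * 5 ^ ν * x ^ (-A) := by
      rw [Real.mul_rpow hK.le (by positivity), Real.mul_rpow hK.le (by positivity),
        ← Real.rpow_mul hx0.le, ← Real.rpow_mul (by positivity), mul_mul_mul_comm, k1 K hK.le,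
        mul_comm (N : ℝ) η, hηN, Real.mul_rpow (by norm_num) hx0.le,
        mul_left_comm (x ^ _), ← Real.rpow_add hx0, ← mul_assoc]
      congr 2
      rw [hA]; ring
    rw [e4, e5] at e3
    exact e3

end RadialKernelBounds


section Plancherel

open FourierTransform SchwartzMap

variable {d : ℕ}

theorem lintegral_comp_smul_eq {E : Type*} [NormedAddCommGroup E] [NormedSpace ℝ E]
    [FiniteDimensional ℝ E] [MeasurableSpace E] [BorelSpace E] (μ : Measure E) [μ.IsAddHaarMeasure]
    (f : E → ℝ≥0∞) {r : ℝ} (hr : 0 < r) :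
    ∫⁻ x, f (r • x) ∂μ = ENNReal.ofReal ((r ^ Module.finrank ℝ E)⁻¹) * ∫⁻ x, f x ∂μ := by
  have h := Measure.map_addHaar_smul μ hr.ne'
  have h2 := (measurableEmbedding_const_smul₀ (α := E) hr.ne').lintegral_map (μ := μ) f
  rw [← h2]
  change ∫⁻ a, f a ∂(Measure.map (r • ·) μ) = _
  rw [h, lintegral_smul_measure, abs_of_pos (by positivity), smul_eq_mul]

theorem FT_eq_fourier (f : Ed d → ℂ) (ξ : Ed d) : FT f ξ = 𝓕 f ((2 * Real.pi)⁻¹ • ξ) := by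
  rw [FT, Real.fourier_eq]
  congr 1
  ext x
  rw [Circle.smul_def, Real.fourierChar_apply, smul_eq_mul, inner_smul_right]
  congr 2
  have := Real.pi_pos.ne'
  push_cast
  field_simp

theorem ae_eq_fourier_toLp {f : Ed d → ℂ} (hf : Integrable f) (hf2 : MemLp f 2) :
    𝓕 f =ᵐ[volume] (𝓕 (hf2.toLp f) : Lp ℂ 2 (volume : Measure (Ed d))) := by
  have hc : Continuous (𝓕 f) :=
    VectorFourier.fourierIntegral_continuous Real.continuous_fourierChar continuous_inner hf
  refine ae_eq_of_integral_contDiff_smul_eq hc.locallyIntegrable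
    ((Lp.memLp _).locallyIntegrable (by norm_num)) fun g hg hgc => ?_
  have hg1 : HasCompactSupport fun x => (g x : ℂ) := hgc.comp_left Complex.ofReal_zero
  have hg2 : ContDiff ℝ (⊤ : ℕ∞) fun x => (g x : ℂ) := Complex.ofRealCLM.contDiff.comp hg
  let φ : 𝓢(Ed d, ℂ) := hg1.toSchwartzMap hg2
  have h1 := congrArg (fun T => T φ) (Lp.fourier_toTemperedDistribution_eq (hf2.toLp f))
  simp only [TemperedDistribution.fourier_apply, Lp.toTemperedDistribution_apply] at h1
  have h2 : ∫ x, g x • 𝓕 f x = ∫ x, φ x • 𝓕 f x := rfl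
  have h3 : ∫ x, g x • (𝓕 (hf2.toLp f) : Lp ℂ 2 (volume : Measure (Ed d))) x =
    ∫ x, φ x • (𝓕 (hf2.toLp f) : Lp ℂ 2 (volume : Measure (Ed d))) x := rfl
  rw [h2, h3, ← h1]
  have h4 := VectorFourier.integral_fourierIntegral_smul_eq_flip (μ := volume) (ν := volume)
    (L := innerₗ (Ed d)) Real.continuous_fourierChar continuous_inner hf φ.integrable
  have h5 : ∀ x, φ x • 𝓕 f x = 𝓕 f x • φ x := fun x => mul_comm _ _
  have h6 : ∀ᵐ x, (𝓕 φ) x • (hf2.toLp f) x = f x • (𝓕 φ) x := by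
    filter_upwards [hf2.coeFn_toLp] with x hx
    rw [hx]; exact mul_comm _ _
  rw [integral_congr_ae h6]
  simp_rw [h5]
  refine h4.trans (integral_congr_ae (Filter.Eventually.of_forall fun x => ?_))
  simp only
  rw [flip_innerₗ]
  rfl

theorem lintegral_enorm_FT_sq {f : Ed d → ℂ} (hf : Integrable f) (hf2 : MemLp f 2) :
    ∫⁻ ξ, ‖FT f ξ‖ₑ ^ (2 : ℝ) = ENNReal.ofReal ((2 * Real.pi) ^ d) * ∫⁻ x, ‖f x‖ₑ ^ (2 : ℝ) := by
  have h1 : eLpNorm (𝓕 f) 2 volume = eLpNorm f 2 volume := by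
    rw [eLpNorm_congr_ae (ae_eq_fourier_toLp hf hf2), ← eLpNorm_congr_ae hf2.coeFn_toLp]
    have := Lp.norm_fourier_eq (hf2.toLp f)
    rw [Lp.norm_def, Lp.norm_def] at this
    exact (ENNReal.toReal_eq_toReal_iff' (Lp.eLpNorm_ne_top _) (Lp.eLpNorm_ne_top _)).1 this
  have h2 : ∫⁻ x, ‖𝓕 f x‖ₑ ^ (2 : ℝ) = ∫⁻ x, ‖f x‖ₑ ^ (2 : ℝ) := by
    rw [eLpNorm_eq_lintegral_rpow_enorm_toReal (by norm_num) (by norm_num),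
      eLpNorm_eq_lintegral_rpow_enorm_toReal (by norm_num) (by norm_num)] at h1
    exact ENNReal.rpow_left_injective (by norm_num) h1
  simp_rw [FT_eq_fourier]
  have hpi := Real.pi_pos
  rw [lintegral_comp_smul_eq volume (fun x => ‖𝓕 f x‖ₑ ^ (2 : ℝ)) (by positivity), h2,
    finrank_euclideanSpace, Fintype.card_fin, inv_pow, inv_inv]

end Plancherel


section ThreeLines

variable {X : Type*} [MeasurableSpace X] {μ : Measure X}

/-- The complex power `U ^ (c * (1 + z))` of a nonnegative number, vanishing for `U = 0`. -/
def powFam (c : ℝ) (z : ℂ) (u : ℝ) : ℂ :=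
  if u = 0 then 0 else Complex.exp ((c : ℂ) * (1 + z) * (Real.log u : ℂ))

theorem norm_powFam {c : ℝ} (hc : 0 < c) {z : ℂ} (hz : -1 < z.re) {u : ℝ} (hu : 0 ≤ u) :
    ‖powFam c z u‖ = u ^ (c * (1 + z.re)) := by
  rw [powFam]
  have h0 : 0 < 1 + z.re := by linarith
  split_ifs with h
  · rw [h, norm_zero, Real.zero_rpow (by positivity)]
  · rw [Complex.norm_exp, Real.rpow_def_of_pos (lt_of_le_of_ne hu (Ne.symm h))]
    congr 1
    simp
    ring

theorem measurable_powFam (c : ℝ) (z : ℂ) : Measurable (powFam c z) := by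
  unfold powFam
  exact Measurable.ite (measurableSet_singleton 0) measurable_const (by fun_prop)

theorem powFam_mul (c : ℝ) (z : ℂ) {u v : ℝ} :
    powFam c z (u * v) = powFam c z u * powFam c z v := by
  unfold powFam
  by_cases hu : u = 0
  · simp [hu]
  by_cases hv : v = 0
  · simp [hv]
  simp only [mul_eq_zero, hu, hv, or_self, if_false]
  rw [Real.log_mul hu hv, ← Complex.exp_add]
  congr 1
  push_cast
  ring

theorem differentiableAt_integral_powFam {c : ℝ} (hc : 0 < c) {U : X → ℝ} (hU : Measurable U)
    (hU0 : ∀ x, 0 ≤ U x) (hU1 : ∀ x, U x ≤ 1) {ω : X → ℂ} (hω : Integrable ω μ) {z : ℂ}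
    (hz : -1 < z.re) : DifferentiableAt ℂ (fun z => ∫ x, powFam c z (U x) * ω x ∂μ) z := by
  have hδ : 0 < (1 + z.re) / 2 := by linarith
  set δ := (1 + z.re) / 2 with hδd
  have hre : ∀ w ∈ Metric.ball z δ, δ < 1 + w.re := by
    intro w hw
    have h1 : |(w - z).re| ≤ ‖w - z‖ := Complex.abs_re_le_norm _
    rw [Metric.mem_ball, dist_eq_norm] at hw
    have h2 := (abs_lt.1 (h1.trans_lt hw)).1
    rw [Complex.sub_re] at h2
    linarith
  have hmeas : ∀ z, AEStronglyMeasurable (fun x => powFam c z (U x) * ω x) μ := fun z =>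
    ((measurable_powFam c z).comp hU).aestronglyMeasurable.mul hω.aestronglyMeasurable
  refine (hasDerivAt_integral_of_dominated_loc_of_deriv_le
    (F' := fun z x => ((c : ℂ) * (Real.log (U x) : ℂ) * powFam c z (U x)) * ω x)
    (bound := fun x => c * (1 / (c * δ)) * ‖ω x‖) (Metric.ball_mem_nhds z hδ)
    (Filter.Eventually.of_forall hmeas) ?_ ?_ ?_ ?_ ?_).2.differentiableAt
  · refine hω.norm.mono (hmeas z) (Filter.Eventually.of_forall fun x => ?_)
    rw [norm_mul, norm_norm, norm_powFam hc hz (hU0 x)]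
    exact mul_le_of_le_one_left (norm_nonneg _)
      (Real.rpow_le_one (hU0 x) (hU1 x) (mul_nonneg hc.le (by linarith)))
  · refine AEStronglyMeasurable.mul ?_ hω.aestronglyMeasurable
    have := measurable_powFam c z
    exact Measurable.aestronglyMeasurable (by fun_prop)
  · refine Filter.Eventually.of_forall fun x w hw => ?_
    rw [norm_mul]
    refine mul_le_mul_of_nonneg_right ?_ (norm_nonneg _)
    have hw' := hre w hw
    rw [norm_mul, norm_mul, norm_powFam hc (by linarith) (hU0 x), Complex.norm_real,
      Complex.norm_real, Real.norm_eq_abs, Real.norm_eq_abs, abs_of_pos hc, mul_assoc]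
    refine mul_le_mul_of_nonneg_left ?_ hc.le
    rcases (hU0 x).eq_or_lt with h | h
    · rw [← h, Real.log_zero, abs_zero, zero_mul]
      positivity
    · have h2 := (Real.abs_log_mul_self_rpow_lt (U x) (c * δ) h (hU1 x) (by positivity)).le
      rw [abs_mul, abs_of_nonneg (Real.rpow_nonneg (hU0 x) _)] at h2
      refine le_trans ?_ h2
      refine mul_le_mul_of_nonneg_left ?_ (abs_nonneg _)
      exact Real.rpow_le_rpow_of_exponent_ge h (hU1 x) (by gcongr)
  · exact hω.norm.const_mul _
  · refine Filter.Eventually.of_forall fun x w _ => ?_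
    refine HasDerivAt.mul_const ?_ _
    by_cases h : U x = 0
    · simp only [powFam, h, if_true, mul_zero]
      exact hasDerivAt_const _ _
    · simp only [powFam, h, if_false]
      have h1 : HasDerivAt (fun w : ℂ => (c : ℂ) * (1 + w) * (Real.log (U x) : ℂ))
          ((c : ℂ) * 1 * (Real.log (U x) : ℂ)) w :=
        (((hasDerivAt_id w).const_add 1).const_mul _).mul_const _
      refine h1.cexp.congr_deriv ?_
      ring

theorem norm_integral_powFam_le {c : ℝ} (hc : 0 < c) {U : X → ℝ} (hU : Measurable U)
    (hU0 : ∀ x, 0 ≤ U x) (hU1 : ∀ x, U x ≤ 1) {ω : X → ℂ} (hω : Integrable ω μ) {M₀ M₁ : ℝ}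
    (h0 : ∀ z : ℂ, z.re = 0 → ‖∫ x, powFam c z (U x) * ω x ∂μ‖ ≤ M₀)
    (h1 : ∀ z : ℂ, z.re = 1 → ‖∫ x, powFam c z (U x) * ω x ∂μ‖ ≤ M₁) {θ : ℝ} (hθ0 : 0 ≤ θ)
    (hθ1 : θ ≤ 1) :
    ‖∫ x, powFam c θ (U x) * ω x ∂μ‖ ≤ M₀ ^ (1 - θ) * M₁ ^ θ := by
  have h := Complex.HadamardThreeLines.norm_le_interp_of_mem_verticalClosedStrip₀₁'
    (f := fun z => ∫ x, powFam c z (U x) * ω x ∂μ) (z := (θ : ℂ)) (a := M₀) (b := M₁)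
    ?_ ?_ ?_ ?_ ?_
  · simpa using h
  · simpa [Complex.HadamardThreeLines.verticalClosedStrip] using ⟨hθ0, hθ1⟩
  · refine DifferentiableOn.diffContOnCl fun z hz => ?_
    refine (differentiableAt_integral_powFam hc hU hU0 hU1 hω ?_).differentiableWithinAt
    have : z ∈ Complex.re ⁻¹' (Set.Icc 0 1) := by
      refine closure_minimal ?_ (isClosed_Icc.preimage Complex.continuous_re) hz
      exact Set.preimage_mono Set.Ioo_subset_Icc_self
    linarith [this.1]
  · refine ⟨∫ x, ‖ω x‖ ∂μ, ?_⟩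
    rintro _ ⟨z, hz, rfl⟩
    have hz1 : 0 ≤ z.re := hz.1
    refine norm_integral_le_of_norm_le hω.norm (Filter.Eventually.of_forall fun x => ?_)
    rw [norm_mul, norm_powFam hc (by linarith) (hU0 x)]
    exact mul_le_of_le_one_left (norm_nonneg _)
      (Real.rpow_le_one (hU0 x) (hU1 x) (mul_nonneg hc.le (by linarith)))
  · exact fun z hz => h0 z hz
  · exact fun z hz => h1 z hz

end ThreeLines


section LocalizedForm

variable {d : ℕ}

/-- Bounded measurable radial functions of bounded support. -/
structure SpaceTest (f : Ed d → ℂ) : Prop where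
  meas : Measurable f
  bdd : ∃ M : ℝ, ∀ x, ‖f x‖ ≤ M
  supp : ∃ R : ℝ, ∀ x, f x ≠ 0 → ‖x‖ ≤ R
  radial : IsRadial f

theorem SpaceTest.integrable_rpow {f : Ed d → ℂ} (hf : SpaceTest f) {p : ℝ} (hp : 0 < p) :
    Integrable fun x => ‖f x‖ ^ p := by
  obtain ⟨M, hM⟩ := hf.bdd
  obtain ⟨R, hR⟩ := hf.supp
  have h : Integrable ((Metric.closedBall (0 : Ed d) R).indicator fun _ => M ^ p) :=
    (integrable_indicator_iff measurableSet_closedBall).2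
      (integrableOn_const measure_closedBall_lt_top.ne)
  refine h.mono' (hf.meas.norm.pow_const p).aestronglyMeasurable
    (Filter.Eventually.of_forall fun x => ?_)
  rw [Real.norm_of_nonneg (by positivity)]
  by_cases hx : f x = 0
  · rw [hx, norm_zero, Real.zero_rpow hp.ne']
    have : 0 ≤ M := (norm_nonneg _).trans (hM x)
    exact Set.indicator_nonneg (fun _ _ => by positivity) _
  · rw [Set.indicator_of_mem (by simpa using hR x hx)]
    exact Real.rpow_le_rpow (norm_nonneg _) (hM x) hp.le

theorem SpaceTest.integrable {f : Ed d → ℂ} (hf : SpaceTest f) : Integrable f := by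
  refine (hf.integrable_rpow one_pos).mono' hf.meas.aestronglyMeasurable
    (Filter.Eventually.of_forall fun x => ?_)
  rw [Real.rpow_one]

theorem SpaceTest.memLp_two {f : Ed d → ℂ} (hf : SpaceTest f) : MemLp f 2 := by
  rw [memLp_two_iff_integrable_sq_norm hf.meas.aestronglyMeasurable]
  simpa using hf.integrable_rpow two_pos

theorem SpaceTest.const_mul {f : Ed d → ℂ} (hf : SpaceTest f) (c : ℂ) :
    SpaceTest fun x => c * f x := by
  obtain ⟨M, hM⟩ := hf.bdd
  obtain ⟨R, hR⟩ := hf.supp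
  refine ⟨hf.meas.const_mul c, ⟨‖c‖ * M, fun x => ?_⟩,
    ⟨R, fun x hx => hR x (right_ne_zero_of_mul hx)⟩, fun x y h => by rw [hf.radial x y h]⟩
  rw [norm_mul]
  exact mul_le_mul_of_nonneg_left (hM x) (norm_nonneg _)

theorem norm_FT_le (f : Ed d → ℂ) (ξ : Ed d) : ‖FT f ξ‖ ≤ ∫ x, ‖f x‖ := by
  refine (norm_integral_le_integral_norm _).trans_eq ?_
  congr 1
  ext x
  rw [norm_mul, norm_exp_negI_mul, one_mul]

theorem continuous_FT {f : Ed d → ℂ} (hf : Integrable f) : Continuous (FT f) := by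
  refine continuous_of_dominated (bound := fun x => ‖f x‖) (fun ξ => ?_) (fun ξ => ?_) hf.norm ?_
  · refine AEStronglyMeasurable.mul (Continuous.aestronglyMeasurable ?_) hf.aestronglyMeasurable
    fun_prop
  · refine Filter.Eventually.of_forall fun x => ?_
    rw [norm_mul, norm_exp_negI_mul, one_mul]
  · exact Filter.Eventually.of_forall fun x => by fun_prop

theorem FT_const_mul (c : ℂ) (f : Ed d → ℂ) (ξ : Ed d) : FT (fun x => c * f x) ξ = c * FT f ξ := by
  rw [FT, FT, ← integral_const_mul]
  congr 1
  ext x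
  ring

/-- The multiplier of the propagator localized to frequencies comparable to `b`. -/
def locMul (a b t : ℝ) (ξ : Ed d) : ℂ :=
  (dyBump (‖ξ‖ / b) : ℂ) * Complex.exp (-I * ((t * ‖ξ‖ ^ a : ℝ) : ℂ))

theorem norm_locMul (a b t : ℝ) (ξ : Ed d) : ‖locMul a b t ξ‖ = dyBump (‖ξ‖ / b) := by
  rw [locMul, norm_mul, norm_exp_negI_mul, mul_one, Complex.norm_real,
    Real.norm_of_nonneg (dyBump_nonneg _)]

theorem measurable_locMul (a b : ℝ) : Measurable fun p : ℝ × Ed d => locMul a b p.1 p.2 := by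
  unfold locMul
  have := continuous_dyBump.measurable
  fun_prop

theorem measurable_locMul_right (a b t : ℝ) : Measurable fun ξ : Ed d => locMul a b t ξ := by
  unfold locMul
  have := continuous_dyBump.measurable
  fun_prop

theorem integrable_dyBump_norm {b : ℝ} (hb : 0 < b) :
    Integrable fun ξ : Ed d => dyBump (‖ξ‖ / b) := by
  have hc : Continuous fun ξ : Ed d => dyBump (‖ξ‖ / b) := by
    have := continuous_dyBump
    fun_prop
  refine hc.integrable_of_hasCompactSupport
    (HasCompactSupport.of_support_subset_isCompact (isCompact_closedBall 0 (2 * b)) fun ξ hξ => ?_)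
  have := (dyBump_ne_zero hξ).2
  rw [div_lt_iff₀ hb] at this
  simpa using this.le

/-- The sesquilinear form of the propagator localized to frequencies comparable to `b`. -/
def locForm (a b t : ℝ) (f g : Ed d → ℂ) : ℂ :=
  ∫ ξ, locMul a b t ξ * (FT f ξ * (starRingEnd ℂ) (FT g ξ))

theorem locForm_const_mul (a b t : ℝ) (c c' : ℂ) (f g : Ed d → ℂ) :
    locForm a b t (fun x => c * f x) (fun x => c' * g x) =
      c * (starRingEnd ℂ) c' * locForm a b t f g := by
  rw [locForm, locForm, ← integral_const_mul]
  congr 1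
  ext ξ
  rw [FT_const_mul, FT_const_mul, map_mul]
  ring

theorem enorm_locForm_le (a b t : ℝ) {f g : Ed d → ℂ} (hf : Integrable f) (hf2 : MemLp f 2)
    (hg : Integrable g) (hg2 : MemLp g 2) :
    ‖locForm a b t f g‖ₑ ≤ ENNReal.ofReal ((2 * Real.pi) ^ d) *
      ((∫⁻ x, ‖f x‖ₑ ^ (2 : ℝ)) ^ (1 / 2 : ℝ) * (∫⁻ x, ‖g x‖ₑ ^ (2 : ℝ)) ^ (1 / 2 : ℝ)) := by
  calc ‖locForm a b t f g‖ₑ ≤ ∫⁻ ξ, ‖FT f ξ‖ₑ * ‖FT g ξ‖ₑ := by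
        refine (enorm_integral_le_lintegral_enorm _).trans (lintegral_mono fun ξ => ?_)
        rw [enorm_mul, enorm_mul, RCLike.enorm_conj]
        refine mul_le_of_le_one_left zero_le ?_
        rw [← ofReal_norm, norm_locMul]
        exact ENNReal.ofReal_le_one.2 (dyBump_le_one _)
    _ ≤ (∫⁻ ξ, ‖FT f ξ‖ₑ ^ (2 : ℝ)) ^ (1 / 2 : ℝ) * (∫⁻ ξ, ‖FT g ξ‖ₑ ^ (2 : ℝ)) ^ (1 / 2 : ℝ) :=
        ENNReal.lintegral_mul_le_Lp_mul_Lq volume Real.HolderConjugate.two_two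
          (continuous_FT hf).enorm.aemeasurable (continuous_FT hg).enorm.aemeasurable
    _ = _ := by
        rw [lintegral_enorm_FT_sq hf hf2, lintegral_enorm_FT_sq hg hg2,
          ENNReal.mul_rpow_of_nonneg _ _ (by norm_num), ENNReal.mul_rpow_of_nonneg _ _ (by norm_num),
          mul_mul_mul_comm, ← ENNReal.rpow_add_of_nonneg _ _ (by norm_num) (by norm_num)]
        norm_num

theorem norm_locForm_le (a b t : ℝ) {f g : Ed d → ℂ} (hf : SpaceTest f) (hg : SpaceTest g) :
    ‖locForm a b t f g‖ ≤ (2 * Real.pi) ^ d *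
      ((∫ x, ‖f x‖ ^ (2 : ℝ)) ^ (1 / 2 : ℝ) * (∫ x, ‖g x‖ ^ (2 : ℝ)) ^ (1 / 2 : ℝ)) := by
  have h := enorm_locForm_le a b t hf.integrable hf.memLp_two hg.integrable hg.memLp_two
  have key : ∀ {f : Ed d → ℂ}, SpaceTest f → (∫⁻ x, ‖f x‖ₑ ^ (2 : ℝ)) =
      ENNReal.ofReal (∫ x, ‖f x‖ ^ (2 : ℝ)) := by
    intro f hf
    rw [ofReal_integral_eq_lintegral_ofReal (hf.integrable_rpow two_pos)
      (Filter.Eventually.of_forall fun x => by positivity)]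
    congr 1
    ext x
    rw [← ofReal_norm, ENNReal.ofReal_rpow_of_nonneg (norm_nonneg _) (by norm_num)]
  have hpos : ∀ f : Ed d → ℂ, 0 ≤ ∫ x, ‖f x‖ ^ (2 : ℝ) := fun f =>
    integral_nonneg fun x => by positivity
  rw [key hf, key hg, ENNReal.ofReal_rpow_of_nonneg (hpos f) (by norm_num),
    ENNReal.ofReal_rpow_of_nonneg (hpos g) (by norm_num), ← ENNReal.ofReal_mul
    (Real.rpow_nonneg (hpos f) _), ← ENNReal.ofReal_mul (by positivity),
    ← ofReal_norm] at h
  exact (ENNReal.ofReal_le_ofReal_iff (mul_nonneg (by positivity)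
    (mul_nonneg (Real.rpow_nonneg (hpos f) _) (Real.rpow_nonneg (hpos g) _)))).1 h

variable [NeZero d]

theorem measurable_radKer (a t b : ℝ) :
    Measurable fun p : Ed d × Ed d => radKer d a t (b * ‖p.1‖) (b * ‖p.2‖) := by
  unfold radKer
  refine (StronglyMeasurable.integral_prod_right' (f := fun q : (Ed d × Ed d) × Ed d =>
    (dyBump ‖q.2‖ : ℂ) * Complex.exp (-I * ((t * ‖q.2‖ ^ a : ℝ) : ℂ)) *
    (sphFun d (b * ‖q.1.1‖ * ‖q.2‖) * (starRingEnd ℂ) (sphFun d (b * ‖q.1.2‖ * ‖q.2‖)))) ?_).measurable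
  refine Measurable.stronglyMeasurable ?_
  have h1 := continuous_dyBump.measurable
  have h2 := (continuous_sphFun d).measurable
  have h3 : Measurable (starRingEnd ℂ) := Complex.continuous_conj.measurable
  fun_prop

theorem integral_locMul_sphFun (a t : ℝ) {b : ℝ} (hb : 0 < b) (ρ σ : ℝ) :
    ∫ ξ : Ed d, locMul a b t ξ * (sphFun d (ρ * ‖ξ‖) * (starRingEnd ℂ) (sphFun d (σ * ‖ξ‖))) =
      ((b ^ d : ℝ) : ℂ) * radKer d a (b ^ a * t) (b * ρ) (b * σ) := by
  have h := Measure.integral_comp_smul (volume : Measure (Ed d)) (fun ξ => locMul a b t ξ *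
    (sphFun d (ρ * ‖ξ‖) * (starRingEnd ℂ) (sphFun d (σ * ‖ξ‖)))) b
  rw [finrank_euclideanSpace, Fintype.card_fin, abs_of_pos (by positivity),
    eq_inv_smul_iff₀ (by positivity)] at h
  rw [← h, Complex.real_smul, radKer]
  congr 2
  ext ξ
  rw [locMul, norm_smul, Real.norm_of_nonneg hb.le, mul_div_cancel_left₀ _ hb.ne',
    Real.mul_rpow hb.le (norm_nonneg _)]
  ring_nf

theorem locForm_eq (a t : ℝ) {b : ℝ} (hb : 0 < b) {f g : Ed d → ℂ} (hft : SpaceTest f)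
    (hgt : SpaceTest g) :
    locForm a b t f g = ∫ p : Ed d × Ed d, f p.1 * (starRingEnd ℂ) (g p.2) *
      (((b ^ d : ℝ) : ℂ) * radKer d a (b ^ a * t) (b * ‖p.1‖) (b * ‖p.2‖)) := by
  have hf := hft.radial
  have hg := hgt.radial
  have hfi := hft.integrable
  have hgi := hgt.integrable
  have h1 : ∀ ξ, locMul a b t ξ * (FT f ξ * (starRingEnd ℂ) (FT g ξ)) =
      ∫ p : Ed d × Ed d, f p.1 * (starRingEnd ℂ) (g p.2) * (locMul a b t ξ *
        (sphFun d (‖p.1‖ * ‖ξ‖) * (starRingEnd ℂ) (sphFun d (‖p.2‖ * ‖ξ‖)))) := by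
    intro ξ
    rw [FT_eq_integral_sphFun hf hfi, FT_eq_integral_sphFun hg hgi, ← integral_conj,
      ← integral_prod_mul, ← integral_const_mul]
    congr 1
    ext p
    rw [map_mul]
    ring
  rw [locForm]
  simp_rw [h1]
  rw [integral_integral_swap]
  · congr 1
    ext p
    rw [integral_const_mul, integral_locMul_sphFun a t hb]
  · have hg' : Integrable fun y => (starRingEnd ℂ) (g y) := by
      refine hgi.mono (Complex.continuous_conj.comp_aestronglyMeasurable hgi.aestronglyMeasurable)
        (Filter.Eventually.of_forall fun y => ?_)
      rw [RCLike.norm_conj]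
    have hfg : Integrable (fun p : Ed d × Ed d => f p.1 * (starRingEnd ℂ) (g p.2))
        (volume.prod volume) := hfi.mul_prod hg'
    have hdom : Integrable (fun q : Ed d × (Ed d × Ed d) => ((dyBump (‖q.1‖ / b) : ℝ) : ℂ) *
        (f q.2.1 * (starRingEnd ℂ) (g q.2.2))) (volume.prod (volume.prod volume)) :=
      (integrable_dyBump_norm (d := d) hb).ofReal.mul_prod hfg
    have hm : AEStronglyMeasurable (fun q : Ed d × (Ed d × Ed d) =>
        f q.2.1 * (starRingEnd ℂ) (g q.2.2) * (locMul a b t q.1 *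
        (sphFun d (‖q.2.1‖ * ‖q.1‖) * (starRingEnd ℂ) (sphFun d (‖q.2.2‖ * ‖q.1‖)))))
        (volume.prod (volume.prod volume)) := by
      have h5 := hft.meas
      have h6 := hgt.meas
      refine Measurable.aestronglyMeasurable ?_
      have h2 := (continuous_sphFun d).measurable
      have h3 : Measurable (starRingEnd ℂ) := Complex.continuous_conj.measurable
      have h4 : Measurable fun ξ : Ed d => locMul a b t ξ :=
        measurable_locMul_right a b t
      fun_prop
    refine hdom.mono hm (Filter.Eventually.of_forall fun q => ?_)
    have := mul_le_one₀ (norm_sphFun_le (d := d) (‖q.2.1‖ * ‖q.1‖)) (norm_nonneg _)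
        (norm_sphFun_le (d := d) (‖q.2.2‖ * ‖q.1‖))
    simp only [Function.uncurry]
    rw [norm_mul (f _ * _), norm_mul (locMul _ _ _ _), norm_locMul, norm_mul (sphFun _ _),
      RCLike.norm_conj (sphFun _ _), norm_mul ((_ : ℝ) : ℂ), Complex.norm_real,
      Real.norm_of_nonneg (dyBump_nonneg _), mul_comm (dyBump _)  ‖_‖]
    exact mul_le_mul_of_nonneg_left (mul_le_of_le_one_right (dyBump_nonneg _) this) (norm_nonneg _)

end LocalizedForm


section Interpolation

variable {d : ℕ}

/-- The analytic deformation `|w| ^ (c * (1 + z)) * (w / |w|)` of a complex number. -/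
def deform (c : ℝ) (z w : ℂ) : ℂ := powFam c z ‖w‖ * (w / (‖w‖ : ℂ))

theorem norm_div_norm_le (w : ℂ) : ‖w / (‖w‖ : ℂ)‖ ≤ 1 := by
  rw [norm_div, Complex.norm_real, norm_norm]
  exact div_self_le_one _

theorem norm_deform {c : ℝ} (hc : 0 < c) {z : ℂ} (hz : -1 < z.re) (w : ℂ) :
    ‖deform c z w‖ = ‖w‖ ^ (c * (1 + z.re)) := by
  have h0 : 0 < 1 + z.re := by linarith
  rw [deform, norm_mul, norm_powFam hc hz (norm_nonneg w)]
  by_cases hw : w = 0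
  · rw [hw, norm_zero, Real.zero_rpow (by positivity), zero_mul]
  · rw [norm_div, Complex.norm_real, norm_norm, div_self (norm_ne_zero_iff.2 hw), mul_one]

theorem deform_eq_self {c θ : ℝ} (h : c * (1 + θ) = 1) (w : ℂ) : deform c θ w = w := by
  rw [deform, powFam]
  split_ifs with hw
  · rw [zero_mul, norm_eq_zero.1 hw]
  · have : (c : ℂ) * (1 + θ) = 1 := by exact_mod_cast h
    rw [this, one_mul, ← Complex.ofReal_exp,
      Real.exp_log (lt_of_le_of_ne (norm_nonneg _) (Ne.symm hw))]
    field_simp [Complex.ofReal_ne_zero.2 hw]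

theorem conj_powFam (c : ℝ) (z : ℂ) (u : ℝ) :
    (starRingEnd ℂ) (powFam c ((starRingEnd ℂ) z) u) = powFam c z u := by
  unfold powFam
  split_ifs
  · simp
  · rw [← Complex.exp_conj]
    simp

theorem SpaceTest.deform {f : Ed d → ℂ} (hf : SpaceTest f) (hf1 : ∀ x, ‖f x‖ ≤ 1) {c : ℝ}
    (hc : 0 < c) {z : ℂ} (hz : -1 < z.re) : SpaceTest fun x => deform c z (f x) := by
  obtain ⟨R, hR⟩ := hf.supp
  refine ⟨?_, ⟨1, fun x => ?_⟩, ⟨R, fun x hx => hR x fun h => hx ?_⟩, fun x y h => by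
    rw [hf.radial x y h]⟩
  · have h1 := hf.meas
    have h2 := measurable_powFam c z
    unfold _root_.deform
    fun_prop
  · rw [norm_deform hc hz]
    exact Real.rpow_le_one (norm_nonneg _) (hf1 x) (mul_nonneg hc.le (by linarith))
  · simp [_root_.deform, h]

variable [NeZero d]

theorem norm_locForm_le_interp_of_le_one (a t : ℝ) {b : ℝ} (hb : 0 < b) {f g : Ed d → ℂ}
    (hf : SpaceTest f) (hg : SpaceTest g) (hf1 : ∀ x, ‖f x‖ ≤ 1) (hg1 : ∀ x, ‖g x‖ ≤ 1) {κ : ℝ}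
    (hκ0 : 0 ≤ κ) (hκ : ∀ x y, f x ≠ 0 → g y ≠ 0 →
      b ^ d * ‖radKer d a (b ^ a * t) (b * ‖x‖) (b * ‖y‖)‖ ≤ κ) {θ p : ℝ} (hθ0 : 0 ≤ θ)
    (hθ1 : θ ≤ 1) (hp : p = 2 / (1 + θ)) :
    ‖locForm a b t f g‖ ≤ ((2 * Real.pi) ^ d) ^ (1 - θ) * κ ^ θ *
      ((∫ x, ‖f x‖ ^ p) ^ (1 / p) * (∫ x, ‖g x‖ ^ p) ^ (1 / p)) := by
  have h1θ : 0 < 1 + θ := by linarith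
  set c : ℝ := 1 / (1 + θ) with hcd
  have hc : 0 < c := by positivity
  have hpc : p = 2 * c := by rw [hp, hcd]; ring
  have hp0 : 0 < p := by rw [hpc]; positivity
  set A := ∫ x, ‖f x‖ ^ p
  set A' := ∫ x, ‖g x‖ ^ p
  have hA : 0 ≤ A := integral_nonneg fun x => by positivity
  have hA' : 0 ≤ A' := integral_nonneg fun x => by positivity
  let k : Ed d × Ed d → ℂ := fun q => if f q.1 = 0 ∨ g q.2 = 0 then 0 else
    ((b ^ d : ℝ) : ℂ) * radKer d a (b ^ a * t) (b * ‖q.1‖) (b * ‖q.2‖)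
  have hk : ∀ q, ‖k q‖ ≤ κ := by
    intro q
    simp only [k]
    split_ifs with h
    · rwa [norm_zero]
    · push Not at h
      rw [norm_mul, Complex.norm_real, Real.norm_of_nonneg (by positivity)]
      exact hκ _ _ h.1 h.2
  have hkm : Measurable k := by
    refine Measurable.ite ?_ measurable_const ((measurable_radKer a (b ^ a * t) b).const_mul _)
    exact ((hf.meas.comp measurable_fst) (measurableSet_singleton 0)).union
      ((hg.meas.comp measurable_snd) (measurableSet_singleton 0))
  let ω : Ed d × Ed d → ℂ := fun q =>
    (f q.1 / (‖f q.1‖ : ℂ)) * (starRingEnd ℂ) (g q.2 / (‖g q.2‖ : ℂ)) * k q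
  let U : Ed d × Ed d → ℝ := fun q => ‖f q.1‖ * ‖g q.2‖
  have hfm := hf.meas
  have hgm := hg.meas
  have hcm : Measurable (starRingEnd ℂ) := Complex.continuous_conj.measurable
  have hU : Measurable U := by simp only [U]; fun_prop
  have hωm : Measurable ω := by simp only [ω]; fun_prop
  have hω : Integrable ω := by
    obtain ⟨R, hR⟩ := hf.supp
    obtain ⟨R', hR'⟩ := hg.supp
    have h : Integrable ((Metric.closedBall (0 : Ed d) R ×ˢ Metric.closedBall (0 : Ed d) R').indicator
        fun _ => κ) := by
      refine (integrable_indicator_iff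
        (measurableSet_closedBall.prod measurableSet_closedBall)).2 (integrableOn_const ?_)
      rw [Measure.volume_eq_prod, Measure.prod_prod]
      exact ENNReal.mul_ne_top measure_closedBall_lt_top.ne measure_closedBall_lt_top.ne
    refine h.mono' hωm.aestronglyMeasurable (Filter.Eventually.of_forall fun q => ?_)
    by_cases h0 : f q.1 = 0 ∨ g q.2 = 0
    · simp only [ω, k, h0, if_true, mul_zero, norm_zero]
      exact Set.indicator_nonneg (fun _ _ => hκ0) _
    · push Not at h0
      have hmem : q ∈ Metric.closedBall (0 : Ed d) R ×ˢ Metric.closedBall (0 : Ed d) R' :=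
        ⟨by simpa using hR _ h0.1, by simpa using hR' _ h0.2⟩
      rw [Set.indicator_of_mem hmem]
      rw [norm_mul, norm_mul, RCLike.norm_conj]
      exact (mul_le_of_le_one_left (norm_nonneg _) (mul_le_one₀ (norm_div_norm_le _) (norm_nonneg _)
        (norm_div_norm_le _))).trans (hk q)
  have hU0 : ∀ q, 0 ≤ U q := fun q => by positivity
  have hU1 : ∀ q, U q ≤ 1 := fun q => mul_le_one₀ (hf1 _) (norm_nonneg _) (hg1 _)
  have hφ : ∀ z : ℂ, ∀ q : Ed d × Ed d, powFam c z (U q) * ω q =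
      deform c z (f q.1) * (starRingEnd ℂ) (deform c ((starRingEnd ℂ) z) (g q.2)) * k q := by
    intro z q
    simp only [U, ω, deform]
    rw [powFam_mul, map_mul, conj_powFam]
    ring
  have hrep : ∀ z : ℂ, -1 < z.re → ∫ q, powFam c z (U q) * ω q =
      locForm a b t (fun x => deform c z (f x)) (fun x => deform c ((starRingEnd ℂ) z) (g x)) := by
    intro z hz
    rw [locForm_eq a t hb (hf.deform hf1 hc hz) (hg.deform hg1 hc (by simpa using hz))]
    congr 1
    ext q
    rw [hφ]
    simp only [k]
    split_ifs with h
    · rcases h with h | h <;> simp [deform, h]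
    · rfl
  have hInt : ∀ z : ℂ, ∀ e : ℝ, -1 < z.re → e * (c * (1 + z.re)) = p → ∀ f : Ed d → ℂ,
      ∫ x, ‖deform c z (f x)‖ ^ e = ∫ x, ‖f x‖ ^ p := by
    intro z e hz he f
    congr 1
    ext x
    rw [norm_deform hc hz, ← Real.rpow_mul (norm_nonneg _), mul_comm, he]
  have h0 : ∀ z : ℂ, z.re = 0 → ‖∫ q, powFam c z (U q) * ω q‖ ≤
      (2 * Real.pi) ^ d * (A ^ (1 / 2 : ℝ) * A' ^ (1 / 2 : ℝ)) := by
    intro z hz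
    have hz' : -1 < z.re := by linarith
    have hz'' : -1 < ((starRingEnd ℂ) z).re := by simpa using hz'
    rw [hrep z hz']
    have := norm_locForm_le a b t (hf.deform hf1 hc hz') (hg.deform hg1 hc hz'')
    rwa [hInt z 2 hz' (by rw [hz, hpc]; ring), hInt _ 2 hz''
      (by rw [Complex.conj_re, hz, hpc]; ring)] at this
  have h1 : ∀ z : ℂ, z.re = 1 → ‖∫ q, powFam c z (U q) * ω q‖ ≤ κ * (A * A') := by
    intro z hz
    have hz' : -1 < z.re := by linarith
    have hz'' : -1 < ((starRingEnd ℂ) z).re := by simpa using hz'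
    have e1 := hInt z 1 hz' (by rw [hz, hpc]; ring) f
    have e2 := hInt _ 1 hz'' (by rw [Complex.conj_re, hz, hpc]; ring) g
    have i1 := (hf.deform hf1 hc hz').integrable_rpow one_pos
    have i2 := (hg.deform hg1 hc hz'').integrable_rpow one_pos
    have hmul := i1.mul_prod i2
    have hval := integral_prod_mul (μ := (volume : Measure (Ed d))) (ν := (volume : Measure (Ed d)))
      (fun x => ‖deform c z (f x)‖ ^ (1 : ℝ)) (fun x => ‖deform c ((starRingEnd ℂ) z) (g x)‖ ^ (1 : ℝ))
    rw [e1, e2] at hval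
    rw [← hval, ← integral_const_mul]
    refine norm_integral_le_of_norm_le (hmul.const_mul κ) (Filter.Eventually.of_forall fun q => ?_)
    rw [hφ, norm_mul, norm_mul, RCLike.norm_conj, Real.rpow_one, Real.rpow_one, mul_comm]
    exact mul_le_mul_of_nonneg_right (hk q) (by positivity)
  have hfin := norm_integral_powFam_le hc hU hU0 hU1 hω h0 h1 hθ0 hθ1
  have hcθ : c * (1 + θ) = 1 := by rw [hcd]; field_simp
  rw [hrep θ (by simp; linarith), Complex.conj_ofReal] at hfin
  simp only [deform_eq_self hcθ] at hfin
  refine hfin.trans_eq ?_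
  have hX : ∀ A : ℝ, 0 ≤ A → (A ^ (1 / 2 : ℝ)) ^ (1 - θ) * A ^ θ = A ^ (1 / p) := fun A hA => by
    rw [← Real.rpow_mul hA, ← Real.rpow_add_of_nonneg hA (by linarith) hθ0]
    congr 1
    rw [hp]
    field_simp
    ring
  rw [Real.mul_rpow (by positivity) (by positivity), Real.mul_rpow (by positivity) (by positivity),
    Real.mul_rpow hκ0 (by positivity), Real.mul_rpow hA hA', ← hX A hA, ← hX A' hA']
  ring

theorem norm_locForm_le_interp (a t : ℝ) {b : ℝ} (hb : 0 < b) {f g : Ed d → ℂ}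
    (hf : SpaceTest f) (hg : SpaceTest g) {κ : ℝ}
    (hκ0 : 0 ≤ κ) (hκ : ∀ x y, f x ≠ 0 → g y ≠ 0 →
      b ^ d * ‖radKer d a (b ^ a * t) (b * ‖x‖) (b * ‖y‖)‖ ≤ κ) {θ p : ℝ} (hθ0 : 0 ≤ θ)
    (hθ1 : θ ≤ 1) (hp : p = 2 / (1 + θ)) :
    ‖locForm a b t f g‖ ≤ ((2 * Real.pi) ^ d) ^ (1 - θ) * κ ^ θ *
      ((∫ x, ‖f x‖ ^ p) ^ (1 / p) * (∫ x, ‖g x‖ ^ p) ^ (1 / p)) := by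
  have hp0 : 0 < p := by rw [hp]; positivity
  have hscale : ∀ {f : Ed d → ℂ}, SpaceTest f → ∃ M : ℝ, 0 < M ∧
      (∀ x, ‖((M⁻¹ : ℝ) : ℂ) * f x‖ ≤ 1) ∧
      (∫ x, ‖((M⁻¹ : ℝ) : ℂ) * f x‖ ^ p) ^ (1 / p) = M⁻¹ * (∫ x, ‖f x‖ ^ p) ^ (1 / p) := by
    intro f hf
    obtain ⟨M, hM⟩ := hf.bdd
    have h0 : 0 < max M 1 := lt_max_of_lt_right one_pos
    refine ⟨max M 1, h0, fun x => ?_, ?_⟩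
    · rw [norm_mul, Complex.norm_real, Real.norm_of_nonneg (by positivity),
        inv_mul_le_one₀ h0]
      exact (hM x).trans (le_max_left _ _)
    · have : ∀ x, ‖(((max M 1)⁻¹ : ℝ) : ℂ) * f x‖ ^ p = ((max M 1)⁻¹) ^ p * ‖f x‖ ^ p := fun x => by
        rw [norm_mul, Complex.norm_real, Real.norm_of_nonneg (by positivity),
          Real.mul_rpow (by positivity) (norm_nonneg _)]
      simp_rw [this]
      rw [integral_const_mul, Real.mul_rpow (by positivity)
        (integral_nonneg fun x => by positivity), ← Real.rpow_mul (by positivity),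
        mul_one_div_cancel hp0.ne', Real.rpow_one]
  obtain ⟨M, hM0, hM1, hM2⟩ := hscale hf
  obtain ⟨M', hM0', hM1', hM2'⟩ := hscale hg
  have h := norm_locForm_le_interp_of_le_one a t hb (hf.const_mul _) (hg.const_mul _) hM1 hM1' hκ0
    (fun x y hx hy => hκ x y (right_ne_zero_of_mul hx) (right_ne_zero_of_mul hy)) hθ0 hθ1 hp
  rw [hM2, hM2', locForm_const_mul, norm_mul, norm_mul, RCLike.norm_conj, Complex.norm_real,
    Complex.norm_real, Real.norm_of_nonneg (by positivity), Real.norm_of_nonneg (by positivity)] at h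
  have e : 0 < M⁻¹ * M'⁻¹ := by positivity
  refine le_of_mul_le_mul_left (h.trans_eq ?_) e
  ring

end Interpolation


theorem measurable_FT_of_measurable_uncurry {d : ℕ} {F : ℝ → Ed d → ℂ}
    (hF : Measurable (Function.uncurry F)) : Measurable fun q : ℝ × Ed d => FT (F q.1) q.2 := by
  unfold FT
  refine (StronglyMeasurable.integral_prod_right' (f := fun q : (ℝ × Ed d) × Ed d =>
    Complex.exp (-Complex.I * ((⟪q.2, q.1.2⟫ : ℝ) : ℂ)) * F q.1.1 q.2) ?_).measurable
  refine Measurable.stronglyMeasurable ?_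
  have h : Measurable fun q : (ℝ × Ed d) × Ed d => F q.1.1 q.2 :=
    hF.comp (f := fun q : (ℝ × Ed d) × Ed d => (q.1.1, q.2)) (by fun_prop)
  exact Measurable.mul (by fun_prop) h


section SpaceTime

variable {d : ℕ}

/-- Bounded measurable space-time functions, radial in space, whose support is bounded in time and
contained in an annulus in space. -/
structure SpaceTimeTest (F : ℝ → Ed d → ℂ) : Prop where
  meas : Measurable (Function.uncurry F)
  bdd : ∃ M : ℝ, ∀ t x, ‖F t x‖ ≤ M
  supp : ∃ T : ℝ, 0 < T ∧ ∀ t x, F t x ≠ 0 → |t| ≤ T ∧ T⁻¹ ≤ ‖x‖ ∧ ‖x‖ ≤ T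
  radial : ∀ t, IsRadial (F t)

variable {F G : ℝ → Ed d → ℂ}

theorem SpaceTimeTest.space (hF : SpaceTimeTest F) (t : ℝ) : SpaceTest (F t) := by
  obtain ⟨M, hM⟩ := hF.bdd
  obtain ⟨T, -, hT⟩ := hF.supp
  exact ⟨hF.meas.comp measurable_prodMk_left, ⟨M, hM t⟩, ⟨T, fun x hx => (hT t x hx).2.2⟩,
    hF.radial t⟩

theorem SpaceTimeTest.time_mul (hF : SpaceTimeTest F) {c : ℝ → ℂ} (hc : Measurable c) {K : ℝ}
    (hK : ∀ t, ‖c t‖ ≤ K) : SpaceTimeTest fun t x => c t * F t x := by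
  obtain ⟨M, hM⟩ := hF.bdd
  obtain ⟨T, hT0, hT⟩ := hF.supp
  refine ⟨(hc.comp measurable_fst).mul hF.meas, ⟨K * M, fun t x => ?_⟩,
    ⟨T, hT0, fun t x hx => hT t x (right_ne_zero_of_mul hx)⟩,
    fun t x y h => by rw [hF.radial t x y h]⟩
  rw [norm_mul]
  exact mul_le_mul (hK t) (hM t x) (norm_nonneg _) ((norm_nonneg _).trans (hK t))

theorem SpaceTimeTest.measurable_FT (hF : SpaceTimeTest F) :
    Measurable fun q : ℝ × Ed d => FT (F q.1) q.2 :=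
  measurable_FT_of_measurable_uncurry hF.meas

theorem SpaceTimeTest.exists_norm_FT_le (hF : SpaceTimeTest F) :
    ∃ M T : ℝ, 0 ≤ M ∧ ∀ t ξ, ‖FT (F t) ξ‖ ≤ (Set.Icc (-T) T).indicator (fun _ => M) t := by
  obtain ⟨M, hM⟩ := hF.bdd
  obtain ⟨T, hT0, hT⟩ := hF.supp
  have hM0 : 0 ≤ M := (norm_nonneg _).trans (hM 0 0)
  refine ⟨∫ x : Ed d, (Metric.closedBall (0 : Ed d) T).indicator (fun _ => M) x, T,
    integral_nonneg fun x => Set.indicator_nonneg (fun _ _ => hM0) _, fun t ξ => ?_⟩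
  by_cases ht : t ∈ Set.Icc (-T) T
  · rw [Set.indicator_of_mem ht]
    refine (norm_FT_le _ _).trans (integral_mono (hF.space t).integrable.norm ?_ fun x => ?_)
    · exact (integrable_indicator_iff measurableSet_closedBall).2
        (integrableOn_const measure_closedBall_lt_top.ne)
    · by_cases hx : F t x = 0
      · simp only [hx, norm_zero]
        exact Set.indicator_nonneg (fun _ _ => hM0) _
      · have hmem : x ∈ Metric.closedBall (0 : Ed d) T := by simpa using (hT t x hx).2.2
        simp only [Set.indicator_of_mem hmem]
        exact hM t x
  · rw [Set.indicator_of_notMem ht]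
    have h0 : F t = fun _ => 0 := by
      ext x
      by_contra hx
      exact ht (abs_le.1 (hT t x hx).1)
    simp [FT, h0]

/-- The space-time sesquilinear form of the localized propagator with kernel `k` in time. -/
def tForm (a b : ℝ) (k : ℝ × ℝ → ℂ) (F G : ℝ → Ed d → ℂ) : ℂ :=
  ∫ z : ℝ × ℝ, k z * locForm a b (z.2 - z.1) (F z.1) (G z.2)

theorem integrable_tForm_integrand (a : ℝ) {b : ℝ} (hb : 0 < b) (hF : SpaceTimeTest F)
    (hG : SpaceTimeTest G) {k : ℝ × ℝ → ℂ} (hk : Measurable k) {K : ℝ} (hK : ∀ z, ‖k z‖ ≤ K) :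
    Integrable (fun w : (ℝ × ℝ) × Ed d => k w.1 * (locMul a b (w.1.2 - w.1.1) w.2 *
      (FT (F w.1.1) w.2 * (starRingEnd ℂ) (FT (G w.1.2) w.2))))
      ((volume.prod volume).prod volume) := by
  obtain ⟨M, T, hM0, hM⟩ := hF.exists_norm_FT_le
  obtain ⟨M', T', hM0', hM'⟩ := hG.exists_norm_FT_le
  have hi : ∀ M T : ℝ, Integrable ((Set.Icc (-T) T).indicator fun _ => M) := fun M T =>
    (integrable_indicator_iff measurableSet_Icc).2 (integrableOn_const measure_Icc_lt_top.ne)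
  have hz : Integrable (fun z : ℝ × ℝ => (Set.Icc (-T) T).indicator (fun _ => M) z.1 *
      (Set.Icc (-T') T').indicator (fun _ => M') z.2) (volume.prod volume) :=
    (hi M T).mul_prod (hi M' T')
  have hw : Integrable (fun w : (ℝ × ℝ) × Ed d => ((Set.Icc (-T) T).indicator (fun _ => M) w.1.1 *
      (Set.Icc (-T') T').indicator (fun _ => M') w.1.2) * dyBump (‖w.2‖ / b))
      ((volume.prod volume).prod volume) := hz.mul_prod (integrable_dyBump_norm (d := d) hb)
  refine (hw.const_mul K).mono' (Measurable.aestronglyMeasurable ?_)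
    (Filter.Eventually.of_forall fun w => ?_)
  · have h1 : Measurable fun w : (ℝ × ℝ) × Ed d => FT (F w.1.1) w.2 :=
      hF.measurable_FT.comp (f := fun w : (ℝ × ℝ) × Ed d => (w.1.1, w.2)) (by fun_prop)
    have h2 : Measurable fun w : (ℝ × ℝ) × Ed d => FT (G w.1.2) w.2 :=
      hG.measurable_FT.comp (f := fun w : (ℝ × ℝ) × Ed d => (w.1.2, w.2)) (by fun_prop)
    have h3 : Measurable (starRingEnd ℂ) := Complex.continuous_conj.measurable
    have h4 : Measurable fun w : (ℝ × ℝ) × Ed d => locMul a b (w.1.2 - w.1.1) w.2 :=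
      (measurable_locMul a b).comp (f := fun w : (ℝ × ℝ) × Ed d => (w.1.2 - w.1.1, w.2))
        (by fun_prop)
    exact (hk.comp measurable_fst).mul (h4.mul (h1.mul (h3.comp h2)))
  · rw [norm_mul, norm_mul, norm_mul, norm_locMul, RCLike.norm_conj]
    have h0 := dyBump_nonneg (‖w.2‖ / b)
    have h1 := hM w.1.1 w.2
    have h2 := hM' w.1.2 w.2
    rw [mul_comm (dyBump _)]
    refine mul_le_mul (hK _) (mul_le_mul_of_nonneg_right (mul_le_mul h1 h2 (norm_nonneg _)
      ((norm_nonneg _).trans h1)) h0) (by positivity) ((norm_nonneg _).trans (hK w.1))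

theorem integrable_tForm (a : ℝ) {b : ℝ} (hb : 0 < b) (hF : SpaceTimeTest F)
    (hG : SpaceTimeTest G) {k : ℝ × ℝ → ℂ} (hk : Measurable k) {K : ℝ} (hK : ∀ z, ‖k z‖ ≤ K) :
    Integrable fun z : ℝ × ℝ => k z * locForm a b (z.2 - z.1) (F z.1) (G z.2) := by
  have h := (integrable_tForm_integrand a hb hF hG hk hK).integral_prod_left
  simp only [integral_const_mul] at h
  exact h

/-- The Fourier transform of a space-time function at frequency `(|ξ| ^ a, ξ)`. -/
def charFT (a : ℝ) (F : ℝ → Ed d → ℂ) (ξ : Ed d) : ℂ :=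
  ∫ t, Complex.exp (I * ((t * ‖ξ‖ ^ a : ℝ) : ℂ)) * FT (F t) ξ

theorem tForm_one_eq (a : ℝ) {b : ℝ} (hb : 0 < b) (hF : SpaceTimeTest F) (hG : SpaceTimeTest G) :
    tForm a b (fun _ => 1) F G = ∫ ξ : Ed d, (dyBump (‖ξ‖ / b) : ℂ) *
      (charFT a F ξ * (starRingEnd ℂ) (charFT a G ξ)) := by
  have h := integrable_tForm_integrand a hb hF hG (k := fun _ => 1) measurable_const (K := 1)
    (by simp)
  simp only [tForm, one_mul] at h ⊢
  simp only [locForm]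
  rw [integral_integral_swap (by exact h)]
  congr 1
  ext ξ
  rw [charFT, charFT, ← integral_conj, ← integral_prod_mul, ← integral_const_mul]
  congr 1
  ext z
  rw [locMul, map_mul, ← Complex.exp_conj, map_mul, Complex.conj_I, Complex.conj_ofReal]
  have : -I * (((z.2 - z.1) * ‖ξ‖ ^ a : ℝ) : ℂ) = I * ((z.1 * ‖ξ‖ ^ a : ℝ) : ℂ) +
      -I * ((z.2 * ‖ξ‖ ^ a : ℝ) : ℂ) := by
    push_cast
    ring
  rw [this, Complex.exp_add]
  ring

theorem conj_locForm (a b t : ℝ) (f g : Ed d → ℂ) :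
    (starRingEnd ℂ) (locForm a b t f g) = locForm a b (-t) g f := by
  rw [locForm, ← integral_conj, locForm]
  congr 1
  ext ξ
  rw [locMul, locMul, map_mul, map_mul, ← Complex.exp_conj, map_mul, map_mul, map_neg,
    Complex.conj_I, Complex.conj_ofReal, Complex.conj_ofReal, Complex.conj_conj]
  push_cast
  ring_nf

theorem conj_tForm (a b : ℝ) (k : ℝ × ℝ → ℂ) (F G : ℝ → Ed d → ℂ) :
    (starRingEnd ℂ) (tForm a b k F G) =
      tForm a b (fun z => (starRingEnd ℂ) (k (z.2, z.1))) G F := by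
  rw [tForm, ← integral_conj, tForm, Measure.volume_eq_prod, ← integral_prod_swap]
  congr 1
  ext z
  simp only [Prod.swap, map_mul, conj_locForm, neg_sub]

/-- The square of the localized `L²` norm of `charFT`. -/
def charSq (a b : ℝ) (F : ℝ → Ed d → ℂ) : ℝ := ∫ ξ : Ed d, dyBump (‖ξ‖ / b) * ‖charFT a F ξ‖ ^ 2

theorem charSq_nonneg (a b : ℝ) (F : ℝ → Ed d → ℂ) : 0 ≤ charSq a b F :=
  integral_nonneg fun ξ => mul_nonneg (dyBump_nonneg _) (by positivity)

theorem charSq_eq (a : ℝ) {b : ℝ} (hb : 0 < b) (hF : SpaceTimeTest F) :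
    (charSq a b F : ℂ) = tForm a b (fun _ => 1) F F := by
  rw [tForm_one_eq a hb hF hF, charSq, ← integral_complex_ofReal]
  congr 1
  ext ξ
  rw [Complex.mul_conj, Complex.normSq_eq_norm_sq]
  push_cast
  rfl

theorem SpaceTimeTest.measurable_charFT (hF : SpaceTimeTest F) (a : ℝ) :
    Measurable (charFT a F) := by
  unfold charFT
  refine (StronglyMeasurable.integral_prod_right' (f := fun q : Ed d × ℝ =>
    Complex.exp (I * ((q.2 * ‖q.1‖ ^ a : ℝ) : ℂ)) * FT (F q.2) q.1) ?_).measurable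
  refine Measurable.stronglyMeasurable ?_
  have h : Measurable fun q : Ed d × ℝ => FT (F q.2) q.1 :=
    hF.measurable_FT.comp (f := fun q : Ed d × ℝ => (q.2, q.1)) (by fun_prop)
  exact Measurable.mul (by fun_prop) h

theorem SpaceTimeTest.exists_norm_charFT_le (hF : SpaceTimeTest F) (a : ℝ) :
    ∃ M : ℝ, ∀ ξ, ‖charFT a F ξ‖ ≤ M := by
  obtain ⟨M, T, hM0, hM⟩ := hF.exists_norm_FT_le
  refine ⟨∫ t, (Set.Icc (-T) T).indicator (fun _ => M) t, fun ξ => ?_⟩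
  refine norm_integral_le_of_norm_le ((integrable_indicator_iff measurableSet_Icc).2
    (integrableOn_const measure_Icc_lt_top.ne)) (Filter.Eventually.of_forall fun t => ?_)
  rw [norm_mul, norm_exp_I_mul, one_mul]
  exact hM t ξ

theorem integrable_charSq (a : ℝ) {b : ℝ} (hb : 0 < b) (hF : SpaceTimeTest F) :
    Integrable fun ξ : Ed d => dyBump (‖ξ‖ / b) * ‖charFT a F ξ‖ ^ 2 := by
  obtain ⟨M, hM⟩ := hF.exists_norm_charFT_le a
  refine ((integrable_dyBump_norm (d := d) hb).mul_const (M ^ 2)).mono'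
    (Measurable.aestronglyMeasurable ?_) (Filter.Eventually.of_forall fun ξ => ?_)
  · have := continuous_dyBump.measurable
    have := hF.measurable_charFT a
    fun_prop
  · have h0 := dyBump_nonneg (‖ξ‖ / b)
    rw [Real.norm_of_nonneg (by positivity)]
    exact mul_le_mul_of_nonneg_left (pow_le_pow_left₀ (norm_nonneg _) (hM ξ) 2) h0

end SpaceTime


section CauchySchwarz

variable {d : ℕ} {F G : ℝ → Ed d → ℂ}

theorem norm_integral_dyBump_mul_le (b : ℝ) {u v : Ed d → ℂ} (hu : Measurable u) (hv : Measurable v)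
    (hui : Integrable fun ξ => dyBump (‖ξ‖ / b) * ‖u ξ‖ ^ 2)
    (hvi : Integrable fun ξ => dyBump (‖ξ‖ / b) * ‖v ξ‖ ^ 2) :
    ‖∫ ξ : Ed d, (dyBump (‖ξ‖ / b) : ℂ) * (u ξ * (starRingEnd ℂ) (v ξ))‖ ≤
      √(∫ ξ, dyBump (‖ξ‖ / b) * ‖u ξ‖ ^ 2) * √(∫ ξ, dyBump (‖ξ‖ / b) * ‖v ξ‖ ^ 2) := by
  have hdm := continuous_dyBump.measurable
  have hsq : ∀ w : Ed d → ℂ, ∀ ξ, (√(dyBump (‖ξ‖ / b)) * ‖w ξ‖) ^ 2 =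
      dyBump (‖ξ‖ / b) * ‖w ξ‖ ^ 2 := fun w ξ => by
    rw [mul_pow, Real.sq_sqrt (dyBump_nonneg _)]
  have hmem : ∀ w : Ed d → ℂ, Measurable w → Integrable (fun ξ => dyBump (‖ξ‖ / b) * ‖w ξ‖ ^ 2) →
      MemLp (fun ξ => √(dyBump (‖ξ‖ / b)) * ‖w ξ‖) (ENNReal.ofReal 2) := by
    intro w hw hwi
    rw [ENNReal.ofReal_ofNat, memLp_two_iff_integrable_sq (Measurable.aestronglyMeasurable
      (by fun_prop))]
    simpa only [hsq] using hwi
  have h := integral_mul_le_Lp_mul_Lq_of_nonneg (μ := volume) Real.HolderConjugate.two_two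
    (f := fun ξ : Ed d => √(dyBump (‖ξ‖ / b)) * ‖u ξ‖)
    (g := fun ξ : Ed d => √(dyBump (‖ξ‖ / b)) * ‖v ξ‖)
    (Filter.Eventually.of_forall fun ξ => by positivity)
    (Filter.Eventually.of_forall fun ξ => by positivity) (hmem u hu hui) (hmem v hv hvi)
  simp only [Real.rpow_two, hsq, ← Real.sqrt_eq_rpow] at h
  refine ((norm_integral_le_integral_norm _).trans_eq ?_).trans h
  congr 1
  ext ξ
  rw [norm_mul, norm_mul, RCLike.norm_conj, Complex.norm_real,
    Real.norm_of_nonneg (dyBump_nonneg _)]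
  nth_rw 1 [← Real.mul_self_sqrt (dyBump_nonneg (‖ξ‖ / b))]
  ring

theorem norm_tForm_one_le (a : ℝ) {b : ℝ} (hb : 0 < b) (hF : SpaceTimeTest F)
    (hG : SpaceTimeTest G) :
    ‖tForm a b (fun _ => 1) F G‖ ≤ √(charSq a b F) * √(charSq a b G) := by
  rw [tForm_one_eq a hb hF hG]
  exact norm_integral_dyBump_mul_le b (hF.measurable_charFT a) (hG.measurable_charFT a)
    (integrable_charSq a hb hF) (integrable_charSq a hb hG)

end CauchySchwarz

section TimeKernel

variable {d : ℕ} {F G : ℝ → Ed d → ℂ}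

/-- Modulation in time. -/
def modulate (ω : ℝ) (F : ℝ → Ed d → ℂ) (t : ℝ) (x : Ed d) : ℂ :=
  Complex.exp (-I * ((ω * t : ℝ) : ℂ)) * F t x

theorem SpaceTimeTest.modulate (hF : SpaceTimeTest F) (ω : ℝ) : SpaceTimeTest (modulate ω F) :=
  hF.time_mul (c := fun t => Complex.exp (-I * ((ω * t : ℝ) : ℂ))) (by fun_prop) (K := 1)
    fun t => (norm_exp_negI_mul _).le

theorem tForm_modulate (a b ω : ℝ) (k : ℝ × ℝ → ℂ) (F G : ℝ → Ed d → ℂ) :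
    tForm a b k (modulate ω F) (modulate ω G) =
      tForm a b (fun z => k z * Complex.exp (I * ((ω * (z.2 - z.1) : ℝ) : ℂ))) F G := by
  unfold tForm modulate
  congr 1
  ext z
  rw [locForm_const_mul, ← Complex.exp_conj, map_mul, map_neg, Complex.conj_I, Complex.conj_ofReal,
    ← Complex.exp_add, mul_assoc]
  congr 3
  push_cast
  ring

theorem exists_norm_tForm_dyBump_le : ∃ K : ℝ, 0 < K ∧ ∀ (d : ℕ) (a b μ : ℝ) (_ : 0 < b)
    (F G : ℝ → Ed d → ℂ) (_ : SpaceTimeTest F) (_ : SpaceTimeTest G) (B : ℝ),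
    (∀ ω, √(charSq a b (modulate ω F)) * √(charSq a b (modulate ω G)) ≤ B) →
    ‖tForm a b (fun z => (dyBump ((z.2 - z.1) / μ) : ℂ)) F G‖ ≤ K * B := by
  obtain ⟨ψ, hψ, hψe⟩ := exists_fourier_dyBump
  refine ⟨(∫ τ, ‖ψ τ‖) + 1, by positivity, fun d a b μ hb F G hF hG B hB => ?_⟩
  have hB0 : 0 ≤ B := le_trans (by positivity) (hB 0)
  have hloc := integrable_tForm a hb hF hG (k := fun _ => 1) measurable_const (K := 1) (by simp)
  simp only [one_mul] at hloc
  have hprod : Integrable (fun w : (ℝ × ℝ) × ℝ =>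
      locForm a b (w.1.2 - w.1.1) (F w.1.1) (G w.1.2) * ψ w.2) (volume.prod volume) :=
    hloc.mul_prod hψ
  have hInt : Integrable (fun w : (ℝ × ℝ) × ℝ =>
      Complex.exp (I * ((2 * Real.pi * w.2 * ((w.1.2 - w.1.1) / μ) : ℝ) : ℂ)) *
      (locForm a b (w.1.2 - w.1.1) (F w.1.1) (G w.1.2) * ψ w.2)) (volume.prod volume) := by
    refine hprod.mono (AEStronglyMeasurable.mul (Measurable.aestronglyMeasurable (by fun_prop))
      hprod.aestronglyMeasurable) (Filter.Eventually.of_forall fun w => ?_)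
    rw [norm_mul (Complex.exp _), norm_exp_I_mul, one_mul]
  have heq : tForm a b (fun z => (dyBump ((z.2 - z.1) / μ) : ℂ)) F G =
      ∫ τ, ψ τ * tForm a b (fun _ => 1) (modulate (2 * Real.pi * τ / μ) F)
        (modulate (2 * Real.pi * τ / μ) G) := by
    simp only [tForm_modulate]
    simp only [tForm, hψe, one_mul]
    simp only [← integral_mul_const, ← integral_const_mul]
    rw [integral_integral_swap]
    · congr 1
      ext τ
      congr 1
      ext z
      rw [mul_assoc]
      congr 4
      push_cast
      ring
    · refine hInt.congr (Filter.Eventually.of_forall fun w => ?_)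
      simp only [Function.uncurry]
      ring
  rw [heq]
  refine (norm_integral_le_of_norm_le (hψ.norm.mul_const B)
    (Filter.Eventually.of_forall fun τ => ?_)).trans ?_
  · rw [norm_mul]
    exact mul_le_mul_of_nonneg_left ((norm_tForm_one_le a hb (hF.modulate _) (hG.modulate _)).trans
      (hB _)) (norm_nonneg _)
  · rw [integral_mul_const]
    exact mul_le_mul_of_nonneg_right (by linarith) hB0

end TimeKernel


section Young

theorem lintegral_mul_mul_norm_pow_le {α : Type*} [MeasurableSpace α] {μ : Measure α}
    {f g h : α → ℝ≥0∞} (hf : AEMeasurable f μ) (hg : AEMeasurable g μ) (hh : AEMeasurable h μ)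
    {x y z : ℝ} (hx : 0 ≤ x) (hy : 0 ≤ y) (hz : 0 ≤ z) (hxyz : x + y + z = 1) :
    ∫⁻ a, f a ^ x * g a ^ y * h a ^ z ∂μ ≤
      (∫⁻ a, f a ∂μ) ^ x * (∫⁻ a, g a ∂μ) ^ y * (∫⁻ a, h a ∂μ) ^ z := by
  have := ENNReal.lintegral_prod_norm_pow_le (μ := μ) (Finset.univ : Finset (Fin 3))
    (f := ![f, g, h]) (p := ![x, y, z])
    (by intro i _; fin_cases i <;> simpa) (by simp [Fin.sum_univ_three, hxyz])
    (by intro i _; fin_cases i <;> simpa)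
  simpa [Fin.prod_univ_three] using this

/-- Young's convolution inequality in trilinear form. -/
theorem lintegral_conv_le {c g k : ℝ → ℝ≥0∞} (hc : Measurable c) (hg : Measurable g)
    (hk : Measurable k) {e e' : ℝ} (he : 0 ≤ e) (he' : 0 ≤ e') (hpos : 0 < e + e')
    (hle : e + e' ≤ 1) (he1 : e < 1) (he1' : e' < 1) :
    ∫⁻ z : ℝ × ℝ, c z.1 * g z.2 * k (z.2 - z.1) ≤
      (∫⁻ t, c t ^ (1 - e)⁻¹) ^ (1 - e) * (∫⁻ t, g t ^ (1 - e')⁻¹) ^ (1 - e') *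
        (∫⁻ t, k t ^ (e + e')⁻¹) ^ (e + e') := by
  have h1 : 0 < 1 - e := by linarith
  have h2 : 0 < 1 - e' := by linarith
  have hsub : ∀ t' : ℝ, ∫⁻ t, k (t - t') ^ (e + e')⁻¹ = ∫⁻ t, k t ^ (e + e')⁻¹ := fun t' =>
    lintegral_sub_right_eq_self (fun t => k t ^ (e + e')⁻¹) t'
  have hsub' : ∀ t : ℝ, ∫⁻ t', k (t - t') ^ (e + e')⁻¹ = ∫⁻ t, k t ^ (e + e')⁻¹ := fun t =>
    lintegral_sub_left_eq_self (fun t => k t ^ (e + e')⁻¹) t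
  have hpt : ∀ z : ℝ × ℝ, c z.1 * g z.2 * k (z.2 - z.1) =
      (c z.1 ^ (1 - e)⁻¹ * k (z.2 - z.1) ^ (e + e')⁻¹) ^ e' *
      (g z.2 ^ (1 - e')⁻¹ * k (z.2 - z.1) ^ (e + e')⁻¹) ^ e *
      (c z.1 ^ (1 - e)⁻¹ * g z.2 ^ (1 - e')⁻¹) ^ (1 - e - e') := by
    intro z
    have h3 : 0 ≤ 1 - e - e' := by linarith
    rw [ENNReal.mul_rpow_of_nonneg _ _ he', ENNReal.mul_rpow_of_nonneg _ _ he,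
      ENNReal.mul_rpow_of_nonneg _ _ h3]
    simp only [← ENNReal.rpow_mul]
    have hcc : c z.1 = c z.1 ^ ((1 - e)⁻¹ * e') * c z.1 ^ ((1 - e)⁻¹ * (1 - e - e')) := by
      rw [← ENNReal.rpow_add_of_nonneg _ _ (by positivity) (by positivity), ← mul_add]
      rw [show e' + (1 - e - e') = 1 - e by ring, inv_mul_cancel₀ h1.ne', ENNReal.rpow_one]
    have hgg : g z.2 = g z.2 ^ ((1 - e')⁻¹ * e) * g z.2 ^ ((1 - e')⁻¹ * (1 - e - e')) := by
      rw [← ENNReal.rpow_add_of_nonneg _ _ (by positivity) (by positivity), ← mul_add]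
      rw [show e + (1 - e - e') = 1 - e' by ring, inv_mul_cancel₀ h2.ne', ENNReal.rpow_one]
    have hkk : k (z.2 - z.1) = k (z.2 - z.1) ^ ((e + e')⁻¹ * e') *
        k (z.2 - z.1) ^ ((e + e')⁻¹ * e) := by
      rw [← ENNReal.rpow_add_of_nonneg _ _ (by positivity) (by positivity), ← mul_add]
      rw [add_comm e' e, inv_mul_cancel₀ hpos.ne', ENNReal.rpow_one]
    nth_rw 1 [hcc, hgg, hkk]
    ring
  simp_rw [hpt]
  have hmk : Measurable fun z : ℝ × ℝ => k (z.2 - z.1) := hk.comp (by fun_prop)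
  refine (lintegral_mul_mul_norm_pow_le (by fun_prop) (by fun_prop) (by fun_prop) he' he
    (by linarith) (by ring)).trans_eq ?_
  have e1 : ∫⁻ z : ℝ × ℝ, c z.1 ^ (1 - e)⁻¹ * k (z.2 - z.1) ^ (e + e')⁻¹ =
      (∫⁻ t, c t ^ (1 - e)⁻¹) * ∫⁻ t, k t ^ (e + e')⁻¹ := by
    rw [Measure.volume_eq_prod, lintegral_prod _ (by fun_prop), ← lintegral_mul_const _ (by fun_prop)]
    refine lintegral_congr fun t => ?_
    rw [← hsub t, ← lintegral_const_mul]
    exact (hk.comp (by fun_prop)).pow_const _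
  have e2 : ∫⁻ z : ℝ × ℝ, g z.2 ^ (1 - e')⁻¹ * k (z.2 - z.1) ^ (e + e')⁻¹ =
      (∫⁻ t, g t ^ (1 - e')⁻¹) * ∫⁻ t, k t ^ (e + e')⁻¹ := by
    rw [Measure.volume_eq_prod, lintegral_prod_symm _ (by fun_prop),
      ← lintegral_mul_const _ (by fun_prop)]
    refine lintegral_congr fun t => ?_
    rw [← hsub' t, ← lintegral_const_mul]
    exact (hk.comp (by fun_prop)).pow_const _
  have e3 : ∫⁻ z : ℝ × ℝ, c z.1 ^ (1 - e)⁻¹ * g z.2 ^ (1 - e')⁻¹ =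
      (∫⁻ t, c t ^ (1 - e)⁻¹) * ∫⁻ t, g t ^ (1 - e')⁻¹ := by
    rw [Measure.volume_eq_prod]
    exact lintegral_prod_mul (f := fun t => c t ^ (1 - e)⁻¹) (g := fun t => g t ^ (1 - e')⁻¹)
      (by fun_prop) (by fun_prop)
  rw [e1, e2, e3]
  set A := ∫⁻ t, c t ^ (1 - e)⁻¹
  set B := ∫⁻ t, g t ^ (1 - e')⁻¹
  set D := ∫⁻ t, k t ^ (e + e')⁻¹
  rw [ENNReal.mul_rpow_of_nonneg _ _ he', ENNReal.mul_rpow_of_nonneg _ _ he,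
      ENNReal.mul_rpow_of_nonneg _ _ (by linarith : 0 ≤ 1 - e - e')]
  rw [show A ^ (1 - e) = A ^ e' * A ^ (1 - e - e') by
      rw [← ENNReal.rpow_add_of_nonneg _ _ he' (by linarith)]; ring_nf,
    show B ^ (1 - e') = B ^ e * B ^ (1 - e - e') by
      rw [← ENNReal.rpow_add_of_nonneg _ _ he (by linarith)]; ring_nf,
    ENNReal.rpow_add_of_nonneg _ _ he he']
  ring

end Young


section Norms

variable {d : ℕ} {F G : ℝ → Ed d → ℂ}

/-- The `L^p` norm in space. -/
def spN (p : ℝ) (f : Ed d → ℂ) : ℝ≥0∞ := (∫⁻ x, ‖f x‖ₑ ^ p) ^ (1 / p)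

/-- The mixed norm with exponent `1 / (1 - e)` in time and `p` in space. -/
def stN (e p : ℝ) (F : ℝ → Ed d → ℂ) : ℝ≥0∞ := (∫⁻ t, spN p (F t) ^ (1 - e)⁻¹) ^ (1 - e)

theorem spN_mono {p : ℝ} (hp : 0 ≤ p) {f g : Ed d → ℂ} (h : ∀ x, ‖f x‖ ≤ ‖g x‖) :
    spN p f ≤ spN p g := by
  unfold spN
  gcongr with x
  exact enorm_le_iff_norm_le.2 (h x)

theorem stN_mono {e p : ℝ} (he : e < 1) (hp : 0 ≤ p) (h : ∀ t x, ‖F t x‖ ≤ ‖G t x‖) :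
    stN e p F ≤ stN e p G := by
  have : 0 < 1 - e := by linarith
  unfold stN
  gcongr with t
  exact spN_mono hp (h t)

theorem stN_modulate {e p : ℝ} (he : e < 1) (hp : 0 ≤ p) (ω : ℝ) :
    stN e p (modulate ω F) = stN e p F := by
  have h : ∀ t x, ‖modulate ω F t x‖ = ‖F t x‖ := fun t x => by
    rw [modulate, norm_mul, norm_exp_negI_mul, one_mul]
  exact le_antisymm (stN_mono he hp fun t x => (h t x).le) (stN_mono he hp fun t x => (h t x).ge)

theorem SpaceTest.spN_eq {f : Ed d → ℂ} (hf : SpaceTest f) {p : ℝ} (hp : 0 < p) :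
    spN p f = ENNReal.ofReal ((∫ x, ‖f x‖ ^ p) ^ (1 / p)) := by
  rw [spN, ← ENNReal.ofReal_rpow_of_nonneg (integral_nonneg fun x => by positivity) (by positivity),
    ofReal_integral_eq_lintegral_ofReal (hf.integrable_rpow hp)
      (Filter.Eventually.of_forall fun x => by positivity)]
  congr 2
  ext x
  rw [← ofReal_norm, ENNReal.ofReal_rpow_of_nonneg (norm_nonneg _) hp.le]

theorem SpaceTimeTest.measurable_spN (hF : SpaceTimeTest F) (p : ℝ) :
    Measurable fun t => spN p (F t) := by
  unfold spN
  have h : Measurable fun q : ℝ × Ed d => ‖F q.1 q.2‖ₑ ^ p := (hF.meas.enorm).pow_const p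
  exact h.lintegral_prod_right'.pow_const _

theorem SpaceTimeTest.exists_spN_le (hF : SpaceTimeTest F) {p : ℝ} (hp : 0 < p) :
    ∃ M : ℝ≥0∞, ∃ T : ℝ, M ≠ ∞ ∧ ∀ t, spN p (F t) ≤ (Set.Icc (-T) T).indicator (fun _ => M) t := by
  obtain ⟨M, hM⟩ := hF.bdd
  obtain ⟨T, hT0, hT⟩ := hF.supp
  have hM0 : 0 ≤ M := (norm_nonneg _).trans (hM 0 0)
  refine ⟨(ENNReal.ofReal M ^ p * volume (Metric.closedBall (0 : Ed d) T)) ^ (1 / p), T,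
    ?_, fun t => ?_⟩
  · have : ENNReal.ofReal M ^ p * volume (Metric.closedBall (0 : Ed d) T) ≠ ∞ :=
      ENNReal.mul_ne_top (by finiteness) measure_closedBall_lt_top.ne
    exact ENNReal.rpow_ne_top_of_nonneg (by positivity) this
  · by_cases ht : t ∈ Set.Icc (-T) T
    · rw [Set.indicator_of_mem ht, spN]
      gcongr
      rw [← lintegral_indicator_const measurableSet_closedBall]
      refine lintegral_mono fun x => ?_
      by_cases hx : F t x = 0
      · simp [hx, hp]
      · have hmem : x ∈ Metric.closedBall (0 : Ed d) T := by simpa using (hT t x hx).2.2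
        rw [Set.indicator_of_mem hmem, ← ofReal_norm]
        gcongr
        exact hM t x
    · rw [Set.indicator_of_notMem ht]
      have h0 : ∀ x, F t x = 0 := by
        intro x
        by_contra hx
        exact ht (abs_le.1 (hT t x hx).1)
      simp [spN, h0, hp]

theorem SpaceTimeTest.spN_ne_top (hF : SpaceTimeTest F) {p : ℝ} (hp : 0 < p) (t : ℝ) :
    spN p (F t) ≠ ∞ := by
  rw [(hF.space t).spN_eq hp]
  exact ENNReal.ofReal_ne_top

theorem SpaceTimeTest.stN_ne_top (hF : SpaceTimeTest F) {e p : ℝ} (he : e < 1) (hp : 0 < p) :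
    stN e p F ≠ ∞ := by
  have he' : 0 < 1 - e := by linarith
  obtain ⟨M, T, hM, hT⟩ := hF.exists_spN_le hp
  refine ENNReal.rpow_ne_top_of_nonneg he'.le (ne_top_of_le_ne_top (b :=
    ∫⁻ t, (Set.Icc (-T) T).indicator (fun _ => M ^ (1 - e)⁻¹) t) ?_ (lintegral_mono fun t => ?_))
  · rw [lintegral_indicator_const measurableSet_Icc]
    exact ENNReal.mul_ne_top (ENNReal.rpow_ne_top_of_nonneg (by positivity) hM)
      measure_Icc_lt_top.ne
  · refine (ENNReal.rpow_le_rpow (hT t) (by positivity)).trans_eq ?_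
    by_cases ht : t ∈ Set.Icc (-T) T
    · rw [Set.indicator_of_mem ht, Set.indicator_of_mem ht]
    · rw [Set.indicator_of_notMem ht, Set.indicator_of_notMem ht,
        ENNReal.zero_rpow_of_pos (by positivity)]

theorem enorm_locForm_le_interp [NeZero d] (a t : ℝ) {b : ℝ} (hb : 0 < b) {f g : Ed d → ℂ}
    (hf : SpaceTest f) (hg : SpaceTest g) {κ : ℝ} (hκ0 : 0 ≤ κ)
    (hκ : ∀ x y, f x ≠ 0 → g y ≠ 0 →
      b ^ d * ‖radKer d a (b ^ a * t) (b * ‖x‖) (b * ‖y‖)‖ ≤ κ) {θ p : ℝ} (hθ0 : 0 ≤ θ)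
    (hθ1 : θ ≤ 1) (hp : p = 2 / (1 + θ)) :
    ‖locForm a b t f g‖ₑ ≤ spN p f * spN p g *
      ENNReal.ofReal (((2 * Real.pi) ^ d) ^ (1 - θ) * κ ^ θ) := by
  have hp0 : 0 < p := by rw [hp]; positivity
  rw [hf.spN_eq hp0, hg.spN_eq hp0, ← ENNReal.ofReal_mul (Real.rpow_nonneg
    (integral_nonneg fun x => by positivity) _), mul_comm, ← ENNReal.ofReal_mul (by positivity),
    ← ofReal_norm]
  exact ENNReal.ofReal_le_ofReal (norm_locForm_le_interp a t hb hf hg hκ0 hκ hθ0 hθ1 hp)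

/-- A pointwise bound of the localized forms controls the space-time form. -/
theorem enorm_tForm_le (a b : ℝ) (hF : SpaceTimeTest F) (hG : SpaceTimeTest G)
    {k : ℝ × ℝ → ℂ} {κ : ℝ → ℝ≥0∞} (hκ : Measurable κ) {e e' p p' : ℝ}
    (h : ∀ t' t, ‖k (t', t) * locForm a b (t - t') (F t') (G t)‖ₑ ≤
      spN p (F t') * spN p' (G t) * κ (t - t')) (he : 0 ≤ e) (he' : 0 ≤ e') (hpos : 0 < e + e')
    (hle : e + e' ≤ 1) (he1 : e < 1) (he1' : e' < 1) :
    ‖tForm a b k F G‖ₑ ≤ stN e p F * stN e' p' G * (∫⁻ t, κ t ^ (e + e')⁻¹) ^ (e + e') := by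
  have h1 := lintegral_conv_le (hF.measurable_spN p) (hG.measurable_spN p') hκ he he' hpos hle he1
    he1'
  have h2 : ∫⁻ z : ℝ × ℝ, ‖k z * locForm a b (z.2 - z.1) (F z.1) (G z.2)‖ₑ ≤
      ∫⁻ z : ℝ × ℝ, spN p (F z.1) * spN p' (G z.2) * κ (z.2 - z.1) :=
    lintegral_mono fun z => h z.1 z.2
  unfold tForm stN
  exact (enorm_integral_le_lintegral_enorm _).trans (h2.trans h1)

end Norms


section Exponents

/-- The interpolation parameter `θ = 1 - 2 / r` attached to the time exponent `q = 1 / e`. -/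
def thetaOf (d : ℕ) (a e : ℝ) : ℝ := 2 * a * e / d

/-- The dual space exponent attached to the time exponent `q = 1 / e`. -/
def spExp (d : ℕ) (a e : ℝ) : ℝ := 2 / (1 + thetaOf d a e)

variable {d : ℕ} {a e : ℝ}

theorem thetaOf_nonneg (ha : 0 ≤ a) (he : 0 ≤ e) : 0 ≤ thetaOf d a e := by
  unfold thetaOf; positivity

theorem thetaOf_lt_one (hd : 2 ≤ d) (ha : 0 < a) (ha2 : a < 2) (he2 : e ≤ 1 / 2) :
    thetaOf d a e < 1 := by
  have hd' : (2 : ℝ) ≤ d := by exact_mod_cast hd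
  rw [thetaOf, div_lt_one (by linarith)]
  nlinarith

theorem thetaOf_mul (hd : 2 ≤ d) : thetaOf d a e * d = 2 * a * e := by
  have hd' : (2 : ℝ) ≤ d := by exact_mod_cast hd
  rw [thetaOf]
  field_simp

theorem spExp_pos (ha : 0 ≤ a) (he : 0 ≤ e) : 0 < spExp d a e := by
  have := thetaOf_nonneg (d := d) ha he
  unfold spExp; positivity

theorem inv_spExp : 1 / spExp d a e = 1 - (1 - thetaOf d a e) / 2 := by
  rw [spExp, one_div_div]
  ring

end Exponents

section AnnularBound

variable {d : ℕ}

theorem exists_spN_one_le (d : ℕ) {p η : ℝ} (hp : 0 < p) (hη : 0 ≤ η) (h : 1 / p = 1 - η) :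
    ∃ C : ℝ, 0 < C ∧ ∀ R : ℝ, 0 < R → ∀ f : Ed d → ℂ, Measurable f →
      (∀ x, f x ≠ 0 → ‖x‖ ≤ 2 * R) →
      spN 1 f ≤ spN p f * ENNReal.ofReal (C * R ^ (d * η)) := by
  set V := (volume (Metric.ball (0 : Ed d) 1)).toReal
  have hV : 0 < V := ENNReal.toReal_pos (Metric.measure_ball_pos _ _ one_pos).ne'
    measure_ball_lt_top.ne
  refine ⟨(2 ^ d * V) ^ η, by positivity, fun R hR f hf hs => ?_⟩
  set B := Metric.closedBall (0 : Ed d) (2 * R)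
  have hvol : volume B = ENNReal.ofReal ((2 * R) ^ d * V) := by
    rw [Measure.addHaar_closedBall _ _ (by positivity), finrank_euclideanSpace, Fintype.card_fin,
      ENNReal.ofReal_mul (by positivity), ENNReal.ofReal_toReal measure_ball_lt_top.ne]
  have hpt : ∀ x, ‖f x‖ₑ ^ (1 : ℝ) = (‖f x‖ₑ ^ p) ^ (1 / p) * (B.indicator 1 x : ℝ≥0∞) ^ η := by
    intro x
    rw [← ENNReal.rpow_mul, mul_one_div_cancel hp.ne', ENNReal.rpow_one]
    by_cases hx : f x = 0
    · simp [hx]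
    · rw [Set.indicator_of_mem (by simpa [B] using hs x hx)]
      simp
  have hone : (1 : ℝ) / 1 = 1 := by norm_num
  rw [spN, hone, ENNReal.rpow_one]
  simp_rw [hpt]
  have hBm : Measurable (B.indicator 1 : Ed d → ℝ≥0∞) :=
    measurable_one.indicator measurableSet_closedBall
  refine (ENNReal.lintegral_mul_norm_pow_le (by fun_prop) hBm.aemeasurable (by positivity) hη
    (by linarith)).trans_eq ?_
  rw [lintegral_indicator_one measurableSet_closedBall, hvol, spN,
    ENNReal.ofReal_rpow_of_nonneg (by positivity) hη]
  congr 2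
  rw [mul_pow, mul_right_comm, Real.mul_rpow (by positivity) (by positivity),
    ← Real.rpow_natCast R d, ← Real.rpow_mul hR.le]

theorem exists_lintegral_decay_le {β : ℝ} (hβ : 1 < β) : ∃ J : ℝ, 0 < J ∧ ∀ c l E : ℝ, 0 ≤ c →
    0 < l → 0 < E → (∫⁻ t : ℝ, ENNReal.ofReal (c * (1 + l * |t|) ^ (-(β * E))) ^ E⁻¹) ^ E ≤
      ENNReal.ofReal (c * (l⁻¹ * J) ^ E) := by
  have hInt : Integrable fun t : ℝ => (1 + ‖t‖) ^ (-β) :=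
    integrable_one_add_norm (by simpa using hβ)
  set I := ∫ t : ℝ, (1 + ‖t‖) ^ (-β)
  have hI0 : 0 ≤ I := integral_nonneg fun t => by positivity
  refine ⟨I + 1, by positivity, fun c l E hc hl hE => ?_⟩
  have hpt : ∀ t : ℝ, ENNReal.ofReal (c * (1 + l * |t|) ^ (-(β * E))) ^ E⁻¹ =
      ENNReal.ofReal (c ^ E⁻¹) * ENNReal.ofReal ((1 + ‖l • t‖) ^ (-β)) := by
    intro t
    rw [ENNReal.ofReal_rpow_of_nonneg (by positivity) (by positivity),
      ← ENNReal.ofReal_mul (by positivity), Real.mul_rpow hc (by positivity),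
      ← Real.rpow_mul (by positivity), norm_smul, Real.norm_of_nonneg hl.le, Real.norm_eq_abs]
    congr 3
    field_simp
  simp_rw [hpt]
  rw [lintegral_const_mul _ (by fun_prop), lintegral_comp_smul_eq volume
    (fun t : ℝ => ENNReal.ofReal ((1 + ‖t‖) ^ (-β))) hl, Module.finrank_self, pow_one,
    ← ofReal_integral_eq_lintegral_ofReal hInt (Filter.Eventually.of_forall fun t => by positivity),
    ← ENNReal.ofReal_mul (by positivity), ← ENNReal.ofReal_mul (by positivity),
    ENNReal.ofReal_rpow_of_nonneg (by positivity) hE.le]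
  refine ENNReal.ofReal_le_ofReal ?_
  rw [Real.mul_rpow (by positivity) (by positivity), ← Real.rpow_mul hc, inv_mul_cancel₀ hE.ne',
    Real.rpow_one]
  gcongr
  change I ≤ I + 1
  linarith

theorem exists_enorm_locForm_annulus_le (hd : 2 ≤ d) {a : ℝ} (ha1 : 1 < a) (ha2 : a < 2)
    {e e' : ℝ} (he : 0 ≤ e) (he2 : e ≤ 1 / 2) (he' : 0 ≤ e') (he2' : e' ≤ 1 / 2) :
    ∃ C : ℝ, 0 < C ∧ ∀ (b R R' t : ℝ) (f g : Ed d → ℂ), 0 < b → 0 < R → 0 < R' →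
      SpaceTest f → SpaceTest g → (∀ x, f x ≠ 0 → R ≤ ‖x‖ ∧ ‖x‖ ≤ 2 * R) →
      (∀ x, g x ≠ 0 → R' ≤ ‖x‖ ∧ ‖x‖ ≤ 2 * R') →
      ‖locForm a b t f g‖ₑ ≤ spN (spExp d a e) f * spN (spExp d a e') g *
        ENNReal.ofReal (C * (b * R) ^ (d * ((1 - thetaOf d a e) / 2)) *
          (b * R') ^ (d * ((1 - thetaOf d a e') / 2)) * (1 + 2 * (b * R) + 2 * (b * R')) ^ 2 *
          (b ^ a) ^ (e + e') * (1 + b ^ a * |t|) ^ (-2 : ℝ)) := by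
  have : NeZero d := ⟨by omega⟩
  have ha0 : 0 < a := by linarith
  obtain ⟨K, hK0, hK⟩ := exists_radKer_le_sq d ha1 ha2
  have hη : 0 ≤ (1 - thetaOf d a e) / 2 := by
    linarith [thetaOf_lt_one hd ha0 ha2 he2]
  have hη' : 0 ≤ (1 - thetaOf d a e') / 2 := by
    linarith [thetaOf_lt_one hd ha0 ha2 he2']
  obtain ⟨D, hD0, hD⟩ := exists_spN_one_le d (spExp_pos ha0.le he) hη inv_spExp
  obtain ⟨D', hD0', hD'⟩ := exists_spN_one_le d (spExp_pos ha0.le he') hη' inv_spExp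
  refine ⟨D * D' * K, by positivity, fun b R R' t f g hb hR hR' hf hg hfs hgs => ?_⟩
  have h1 := enorm_locForm_le_interp a t hb hf hg
    (κ := b ^ d * (K * (1 + 2 * (b * R) + 2 * (b * R')) ^ 2 * (1 + b ^ a * |t|) ^ (-2 : ℝ)))
    (by positivity) (fun x y hx hy => by
      refine mul_le_mul_of_nonneg_left ((hK _ _ _ (by positivity) (by positivity)).trans ?_)
        (by positivity)
      rw [abs_mul, abs_of_pos (by positivity : 0 < b ^ a)]
      have h6 := mul_le_mul_of_nonneg_left (hfs x hx).2 hb.le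
      have h7 := mul_le_mul_of_nonneg_left (hgs y hy).2 hb.le
      have h8 : 1 + b * ‖x‖ + b * ‖y‖ ≤ 1 + 2 * (b * R) + 2 * (b * R') := by linarith
      exact mul_le_mul_of_nonneg_right (mul_le_mul_of_nonneg_left (pow_le_pow_left₀ (by positivity)
        h8 2) hK0.le) (by positivity)) (θ := 1) (p := 1) zero_le_one le_rfl (by norm_num)
  rw [sub_self, Real.rpow_zero, Real.rpow_one, one_mul] at h1
  have h2 := hD R hR f hf.meas fun x hx => (hfs x hx).2
  have h3 := hD' R' hR' g hg.meas fun x hx => (hgs x hx).2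
  refine h1.trans ((mul_le_mul_left (mul_le_mul' h2 h3) _).trans_eq ?_)
  rw [mul_mul_mul_comm, mul_assoc, ← ENNReal.ofReal_mul (by positivity),
    ← ENNReal.ofReal_mul (by positivity)]
  congr 2
  have hpow : (b : ℝ) ^ d = b ^ (d * ((1 - thetaOf d a e) / 2)) *
      b ^ (d * ((1 - thetaOf d a e') / 2)) * (b ^ a) ^ (e + e') := by
    rw [← Real.rpow_natCast, ← Real.rpow_mul hb.le, ← Real.rpow_add hb, ← Real.rpow_add hb]
    congr 1
    have h4 := thetaOf_mul (d := d) (a := a) (e := e) hd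
    have h5 := thetaOf_mul (d := d) (a := a) (e := e') hd
    linarith
  rw [hpow, Real.mul_rpow hb.le hR.le, Real.mul_rpow hb.le hR'.le]
  ring

end AnnularBound


section DiagonalBound

variable {d : ℕ} {F G : ℝ → Ed d → ℂ}

/-- The real-valued dual Strichartz norm attached to the time exponent `q = 1 / e`. -/
def nrm (a e : ℝ) (F : ℝ → Ed d → ℂ) : ℝ := (stN e (spExp d a e) F).toReal

theorem nrm_nonneg (a e : ℝ) (F : ℝ → Ed d → ℂ) : 0 ≤ nrm a e F := ENNReal.toReal_nonneg

theorem SpaceTimeTest.ofReal_nrm (hF : SpaceTimeTest F) {a e : ℝ} (ha : 0 ≤ a) (he : 0 ≤ e)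
    (he1 : e < 1) : ENNReal.ofReal (nrm a e F) = stN e (spExp d a e) F :=
  ENNReal.ofReal_toReal (hF.stN_ne_top he1 (spExp_pos ha he))

theorem norm_tForm_le (hF : SpaceTimeTest F) (hG : SpaceTimeTest G) {a b : ℝ} (ha : 0 ≤ a)
    {k : ℝ × ℝ → ℂ} {κ : ℝ → ℝ≥0∞} (hκ : Measurable κ) {e e' D : ℝ}
    (h : ∀ t' t, ‖k (t', t) * locForm a b (t - t') (F t') (G t)‖ₑ ≤
      spN (spExp d a e) (F t') * spN (spExp d a e') (G t) * κ (t - t')) (he : 0 ≤ e) (he' : 0 ≤ e')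
    (hpos : 0 < e + e') (he1 : e ≤ 1 / 2) (he1' : e' ≤ 1 / 2) (hD : 0 ≤ D)
    (hκD : (∫⁻ t, κ t ^ (e + e')⁻¹) ^ (e + e') ≤ ENNReal.ofReal D) :
    ‖tForm a b k F G‖ ≤ D * (nrm a e F * nrm a e' G) := by
  have h1 := enorm_tForm_le a b hF hG hκ h he he' hpos (by linarith) (by linarith) (by linarith)
  rw [← hF.ofReal_nrm ha he (by linarith), ← hG.ofReal_nrm ha he' (by linarith), ← ofReal_norm,
    ← ENNReal.ofReal_mul (nrm_nonneg _ _ _)] at h1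
  have h2 := h1.trans (mul_le_mul_right hκD _)
  rw [← ENNReal.ofReal_mul (mul_nonneg (nrm_nonneg _ _ _) (nrm_nonneg _ _ _)),
    ENNReal.ofReal_le_ofReal_iff (mul_nonneg (mul_nonneg (nrm_nonneg _ _ _) (nrm_nonneg _ _ _))
      hD)] at h2
  linarith

theorem charSq_eq_norm (a : ℝ) {b : ℝ} (hb : 0 < b) (hF : SpaceTimeTest F) :
    charSq a b F = ‖tForm a b (fun _ => 1) F F‖ := by
  rw [← charSq_eq a hb hF, Complex.norm_real, Real.norm_of_nonneg (charSq_nonneg _ _ _)]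

theorem exists_charSq_le_of_one_le (hd : 2 ≤ d) {a : ℝ} (ha1 : 1 < a) (ha2 : a < 2)
    (had : 2 * (d : ℝ) / (2 * d - 1) < a) {e : ℝ} (he : 0 < e) (he2 : e ≤ 1 / 2) :
    ∃ C A : ℝ, 0 < C ∧ 0 < A ∧ ∀ (b R : ℝ) (F : ℝ → Ed d → ℂ), 0 < b → 0 < R →
      1 ≤ b * R → SpaceTimeTest F → (∀ t x, F t x ≠ 0 → R ≤ ‖x‖ ∧ ‖x‖ ≤ 2 * R) →
      charSq a b F ≤ C * (b * R) ^ (-A) * (nrm a e F * nrm a e F) := by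
  have : NeZero d := ⟨by omega⟩
  have hd0 : (0 : ℝ) < d := by exact_mod_cast (by omega : 0 < d)
  have ha0 : 0 < a := by linarith
  obtain ⟨A, B, K, hA, hB, hK0, hK⟩ := exists_radKer_decay d hd ha1 ha2 had
  obtain ⟨J, hJ0, hJ⟩ := exists_lintegral_decay_le hB
  set θ := thetaOf d a e with hθ
  have hθ0 : 0 < θ := by rw [hθ, thetaOf]; positivity
  have hθ1 : θ < 1 := thetaOf_lt_one hd ha0 ha2 he2
  refine ⟨((2 * Real.pi) ^ d) ^ (1 - θ) * K ^ θ * J ^ (e + e), A * θ, by positivity, by positivity,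
    fun b R F hb hR hx hF hFs => ?_⟩
  set x := b * R
  have hx0 : 0 < x := by positivity
  rw [charSq_eq_norm a hb hF]
  set c := ((2 * Real.pi) ^ d) ^ (1 - θ) * (b ^ d * (K * x ^ (-A))) ^ θ with hc
  refine norm_tForm_le hF hF ha0.le (κ := fun t => ENNReal.ofReal (c * (1 + b ^ a * |t|) ^
    (-(a / d * B * (e + e))))) (by fun_prop) (fun t' t => ?_) he.le he.le (by linarith) he2 he2
    (by positivity) ((hJ c (b ^ a) (e + e) (by positivity) (by positivity) (by positivity)).trans_eq
      ?_)
  · rw [one_mul]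
    have h1 := enorm_locForm_le_interp a (t - t') hb (hF.space t') (hF.space t)
      (κ := b ^ d * (K * x ^ (-A) * (1 + b ^ a * |t - t'|) ^ (-B))) (by positivity)
      (fun y y' hy hy' => by
        have h2 := hFs _ _ hy
        have h3 := hFs _ _ hy'
        have h4 := mul_le_mul_of_nonneg_left h2.1 hb.le
        have h5 := mul_le_mul_of_nonneg_left h2.2 hb.le
        have h6 := mul_le_mul_of_nonneg_left h3.1 hb.le
        have h7 := mul_le_mul_of_nonneg_left h3.2 hb.le
        refine mul_le_mul_of_nonneg_left ((hK (b ^ a * (t - t')) x _ _ hx h4 (by linarith) h6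
          (by linarith)).trans_eq ?_) (by positivity)
        rw [abs_mul, abs_of_pos (by positivity : 0 < b ^ a)]) hθ0.le hθ1.le (p := spExp d a e) rfl
    refine h1.trans_eq ?_
    congr 2
    rw [← mul_assoc (b ^ d), Real.mul_rpow (by positivity) (by positivity), ← mul_assoc,
      ← Real.rpow_mul (by positivity)]
    congr 2
    rw [hθ, thetaOf]
    field_simp
    ring
  · congr 1
    rw [hc, Real.mul_rpow (by positivity) (by positivity), Real.mul_rpow hK0.le (by positivity),
      Real.mul_rpow (by positivity) hJ0.le, ← Real.rpow_mul hx0.le, Real.inv_rpow (by positivity),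
      ← Real.rpow_mul hb.le, ← Real.rpow_natCast b, ← Real.rpow_mul hb.le]
    have h4 : (d : ℝ) * θ = a * (e + e) := by
      have := thetaOf_mul (d := d) (a := a) (e := e) hd
      rw [← hθ] at this
      linarith
    rw [h4]
    have : (b ^ (a * (e + e)) : ℝ) ≠ 0 := by positivity
    field_simp

theorem exists_charSq_le_of_le_one (hd : 2 ≤ d) {a : ℝ} (ha1 : 1 < a) (ha2 : a < 2) {e : ℝ}
    (he : 0 < e) (he2 : e ≤ 1 / 2) :
    ∃ C A : ℝ, 0 < C ∧ 0 < A ∧ ∀ (b R : ℝ) (F : ℝ → Ed d → ℂ), 0 < b → 0 < R →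
      b * R ≤ 1 → SpaceTimeTest F → (∀ t x, F t x ≠ 0 → R ≤ ‖x‖ ∧ ‖x‖ ≤ 2 * R) →
      charSq a b F ≤ C * (b * R) ^ A * (nrm a e F * nrm a e F) := by
  have hd0 : (0 : ℝ) < d := by exact_mod_cast (by omega : 0 < d)
  have ha0 : 0 < a := by linarith
  obtain ⟨D, hD0, hD⟩ := exists_enorm_locForm_annulus_le hd ha1 ha2 he.le he2 he.le he2
  obtain ⟨J, hJ0, hJ⟩ := exists_lintegral_decay_le (β := 2 / (e + e))
    (by rw [lt_div_iff₀ (by linarith)]; linarith)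
  have hθ1 := thetaOf_lt_one hd ha0 ha2 he2
  set η := d * ((1 - thetaOf d a e) / 2) with hη
  have hη0 : 0 < η := by
    have : 0 < 1 - thetaOf d a e := by linarith
    positivity
  refine ⟨D * 25 * J ^ (e + e), η + η, by positivity, by positivity,
    fun b R F hb hR hx hF hFs => ?_⟩
  set x := b * R
  have hx0 : 0 < x := by positivity
  rw [charSq_eq_norm a hb hF]
  set c := D * x ^ η * x ^ η * (1 + 2 * x + 2 * x) ^ 2 * (b ^ a) ^ (e + e) with hc
  refine norm_tForm_le hF hF ha0.le (κ := fun t => ENNReal.ofReal (c * (1 + b ^ a * |t|) ^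
    (-(2 / (e + e) * (e + e))))) (by fun_prop) (fun t' t => ?_) he.le he.le (by linarith) he2 he2
    (by positivity) ((hJ c (b ^ a) (e + e) (by positivity) (by positivity) (by positivity)).trans
      (ENNReal.ofReal_le_ofReal ?_))
  · rw [one_mul, div_mul_cancel₀ _ (by linarith : e + e ≠ 0)]
    exact hD b R R (t - t') _ _ hb hR hR (hF.space t') (hF.space t) (hFs t') (hFs t)
  · have h1 : (1 + 2 * x + 2 * x) ^ 2 ≤ 25 := by nlinarith
    have h2 : (b ^ a) ^ (e + e) * ((b ^ a)⁻¹ * J) ^ (e + e) = J ^ (e + e) := by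
      rw [← Real.mul_rpow (by positivity) (by positivity), mul_inv_cancel_left₀ (by positivity)]
    calc c * ((b ^ a)⁻¹ * J) ^ (e + e)
        = D * x ^ η * x ^ η * (1 + 2 * x + 2 * x) ^ 2 *
          ((b ^ a) ^ (e + e) * ((b ^ a)⁻¹ * J) ^ (e + e)) := by rw [hc]; ring
      _ ≤ D * x ^ η * x ^ η * 25 * J ^ (e + e) := by rw [h2]; gcongr
      _ = _ := by rw [Real.rpow_add hx0]; ring

theorem exists_sqrt_charSq_le (hd : 2 ≤ d) {a : ℝ} (ha1 : 1 < a) (ha2 : a < 2)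
    (had : 2 * (d : ℝ) / (2 * d - 1) < a) {e : ℝ} (he : 0 < e) (he2 : e ≤ 1 / 2) :
    ∃ C δ : ℝ, 0 < C ∧ 0 < δ ∧ ∀ (b R : ℝ) (F : ℝ → Ed d → ℂ), 0 < b → 0 < R →
      SpaceTimeTest F → (∀ t x, F t x ≠ 0 → R ≤ ‖x‖ ∧ ‖x‖ ≤ 2 * R) →
      √(charSq a b F) ≤ C * (max (b * R) (b * R)⁻¹) ^ (-δ) * nrm a e F := by
  obtain ⟨C, A, hC, hA, h1⟩ := exists_charSq_le_of_one_le hd ha1 ha2 had he he2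
  obtain ⟨C', A', hC', hA', h2⟩ := exists_charSq_le_of_le_one hd ha1 ha2 he he2
  refine ⟨√(C + C'), min A A' / 2, by positivity, by positivity, fun b R F hb hR hF hFs => ?_⟩
  set x := b * R with hx
  have hx0 : 0 < x := by positivity
  have hn := nrm_nonneg a e F
  have hmax : 0 < max x x⁻¹ := lt_max_of_lt_left hx0
  refine Real.sqrt_le_iff.2 ⟨by positivity, ?_⟩
  rw [mul_pow, mul_pow, Real.sq_sqrt (by positivity), ← Real.rpow_natCast (_ ^ _),
    ← Real.rpow_mul hmax.le, sq (nrm a e F)]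
  have hexp : -(min A A' / 2) * ((2 : ℕ) : ℝ) = -min A A' := by push_cast; ring
  rw [hexp]
  rcases le_total 1 x with h | h
  · refine (h1 b R F hb hR h hF hFs).trans ?_
    rw [max_eq_left ((inv_le_one_of_one_le₀ h).trans h)]
    gcongr
    · linarith
    · exact min_le_left _ _
  · refine (h2 b R F hb hR h hF hFs).trans ?_
    have h3 := (one_le_inv₀ hx0).2 h
    rw [max_eq_right (h.trans h3), Real.rpow_neg (by positivity), Real.inv_rpow hx0.le, inv_inv]
    gcongr ?_ * ?_ * _
    · linarith
    · exact Real.rpow_le_rpow_of_exponent_ge hx0 h (min_le_right _ _)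

end DiagonalBound


section BilinearBound

variable {d : ℕ}

theorem bump_time_factor_le {M E : ℝ} (hM : 0 < M) (hE1 : E ≤ 1) :
    (1 + M / 2) ^ (-2 : ℝ) * (2 * M) ^ E ≤ 8 * (max M M⁻¹) ^ (-E) := by
  have h2 : (2 : ℝ) ^ E ≤ 2 := by
    simpa using Real.rpow_le_rpow_of_exponent_le (x := 2) one_le_two hE1
  rw [Real.mul_rpow zero_le_two hM.le]
  rcases le_total 1 M with h | h
  · rw [max_eq_left ((inv_le_one_of_one_le₀ h).trans h)]
    have h3 : (1 + M / 2) ^ (-2 : ℝ) ≤ 4 * M ^ (-2 : ℝ) := by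
      have h4 : (M / 2) ^ (-2 : ℝ) = 4 * M ^ (-2 : ℝ) := by
        rw [Real.div_rpow hM.le zero_le_two]
        norm_num [Real.rpow_neg]
        ring
      rw [← h4]
      exact Real.rpow_le_rpow_of_nonpos (by positivity) (by linarith) (by norm_num)
    have h5 : M ^ (-2 : ℝ) * M ^ E ≤ M ^ (-E) := by
      rw [← Real.rpow_add hM]
      exact Real.rpow_le_rpow_of_exponent_le h (by linarith)
    calc (1 + M / 2) ^ (-2 : ℝ) * (2 ^ E * M ^ E) ≤ 4 * M ^ (-2 : ℝ) * (2 * M ^ E) := by gcongr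
      _ = 8 * (M ^ (-2 : ℝ) * M ^ E) := by ring
      _ ≤ _ := by gcongr
  · have h3 := (one_le_inv₀ hM).2 h
    rw [max_eq_right (h.trans h3), Real.rpow_neg (inv_nonneg.2 hM.le), Real.inv_rpow hM.le, inv_inv]
    have h6 : (1 + M / 2) ^ (-2 : ℝ) ≤ 1 :=
      Real.rpow_le_one_of_one_le_of_nonpos (by linarith) (by norm_num)
    have h7 : 0 < M ^ E := by positivity
    calc (1 + M / 2) ^ (-2 : ℝ) * (2 ^ E * M ^ E) ≤ 1 * (2 * M ^ E) := by gcongr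
      _ ≤ 8 * M ^ E := by linarith

theorem spatial_factor_le {x y η η' : ℝ} (hx : 0 < x) (hy : 0 < y) (hη : 0 ≤ η) (hη' : 0 ≤ η')
    (hd : η ≤ d) (hd' : η' ≤ d) :
    x ^ η * y ^ η' * (1 + 2 * x + 2 * y) ^ 2 ≤
      25 * (max x x⁻¹ * max y y⁻¹) ^ ((d : ℝ) + 2) := by
  have hone : ∀ {x : ℝ}, 0 < x → 1 ≤ max x x⁻¹ := by
    intro x hx
    rcases le_total 1 x with h | h
    · exact le_max_of_le_left h
    · exact le_max_of_le_right ((one_le_inv₀ hx).2 h)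
  have h1 := hone hx
  have h2 := hone hy
  have hx' : x ≤ max x x⁻¹ := le_max_left _ _
  have hy' : y ≤ max y y⁻¹ := le_max_left _ _
  set X := max x x⁻¹
  set Y := max y y⁻¹
  have h3 : x ^ η ≤ X ^ (d : ℝ) := (Real.rpow_le_rpow hx.le hx' hη).trans
    (Real.rpow_le_rpow_of_exponent_le h1 hd)
  have h4 : y ^ η' ≤ Y ^ (d : ℝ) := (Real.rpow_le_rpow hy.le hy' hη').trans
    (Real.rpow_le_rpow_of_exponent_le h2 hd')
  have h5 : (1 + 2 * x + 2 * y) ^ 2 ≤ 25 * (X * Y) ^ 2 := by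
    have : 1 + 2 * x + 2 * y ≤ 5 * (X * Y) := by nlinarith
    calc (1 + 2 * x + 2 * y) ^ 2 ≤ (5 * (X * Y)) ^ 2 := by gcongr
      _ = _ := by ring
  calc x ^ η * y ^ η' * (1 + 2 * x + 2 * y) ^ 2
      ≤ X ^ (d : ℝ) * Y ^ (d : ℝ) * (25 * (X * Y) ^ 2) := by gcongr
    _ = _ := by
      rw [Real.rpow_add (by positivity), Real.mul_rpow (by positivity) (by positivity),
        Real.rpow_two]
      ring

theorem exists_norm_tForm_bump_le (hd : 2 ≤ d) {a : ℝ} (ha1 : 1 < a) (ha2 : a < 2)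
    {e e' : ℝ} (he : 0 < e) (he2 : e ≤ 1 / 2) (he' : 0 < e') (he2' : e' ≤ 1 / 2) :
    ∃ C : ℝ, 0 < C ∧ ∀ (b R R' M : ℝ) (F G : ℝ → Ed d → ℂ), 0 < b → 0 < R → 0 < R' → 0 < M →
      SpaceTimeTest F → SpaceTimeTest G → (∀ t x, F t x ≠ 0 → R ≤ ‖x‖ ∧ ‖x‖ ≤ 2 * R) →
      (∀ t x, G t x ≠ 0 → R' ≤ ‖x‖ ∧ ‖x‖ ≤ 2 * R') →
      ‖tForm a b (fun z => (dyBump ((z.2 - z.1) / ((b ^ a)⁻¹ * M)) : ℂ)) F G‖ ≤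
        C * ((max (b * R) (b * R)⁻¹ * max (b * R') (b * R')⁻¹) ^ ((d : ℝ) + 2) *
          (max M M⁻¹) ^ (-(e + e'))) * (nrm a e F * nrm a e' G) := by
  have ha0 : 0 < a := by linarith
  have hd0 : (0 : ℝ) < d := by exact_mod_cast (by omega : 0 < d)
  obtain ⟨D, hD0, hD⟩ := exists_enorm_locForm_annulus_le hd ha1 ha2 he.le he2 he'.le he2'
  refine ⟨D * 25 * 8, by positivity, fun b R R' M F G hb hR hR' hM hF hG hFs hGs => ?_⟩
  have hη : ∀ {e : ℝ}, 0 < e → e ≤ 1 / 2 → 0 ≤ d * ((1 - thetaOf d a e) / 2) ∧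
      d * ((1 - thetaOf d a e) / 2) ≤ d := by
    intro e he he2
    have h1 := thetaOf_lt_one hd ha0 ha2 he2
    have h2 := thetaOf_nonneg (d := d) ha0.le he.le
    have h3 : 0 < 1 - thetaOf d a e := by linarith
    exact ⟨by positivity, by nlinarith⟩
  obtain ⟨hη0, hη1⟩ := hη he he2
  obtain ⟨hη0', hη1'⟩ := hη he' he2'
  set η := d * ((1 - thetaOf d a e) / 2)
  set η' := d * ((1 - thetaOf d a e') / 2)
  set x := b * R with hx
  set y := b * R' with hy
  have hx0 : 0 < x := by positivity
  have hy0 : 0 < y := by positivity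
  set c := D * x ^ η * y ^ η' * (1 + 2 * x + 2 * y) ^ 2 * (b ^ a) ^ (e + e') *
    (1 + M / 2) ^ (-2 : ℝ) with hc
  have hc0 : 0 ≤ c := by positivity
  have hE : 0 < e + e' := by linarith
  refine norm_tForm_le hF hG ha0.le (κ := (Set.Icc 0 (2 * ((b ^ a)⁻¹ * M))).indicator
    fun _ => ENNReal.ofReal c) (measurable_const.indicator measurableSet_Icc) (fun t' t => ?_)
    he.le he'.le hE he2 he2' (by positivity) ?_
  · by_cases h0 : dyBump ((t - t') / ((b ^ a)⁻¹ * M)) = 0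
    · rw [h0, Complex.ofReal_zero, zero_mul, enorm_zero]
      exact zero_le
    · have h1 := dyBump_ne_zero h0
      rw [lt_div_iff₀ (by positivity), div_lt_iff₀ (by positivity)] at h1
      have hpos : 0 < 1 / 2 * ((b ^ a)⁻¹ * M) := by positivity
      have hmem : t - t' ∈ Set.Icc 0 (2 * ((b ^ a)⁻¹ * M)) := ⟨by linarith, h1.2.le⟩
      rw [Set.indicator_of_mem hmem, enorm_mul]
      have h2 := hD b R R' (t - t') _ _ hb hR hR' (hF.space t') (hG.space t) (hFs t') (hGs t)
      have h3 : ‖((dyBump ((t - t') / ((b ^ a)⁻¹ * M)) : ℝ) : ℂ)‖ₑ ≤ 1 := by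
        rw [← ofReal_norm, Complex.norm_real, Real.norm_of_nonneg (dyBump_nonneg _)]
        exact ENNReal.ofReal_le_one.2 (dyBump_le_one _)
      refine (mul_le_of_le_one_left zero_le h3).trans (h2.trans ?_)
      gcongr
      rw [hc]
      refine mul_le_mul_of_nonneg_left (Real.rpow_le_rpow_of_nonpos (by positivity) ?_
        (by norm_num)) (by positivity)
      rw [abs_of_pos (by linarith)]
      have h4 := mul_le_mul_of_nonneg_left h1.1.le (by positivity : 0 ≤ b ^ a)
      have h5 : b ^ a * (1 / 2 * ((b ^ a)⁻¹ * M)) = M / 2 := by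
        have : b ^ a ≠ 0 := by positivity
        field_simp
      linarith
  · have hpt : ∀ t : ℝ, (Set.Icc 0 (2 * ((b ^ a)⁻¹ * M))).indicator (fun _ => ENNReal.ofReal c) t ^
        (e + e')⁻¹ = (Set.Icc 0 (2 * ((b ^ a)⁻¹ * M))).indicator
        (fun _ => ENNReal.ofReal c ^ (e + e')⁻¹) t := by
      intro t
      by_cases ht : t ∈ Set.Icc 0 (2 * ((b ^ a)⁻¹ * M))
      · rw [Set.indicator_of_mem ht, Set.indicator_of_mem ht]
      · rw [Set.indicator_of_notMem ht, Set.indicator_of_notMem ht,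
          ENNReal.zero_rpow_of_pos (by positivity)]
    simp_rw [hpt]
    rw [lintegral_indicator_const measurableSet_Icc, Real.volume_Icc, sub_zero,
      ENNReal.mul_rpow_of_nonneg _ _ hE.le, ← ENNReal.rpow_mul, inv_mul_cancel₀ hE.ne',
      ENNReal.rpow_one, ENNReal.ofReal_rpow_of_nonneg (by positivity) hE.le,
      ← ENNReal.ofReal_mul hc0]
    refine ENNReal.ofReal_le_ofReal ?_
    have h1 := bump_time_factor_le (E := e + e') hM (by linarith)
    have h2 := spatial_factor_le (d := d) hx0 hy0 hη0 hη0' hη1 hη1'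
    have h3 : (2 * ((b ^ a)⁻¹ * M)) ^ (e + e') * (b ^ a) ^ (e + e') = (2 * M) ^ (e + e') := by
      rw [← Real.mul_rpow (by positivity) (by positivity)]
      congr 1
      have : b ^ a ≠ 0 := by positivity
      field_simp
    calc c * (2 * ((b ^ a)⁻¹ * M)) ^ (e + e')
        = D * (x ^ η * y ^ η' * (1 + 2 * x + 2 * y) ^ 2) * ((1 + M / 2) ^ (-2 : ℝ) *
          ((2 * ((b ^ a)⁻¹ * M)) ^ (e + e') * (b ^ a) ^ (e + e'))) := by rw [hc]; ring
      _ ≤ D * (25 * (max x x⁻¹ * max y y⁻¹) ^ ((d : ℝ) + 2)) * (8 * (max M M⁻¹) ^ (-(e + e'))) := by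
        rw [h3]
        gcongr
      _ = _ := by ring

theorem geom_mean_le {T C C' W V n δ D : ℝ} (hT : 0 ≤ T) (hC : 0 < C) (hC' : 0 < C') (hW : 1 ≤ W)
    (hV : 0 < V) (hn : 0 ≤ n) (hδ : 0 < δ) (hD : 0 < D) (h1 : T ≤ C * W ^ (-δ) * n)
    (h2 : T ≤ C' * (W ^ D * V) * n) :
    T ≤ (C + C') * (W ^ (-(δ / 2)) * V ^ (δ / (2 * (D + δ)))) * n := by
  set l := δ / (2 * (D + δ)) with hl
  have hl0 : 0 < l := by positivity
  have hl1 : l < 1 := by rw [hl, div_lt_one (by positivity)]; linarith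
  have hW0 : 0 < W := by linarith
  have hrep : T = T ^ (1 - l) * T ^ l := by
    rcases hT.eq_or_lt with h | h
    · rw [← h, Real.zero_rpow hl0.ne', mul_zero]
    · rw [← Real.rpow_add h]; simp
  have hsplit : ∀ y : ℝ, 0 ≤ y → y ^ (1 - l) * y ^ l = y := by
    intro y hy
    rcases hy.eq_or_lt with h | h
    · rw [← h, Real.zero_rpow hl0.ne', mul_zero]
    · rw [← Real.rpow_add h]; simp
  have hexp : -δ * (1 - l) + D * l = -(δ / 2) := by
    rw [hl]
    field_simp
    ring
  calc T = T ^ (1 - l) * T ^ l := hrep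
    _ ≤ ((C + C') * W ^ (-δ) * n) ^ (1 - l) * ((C + C') * (W ^ D * V) * n) ^ l := by
      refine mul_le_mul (Real.rpow_le_rpow hT (h1.trans ?_) (by linarith))
        (Real.rpow_le_rpow hT (h2.trans ?_) hl0.le) (by positivity) (by positivity)
      · gcongr; linarith
      · gcongr; linarith
    _ = ((C + C') ^ (1 - l) * (C + C') ^ l) * (W ^ (-δ * (1 - l)) * W ^ (D * l) * V ^ l) *
        (n ^ (1 - l) * n ^ l) := by
      rw [Real.mul_rpow (by positivity) hn, Real.mul_rpow (by positivity) hn,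
        Real.mul_rpow (by positivity) (by positivity), Real.mul_rpow (by positivity) (by positivity),
        Real.mul_rpow (by positivity) (by positivity), ← Real.rpow_mul hW0.le,
        ← Real.rpow_mul hW0.le]
      ring
    _ = _ := by
      rw [hsplit _ (by positivity), hsplit _ hn, ← Real.rpow_add hW0, hexp]

end BilinearBound


section BilinearDecay

variable {d : ℕ}

theorem one_le_max_inv {x : ℝ} (hx : 0 < x) : 1 ≤ max x x⁻¹ := by
  rcases le_total 1 x with h | h
  · exact le_max_of_le_left h
  · exact le_max_of_le_right ((one_le_inv₀ hx).2 h)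

theorem exists_norm_tForm_bump_decay (hd : 2 ≤ d) {a : ℝ} (ha1 : 1 < a) (ha2 : a < 2)
    (had : 2 * (d : ℝ) / (2 * d - 1) < a)
    {e e' : ℝ} (he : 0 < e) (he2 : e ≤ 1 / 2) (he' : 0 < e') (he2' : e' ≤ 1 / 2) :
    ∃ C δ ε : ℝ, 0 < C ∧ 0 < δ ∧ 0 < ε ∧ ∀ (b R R' M : ℝ) (F G : ℝ → Ed d → ℂ),
      0 < b → 0 < R → 0 < R' → 0 < M →
      SpaceTimeTest F → SpaceTimeTest G → (∀ t x, F t x ≠ 0 → R ≤ ‖x‖ ∧ ‖x‖ ≤ 2 * R) →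
      (∀ t x, G t x ≠ 0 → R' ≤ ‖x‖ ∧ ‖x‖ ≤ 2 * R') →
      ‖tForm a b (fun z => (dyBump ((z.2 - z.1) / ((b ^ a)⁻¹ * M)) : ℂ)) F G‖ ≤
        C * (max M M⁻¹) ^ (-ε) * ((max (b * R) (b * R)⁻¹) ^ (-δ) *
          (max (b * R') (b * R')⁻¹) ^ (-δ)) * (nrm a e F * nrm a e' G) := by
  have ha0 : 0 < a := by linarith
  have hd0 : (0 : ℝ) < d := by exact_mod_cast (by omega : 0 < d)
  obtain ⟨K, hK0, hK⟩ := exists_norm_tForm_dyBump_le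
  obtain ⟨C₁, δ₁, hC₁, hδ₁, h₁⟩ := exists_sqrt_charSq_le hd ha1 ha2 had he he2
  obtain ⟨C₂, δ₂, hC₂, hδ₂, h₂⟩ := exists_sqrt_charSq_le hd ha1 ha2 had he' he2'
  obtain ⟨C₃, hC₃, h₃⟩ := exists_norm_tForm_bump_le hd ha1 ha2 he he2 he' he2'
  set δ := min δ₁ δ₂ with hδ
  have hδ0 : 0 < δ := lt_min hδ₁ hδ₂
  set D : ℝ := d + 2
  have hD0 : 0 < D := by positivity
  refine ⟨K * (C₁ * C₂) + C₃, δ / 2, (e + e') * (δ / (2 * (D + δ))), by positivity, by positivity,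
    by positivity, fun b R R' M F G hb hR hR' hM hF hG hFs hGs => ?_⟩
  have hX := one_le_max_inv (x := b * R) (by positivity)
  have hY := one_le_max_inv (x := b * R') (by positivity)
  have hZ := one_le_max_inv hM
  have h3 := h₃ b R R' M F G hb hR hR' hM hF hG hFs hGs
  set X := max (b * R) (b * R)⁻¹
  set Y := max (b * R') (b * R')⁻¹
  set Z := max M M⁻¹
  have hX0 : 0 < X := by linarith
  have hY0 : 0 < Y := by linarith
  have hZ0 : 0 < Z := by linarith
  have hn := nrm_nonneg a e F
  have hn' := nrm_nonneg a e' G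
  have hmod : ∀ ω : ℝ, ∀ {F : ℝ → Ed d → ℂ} {R : ℝ}, (∀ t x, F t x ≠ 0 → R ≤ ‖x‖ ∧ ‖x‖ ≤ 2 * R) →
      ∀ t x, modulate ω F t x ≠ 0 → R ≤ ‖x‖ ∧ ‖x‖ ≤ 2 * R := fun ω F R h t x hx =>
    h t x (right_ne_zero_of_mul hx)
  have h1 : ‖tForm a b (fun z => (dyBump ((z.2 - z.1) / ((b ^ a)⁻¹ * M)) : ℂ)) F G‖ ≤
      K * (C₁ * C₂) * (X * Y) ^ (-δ) * (nrm a e F * nrm a e' G) := by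
    refine (hK d a b ((b ^ a)⁻¹ * M) hb F G hF hG (C₁ * C₂ * (X * Y) ^ (-δ) *
      (nrm a e F * nrm a e' G)) fun ω => ?_).trans_eq (by ring)
    have h4 := h₁ b R _ hb hR (hF.modulate ω) (hmod ω hFs)
    have h5 := h₂ b R' _ hb hR' (hG.modulate ω) (hmod ω hGs)
    unfold nrm at h4 h5
    rw [stN_modulate (by linarith) (spExp_pos ha0.le he.le).le] at h4
    rw [stN_modulate (by linarith) (spExp_pos ha0.le he'.le).le] at h5
    change _ ≤ C₁ * X ^ (-δ₁) * nrm a e F at h4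
    change _ ≤ C₂ * Y ^ (-δ₂) * nrm a e' G at h5
    have h6 : X ^ (-δ₁) ≤ X ^ (-δ) :=
      Real.rpow_le_rpow_of_exponent_le hX (by linarith [min_le_left δ₁ δ₂])
    have h7 : Y ^ (-δ₂) ≤ Y ^ (-δ) :=
      Real.rpow_le_rpow_of_exponent_le hY (by linarith [min_le_right δ₁ δ₂])
    calc _ ≤ (C₁ * X ^ (-δ₁) * nrm a e F) * (C₂ * Y ^ (-δ₂) * nrm a e' G) := by gcongr
      _ ≤ (C₁ * X ^ (-δ) * nrm a e F) * (C₂ * Y ^ (-δ) * nrm a e' G) := by gcongr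
      _ = _ := by rw [Real.mul_rpow hX0.le hY0.le]; ring
  have h2 := geom_mean_le (norm_nonneg _) (by positivity) hC₃ (one_le_mul_of_one_le_of_one_le hX hY)
    (by positivity) (mul_nonneg hn hn') hδ0 hD0 h1 h3
  refine h2.trans_eq ?_
  rw [← Real.rpow_mul hZ0.le, Real.mul_rpow hX0.le hY0.le, neg_mul]
  ring

end BilinearDecay


section Annuli

variable {d : ℕ} {F G : ℝ → Ed d → ℂ}

/-- The part of `F` supported in the dyadic annulus of radius `2 ^ j`. -/
def ann (j : ℤ) (F : ℝ → Ed d → ℂ) (t : ℝ) (x : Ed d) : ℂ :=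
  if (2 : ℝ) ^ j ≤ ‖x‖ ∧ ‖x‖ < (2 : ℝ) ^ (j + 1) then F t x else 0

theorem ann_support {j : ℤ} {t : ℝ} {x : Ed d} (h : ann j F t x ≠ 0) :
    (2 : ℝ) ^ j ≤ ‖x‖ ∧ ‖x‖ ≤ 2 * (2 : ℝ) ^ j := by
  unfold ann at h
  split_ifs at h with hx
  · refine ⟨hx.1, hx.2.le.trans_eq ?_⟩
    rw [zpow_add₀ two_ne_zero, zpow_one, mul_comm]
  · exact absurd rfl h

theorem norm_ann_le (j : ℤ) (F : ℝ → Ed d → ℂ) (t : ℝ) (x : Ed d) : ‖ann j F t x‖ ≤ ‖F t x‖ := by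
  unfold ann
  split_ifs
  · exact le_rfl
  · simp

theorem SpaceTimeTest.ann (hF : SpaceTimeTest F) (j : ℤ) : SpaceTimeTest (ann j F) := by
  obtain ⟨M, hM⟩ := hF.bdd
  obtain ⟨T, hT0, hT⟩ := hF.supp
  refine ⟨?_, ⟨M, fun t x => (norm_ann_le j F t x).trans (hM t x)⟩, ⟨T, hT0, fun t x hx => hT t x
    fun h0 => hx ?_⟩, fun t x y h => ?_⟩
  · refine Measurable.ite ?_ hF.meas measurable_const
    exact (measurableSet_le measurable_const measurable_snd.norm).inter
      (measurableSet_lt measurable_snd.norm measurable_const)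
  · unfold _root_.ann
    rw [h0, ite_self]
  · unfold _root_.ann
    rw [h, hF.radial t x y h]

theorem zpow_annulus_unique {j k : ℤ} {r : ℝ} (hj : (2 : ℝ) ^ j ≤ r ∧ r < (2 : ℝ) ^ (j + 1))
    (hk : (2 : ℝ) ^ k ≤ r ∧ r < (2 : ℝ) ^ (k + 1)) : j = k := by
  have h1 := (zpow_lt_zpow_iff_right₀ (one_lt_two (α := ℝ))).1 (hj.1.trans_lt hk.2)
  have h2 := (zpow_lt_zpow_iff_right₀ (one_lt_two (α := ℝ))).1 (hk.1.trans_lt hj.2)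
  omega

theorem exists_zpow_annulus {r : ℝ} (hr : 0 < r) :
    ∃ j : ℤ, (2 : ℝ) ^ j ≤ r ∧ r < (2 : ℝ) ^ (j + 1) :=
  exists_mem_Ico_zpow hr one_lt_two

theorem SpaceTimeTest.exists_sum_ann (hF : SpaceTimeTest F) :
    ∃ J : ℕ, F = fun t x => ∑ j ∈ Finset.Icc (-(J : ℤ)) J, _root_.ann j F t x := by
  obtain ⟨T, hT0, hT⟩ := hF.supp
  obtain ⟨k, hk1, hk2⟩ := exists_zpow_annulus hT0
  refine ⟨(|k| + 2).toNat, ?_⟩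
  have hkJ : (((|k| + 2).toNat : ℕ) : ℤ) = |k| + 2 := Int.toNat_of_nonneg (by positivity)
  rw [hkJ]
  ext t x
  by_cases h0 : F t x = 0
  · rw [h0, Finset.sum_eq_zero]
    intro j _
    unfold _root_.ann
    rw [h0, ite_self]
  · obtain ⟨-, h1, h2⟩ := hT t x h0
    obtain ⟨j, hj⟩ := exists_zpow_annulus ((inv_pos.2 hT0).trans_le h1)
    have h3 := (zpow_lt_zpow_iff_right₀ (one_lt_two (α := ℝ))).1 (hj.1.trans_lt (h2.trans_lt hk2))
    have h4 : (2 : ℝ) ^ (-(k + 1)) < (2 : ℝ) ^ (j + 1) := by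
      refine lt_of_le_of_lt ?_ hj.2
      rw [zpow_neg]
      exact (inv_anti₀ hT0 hk2.le).trans h1
    have h5 := (zpow_lt_zpow_iff_right₀ (one_lt_two (α := ℝ))).1 h4
    have h6 := le_abs_self k
    have h7 := neg_abs_le k
    rw [Finset.sum_eq_single j]
    · unfold _root_.ann
      rw [if_pos hj]
    · intro i _ hij
      unfold _root_.ann
      rw [if_neg fun hi => hij (zpow_annulus_unique hi hj)]
    · intro hn
      exact absurd (Finset.mem_Icc.2 ⟨by omega, by omega⟩) hn

theorem tForm_sum_left {ι : Type*} (I : Finset ι) (a : ℝ) {b : ℝ} (hb : 0 < b)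
    {F : ι → ℝ → Ed d → ℂ} (hF : ∀ i, SpaceTimeTest (F i)) (hG : SpaceTimeTest G)
    {k : ℝ × ℝ → ℂ} (hk : Measurable k) {K : ℝ} (hK : ∀ z, ‖k z‖ ≤ K) :
    tForm a b k (fun t x => ∑ i ∈ I, F i t x) G = ∑ i ∈ I, tForm a b k (F i) G := by
  have hFT : ∀ t ξ, FT (fun x => ∑ i ∈ I, F i t x) ξ = ∑ i ∈ I, FT (F i t) ξ := by
    intro t ξ
    unfold FT
    rw [← integral_finsetSum]
    · simp only [Finset.mul_sum]
    · intro i _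
      refine (((hF i).space t).integrable).bdd_mul (c := 1) (Measurable.aestronglyMeasurable
        (by fun_prop)) (Filter.Eventually.of_forall fun x => (norm_exp_negI_mul _).le)
  have hloc : ∀ z : ℝ × ℝ, locForm a b (z.2 - z.1) (fun x => ∑ i ∈ I, F i z.1 x) (G z.2) =
      ∑ i ∈ I, locForm a b (z.2 - z.1) (F i z.1) (G z.2) := by
    intro z
    unfold locForm
    rw [← integral_finsetSum]
    · simp only [hFT, Finset.sum_mul, Finset.mul_sum]
    · intro i _
      obtain ⟨M, T, hM0, hM⟩ := (hF i).exists_norm_FT_le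
      obtain ⟨M', T', hM0', hM'⟩ := hG.exists_norm_FT_le
      have hle : ∀ M T t : ℝ, 0 ≤ M → (Set.Icc (-T) T).indicator (fun _ => M) t ≤ M :=
        fun M T t h => Set.indicator_le_self' (fun _ _ => h) t
      refine ((integrable_dyBump_norm (d := d) hb).const_mul (M * M')).mono'
        (((measurable_locMul_right a b _).mul
          ((continuous_FT ((hF i).space z.1).integrable).measurable.mul
            (Complex.continuous_conj.measurable.comp
              (continuous_FT (hG.space z.2).integrable).measurable))).aestronglyMeasurable)
        (Filter.Eventually.of_forall fun ξ => ?_)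
      rw [norm_mul, norm_mul, norm_locMul, RCLike.norm_conj, mul_comm]
      exact mul_le_mul_of_nonneg_right (mul_le_mul ((hM _ _).trans (hle M T _ hM0))
        ((hM' _ _).trans (hle M' T' _ hM0')) (norm_nonneg _) hM0) (dyBump_nonneg _)
  unfold tForm
  rw [← integral_finsetSum]
  · simp only [hloc, Finset.mul_sum]
  · exact fun i _ => integrable_tForm a hb (hF i) hG hk hK

theorem tForm_sum_right {ι : Type*} (I : Finset ι) (a : ℝ) {b : ℝ} (hb : 0 < b)
    {G : ι → ℝ → Ed d → ℂ} (hF : SpaceTimeTest F) (hG : ∀ i, SpaceTimeTest (G i))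
    {k : ℝ × ℝ → ℂ} (hk : Measurable k) {K : ℝ} (hK : ∀ z, ‖k z‖ ≤ K) :
    tForm a b k F (fun t x => ∑ i ∈ I, G i t x) = ∑ i ∈ I, tForm a b k F (G i) := by
  apply (starRingEnd ℂ).injective
  rw [map_sum, conj_tForm, tForm_sum_left I a hb hG hF (K := K)]
  · simp only [conj_tForm]
  · exact Complex.continuous_conj.measurable.comp (hk.comp measurable_swap)
  · intro z
    rw [RCLike.norm_conj]
    exact hK _

end Annuli


section SquareFunction

theorem sum_rpow_le_rpow_sum {ι : Type*} (I : Finset ι) (u : ι → ℝ≥0∞) {p : ℝ} (hp : 1 ≤ p) :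
    ∑ i ∈ I, u i ^ p ≤ (∑ i ∈ I, u i) ^ p := by
  classical
  induction I using Finset.induction_on with
  | empty => simp
  | insert i I hi ih =>
    rw [Finset.sum_insert hi, Finset.sum_insert hi]
    exact (add_le_add_right ih _).trans (ENNReal.add_rpow_le_rpow_add _ _ hp)

/-- Minkowski's inequality exchanging `L^P` with `ℓ^2` for `P ≤ 2`. -/
theorem sum_lintegral_rpow_sq_le {ι : Type*} (I : Finset ι) {u : ι → ℝ → ℝ≥0∞} {A : ℝ → ℝ≥0∞}
    (hu : ∀ i, Measurable (u i)) (hA : Measurable A) (hA' : ∀ t, A t ≠ ∞)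
    (h : ∀ t, ∑ i ∈ I, u i t ^ (2 : ℝ) ≤ A t ^ (2 : ℝ)) {e : ℝ} (he2 : e ≤ 1 / 2) :
    ∑ i ∈ I, ((∫⁻ t, u i t ^ (1 - e)⁻¹) ^ (1 - e)) ^ (2 : ℝ) ≤
      ((∫⁻ t, A t ^ (1 - e)⁻¹) ^ (1 - e)) ^ (2 : ℝ) := by
  have he1 : 0 < 1 - e := by linarith
  set P : ℝ := (1 - e)⁻¹ with hP
  have hP0 : 0 < P := inv_pos.2 he1
  have hP2 : P ≤ 2 := by
    rw [hP, inv_le_comm₀ he1 two_pos]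
    linarith
  have hPe : P * (1 - e) = 1 := inv_mul_cancel₀ he1.ne'
  set B := ∫⁻ t, A t ^ P with hB
  have hui : ∀ i ∈ I, ∀ t, u i t ≤ A t := by
    intro i hi t
    have h1 : u i t ^ (2 : ℝ) ≤ A t ^ (2 : ℝ) :=
      (Finset.single_le_sum (f := fun i => u i t ^ (2 : ℝ)) (fun _ _ => zero_le) hi).trans (h t)
    exact (ENNReal.rpow_le_rpow_iff two_pos).1 h1
  have hterm : ∀ i ∈ I, ((∫⁻ t, u i t ^ P) ^ (1 - e)) ^ (2 : ℝ) ≤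
      (∫⁻ t, u i t ^ (2 : ℝ) * A t ^ (P - 2)) * B ^ (2 * (1 - e) - 1) := by
    intro i hi
    have h1 : ∫⁻ t, u i t ^ P ≤ (∫⁻ t, u i t ^ (2 : ℝ) * A t ^ (P - 2)) ^ (P / 2) *
        B ^ (1 - P / 2) := by
      refine le_trans (lintegral_mono fun t => ?_) (ENNReal.lintegral_mul_norm_pow_le
        (((hu i).pow_const _).mul (hA.pow_const _)).aemeasurable (hA.pow_const P).aemeasurable
        (by positivity) (by linarith) (by ring))
      by_cases h0 : A t = 0
      · have : u i t = 0 := le_antisymm ((hui i hi t).trans_eq h0) zero_le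
        simp [this, hP0]
      · change u i t ^ P ≤ (u i t ^ (2 : ℝ) * A t ^ (P - 2)) ^ (P / 2) * (A t ^ P) ^ (1 - P / 2)
        rw [ENNReal.mul_rpow_of_nonneg _ _ (by positivity), ← ENNReal.rpow_mul, ← ENNReal.rpow_mul,
          ← ENNReal.rpow_mul, mul_assoc, ← ENNReal.rpow_add _ _ h0 (hA' t)]
        have e1 : 2 * (P / 2) = P := by ring
        have e2 : (P - 2) * (P / 2) + P * (1 - P / 2) = 0 := by ring
        rw [e1, e2, ENNReal.rpow_zero, mul_one]
    calc ((∫⁻ t, u i t ^ P) ^ (1 - e)) ^ (2 : ℝ) = (∫⁻ t, u i t ^ P) ^ (2 * (1 - e)) := by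
          rw [← ENNReal.rpow_mul, mul_comm]
      _ ≤ ((∫⁻ t, u i t ^ (2 : ℝ) * A t ^ (P - 2)) ^ (P / 2) * B ^ (1 - P / 2)) ^
          (2 * (1 - e)) := ENNReal.rpow_le_rpow h1 (by positivity)
      _ = _ := by
          rw [ENNReal.mul_rpow_of_nonneg _ _ (by positivity), ← ENNReal.rpow_mul,
            ← ENNReal.rpow_mul]
          have e1 : P / 2 * (2 * (1 - e)) = 1 := by linear_combination hPe
          have e2 : (1 - P / 2) * (2 * (1 - e)) = 2 * (1 - e) - 1 := by linear_combination -hPe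
          rw [e1, e2, ENNReal.rpow_one]
  calc ∑ i ∈ I, ((∫⁻ t, u i t ^ P) ^ (1 - e)) ^ (2 : ℝ)
      ≤ ∑ i ∈ I, (∫⁻ t, u i t ^ (2 : ℝ) * A t ^ (P - 2)) * B ^ (2 * (1 - e) - 1) :=
        Finset.sum_le_sum hterm
    _ = (∫⁻ t, (∑ i ∈ I, u i t ^ (2 : ℝ)) * A t ^ (P - 2)) * B ^ (2 * (1 - e) - 1) := by
        rw [← Finset.sum_mul, ← lintegral_finsetSum]
        · simp only [Finset.sum_mul]
        · exact fun i _ => ((hu i).pow_const _).mul (hA.pow_const _)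
    _ ≤ B * B ^ (2 * (1 - e) - 1) := by
        refine mul_le_mul_left (lintegral_mono fun t => ?_) _
        refine (mul_le_mul_left (h t) _).trans ?_
        by_cases h0 : A t = 0
        · simp [h0, hP0]
        · rw [← ENNReal.rpow_add _ _ h0 (hA' t)]
          apply le_of_eq
          congr 1
          ring
    _ = (B ^ (1 - e)) ^ (2 : ℝ) := by
        nth_rewrite 1 [← ENNReal.rpow_one B]
        rw [← ENNReal.rpow_add_of_nonneg _ _ zero_le_one (by linarith), ← ENNReal.rpow_mul]
        congr 1
        ring

variable {d : ℕ} {F : ℝ → Ed d → ℂ}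

theorem sum_enorm_ann_rpow_le (I : Finset ℤ) (F : ℝ → Ed d → ℂ) (t : ℝ) (x : Ed d) {p : ℝ}
    (hp : 0 < p) : ∑ j ∈ I, ‖ann j F t x‖ₑ ^ p ≤ ‖F t x‖ₑ ^ p := by
  by_cases h : ∃ j ∈ I, (2 : ℝ) ^ j ≤ ‖x‖ ∧ ‖x‖ < (2 : ℝ) ^ (j + 1)
  · obtain ⟨j, hjI, hj⟩ := h
    rw [Finset.sum_eq_single_of_mem j hjI]
    · unfold ann
      rw [if_pos hj]
    · intro i _ hij
      unfold ann
      rw [if_neg fun hi => hij (zpow_annulus_unique hi hj)]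
      simp [hp]
  · push Not at h
    rw [Finset.sum_eq_zero]
    · exact zero_le
    · intro i hi
      unfold ann
      rw [if_neg fun hh => absurd hh.2 (not_lt.2 (h i hi hh.1))]
      simp [hp]

theorem SpaceTimeTest.sum_spN_ann_sq_le (hF : SpaceTimeTest F) (I : Finset ℤ) {p : ℝ} (hp : 0 < p)
    (hp2 : p ≤ 2) (t : ℝ) :
    ∑ j ∈ I, spN p (_root_.ann j F t) ^ (2 : ℝ) ≤ spN p (F t) ^ (2 : ℝ) := by
  unfold spN
  simp only [← ENNReal.rpow_mul]
  have hq : 1 ≤ 1 / p * 2 := by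
    rw [one_div_mul_eq_div, le_div_iff₀ hp]
    linarith
  refine (sum_rpow_le_rpow_sum I _ hq).trans (ENNReal.rpow_le_rpow ?_ (by positivity))
  rw [← lintegral_finsetSum]
  · exact lintegral_mono fun x => sum_enorm_ann_rpow_le I F t x hp
  · exact fun j _ => ((hF.ann j).space t).meas.enorm.pow_const _

theorem SpaceTimeTest.sum_nrm_ann_sq_le (hF : SpaceTimeTest F) (I : Finset ℤ) {a e : ℝ}
    (ha : 0 ≤ a) (he : 0 ≤ e) (he2 : e ≤ 1 / 2) :
    ∑ j ∈ I, nrm a e (_root_.ann j F) ^ 2 ≤ nrm a e F ^ 2 := by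
  have hp := spExp_pos (d := d) ha he
  have hp2 : spExp d a e ≤ 2 := by
    rw [spExp, div_le_iff₀ (by linarith [thetaOf_nonneg (d := d) ha he])]
    linarith [thetaOf_nonneg (d := d) ha he]
  have h := sum_lintegral_rpow_sq_le I (u := fun j t => spN (spExp d a e) (_root_.ann j F t))
    (A := fun t => spN (spExp d a e) (F t)) (fun j => (hF.ann j).measurable_spN _)
    (hF.measurable_spN _) (hF.spN_ne_top hp) (hF.sum_spN_ann_sq_le I hp hp2) he2
  have h1 : ∑ j ∈ I, stN e (spExp d a e) (_root_.ann j F) ^ (2 : ℝ) ≤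
      stN e (spExp d a e) F ^ (2 : ℝ) := h
  have hsq : ∀ {G : ℝ → Ed d → ℂ}, SpaceTimeTest G → stN e (spExp d a e) G ^ (2 : ℝ) =
      ENNReal.ofReal (nrm a e G ^ 2) := by
    intro G hG
    rw [← hG.ofReal_nrm ha he (by linarith), ENNReal.ofReal_rpow_of_nonneg (nrm_nonneg _ _ _)
      zero_le_two, Real.rpow_two]
  rw [hsq hF, Finset.sum_congr rfl fun j _ => hsq (hF.ann j),
    ← ENNReal.ofReal_sum_of_nonneg fun j _ => sq_nonneg _] at h1
  exact (ENNReal.ofReal_le_ofReal_iff (sq_nonneg _)).1 h1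

end SquareFunction


section Schur

/-- The dyadic weight `2 ^ (-δ |m|)`. -/
def dyW (δ : ℝ) (m : ℤ) : ℝ := (max ((2 : ℝ) ^ m) ((2 : ℝ) ^ m)⁻¹) ^ (-δ)

theorem dyW_nonneg (δ : ℝ) (m : ℤ) : 0 ≤ dyW δ m := by
  unfold dyW
  positivity

theorem dyW_eq (δ : ℝ) (m : ℤ) : dyW δ m = ((2 : ℝ) ^ (-δ)) ^ m.natAbs := by
  have h : max ((2 : ℝ) ^ m) ((2 : ℝ) ^ m)⁻¹ = (2 : ℝ) ^ (m.natAbs : ℤ) := by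
    rw [← zpow_neg, Int.natCast_natAbs]
    rcases le_total 0 m with hm | hm
    · rw [abs_of_nonneg hm, max_eq_left (zpow_le_zpow_right₀ one_le_two (by omega))]
    · rw [abs_of_nonpos hm, max_eq_right (zpow_le_zpow_right₀ one_le_two (by omega))]
  rw [dyW, h, zpow_natCast, ← Real.rpow_natCast, ← Real.rpow_natCast, ← Real.rpow_mul two_pos.le,
    ← Real.rpow_mul two_pos.le, mul_comm]

theorem summable_dyW {δ : ℝ} (hδ : 0 < δ) : Summable (dyW δ) := by
  have h1 : (2 : ℝ) ^ (-δ) < 1 := Real.rpow_lt_one_of_one_lt_of_neg one_lt_two (by linarith)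
  have h : Summable fun n : ℕ => ((2 : ℝ) ^ (-δ)) ^ n :=
    summable_geometric_of_lt_one (by positivity) h1
  refine Summable.of_nat_of_neg ?_ ?_
  · simpa [dyW_eq] using h
  · simpa [dyW_eq] using h

theorem exists_sum_dyW_le {δ : ℝ} (hδ : 0 < δ) :
    ∃ S : ℝ, 0 < S ∧ ∀ (N : Finset ℤ) (j : ℤ), ∑ n ∈ N, dyW δ (n + j) ≤ S := by
  refine ⟨(∑' m, dyW δ m) + 1, ?_, fun N j => ?_⟩
  · have : 0 ≤ ∑' m, dyW δ m := tsum_nonneg (dyW_nonneg δ)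
    linarith
  · have h := (summable_dyW hδ).sum_le_tsum (N.map (addRightEmbedding j)) fun m _ => dyW_nonneg δ m
    rw [Finset.sum_map] at h
    simp only [addRightEmbedding_apply] at h
    linarith

theorem exists_schur_le {δ : ℝ} (hδ : 0 < δ) : ∃ S : ℝ, 0 < S ∧ ∀ (N J K : Finset ℤ) (u v : ℤ → ℝ),
    ∑ n ∈ N, (∑ j ∈ J, dyW δ (n + j) * u j) * (∑ k ∈ K, dyW δ (n + k) * v k) ≤
      S * (√(∑ j ∈ J, u j ^ 2) * √(∑ k ∈ K, v k ^ 2)) := by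
  obtain ⟨S, hS0, hS⟩ := exists_sum_dyW_le hδ
  have hS' : ∀ (N : Finset ℤ) (j : ℤ), ∑ n ∈ N, dyW δ (j + n) ≤ S := fun N j => by
    simpa only [add_comm] using hS N j
  have key : ∀ (N J : Finset ℤ) (u : ℤ → ℝ),
      ∑ n ∈ N, (∑ j ∈ J, dyW δ (n + j) * u j) ^ 2 ≤ S ^ 2 * ∑ j ∈ J, u j ^ 2 := by
    intro N J u
    have h1 : ∀ n, (∑ j ∈ J, dyW δ (n + j) * u j) ^ 2 ≤ S * ∑ j ∈ J, dyW δ (n + j) * u j ^ 2 := by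
      intro n
      have h2 := Finset.sum_mul_sq_le_sq_mul_sq J (fun j => √(dyW δ (n + j)))
        (fun j => √(dyW δ (n + j)) * u j)
      have e1 : ∀ j, √(dyW δ (n + j)) * (√(dyW δ (n + j)) * u j) = dyW δ (n + j) * u j := by
        intro j
        rw [← mul_assoc, Real.mul_self_sqrt (dyW_nonneg _ _)]
      have e2 : ∀ j, (√(dyW δ (n + j)) * u j) ^ 2 = dyW δ (n + j) * u j ^ 2 := by
        intro j
        rw [mul_pow, Real.sq_sqrt (dyW_nonneg _ _)]
      simp only [e1, e2, Real.sq_sqrt (dyW_nonneg _ _)] at h2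
      exact h2.trans (mul_le_mul_of_nonneg_right (hS' J n)
        (Finset.sum_nonneg fun j _ => mul_nonneg (dyW_nonneg _ _) (sq_nonneg _)))
    calc ∑ n ∈ N, (∑ j ∈ J, dyW δ (n + j) * u j) ^ 2
        ≤ ∑ n ∈ N, S * ∑ j ∈ J, dyW δ (n + j) * u j ^ 2 := Finset.sum_le_sum fun n _ => h1 n
      _ = S * ∑ j ∈ J, (∑ n ∈ N, dyW δ (n + j)) * u j ^ 2 := by
          rw [← Finset.mul_sum, Finset.sum_comm]
          simp only [Finset.sum_mul]
      _ ≤ S * ∑ j ∈ J, S * u j ^ 2 := by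
          refine mul_le_mul_of_nonneg_left (Finset.sum_le_sum fun j _ => ?_) hS0.le
          exact mul_le_mul_of_nonneg_right (hS N j) (sq_nonneg _)
      _ = S ^ 2 * ∑ j ∈ J, u j ^ 2 := by
          rw [← Finset.mul_sum]
          ring
  have hsqrt : ∀ (N J : Finset ℤ) (u : ℤ → ℝ),
      √(∑ n ∈ N, (∑ j ∈ J, dyW δ (n + j) * u j) ^ 2) ≤ S * √(∑ j ∈ J, u j ^ 2) := by
    intro N J u
    refine (Real.sqrt_le_sqrt (key N J u)).trans_eq ?_
    rw [Real.sqrt_mul (sq_nonneg _), Real.sqrt_sq hS0.le]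
  refine ⟨S ^ 2, by positivity, fun N J K u v => ?_⟩
  refine (Real.sum_mul_le_sqrt_mul_sqrt N _ _).trans ?_
  calc _ ≤ (S * √(∑ j ∈ J, u j ^ 2)) * (S * √(∑ k ∈ K, v k ^ 2)) :=
        mul_le_mul (hsqrt N J u) (hsqrt N K v) (Real.sqrt_nonneg _) (by positivity)
    _ = _ := by ring

variable {d : ℕ}

/-- Bounds with off-diagonal decay on dyadic annuli can be summed over annuli and frequencies. -/
theorem exists_sum_norm_tForm_le {δ : ℝ} (hδ : 0 < δ) {a e e' : ℝ} (ha : 0 ≤ a) (he : 0 ≤ e)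
    (he2 : e ≤ 1 / 2) (he' : 0 ≤ e') (he2' : e' ≤ 1 / 2) :
    ∃ S : ℝ, 0 < S ∧ ∀ (C K : ℝ) (k : ℤ → ℝ × ℝ → ℂ) (F G : ℝ → Ed d → ℂ), 0 ≤ C →
      (∀ n, Measurable (k n)) → (∀ n z, ‖k n z‖ ≤ K) → SpaceTimeTest F → SpaceTimeTest G →
      (∀ n j l, ‖tForm a ((2 : ℝ) ^ n) (k n) (ann j F) (ann l G)‖ ≤
        C * (dyW δ (n + j) * dyW δ (n + l)) * (nrm a e (ann j F) * nrm a e' (ann l G))) →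
      ∀ N : Finset ℤ, ∑ n ∈ N, ‖tForm a ((2 : ℝ) ^ n) (k n) F G‖ ≤
        S * C * (nrm a e F * nrm a e' G) := by
  obtain ⟨S, hS0, hS⟩ := exists_schur_le hδ
  refine ⟨S, hS0, fun C K k F G hC hk hK hF hG h N => ?_⟩
  obtain ⟨J, hJ⟩ := hF.exists_sum_ann
  obtain ⟨L, hL⟩ := hG.exists_sum_ann
  generalize Finset.Icc (-(J : ℤ)) J = IJ at hJ
  generalize Finset.Icc (-(L : ℤ)) L = IL at hL
  have hexp : ∀ n, ‖tForm a ((2 : ℝ) ^ n) (k n) F G‖ ≤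
      C * ((∑ j ∈ IJ, dyW δ (n + j) * nrm a e (ann j F)) *
        (∑ l ∈ IL, dyW δ (n + l) * nrm a e' (ann l G))) := by
    intro n
    have e1 : tForm a ((2 : ℝ) ^ n) (k n) F G =
        ∑ j ∈ IJ, ∑ l ∈ IL, tForm a ((2 : ℝ) ^ n) (k n) (ann j F) (ann l G) := by
      have hb : 0 < (2 : ℝ) ^ n := by positivity
      have h1 := tForm_sum_left IJ a hb (F := fun j => ann j F) (fun j => hF.ann j) hG (hk n) (hK n)
      have h2 := fun j => tForm_sum_right IL a hb (G := fun l => ann l G) (hF.ann j)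
        (fun l => hG.ann l) (hk n) (hK n)
      rw [← hJ] at h1
      simp only [← hL] at h2
      rw [h1]
      exact Finset.sum_congr rfl fun j _ => h2 j
    rw [e1]
    refine (norm_sum_le _ _).trans ((Finset.sum_le_sum fun j _ => norm_sum_le _ _).trans ?_)
    rw [Finset.sum_mul_sum, Finset.mul_sum]
    refine Finset.sum_le_sum fun j _ => ?_
    rw [Finset.mul_sum]
    refine Finset.sum_le_sum fun l _ => (h n j l).trans_eq ?_
    ring
  have hsq : ∀ {F : ℝ → Ed d → ℂ} {e : ℝ}, SpaceTimeTest F → 0 ≤ e → e ≤ 1 / 2 → ∀ I : Finset ℤ,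
      √(∑ j ∈ I, nrm a e (ann j F) ^ 2) ≤ nrm a e F := by
    intro F e hF he he2 I
    rw [← Real.sqrt_sq (nrm_nonneg a e F)]
    exact Real.sqrt_le_sqrt (hF.sum_nrm_ann_sq_le I ha he he2)
  calc ∑ n ∈ N, ‖tForm a ((2 : ℝ) ^ n) (k n) F G‖
      ≤ ∑ n ∈ N, C * ((∑ j ∈ IJ, dyW δ (n + j) * nrm a e (ann j F)) *
        (∑ l ∈ IL, dyW δ (n + l) * nrm a e' (ann l G))) := Finset.sum_le_sum fun n _ => hexp n
    _ ≤ C * (S * (√(∑ j ∈ IJ, nrm a e (ann j F) ^ 2) * √(∑ l ∈ IL, nrm a e' (ann l G) ^ 2))) := by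
        rw [← Finset.mul_sum]
        exact mul_le_mul_of_nonneg_left (hS N IJ IL (fun j => nrm a e (ann j F))
          (fun l => nrm a e' (ann l G))) hC
    _ ≤ C * (S * (nrm a e F * nrm a e' G)) := by
        refine mul_le_mul_of_nonneg_left (mul_le_mul_of_nonneg_left ?_ hS0.le) hC
        exact mul_le_mul (hsq hF he he2 IJ) (hsq hG he' he2' IL) (Real.sqrt_nonneg _)
          (nrm_nonneg a e F)
    _ = _ := by ring

end Schur


section EndpointTime

variable {d : ℕ} {F G : ℝ → Ed d → ℂ}

theorem integral_locForm_eq (a t' : ℝ) {b : ℝ} (hb : 0 < b) {f : Ed d → ℂ} (hf : SpaceTest f)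
    (hG : SpaceTimeTest G) :
    ∫ t, locForm a b (t - t') f (G t) = ∫ ξ : Ed d, (dyBump (‖ξ‖ / b) : ℂ) *
      ((Complex.exp (I * ((t' * ‖ξ‖ ^ a : ℝ) : ℂ)) * FT f ξ) *
        (starRingEnd ℂ) (charFT a G ξ)) := by
  obtain ⟨M', T', hM0', hM'⟩ := hG.exists_norm_FT_le
  have hi : Integrable ((Set.Icc (-T') T').indicator fun _ => M') :=
    (integrable_indicator_iff measurableSet_Icc).2 (integrableOn_const measure_Icc_lt_top.ne)
  have hInt : Integrable (fun w : ℝ × Ed d => locMul a b (w.1 - t') w.2 *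
      (FT f w.2 * (starRingEnd ℂ) (FT (G w.1) w.2))) (volume.prod volume) := by
    refine ((hi.mul_prod (integrable_dyBump_norm (d := d) hb)).const_mul (∫ x, ‖f x‖)).mono'
      (Measurable.aestronglyMeasurable ?_) (Filter.Eventually.of_forall fun w => ?_)
    · have h1 := (continuous_FT hf.integrable).measurable
      have h2 := hG.measurable_FT
      have h3 : Measurable (starRingEnd ℂ) := Complex.continuous_conj.measurable
      have h4 : Measurable fun w : ℝ × Ed d => locMul a b (w.1 - t') w.2 :=
        (measurable_locMul a b).comp (f := fun w : ℝ × Ed d => (w.1 - t', w.2)) (by fun_prop)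
      exact h4.mul ((h1.comp measurable_snd).mul (h3.comp h2))
    · rw [norm_mul, norm_mul, norm_locMul, RCLike.norm_conj]
      calc dyBump (‖w.2‖ / b) * (‖FT f w.2‖ * ‖FT (G w.1) w.2‖)
          ≤ dyBump (‖w.2‖ / b) * ((∫ x, ‖f x‖) * (Set.Icc (-T') T').indicator (fun _ => M') w.1) :=
            mul_le_mul_of_nonneg_left (mul_le_mul (norm_FT_le f w.2) (hM' w.1 w.2) (norm_nonneg _)
              (integral_nonneg fun x => norm_nonneg _)) (dyBump_nonneg _)
        _ = _ := by ring
  simp only [locForm]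
  rw [integral_integral_swap (by exact hInt)]
  congr 1
  ext ξ
  rw [charFT, ← integral_conj, ← integral_const_mul, ← integral_const_mul]
  congr 1
  ext t
  rw [locMul, map_mul, ← Complex.exp_conj, map_mul, Complex.conj_I, Complex.conj_ofReal]
  have : -I * (((t - t') * ‖ξ‖ ^ a : ℝ) : ℂ) = I * ((t' * ‖ξ‖ ^ a : ℝ) : ℂ) +
      -I * ((t * ‖ξ‖ ^ a : ℝ) : ℂ) := by
    push_cast
    ring
  rw [this, Complex.exp_add]
  ring

theorem SpaceTest.lintegral_FT_sq {f : Ed d → ℂ} (hf : SpaceTest f) :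
    ∫⁻ ξ, ENNReal.ofReal (‖FT f ξ‖ ^ 2) =
      ENNReal.ofReal ((2 * Real.pi) ^ d * (spN 2 f).toReal ^ 2) := by
  have h := lintegral_enorm_FT_sq hf.integrable hf.memLp_two
  have h1 : ∫⁻ x, ‖f x‖ₑ ^ (2 : ℝ) = spN 2 f ^ (2 : ℝ) := by
    rw [spN, ← ENNReal.rpow_mul, one_div_mul_cancel two_ne_zero, ENNReal.rpow_one]
  have h2 : spN 2 f ≠ ∞ := by
    rw [hf.spN_eq two_pos]
    exact ENNReal.ofReal_ne_top
  rw [ENNReal.ofReal_mul (by positivity), ENNReal.ofReal_pow ENNReal.toReal_nonneg,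
    ENNReal.ofReal_toReal h2, ← ENNReal.rpow_two, ← h1, ← h]
  congr 1
  ext ξ
  rw [← ofReal_norm, ENNReal.ofReal_rpow_of_nonneg (norm_nonneg _) zero_le_two, Real.rpow_two]

theorem SpaceTest.integrable_FT_sq {f : Ed d → ℂ} (hf : SpaceTest f) :
    Integrable fun ξ => ‖FT f ξ‖ ^ 2 := by
  refine ⟨((continuous_FT hf.integrable).norm.pow 2).aestronglyMeasurable, ?_⟩
  rw [hasFiniteIntegral_iff_ofReal (Filter.Eventually.of_forall fun ξ => by positivity),
    hf.lintegral_FT_sq]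
  exact ENNReal.ofReal_lt_top

theorem SpaceTest.integral_FT_sq {f : Ed d → ℂ} (hf : SpaceTest f) :
    ∫ ξ, ‖FT f ξ‖ ^ 2 = (2 * Real.pi) ^ d * (spN 2 f).toReal ^ 2 := by
  rw [integral_eq_lintegral_of_nonneg_ae (Filter.Eventually.of_forall fun ξ => by positivity)
    hf.integrable_FT_sq.aestronglyMeasurable, hf.lintegral_FT_sq,
    ENNReal.toReal_ofReal (by positivity)]

theorem integrable_dyBump_mul {u : Ed d → ℝ} (hu : Integrable u) (b : ℝ) :
    Integrable fun ξ : Ed d => dyBump (‖ξ‖ / b) * u ξ := by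
  have := continuous_dyBump.measurable
  refine hu.bdd_mul (c := 1) (Measurable.aestronglyMeasurable (by fun_prop))
    (Filter.Eventually.of_forall fun ξ => ?_)
  rw [Real.norm_of_nonneg (dyBump_nonneg _)]
  exact dyBump_le_one _

theorem sum_integral_dyBump_mul_le (L : ℕ) {u : Ed d → ℝ} (hu : Integrable u) (hu0 : ∀ ξ, 0 ≤ u ξ) :
    ∑ n ∈ Finset.Icc (-(L : ℤ)) L, ∫ ξ, dyBump (‖ξ‖ / (2 : ℝ) ^ n) * u ξ ≤ ∫ ξ, u ξ := by
  rw [← integral_finsetSum _ fun n _ => integrable_dyBump_mul hu _]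
  refine integral_mono (integrable_finsetSum _ fun n _ => integrable_dyBump_mul hu _) hu
    fun ξ => ?_
  simp only [← Finset.sum_mul]
  refine mul_le_of_le_one_left (hu0 ξ) (le_of_eq_of_le (Finset.sum_congr rfl fun n _ => ?_)
    (sum_dyBump_le_one L ‖ξ‖))
  rw [zpow_neg, div_eq_inv_mul]

theorem SpaceTimeTest.integral_spN_two (hF : SpaceTimeTest F) (a : ℝ) :
    Integrable (fun t => (spN 2 (F t)).toReal) ∧ ∫ t, (spN 2 (F t)).toReal = nrm a 0 F := by
  have hp : spExp d a 0 = 2 := by simp [spExp, thetaOf]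
  have e1 : stN 0 2 F = ∫⁻ t, spN 2 (F t) := by simp [stN]
  have h1 : stN 0 2 F ≠ ∞ := hF.stN_ne_top zero_lt_one two_pos
  rw [e1] at h1
  refine ⟨integrable_toReal_of_lintegral_ne_top (hF.measurable_spN 2).aemeasurable h1, ?_⟩
  rw [nrm, hp, e1, integral_toReal (hF.measurable_spN 2).aemeasurable
    (Filter.Eventually.of_forall fun t => (hF.spN_ne_top two_pos t).lt_top)]

/-- The energy bound in the first variable, given a square function bound in the second. -/
theorem sum_norm_tForm_le_energy (a : ℝ) (hF : SpaceTimeTest F) (hG : SpaceTimeTest G)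
    {k : ℝ × ℝ → ℂ} (hk : Measurable k) (hk1 : ∀ z, ‖k z‖ ≤ 1) (L : ℕ) {D : ℝ} (hD : 0 ≤ D)
    (h : ∀ t', ∑ n ∈ Finset.Icc (-(L : ℤ)) L, charSq a ((2 : ℝ) ^ n)
      (fun t x => (starRingEnd ℂ) (k (t', t)) * G t x) ≤ D ^ 2) :
    ∑ n ∈ Finset.Icc (-(L : ℤ)) L, ‖tForm a ((2 : ℝ) ^ n) k F G‖ ≤
      √((2 * Real.pi) ^ d) * D * nrm a 0 F := by
  have hconj : Measurable (starRingEnd ℂ) := Complex.continuous_conj.measurable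
  set N := Finset.Icc (-(L : ℤ)) L with hN
  have hkG : ∀ t', SpaceTimeTest fun t x => (starRingEnd ℂ) (k (t', t)) * G t x := fun t' =>
    hG.time_mul (hconj.comp (hk.comp measurable_prodMk_left)) (K := 1) fun t => by
      rw [RCLike.norm_conj]
      exact hk1 _
  have hb : ∀ n : ℤ, 0 < (2 : ℝ) ^ n := fun n => by positivity
  have hT : ∀ n : ℤ, Integrable (fun z : ℝ × ℝ => k z * locForm a ((2 : ℝ) ^ n) (z.2 - z.1)
      (F z.1) (G z.2)) (volume.prod volume) := fun n => integrable_tForm a (hb n) hF hG hk hk1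
  have hform : ∀ n : ℤ, tForm a ((2 : ℝ) ^ n) k F G = ∫ t', (∫ t, k (t', t) *
      locForm a ((2 : ℝ) ^ n) (t - t') (F t') (G t)) := fun n => by
    rw [tForm, Measure.volume_eq_prod, integral_prod _ (hT n)]
  have hinner : ∀ (n : ℤ) (t' : ℝ), ‖∫ t, k (t', t) * locForm a ((2 : ℝ) ^ n) (t - t') (F t')
      (G t)‖ ≤ √(∫ ξ : Ed d, dyBump (‖ξ‖ / (2 : ℝ) ^ n) * ‖FT (F t') ξ‖ ^ 2) *
        √(charSq a ((2 : ℝ) ^ n) (fun t x => (starRingEnd ℂ) (k (t', t)) * G t x)) := by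
    intro n t'
    have e1 : ∀ t, k (t', t) * locForm a ((2 : ℝ) ^ n) (t - t') (F t') (G t) =
        locForm a ((2 : ℝ) ^ n) (t - t') (F t') (fun x => (starRingEnd ℂ) (k (t', t)) * G t x) := by
      intro t
      have := locForm_const_mul a ((2 : ℝ) ^ n) (t - t') 1 ((starRingEnd ℂ) (k (t', t))) (F t')
        (G t)
      simp only [one_mul, Complex.conj_conj] at this
      exact this.symm
    simp only [e1]
    rw [integral_locForm_eq a t' (hb n) (hF.space t') (hkG t')]
    have hnorm : ∀ ξ : Ed d, ‖Complex.exp (I * ((t' * ‖ξ‖ ^ a : ℝ) : ℂ)) * FT (F t') ξ‖ =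
        ‖FT (F t') ξ‖ := fun ξ => by rw [norm_mul, norm_exp_I_mul, one_mul]
    have h1 := norm_integral_dyBump_mul_le ((2 : ℝ) ^ n)
      (u := fun ξ => Complex.exp (I * ((t' * ‖ξ‖ ^ a : ℝ) : ℂ)) * FT (F t') ξ)
      (Measurable.mul (by fun_prop) (continuous_FT (hF.space t').integrable).measurable)
      ((hkG t').measurable_charFT a) (by
        simp only [hnorm]
        exact integrable_dyBump_mul (hF.space t').integrable_FT_sq _)
      (integrable_charSq a (hb n) (hkG t'))
    simp only [hnorm] at h1
    exact h1
  have hsum : ∀ t', ∑ n ∈ N, ‖∫ t, k (t', t) * locForm a ((2 : ℝ) ^ n) (t - t') (F t')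
      (G t)‖ ≤ √((2 * Real.pi) ^ d) * D * (spN 2 (F t')).toReal := by
    intro t'
    refine (Finset.sum_le_sum fun n _ => hinner n t').trans ((Real.sum_sqrt_mul_sqrt_le N
      (fun n => integral_nonneg fun ξ => mul_nonneg (dyBump_nonneg _) (sq_nonneg _))
      (fun n => charSq_nonneg _ _ _)).trans ?_)
    have h1 : √(∑ n ∈ N, ∫ ξ : Ed d, dyBump (‖ξ‖ / (2 : ℝ) ^ n) * ‖FT (F t') ξ‖ ^ 2) ≤
        √((2 * Real.pi) ^ d) * (spN 2 (F t')).toReal := by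
      rw [← Real.sqrt_sq (ENNReal.toReal_nonneg (a := spN 2 (F t'))), ← Real.sqrt_mul
        (by positivity), ← (hF.space t').integral_FT_sq]
      exact Real.sqrt_le_sqrt (sum_integral_dyBump_mul_le L (hF.space t').integrable_FT_sq
        fun ξ => sq_nonneg _)
    have h2 : √(∑ n ∈ N, charSq a ((2 : ℝ) ^ n)
        (fun t x => (starRingEnd ℂ) (k (t', t)) * G t x)) ≤ D := by
      rw [← Real.sqrt_sq hD]
      exact Real.sqrt_le_sqrt (h t')
    refine (mul_le_mul h1 h2 (Real.sqrt_nonneg _) (by positivity)).trans_eq ?_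
    ring
  obtain ⟨hi, hi2⟩ := hF.integral_spN_two a
  rw [← hi2, ← integral_const_mul]
  calc ∑ n ∈ N, ‖tForm a ((2 : ℝ) ^ n) k F G‖
      ≤ ∑ n ∈ N, ∫ t', ‖∫ t, k (t', t) * locForm a ((2 : ℝ) ^ n) (t - t') (F t') (G t)‖ := by
        refine Finset.sum_le_sum fun n _ => ?_
        rw [hform n]
        exact norm_integral_le_integral_norm _
    _ = ∫ t', ∑ n ∈ N, ‖∫ t, k (t', t) * locForm a ((2 : ℝ) ^ n) (t - t') (F t') (G t)‖ := by
        rw [integral_finsetSum]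
        exact fun n _ => (hT n).integral_prod_left.norm
    _ ≤ _ := integral_mono (integrable_finsetSum _ fun n _ => (hT n).integral_prod_left.norm)
        (hi.const_mul _) hsum

end EndpointTime


section SquareFunctionBound

variable {d : ℕ}

theorem dyW_add (δ : ℝ) (n j : ℤ) :
    (max ((2 : ℝ) ^ n * (2 : ℝ) ^ j) ((2 : ℝ) ^ n * (2 : ℝ) ^ j)⁻¹) ^ (-δ) = dyW δ (n + j) := by
  rw [dyW, zpow_add₀ two_ne_zero]

theorem exists_sum_charSq_le_of_pos (hd : 2 ≤ d) {a : ℝ} (ha1 : 1 < a) (ha2 : a < 2)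
    (had : 2 * (d : ℝ) / (2 * d - 1) < a) {e : ℝ} (he : 0 < e) (he2 : e ≤ 1 / 2) :
    ∃ C : ℝ, 0 < C ∧ ∀ (F : ℝ → Ed d → ℂ) (L : ℕ), SpaceTimeTest F →
      ∑ n ∈ Finset.Icc (-(L : ℤ)) L, charSq a ((2 : ℝ) ^ n) F ≤ (C * nrm a e F) ^ 2 := by
  obtain ⟨C, δ, hC, hδ, h⟩ := exists_sqrt_charSq_le hd ha1 ha2 had he he2
  obtain ⟨S, hS0, hS⟩ := exists_sum_norm_tForm_le (d := d) hδ (a := a) (by linarith) he.le he2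
    he.le he2
  refine ⟨√S * C, by positivity, fun F L hF => ?_⟩
  have h1 := hS (C ^ 2) 1 (fun _ _ => 1) F F (sq_nonneg _) (fun _ => measurable_const) (by simp)
    hF hF (fun n j l => ?_) (Finset.Icc (-(L : ℤ)) L)
  · rw [Finset.sum_congr rfl fun n _ => charSq_eq_norm a (by positivity) hF]
    refine h1.trans_eq ?_
    rw [mul_pow, mul_pow, Real.sq_sqrt hS0.le]
    ring
  · have hb : 0 < (2 : ℝ) ^ n := by positivity
    have h2 := fun j : ℤ => h _ _ (ann j F) hb (by positivity : 0 < (2 : ℝ) ^ j) (hF.ann j)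
      fun t x hx => ann_support hx
    simp only [dyW_add] at h2
    refine (norm_tForm_one_le a hb (hF.ann j) (hF.ann l)).trans ((mul_le_mul (h2 j) (h2 l)
      (Real.sqrt_nonneg _) ((Real.sqrt_nonneg _).trans (h2 j))).trans_eq ?_)
    ring

theorem sum_charSq_le_zero (a : ℝ) {F : ℝ → Ed d → ℂ} (hF : SpaceTimeTest F) (L : ℕ) :
    ∑ n ∈ Finset.Icc (-(L : ℤ)) L, charSq a ((2 : ℝ) ^ n) F ≤
      (√((2 * Real.pi) ^ d) * nrm a 0 F) ^ 2 := by
  set X := ∑ n ∈ Finset.Icc (-(L : ℤ)) L, charSq a ((2 : ℝ) ^ n) F with hX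
  have hX0 : 0 ≤ X := Finset.sum_nonneg fun n _ => charSq_nonneg _ _ _
  have h := sum_norm_tForm_le_energy a hF hF (k := fun _ => 1) measurable_const (by simp) L
    (D := √X) (Real.sqrt_nonneg _) (fun t' => by
      simp only [map_one, one_mul]
      rw [Real.sq_sqrt hX0])
  rw [← Finset.sum_congr rfl fun n _ => charSq_eq_norm a (by positivity) hF, ← hX] at h
  have hn := nrm_nonneg a 0 F
  rcases hX0.eq_or_lt with h0 | h0
  · rw [← h0]
    positivity
  · have h1 : √X ≤ √((2 * Real.pi) ^ d) * nrm a 0 F := by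
      refine le_of_mul_le_mul_right ?_ (Real.sqrt_pos.2 h0)
      rw [Real.mul_self_sqrt hX0]
      linarith
    rw [← Real.sq_sqrt hX0]
    exact pow_le_pow_left₀ (Real.sqrt_nonneg _) h1 2

/-- The dual homogeneous estimate, localized in frequency and square summed. -/
theorem exists_sum_charSq_le (hd : 2 ≤ d) {a : ℝ} (ha1 : 1 < a) (ha2 : a < 2)
    (had : 2 * (d : ℝ) / (2 * d - 1) < a) {e : ℝ} (he : 0 ≤ e) (he2 : e ≤ 1 / 2) :
    ∃ C : ℝ, 0 < C ∧ ∀ (F : ℝ → Ed d → ℂ) (L : ℕ), SpaceTimeTest F →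
      ∑ n ∈ Finset.Icc (-(L : ℤ)) L, charSq a ((2 : ℝ) ^ n) F ≤ (C * nrm a e F) ^ 2 := by
  rcases he.eq_or_lt with rfl | he0
  · exact ⟨√((2 * Real.pi) ^ d), by positivity, fun F L hF => sum_charSq_le_zero a hF L⟩
  · exact exists_sum_charSq_le_of_pos hd ha1 ha2 had he0 he2

theorem SpaceTimeTest.nrm_mono {F G : ℝ → Ed d → ℂ} (hG : SpaceTimeTest G) {a e : ℝ} (ha : 0 ≤ a)
    (he : 0 ≤ e) (he1 : e < 1) (h : ∀ t x, ‖F t x‖ ≤ ‖G t x‖) : nrm a e F ≤ nrm a e G :=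
  ENNReal.toReal_mono (hG.stN_ne_top he1 (spExp_pos ha he))
    (stN_mono he1 (spExp_pos ha he).le h)

/-- The bilinear estimate when the first exponent is the energy one. -/
theorem exists_sum_norm_tForm_le_zero (hd : 2 ≤ d) {a : ℝ} (ha1 : 1 < a) (ha2 : a < 2)
    (had : 2 * (d : ℝ) / (2 * d - 1) < a) {e : ℝ} (he : 0 ≤ e) (he2 : e ≤ 1 / 2) :
    ∃ C : ℝ, 0 < C ∧ ∀ (F G : ℝ → Ed d → ℂ) (k : ℝ × ℝ → ℂ) (L : ℕ), SpaceTimeTest F →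
      SpaceTimeTest G → Measurable k → (∀ z, ‖k z‖ ≤ 1) →
      ∑ n ∈ Finset.Icc (-(L : ℤ)) L, ‖tForm a ((2 : ℝ) ^ n) k F G‖ ≤
        C * (nrm a 0 F * nrm a e G) := by
  obtain ⟨C, hC, h⟩ := exists_sum_charSq_le hd ha1 ha2 had he he2
  refine ⟨√((2 * Real.pi) ^ d) * C, by positivity, fun F G k L hF hG hk hk1 => ?_⟩
  have hn := nrm_nonneg a e G
  refine (sum_norm_tForm_le_energy a hF hG hk hk1 L (D := C * nrm a e G) (by positivity)
    fun t' => ?_).trans_eq (by ring)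
  have hconj : Measurable (starRingEnd ℂ) := Complex.continuous_conj.measurable
  have hkn : ∀ t, ‖(starRingEnd ℂ) (k (t', t))‖ ≤ 1 := fun t => by
    rw [RCLike.norm_conj]
    exact hk1 _
  refine (h _ L (hG.time_mul (hconj.comp (hk.comp measurable_prodMk_left)) hkn)).trans ?_
  refine pow_le_pow_left₀ (mul_nonneg hC.le (nrm_nonneg _ _ _)) ?_ 2
  refine mul_le_mul_of_nonneg_left (hG.nrm_mono (by linarith) he (by linarith) fun t x => ?_) hC.le
  rw [norm_mul]
  exact mul_le_of_le_one_left (norm_nonneg _) (hkn t)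

/-- The homogeneous bilinear estimate. -/
theorem exists_sum_norm_tForm_one_le (hd : 2 ≤ d) {a : ℝ} (ha1 : 1 < a) (ha2 : a < 2)
    (had : 2 * (d : ℝ) / (2 * d - 1) < a) {e e' : ℝ} (he : 0 ≤ e) (he2 : e ≤ 1 / 2)
    (he' : 0 ≤ e') (he2' : e' ≤ 1 / 2) :
    ∃ C : ℝ, 0 < C ∧ ∀ (F G : ℝ → Ed d → ℂ) (L : ℕ), SpaceTimeTest F → SpaceTimeTest G →
      ∑ n ∈ Finset.Icc (-(L : ℤ)) L, ‖tForm a ((2 : ℝ) ^ n) (fun _ => 1) F G‖ ≤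
        C * (nrm a e F * nrm a e' G) := by
  obtain ⟨C, hC, h⟩ := exists_sum_charSq_le hd ha1 ha2 had he he2
  obtain ⟨C', hC', h'⟩ := exists_sum_charSq_le hd ha1 ha2 had he' he2'
  refine ⟨C * C', by positivity, fun F G L hF hG => ?_⟩
  have hn := nrm_nonneg a e F
  have hn' := nrm_nonneg a e' G
  refine (Finset.sum_le_sum fun n _ => norm_tForm_one_le a (by positivity) hF hG).trans
    ((Real.sum_sqrt_mul_sqrt_le _ (fun n => charSq_nonneg _ _ _)
      (fun n => charSq_nonneg _ _ _)).trans ?_)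
  refine (mul_le_mul (Real.sqrt_le_sqrt (h F L hF)) (Real.sqrt_le_sqrt (h' G L hG))
    (Real.sqrt_nonneg _) (Real.sqrt_nonneg _)).trans_eq ?_
  rw [Real.sqrt_sq (by positivity), Real.sqrt_sq (by positivity)]
  ring

end SquareFunctionBound


section Retarded

variable {d : ℕ} {F G : ℝ → Ed d → ℂ}

theorem tForm_kernel_sum {ι : Type*} (I : Finset ι) (a : ℝ) {b : ℝ} (hb : 0 < b)
    (hF : SpaceTimeTest F) (hG : SpaceTimeTest G) {k : ι → ℝ × ℝ → ℂ} (hk : ∀ i, Measurable (k i))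
    {K : ℝ} (hK : ∀ i z, ‖k i z‖ ≤ K) :
    tForm a b (fun z => ∑ i ∈ I, k i z) F G = ∑ i ∈ I, tForm a b (k i) F G := by
  unfold tForm
  rw [← integral_finsetSum _ fun i _ => integrable_tForm a hb hF hG (hk i) (hK i)]
  simp only [Finset.sum_mul]

theorem tForm_kernel_sub (a : ℝ) {b : ℝ} (hb : 0 < b) (hF : SpaceTimeTest F)
    (hG : SpaceTimeTest G) {k k' : ℝ × ℝ → ℂ} (hk : Measurable k) (hk' : Measurable k') {K : ℝ}
    (hK : ∀ z, ‖k z‖ ≤ K) (hK' : ∀ z, ‖k' z‖ ≤ K) :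
    tForm a b (fun z => k z - k' z) F G = tForm a b k F G - tForm a b k' F G := by
  unfold tForm
  rw [← integral_sub (integrable_tForm a hb hF hG hk hK) (integrable_tForm a hb hF hG hk' hK')]
  simp only [sub_mul]

theorem tendsto_tForm_kernel (a : ℝ) {b : ℝ} (hb : 0 < b) (hF : SpaceTimeTest F)
    (hG : SpaceTimeTest G) {k : ℕ → ℝ × ℝ → ℂ} {k₀ : ℝ × ℝ → ℂ} (hk : ∀ M, Measurable (k M))
    {K : ℝ} (hK : ∀ M z, ‖k M z‖ ≤ K)
    (hlim : ∀ z, Filter.Tendsto (fun M => k M z) Filter.atTop (nhds (k₀ z))) :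
    Filter.Tendsto (fun M => tForm a b (k M) F G) Filter.atTop (nhds (tForm a b k₀ F G)) := by
  have h1 := integrable_tForm a hb hF hG (k := fun _ => 1) measurable_const (K := 1) (by simp)
  simp only [one_mul] at h1
  unfold tForm
  refine tendsto_integral_of_dominated_convergence _
    (fun M => (integrable_tForm a hb hF hG (hk M) (hK M)).aestronglyMeasurable)
    (h1.norm.const_mul K) (fun M => Filter.Eventually.of_forall fun z => ?_)
    (Filter.Eventually.of_forall fun z => (hlim z).mul_const _)
  rw [norm_mul]
  exact mul_le_mul_of_nonneg_right (hK M z) (norm_nonneg _)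

/-- The kernel of the retarded integral. -/
def retarded (z : ℝ × ℝ) : ℂ := if z.1 < z.2 then 1 else 0

theorem measurable_retarded : Measurable retarded :=
  Measurable.ite (measurableSet_lt measurable_fst measurable_snd) measurable_const measurable_const

theorem norm_retarded_le (z : ℝ × ℝ) : ‖retarded z‖ ≤ 1 := by
  unfold retarded
  split_ifs <;> simp

theorem tendsto_sum_dyBump_retarded {l : ℝ} (hl : 0 < l) (z : ℝ × ℝ) :
    Filter.Tendsto (fun M : ℕ => ∑ m ∈ Finset.Icc (-(M : ℤ)) M,
      (dyBump ((z.2 - z.1) / (l⁻¹ * (2 : ℝ) ^ m)) : ℂ)) Filter.atTop (nhds (retarded z)) := by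
  have e1 : ∀ m : ℤ, (z.2 - z.1) / (l⁻¹ * (2 : ℝ) ^ m) = (2 : ℝ) ^ (-m) * (l * (z.2 - z.1)) := by
    intro m
    rw [zpow_neg]
    field_simp
  simp only [e1]
  norm_cast
  unfold retarded
  split_ifs with h
  · refine tendsto_const_nhds.congr' ?_
    filter_upwards [eventually_sum_dyBump_eq_one (mul_pos hl (sub_pos.2 h))] with M hM
    rw [hM, Complex.ofReal_one]
  · have : l * (z.2 - z.1) ≤ 0 := mul_nonpos_of_nonneg_of_nonpos hl.le (by linarith)
    simp only [sum_dyBump_of_nonpos _ this, Complex.ofReal_zero]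
    exact tendsto_const_nhds

theorem norm_sum_dyBump_le_one {l : ℝ} (hl : 0 < l) (M : ℕ) (z : ℝ × ℝ) :
    ‖∑ m ∈ Finset.Icc (-(M : ℤ)) M, (dyBump ((z.2 - z.1) / (l⁻¹ * (2 : ℝ) ^ m)) : ℂ)‖ ≤ 1 := by
  have e1 : ∀ m : ℤ, (z.2 - z.1) / (l⁻¹ * (2 : ℝ) ^ m) = (2 : ℝ) ^ (-m) * (l * (z.2 - z.1)) := by
    intro m
    rw [zpow_neg]
    field_simp
  simp only [e1]
  rw [← Complex.ofReal_sum, Complex.norm_real, Real.norm_of_nonneg (sum_dyBump_nonneg _ _)]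
  exact sum_dyBump_le_one _ _

theorem exists_sum_norm_tForm_retarded_le (hd : 2 ≤ d) {a : ℝ} (ha1 : 1 < a) (ha2 : a < 2)
    (had : 2 * (d : ℝ) / (2 * d - 1) < a) {e e' : ℝ} (he : 0 < e) (he2 : e ≤ 1 / 2)
    (he' : 0 < e') (he2' : e' ≤ 1 / 2) :
    ∃ C : ℝ, 0 < C ∧ ∀ (F G : ℝ → Ed d → ℂ) (L : ℕ), SpaceTimeTest F → SpaceTimeTest G →
      ∑ n ∈ Finset.Icc (-(L : ℤ)) L, ‖tForm a ((2 : ℝ) ^ n) retarded F G‖ ≤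
        C * (nrm a e F * nrm a e' G) := by
  obtain ⟨C, δ, ε, hC, hδ, hε, h⟩ := exists_norm_tForm_bump_decay hd ha1 ha2 had he he2 he' he2'
  obtain ⟨S, hS0, hS⟩ := exists_sum_norm_tForm_le (d := d) hδ (a := a) (by linarith) he.le he2
    he'.le he2'
  obtain ⟨S', hS0', hS'⟩ := exists_sum_dyW_le hε
  refine ⟨S * C * S', by positivity, fun F G L hF hG => ?_⟩
  have hb : ∀ n : ℤ, 0 < (2 : ℝ) ^ n := fun n => by positivity
  set κ : ℤ → ℤ → ℝ × ℝ → ℂ := fun m n z =>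
    (dyBump ((z.2 - z.1) / ((((2 : ℝ) ^ n) ^ a)⁻¹ * (2 : ℝ) ^ m)) : ℂ) with hκ
  have hκm : ∀ m n, Measurable (κ m n) := fun m n => by
    have := continuous_dyBump.measurable
    simp only [hκ]
    fun_prop
  have hκ1 : ∀ m n z, ‖κ m n z‖ ≤ 1 := fun m n z => by
    simp only [hκ]
    rw [Complex.norm_real, Real.norm_of_nonneg (dyBump_nonneg _)]
    exact dyBump_le_one _
  have hm : ∀ m, ∑ n ∈ Finset.Icc (-(L : ℤ)) L, ‖tForm a ((2 : ℝ) ^ n) (κ m n) F G‖ ≤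
      S * (C * dyW ε m) * (nrm a e F * nrm a e' G) := by
    intro m
    refine hS (C * dyW ε m) 1 (κ m) F G (mul_nonneg hC.le (dyW_nonneg _ _)) (hκm m) (hκ1 m) hF hG
      (fun n j l => ?_) _
    have h1 := h _ _ _ _ (ann j F) (ann l G) (hb n) (hb j) (hb l) (hb m) (hF.ann j) (hG.ann l)
      (fun t x hx => ann_support hx) (fun t x hx => ann_support hx)
    simp only [dyW_add] at h1
    exact h1
  have hlim : Filter.Tendsto (fun M : ℕ => ∑ n ∈ Finset.Icc (-(L : ℤ)) L,
      ‖tForm a ((2 : ℝ) ^ n) (fun z => ∑ m ∈ Finset.Icc (-(M : ℤ)) M, κ m n z) F G‖) Filter.atTop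
      (nhds (∑ n ∈ Finset.Icc (-(L : ℤ)) L, ‖tForm a ((2 : ℝ) ^ n) retarded F G‖)) := by
    refine tendsto_finsetSum _ fun n _ => Filter.Tendsto.norm ?_
    have hl : 0 < ((2 : ℝ) ^ n) ^ a := by positivity
    exact tendsto_tForm_kernel a (hb n) hF hG
      (fun M => Finset.measurable_sum _ fun m _ => hκm m n) (K := 1)
      (fun M z => norm_sum_dyBump_le_one hl M z) (fun z => tendsto_sum_dyBump_retarded hl z)
  refine le_of_tendsto hlim (Filter.Eventually.of_forall fun M => ?_)
  calc ∑ n ∈ Finset.Icc (-(L : ℤ)) L,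
        ‖tForm a ((2 : ℝ) ^ n) (fun z => ∑ m ∈ Finset.Icc (-(M : ℤ)) M, κ m n z) F G‖
      ≤ ∑ n ∈ Finset.Icc (-(L : ℤ)) L, ∑ m ∈ Finset.Icc (-(M : ℤ)) M,
        ‖tForm a ((2 : ℝ) ^ n) (κ m n) F G‖ := by
        refine Finset.sum_le_sum fun n _ => ?_
        rw [tForm_kernel_sum _ a (hb n) hF hG (fun m => hκm m n) (fun m => hκ1 m n)]
        exact norm_sum_le _ _
    _ ≤ ∑ m ∈ Finset.Icc (-(M : ℤ)) M, S * (C * dyW ε m) * (nrm a e F * nrm a e' G) := by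
        rw [Finset.sum_comm]
        exact Finset.sum_le_sum fun m _ => hm m
    _ = (S * C * (nrm a e F * nrm a e' G)) * ∑ m ∈ Finset.Icc (-(M : ℤ)) M, dyW ε (m + 0) := by
        rw [Finset.mul_sum]
        refine Finset.sum_congr rfl fun m _ => ?_
        rw [add_zero]
        ring
    _ ≤ (S * C * (nrm a e F * nrm a e' G)) * S' :=
        mul_le_mul_of_nonneg_left (hS' _ 0) (mul_nonneg (by positivity)
          (mul_nonneg (nrm_nonneg _ _ _) (nrm_nonneg _ _ _)))
    _ = _ := by ring

/-- The kernel of the integral from `0` to `t`. -/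
def duhamel (z : ℝ × ℝ) : ℂ := retarded z - retarded (z.1, 0)

theorem measurable_duhamel : Measurable duhamel :=
  measurable_retarded.sub (measurable_retarded.comp (measurable_fst.prodMk measurable_const))

theorem norm_duhamel_le (z : ℝ × ℝ) : ‖duhamel z‖ ≤ 1 := by
  unfold duhamel retarded
  split_ifs <;> simp

/-- The inhomogeneous Strichartz estimate in bilinear form, with a frequency cutoff. -/
theorem exists_sum_norm_tForm_duhamel_le (hd : 2 ≤ d) {a : ℝ} (ha1 : 1 < a) (ha2 : a < 2)
    (had : 2 * (d : ℝ) / (2 * d - 1) < a) {e e' : ℝ} (he : 0 ≤ e) (he2 : e ≤ 1 / 2)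
    (he' : 0 ≤ e') (he2' : e' ≤ 1 / 2) :
    ∃ C : ℝ, 0 < C ∧ ∀ (F G : ℝ → Ed d → ℂ) (L : ℕ), SpaceTimeTest F → SpaceTimeTest G →
      ∑ n ∈ Finset.Icc (-(L : ℤ)) L, ‖tForm a ((2 : ℝ) ^ n) duhamel F G‖ ≤
        C * (nrm a e F * nrm a e' G) := by
  rcases he.eq_or_lt with rfl | he0
  · obtain ⟨C, hC, h⟩ := exists_sum_norm_tForm_le_zero hd ha1 ha2 had he' he2'
    exact ⟨C, hC, fun F G L hF hG => h F G _ L hF hG measurable_duhamel norm_duhamel_le⟩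
  rcases he'.eq_or_lt with rfl | he0'
  · obtain ⟨C, hC, h⟩ := exists_sum_norm_tForm_le_zero hd ha1 ha2 had he he2
    refine ⟨C, hC, fun F G L hF hG => ?_⟩
    have hconj : Measurable (starRingEnd ℂ) := Complex.continuous_conj.measurable
    have h1 := h G F (fun z => (starRingEnd ℂ) (duhamel (z.2, z.1))) L hG hF
      (hconj.comp (measurable_duhamel.comp measurable_swap)) (fun z => by
        rw [RCLike.norm_conj]
        exact norm_duhamel_le _)
    simp only [← conj_tForm, RCLike.norm_conj] at h1
    rwa [mul_comm (nrm a e F)]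
  obtain ⟨C, hC, h⟩ := exists_sum_norm_tForm_retarded_le hd ha1 ha2 had he0 he2 he0' he2'
  obtain ⟨C', hC', h'⟩ := exists_sum_norm_tForm_one_le hd ha1 ha2 had he he2 he' he2'
  refine ⟨C + C', by positivity, fun F G L hF hG => ?_⟩
  have hm : Measurable fun t : ℝ => retarded (t, 0) :=
    measurable_retarded.comp (measurable_id.prodMk measurable_const)
  have hF0 : SpaceTimeTest fun t x => retarded (t, 0) * F t x :=
    hF.time_mul hm fun t => norm_retarded_le _
  have hsub : ∀ n : ℤ, tForm a ((2 : ℝ) ^ n) duhamel F G = tForm a ((2 : ℝ) ^ n) retarded F G -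
      tForm a ((2 : ℝ) ^ n) (fun _ => 1) (fun t x => retarded (t, 0) * F t x) G := by
    intro n
    have e1 : tForm a ((2 : ℝ) ^ n) (fun _ => 1) (fun t x => retarded (t, 0) * F t x) G =
        tForm a ((2 : ℝ) ^ n) (fun z => retarded (z.1, 0)) F G := by
      unfold tForm
      congr 1
      ext z
      have := locForm_const_mul a ((2 : ℝ) ^ n) (z.2 - z.1) (retarded (z.1, 0)) 1 (F z.1) (G z.2)
      simp only [one_mul, map_one, mul_one] at this
      rw [one_mul, this]
    rw [e1]
    exact tForm_kernel_sub a (by positivity) hF hG measurable_retarded (hm.comp measurable_fst)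
      norm_retarded_le fun z => norm_retarded_le _
  have h2 := h' _ G L hF0 hG
  have h3 : nrm a e (fun t x => retarded (t, 0) * F t x) ≤ nrm a e F :=
    hF.nrm_mono (by linarith) he (by linarith) fun t x => by
      rw [norm_mul]
      exact mul_le_of_le_one_left (norm_nonneg _) (norm_retarded_le _)
  have h4 := mul_le_mul_of_nonneg_left (mul_le_mul_of_nonneg_right h3 (nrm_nonneg a e' G)) hC'.le
  have h1 := h F G L hF hG
  simp only [hsub]
  refine (Finset.sum_le_sum fun n _ => norm_sub_le _ _).trans ?_
  rw [Finset.sum_add_distrib, add_mul]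
  linarith

end Retarded


section SchwartzSource

variable {d : ℕ} {F : ℝ → Ed d → ℂ}

/-- Bounded measurable space-time functions, radial in space and boundedly supported in time, which
together with their spatial Fourier transforms are dominated by an integrable function. -/
structure RadialSource (F : ℝ → Ed d → ℂ) : Prop where
  meas : Measurable (Function.uncurry F)
  bdd : ∃ M : ℝ, ∀ t x, ‖F t x‖ ≤ M
  dom : ∃ (T : ℝ) (g : Ed d → ℝ), 0 < T ∧ Integrable g ∧ ∀ t x,
    ‖F t x‖ ≤ (Set.Icc (-T) T).indicator (fun _ => 1) t * g x
  domFT : ∃ (T : ℝ) (g : Ed d → ℝ), 0 < T ∧ Integrable g ∧ ∀ t ξ,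
    ‖FT (F t) ξ‖ ≤ (Set.Icc (-T) T).indicator (fun _ => 1) t * g ξ
  radial : ∀ t, IsRadial (F t)

theorem exists_schwartz_path_bound {H : ℝ → SchwartzMap (Ed d) ℂ} (hc : Continuous H)
    (hs : HasCompactSupport H) : ∃ M T : ℝ, 0 ≤ M ∧ 0 < T ∧ ∀ t x,
      ‖H t x‖ ≤ (Set.Icc (-T) T).indicator (fun _ => 1) t *
        (M * (1 + ‖x‖) ^ (-((d : ℝ) + 1))) := by
  obtain ⟨T, hT⟩ := hs.isCompact.isBounded.subset_closedBall 0
  have hsupp : ∀ t, H t ≠ 0 → t ∈ Set.Icc (-(max T 1)) (max T 1) := fun t ht => by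
    have h1 := hT (subset_tsupport _ ht)
    rw [mem_closedBall_zero_iff, Real.norm_eq_abs] at h1
    exact abs_le.1 (h1.trans (le_max_left _ _))
  have hsem : ∀ k : ℕ, Continuous fun t => SchwartzMap.seminorm ℝ k 0 (H t) := fun k =>
    ((schwartz_withSeminorms ℝ (Ed d) ℂ).continuous_seminorm (k, 0)).comp hc
  obtain ⟨B, hB⟩ := isCompact_Icc.exists_bound_of_continuousOn
    (s := Set.Icc (-(max T 1)) (max T 1)) (hsem 0).continuousOn
  obtain ⟨B', hB'⟩ := isCompact_Icc.exists_bound_of_continuousOn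
    (s := Set.Icc (-(max T 1)) (max T 1)) (hsem (d + 1)).continuousOn
  have h0mem : (0 : ℝ) ∈ Set.Icc (-(max T 1)) (max T 1) := by
    have := le_max_right T 1
    constructor <;> linarith
  have hB0 : 0 ≤ B := (norm_nonneg _).trans (hB 0 h0mem)
  have hB0' : 0 ≤ B' := (norm_nonneg _).trans (hB' 0 h0mem)
  refine ⟨2 ^ (d + 1) * (B + B'), max T 1, by positivity, by positivity, fun t x => ?_⟩
  by_cases ht : H t = 0
  · have h0 : H t x = 0 := by rw [ht]; rfl
    rw [h0, norm_zero]
    exact mul_nonneg (Set.indicator_nonneg (fun _ _ => zero_le_one) _) (by positivity)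
  have htm := hsupp t ht
  rw [Set.indicator_of_mem htm, one_mul, Real.rpow_neg (by positivity)]
  have h1 : ‖H t x‖ ≤ B := by
    refine le_trans ?_ ((Real.le_norm_self _).trans (hB t htm))
    simpa using SchwartzMap.norm_le_seminorm ℝ (H t) x
  have h2 : ‖x‖ ^ (d + 1) * ‖H t x‖ ≤ B' :=
    (SchwartzMap.norm_pow_mul_le_seminorm ℝ (H t) (d + 1) x).trans
      ((Real.le_norm_self _).trans (hB' t htm))
  have h3 : (1 + ‖x‖) ^ (d + 1) ≤ 2 ^ (d + 1) * (1 + ‖x‖ ^ (d + 1)) := by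
    have hx := norm_nonneg x
    rcases le_total ‖x‖ 1 with h | h
    · calc (1 + ‖x‖) ^ (d + 1) ≤ 2 ^ (d + 1) := by gcongr; linarith
        _ ≤ _ := le_mul_of_one_le_right (by positivity) (by linarith [pow_nonneg hx (d + 1)])
    · calc (1 + ‖x‖) ^ (d + 1) ≤ (2 * ‖x‖) ^ (d + 1) := by gcongr; linarith
        _ = 2 ^ (d + 1) * ‖x‖ ^ (d + 1) := mul_pow _ _ _
        _ ≤ _ := by gcongr; linarith
  have e1 : (1 + ‖x‖) ^ ((d : ℝ) + 1) = (1 + ‖x‖) ^ (d + 1) := by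
    rw [← Real.rpow_natCast]
    push_cast
    rfl
  rw [e1, ← div_eq_mul_inv, le_div_iff₀ (by positivity)]
  calc ‖H t x‖ * (1 + ‖x‖) ^ (d + 1) ≤ ‖H t x‖ * (2 ^ (d + 1) * (1 + ‖x‖ ^ (d + 1))) := by gcongr
    _ = 2 ^ (d + 1) * (‖H t x‖ + ‖x‖ ^ (d + 1) * ‖H t x‖) := by ring
    _ ≤ _ := by gcongr

theorem integrable_const_mul_one_add_norm (M : ℝ) :
    Integrable fun x : Ed d => M * (1 + ‖x‖) ^ (-((d : ℝ) + 1)) := by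
  refine Integrable.const_mul ?_ M
  refine integrable_one_add_norm ?_
  simp

theorem continuous_uncurry_schwartz_path {H : ℝ → SchwartzMap (Ed d) ℂ} (hc : Continuous H) :
    Continuous fun p : ℝ × Ed d => H p.1 p.2 := by
  have h : Continuous fun t => SchwartzMap.toBoundedContinuousFunctionCLM ℝ (Ed d) ℂ (H t) :=
    (SchwartzMap.toBoundedContinuousFunctionCLM ℝ (Ed d) ℂ).continuous.comp hc
  have h2 : Continuous fun p : ℝ × Ed d =>
      (SchwartzMap.toBoundedContinuousFunctionCLM ℝ (Ed d) ℂ (H p.1)) p.2 :=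
    (h.comp continuous_fst).eval continuous_snd
  exact h2

theorem radialSource_of_schwartz {H : ℝ → SchwartzMap (Ed d) ℂ} (hc : Continuous H)
    (hs : HasCompactSupport H) (hr : ∀ t, IsRadial (⇑(H t))) :
    RadialSource fun t => ⇑(H t) := by
  have hb := exists_schwartz_path_bound hc hs
  obtain ⟨M, T, hM0, hT, hM⟩ := hb
  refine ⟨(continuous_uncurry_schwartz_path hc).measurable, ⟨M, fun t x => ?_⟩,
    ⟨T, _, hT, integrable_const_mul_one_add_norm M, hM⟩, ?_, hr⟩
  · refine (hM t x).trans ?_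
    have h1 : (Set.Icc (-T) T).indicator (fun _ => (1 : ℝ)) t ≤ 1 :=
      Set.indicator_le_self' (fun _ _ => zero_le_one) t
    have h2 : (1 + ‖x‖) ^ (-((d : ℝ) + 1)) ≤ 1 :=
      Real.rpow_le_one_of_one_le_of_nonpos (by linarith [norm_nonneg x]) (by
        have : (0 : ℝ) ≤ d := by positivity
        linarith)
    calc _ ≤ 1 * (M * 1) := by gcongr
      _ = M := by ring
  · have hcF : Continuous fun t => FourierTransform.fourierCLM ℂ (SchwartzMap (Ed d) ℂ) (H t) :=
      (FourierTransform.fourierCLM ℂ (SchwartzMap (Ed d) ℂ)).continuous.comp hc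
    have hsF : HasCompactSupport
        fun t => FourierTransform.fourierCLM ℂ (SchwartzMap (Ed d) ℂ) (H t) :=
      hs.comp_left (map_zero _)
    obtain ⟨M', T', hM0', hT', hM'⟩ := exists_schwartz_path_bound hcF hsF
    refine ⟨T', fun ξ => M' * (1 + ‖(2 * Real.pi)⁻¹ • ξ‖) ^ (-((d : ℝ) + 1)), hT', ?_,
      fun t ξ => ?_⟩
    · exact (integrable_const_mul_one_add_norm M').comp_smul (by positivity)
    · rw [FT_eq_fourier]
      exact hM' t _

end SchwartzSource


section FrequencyLimit

variable {d : ℕ} {F G : ℝ → Ed d → ℂ}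

/-- The integrand, in times and frequency, of the duality pairing with the Duhamel integral. -/
def pairing (a : ℝ) (F G : ℝ → Ed d → ℂ) (w : (ℝ × ℝ) × Ed d) : ℂ :=
  duhamel w.1 * (Complex.exp (-I * (((w.1.2 - w.1.1) * ‖w.2‖ ^ a : ℝ) : ℂ)) *
    (FT (F w.1.1) w.2 * (starRingEnd ℂ) (FT (G w.1.2) w.2)))

theorem measurable_pairing (a : ℝ) (hF : Measurable (Function.uncurry F))
    (hG : Measurable (Function.uncurry G)) : Measurable (pairing a F G) := by
  have h1 : Measurable fun w : (ℝ × ℝ) × Ed d => FT (F w.1.1) w.2 :=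
    (measurable_FT_of_measurable_uncurry hF).comp (f := fun w : (ℝ × ℝ) × Ed d => (w.1.1, w.2))
      (by fun_prop)
  have h2 : Measurable fun w : (ℝ × ℝ) × Ed d => FT (G w.1.2) w.2 :=
    (measurable_FT_of_measurable_uncurry hG).comp (f := fun w : (ℝ × ℝ) × Ed d => (w.1.2, w.2))
      (by fun_prop)
  have h3 : Measurable (starRingEnd ℂ) := Complex.continuous_conj.measurable
  exact (measurable_duhamel.comp measurable_fst).mul
    (Measurable.mul (by fun_prop) (h1.mul (h3.comp h2)))

theorem norm_pairing_le (a : ℝ) (F G : ℝ → Ed d → ℂ) (w : (ℝ × ℝ) × Ed d) :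
    ‖pairing a F G w‖ ≤ ‖FT (F w.1.1) w.2‖ * ‖FT (G w.1.2) w.2‖ := by
  rw [pairing, norm_mul, norm_mul, norm_mul, RCLike.norm_conj, norm_exp_negI_mul, one_mul]
  exact mul_le_of_le_one_left (by positivity) (norm_duhamel_le _)

theorem tForm_duhamel_eq (a : ℝ) {b : ℝ} (hb : 0 < b) (hF : SpaceTimeTest F)
    (hG : SpaceTimeTest G) : tForm a b duhamel F G =
      ∫ w : (ℝ × ℝ) × Ed d, (dyBump (‖w.2‖ / b) : ℂ) * pairing a F G w := by
  have h := integrable_tForm_integrand a hb hF hG measurable_duhamel norm_duhamel_le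
  have e1 : ∀ w : (ℝ × ℝ) × Ed d, (dyBump (‖w.2‖ / b) : ℂ) * pairing a F G w =
      duhamel w.1 * (locMul a b (w.1.2 - w.1.1) w.2 *
      (FT (F w.1.1) w.2 * (starRingEnd ℂ) (FT (G w.1.2) w.2))) := fun w => by
    rw [pairing, locMul]
    ring
  simp only [e1]
  have h2 := integral_prod _ h
  simp only [integral_const_mul] at h2
  exact h2.symm

theorem integrable_indicator_Icc (M T : ℝ) : Integrable ((Set.Icc (-T) T).indicator fun _ => M) :=
  (integrable_indicator_iff measurableSet_Icc).2 (integrableOn_const measure_Icc_lt_top.ne)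

/-- Restriction to the annulus `1 / R ≤ |x| ≤ R`. -/
def cutoff (R : ℝ) (F : ℝ → Ed d → ℂ) (t : ℝ) (x : Ed d) : ℂ :=
  if R⁻¹ ≤ ‖x‖ ∧ ‖x‖ ≤ R then F t x else 0

theorem norm_cutoff_le (R : ℝ) (F : ℝ → Ed d → ℂ) (t : ℝ) (x : Ed d) :
    ‖cutoff R F t x‖ ≤ ‖F t x‖ := by
  unfold cutoff
  split_ifs <;> simp

theorem measurable_cutoff (R : ℝ) (hF : Measurable (Function.uncurry F)) :
    Measurable (Function.uncurry (cutoff R F)) := by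
  have hs : MeasurableSet {p : ℝ × Ed d | R⁻¹ ≤ ‖p.2‖ ∧ ‖p.2‖ ≤ R} :=
    have hn : Measurable fun p : ℝ × Ed d => ‖p.2‖ := by fun_prop
    (measurableSet_le measurable_const hn).inter (measurableSet_le hn measurable_const)
  exact Measurable.ite hs hF measurable_const

theorem isRadial_cutoff (R : ℝ) {t : ℝ} (hF : IsRadial (F t)) : IsRadial (cutoff R F t) := by
  intro x y h
  unfold cutoff
  rw [h, hF x y h]

theorem tendsto_cutoff (F : ℝ → Ed d → ℂ) (t : ℝ) {x : Ed d} (hx : x ≠ 0) :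
    Filter.Tendsto (fun n : ℕ => cutoff ((n : ℝ) + 1) F t x) Filter.atTop (nhds (F t x)) := by
  refine tendsto_const_nhds.congr' ?_
  have hx0 : 0 < ‖x‖ := norm_pos_iff.2 hx
  obtain ⟨N, hN⟩ := exists_nat_ge (max ‖x‖ ‖x‖⁻¹)
  filter_upwards [Filter.eventually_ge_atTop N] with n hn
  have h1 : max ‖x‖ ‖x‖⁻¹ ≤ (n : ℝ) + 1 := by
    have : (N : ℝ) ≤ n := by exact_mod_cast hn
    linarith
  have h2 : ((n : ℝ) + 1)⁻¹ ≤ ‖x‖ :=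
    inv_le_of_inv_le₀ hx0 ((le_max_right _ _).trans h1)
  rw [cutoff, if_pos ⟨h2, (le_max_left _ _).trans h1⟩]

theorem RadialSource.spaceTimeTest_cutoff (hF : RadialSource F) {R : ℝ} (hR : 0 < R) :
    SpaceTimeTest (cutoff R F) := by
  obtain ⟨M, hM⟩ := hF.bdd
  obtain ⟨T, g, hT0, -, hT⟩ := hF.dom
  refine ⟨measurable_cutoff R hF.meas, ⟨M, fun t x => (norm_cutoff_le R F t x).trans (hM t x)⟩,
    ⟨max T R, lt_max_of_lt_left hT0, fun t x hx => ?_⟩, fun t => isRadial_cutoff R (hF.radial t)⟩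
  have h1 : R⁻¹ ≤ ‖x‖ ∧ ‖x‖ ≤ R := by
    by_contra h
    exact hx (if_neg h)
  refine ⟨?_, (inv_anti₀ hR (le_max_right _ _)).trans h1.1, h1.2.trans (le_max_right _ _)⟩
  refine le_trans ?_ (le_max_left _ _)
  by_contra h
  have h2 : t ∉ Set.Icc (-T) T := fun h' => h (abs_le.2 h')
  have h3 := (norm_cutoff_le R F t x).trans (hT t x)
  rw [Set.indicator_of_notMem h2, zero_mul] at h3
  exact hx (norm_le_zero_iff.1 h3)

theorem RadialSource.integrable (hF : RadialSource F) (t : ℝ) : Integrable (F t) := by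
  obtain ⟨T, g, -, hg, hT⟩ := hF.dom
  exact (hg.const_mul _).mono' (hF.meas.comp measurable_prodMk_left).aestronglyMeasurable
    (Filter.Eventually.of_forall fun x => hT t x)

theorem RadialSource.tendsto_FT_cutoff (hd : 2 ≤ d) (hF : RadialSource F) (t : ℝ) (ξ : Ed d) :
    Filter.Tendsto (fun n : ℕ => FT (cutoff ((n : ℝ) + 1) F t) ξ) Filter.atTop
      (nhds (FT (F t) ξ)) := by
  have : NeZero d := ⟨by omega⟩
  unfold FT
  have hmeas : ∀ n : ℕ, Measurable (cutoff ((n : ℝ) + 1) F t) := fun n =>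
    (measurable_cutoff _ hF.meas).of_uncurry_left
  refine tendsto_integral_of_dominated_convergence (fun x => ‖F t x‖) (fun n => ?_)
    (hF.integrable t).norm (fun n => Filter.Eventually.of_forall fun x => ?_) ?_
  · have := hmeas n
    exact Measurable.aestronglyMeasurable (by fun_prop)
  · rw [norm_mul, norm_exp_negI_mul, one_mul]
    exact norm_cutoff_le _ _ _ _
  · have h0 : ∀ᵐ x : Ed d, x ≠ 0 := Measure.ae_ne volume 0
    filter_upwards [h0] with x hx
    exact (tendsto_cutoff F t hx).const_mul _

theorem RadialSource.tendsto_tForm_cutoff (hd : 2 ≤ d) (a : ℝ) {b : ℝ} (hb : 0 < b)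
    (hF : RadialSource F) (hG : SpaceTimeTest G) :
    Filter.Tendsto (fun n : ℕ => tForm a b duhamel (cutoff ((n : ℝ) + 1) F) G) Filter.atTop
      (nhds (∫ w : (ℝ × ℝ) × Ed d, (dyBump (‖w.2‖ / b) : ℂ) * pairing a F G w)) := by
  have hn : ∀ n : ℕ, (0 : ℝ) < (n : ℝ) + 1 := fun n => by positivity
  simp only [tForm_duhamel_eq a hb (hF.spaceTimeTest_cutoff (hn _)) hG]
  obtain ⟨T, g, hT0, hg, hT⟩ := hF.dom
  obtain ⟨M', T', hM0', hM'⟩ := hG.exists_norm_FT_le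
  have hw : Integrable (fun w : (ℝ × ℝ) × Ed d =>
      ((Set.Icc (-T) T).indicator (fun _ => ∫ x, g x) w.1.1 *
      (Set.Icc (-T') T').indicator (fun _ => M') w.1.2) * dyBump (‖w.2‖ / b))
      ((volume.prod volume).prod volume) :=
    ((integrable_indicator_Icc _ T).mul_prod (integrable_indicator_Icc M' T')).mul_prod
      (integrable_dyBump_norm (d := d) hb)
  have hbm := continuous_dyBump.measurable
  refine tendsto_integral_of_dominated_convergence _ (fun n => ?_) hw
    (fun n => Filter.Eventually.of_forall fun w => ?_) (Filter.Eventually.of_forall fun w => ?_)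
  · exact (Measurable.mul (by fun_prop) (measurable_pairing a (measurable_cutoff _ hF.meas)
      hG.meas)).aestronglyMeasurable
  · rw [norm_mul, Complex.norm_real, Real.norm_of_nonneg (dyBump_nonneg _), mul_comm]
    refine mul_le_mul_of_nonneg_right ((norm_pairing_le _ _ _ _).trans ?_) (dyBump_nonneg _)
    have h1 : ‖FT (cutoff ((n : ℝ) + 1) F w.1.1) w.2‖ ≤
        (Set.Icc (-T) T).indicator (fun _ => ∫ x, g x) w.1.1 := by
      refine (norm_FT_le _ _).trans ?_
      have h2 : ∫ x, ‖cutoff ((n : ℝ) + 1) F w.1.1 x‖ ≤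
          ∫ x, (Set.Icc (-T) T).indicator (fun _ => 1) w.1.1 * g x :=
        integral_mono ((hF.spaceTimeTest_cutoff (hn n)).space w.1.1).integrable.norm
          (hg.const_mul _) fun x => (norm_cutoff_le _ _ _ _).trans (hT _ x)
      refine h2.trans (le_of_eq ?_)
      rw [integral_const_mul]
      by_cases h : w.1.1 ∈ Set.Icc (-T) T
      · simp only [Set.indicator_of_mem h, one_mul]
      · simp only [Set.indicator_of_notMem h, zero_mul]
    exact mul_le_mul h1 (hM' _ _) (norm_nonneg _) ((norm_nonneg _).trans h1)
  · unfold pairing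
    exact ((((hF.tendsto_FT_cutoff hd w.1.1 w.2).mul_const _).const_mul _).const_mul _).const_mul _

theorem RadialSource.integrable_pairing (hF : RadialSource F) (hG : SpaceTimeTest G) (a : ℝ) :
    Integrable (pairing a F G) ((volume.prod volume).prod volume) := by
  obtain ⟨T, g, hT0, hg, hT⟩ := hF.domFT
  obtain ⟨M', T', hM0', hM'⟩ := hG.exists_norm_FT_le
  have hw : Integrable (fun w : (ℝ × ℝ) × Ed d => ((Set.Icc (-T) T).indicator (fun _ => 1) w.1.1 *
      (Set.Icc (-T') T').indicator (fun _ => M') w.1.2) * g w.2)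
      ((volume.prod volume).prod volume) :=
    ((integrable_indicator_Icc _ T).mul_prod (integrable_indicator_Icc M' T')).mul_prod hg
  refine hw.mono' (measurable_pairing a hF.meas hG.meas).aestronglyMeasurable
    (Filter.Eventually.of_forall fun w => (norm_pairing_le _ _ _ _).trans ?_)
  have h1 := hT w.1.1 w.2
  have h2 := mul_le_mul h1 (hM' w.1.2 w.2) (norm_nonneg _) ((norm_nonneg _).trans h1)
  linarith

theorem RadialSource.tendsto_sum_pairing (hd : 2 ≤ d) (a : ℝ) (hF : RadialSource F)
    (hG : SpaceTimeTest G) :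
    Filter.Tendsto (fun L : ℕ => ∑ n ∈ Finset.Icc (-(L : ℤ)) L,
      ∫ w : (ℝ × ℝ) × Ed d, (dyBump (‖w.2‖ / (2 : ℝ) ^ n) : ℂ) * pairing a F G w) Filter.atTop
      (nhds (∫ w : (ℝ × ℝ) × Ed d, pairing a F G w)) := by
  have : NeZero d := ⟨by omega⟩
  have hi := hF.integrable_pairing hG a
  have hbm := continuous_dyBump.measurable
  have hin : ∀ n : ℤ, Integrable (fun w : (ℝ × ℝ) × Ed d =>
      (dyBump (‖w.2‖ / (2 : ℝ) ^ n) : ℂ) * pairing a F G w) := fun n => by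
    refine hi.norm.mono' (Measurable.mul (by fun_prop)
      (measurable_pairing a hF.meas hG.meas)).aestronglyMeasurable
      (Filter.Eventually.of_forall fun w => ?_)
    rw [norm_mul, Complex.norm_real, Real.norm_of_nonneg (dyBump_nonneg _)]
    exact mul_le_of_le_one_left (norm_nonneg _) (dyBump_le_one _)
  have e1 : ∀ (n : ℤ) (w : (ℝ × ℝ) × Ed d),
      dyBump (‖w.2‖ / (2 : ℝ) ^ n) = dyBump ((2 : ℝ) ^ (-n) * ‖w.2‖) := fun n w => by
    rw [zpow_neg, div_eq_inv_mul]
  have e2 : ∀ L : ℕ, ∑ n ∈ Finset.Icc (-(L : ℤ)) L,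
      ∫ w : (ℝ × ℝ) × Ed d, (dyBump (‖w.2‖ / (2 : ℝ) ^ n) : ℂ) * pairing a F G w =
      ∫ w : (ℝ × ℝ) × Ed d, ((∑ n ∈ Finset.Icc (-(L : ℤ)) L,
        dyBump ((2 : ℝ) ^ (-n) * ‖w.2‖) : ℝ) : ℂ) * pairing a F G w := fun L => by
    rw [← integral_finsetSum _ fun n _ => hin n]
    congr 1
    ext w
    rw [← Finset.sum_mul, Complex.ofReal_sum]
    simp only [e1]
  simp only [e2]
  refine tendsto_integral_of_dominated_convergence _ (fun L => ?_) hi.norm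
    (fun L => Filter.Eventually.of_forall fun w => ?_) ?_
  · exact (Measurable.mul (by fun_prop)
      (measurable_pairing a hF.meas hG.meas)).aestronglyMeasurable
  · rw [norm_mul, Complex.norm_real, Real.norm_of_nonneg (sum_dyBump_nonneg _ _)]
    exact mul_le_of_le_one_left (norm_nonneg _) (sum_dyBump_le_one _ _)
  · have h0 : ∀ᵐ x : Ed d, x ≠ 0 := Measure.ae_ne volume 0
    have h1 : ∀ᵐ w : (ℝ × ℝ) × Ed d, w.2 ≠ 0 :=
      (Measure.quasiMeasurePreserving_snd (μ := (volume : Measure (ℝ × ℝ)))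
        (ν := (volume : Measure (Ed d)))).ae h0
    filter_upwards [h1] with w hw
    refine tendsto_const_nhds.congr' ?_
    filter_upwards [eventually_sum_dyBump_eq_one (norm_pos_iff.2 hw)] with L hL
    rw [hL, Complex.ofReal_one, one_mul]

theorem exists_norm_integral_pairing_le (hd : 2 ≤ d) {a : ℝ} (ha1 : 1 < a) (ha2 : a < 2)
    (had : 2 * (d : ℝ) / (2 * d - 1) < a) {e e' : ℝ} (he : 0 ≤ e) (he2 : e ≤ 1 / 2)
    (he' : 0 ≤ e') (he2' : e' ≤ 1 / 2) :
    ∃ C : ℝ, 0 < C ∧ ∀ F G : ℝ → Ed d → ℂ, RadialSource F → SpaceTimeTest G →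
      stN e (spExp d a e) F ≠ ∞ →
      ‖∫ w : (ℝ × ℝ) × Ed d, pairing a F G w‖ ≤
        C * ((stN e (spExp d a e) F).toReal * nrm a e' G) := by
  obtain ⟨C, hC, h⟩ := exists_sum_norm_tForm_duhamel_le hd ha1 ha2 had he he2 he' he2'
  refine ⟨C, hC, fun F G hF hG hfin => ?_⟩
  refine le_of_tendsto (hF.tendsto_sum_pairing hd a hG).norm (Filter.Eventually.of_forall
    fun L => ?_)
  have h1 : Filter.Tendsto (fun m : ℕ => ∑ n ∈ Finset.Icc (-(L : ℤ)) L,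
      tForm a ((2 : ℝ) ^ n) duhamel (cutoff ((m : ℝ) + 1) F) G) Filter.atTop
      (nhds (∑ n ∈ Finset.Icc (-(L : ℤ)) L, ∫ w : (ℝ × ℝ) × Ed d,
        (dyBump (‖w.2‖ / (2 : ℝ) ^ n) : ℂ) * pairing a F G w)) :=
    tendsto_finsetSum _ fun n _ => hF.tendsto_tForm_cutoff hd a (by positivity) hG
  refine le_of_tendsto h1.norm (Filter.Eventually.of_forall fun m => ?_)
  refine (norm_sum_le _ _).trans ((h _ G L (hF.spaceTimeTest_cutoff (by positivity)) hG).trans ?_)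
  have h2 : nrm a e (cutoff ((m : ℝ) + 1) F) ≤ (stN e (spExp d a e) F).toReal :=
    ENNReal.toReal_mono hfin (stN_mono (by linarith) (spExp_pos (by linarith) he).le
      fun t x => norm_cutoff_le _ _ _ _)
  exact mul_le_mul_of_nonneg_left (mul_le_mul_of_nonneg_right h2 (nrm_nonneg _ _ _)) hC.le

end FrequencyLimit


section DuhamelIntegral

variable {d : ℕ} {F G : ℝ → Ed d → ℂ}

/-- The Duhamel integral as an absolutely convergent integral over time and frequency. -/
def duhamelInt (a : ℝ) (F : ℝ → Ed d → ℂ) (t : ℝ) (x : Ed d) : ℂ :=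
  (((2 * Real.pi) ^ (-(d : ℝ)) : ℝ) : ℂ) * ∫ p : ℝ × Ed d, duhamel (p.1, t) *
    (Complex.exp (I * ((⟪x, p.2⟫ : ℝ) : ℂ)) *
      (Complex.exp (-I * (((t - p.1) * ‖p.2‖ ^ a : ℝ) : ℂ)) * FT (F p.1) p.2))

theorem measurable_FT_phase (a t : ℝ) (hF : Measurable (Function.uncurry F)) :
    Measurable fun p : ℝ × Ed d =>
      Complex.exp (-I * (((t - p.1) * ‖p.2‖ ^ a : ℝ) : ℂ)) * FT (F p.1) p.2 :=
  Measurable.mul (by fun_prop) (measurable_FT_of_measurable_uncurry hF)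

theorem RadialSource.integrable_FT_phase (hF : RadialSource F) (a t : ℝ) (x : Ed d) :
    Integrable (fun p : ℝ × Ed d => Complex.exp (I * ((⟪x, p.2⟫ : ℝ) : ℂ)) *
      (Complex.exp (-I * (((t - p.1) * ‖p.2‖ ^ a : ℝ) : ℂ)) * FT (F p.1) p.2))
      (volume.prod volume) := by
  obtain ⟨T, g, hT0, hg, hT⟩ := hF.domFT
  refine ((integrable_indicator_Icc 1 T).mul_prod hg).mono' (Measurable.mul (by fun_prop)
    (measurable_FT_phase a t hF.meas)).aestronglyMeasurable
    (Filter.Eventually.of_forall fun p => ?_)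
  rw [norm_mul, norm_mul, norm_exp_I_mul, norm_exp_negI_mul, one_mul, one_mul]
  exact hT p.1 p.2

theorem RadialSource.integrable_duhamelInt (hF : RadialSource F) (a t : ℝ) (x : Ed d) :
    Integrable (fun p : ℝ × Ed d => duhamel (p.1, t) * (Complex.exp (I * ((⟪x, p.2⟫ : ℝ) : ℂ)) *
      (Complex.exp (-I * (((t - p.1) * ‖p.2‖ ^ a : ℝ) : ℂ)) * FT (F p.1) p.2)))
      (volume.prod volume) := by
  have hm : Measurable fun p : ℝ × Ed d => duhamel (p.1, t) :=
    measurable_duhamel.comp (f := fun p : ℝ × Ed d => (p.1, t)) (by fun_prop)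
  exact (hF.integrable_FT_phase a t x).bdd_mul hm.aestronglyMeasurable
    (Filter.Eventually.of_forall fun p => norm_duhamel_le _)

theorem duhamel_eq_indicator (t t' : ℝ) : duhamel (t', t) =
    (Set.Iio t).indicator (fun _ => (1 : ℂ)) t' - (Set.Iio 0).indicator (fun _ => (1 : ℂ)) t' := by
  simp only [duhamel, retarded, Set.indicator, Set.mem_Iio]

theorem integral_duhamel_mul {h : ℝ → ℂ} (hh : Integrable h) (t : ℝ) :
    ∫ t', duhamel (t', t) * h t' = ∫ t' in (0 : ℝ)..t, h t' := by
  have e1 : ∀ (s t' : ℝ), (Set.Iio s).indicator (fun _ => (1 : ℂ)) t' * h t' =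
      (Set.Iio s).indicator h t' := fun s t' => by
    by_cases h' : t' ∈ Set.Iio s
    · rw [Set.indicator_of_mem h', Set.indicator_of_mem h', one_mul]
    · rw [Set.indicator_of_notMem h', Set.indicator_of_notMem h', zero_mul]
  simp only [duhamel_eq_indicator, sub_mul, e1]
  rw [integral_sub (hh.indicator measurableSet_Iio) (hh.indicator measurableSet_Iio),
    integral_indicator measurableSet_Iio, integral_indicator measurableSet_Iio,
    ← integral_Iic_eq_integral_Iio, ← integral_Iic_eq_integral_Iio]
  exact intervalIntegral.integral_Iic_sub_Iic hh.integrableOn hh.integrableOn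

theorem RadialSource.intervalIntegral_fprop (hF : RadialSource F) (s t : ℝ) (x : Ed d) :
    ∫ t' in (0 : ℝ)..t, fprop s (t - t') (F t') x = duhamelInt (2 * s) F t x := by
  have h1 := hF.integrable_FT_phase (2 * s) t x
  have e1 : ∀ t', fprop s (t - t') (F t') x = (((2 * Real.pi) ^ (-(d : ℝ)) : ℝ) : ℂ) *
      ∫ ξ : Ed d, Complex.exp (I * ((⟪x, ξ⟫ : ℝ) : ℂ)) *
        (Complex.exp (-I * (((t - t') * ‖ξ‖ ^ (2 * s) : ℝ) : ℂ)) * FT (F t') ξ) := fun t' => by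
    rw [fprop, FTinv]
    congr 2
    ext ξ
    congr 3
    push_cast
    ring
  simp only [e1]
  rw [intervalIntegral.integral_const_mul, ← integral_duhamel_mul h1.integral_prod_left,
    duhamelInt]
  congr 1
  have h2 := integral_prod _ (hF.integrable_duhamelInt (2 * s) t x)
  simp only [integral_const_mul] at h2
  exact h2.symm

theorem RadialSource.measurable_duhamelInt (hF : RadialSource F) (a : ℝ) :
    Measurable (Function.uncurry (duhamelInt a F)) := by
  have hm : Measurable fun q : (ℝ × Ed d) × (ℝ × Ed d) => duhamel (q.2.1, q.1.1) *
      (Complex.exp (I * ((⟪q.1.2, q.2.2⟫ : ℝ) : ℂ)) *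
      (Complex.exp (-I * (((q.1.1 - q.2.1) * ‖q.2.2‖ ^ a : ℝ) : ℂ)) * FT (F q.2.1) q.2.2)) := by
    have h1 : Measurable fun q : (ℝ × Ed d) × (ℝ × Ed d) => duhamel (q.2.1, q.1.1) :=
      measurable_duhamel.comp (f := fun q : (ℝ × Ed d) × (ℝ × Ed d) => (q.2.1, q.1.1))
        (by fun_prop)
    have h2 : Measurable fun q : (ℝ × Ed d) × (ℝ × Ed d) => FT (F q.2.1) q.2.2 :=
      (measurable_FT_of_measurable_uncurry hF.meas).comp measurable_snd
    exact h1.mul (Measurable.mul (by fun_prop) (Measurable.mul (by fun_prop) h2))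
  have h3 := (StronglyMeasurable.integral_prod_right' (ν := (volume : Measure (ℝ × Ed d)))
    hm.stronglyMeasurable).measurable
  exact h3.const_mul _

theorem RadialSource.exists_norm_duhamelInt_le (hF : RadialSource F) (a : ℝ) :
    ∃ M : ℝ, ∀ t x, ‖duhamelInt a F t x‖ ≤ M := by
  obtain ⟨T, g, hT0, hg, hT⟩ := hF.domFT
  refine ⟨‖(((2 * Real.pi) ^ (-(d : ℝ)) : ℝ) : ℂ)‖ *
    ∫ p : ℝ × Ed d, (Set.Icc (-T) T).indicator (fun _ => 1) p.1 * g p.2, fun t x => ?_⟩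
  rw [duhamelInt, norm_mul]
  refine mul_le_mul_of_nonneg_left (norm_integral_le_of_norm_le
    ((integrable_indicator_Icc 1 T).mul_prod hg) (Filter.Eventually.of_forall fun p => ?_))
    (norm_nonneg _)
  rw [norm_mul, norm_mul, norm_mul, norm_exp_I_mul, norm_exp_negI_mul, one_mul, one_mul]
  exact (mul_le_of_le_one_left (norm_nonneg _) (norm_duhamel_le _)).trans (hT p.1 p.2)

theorem RadialSource.isRadial_duhamelInt (hF : RadialSource F) (a t : ℝ) :
    IsRadial (duhamelInt a F t) := by
  intro x y hxy
  rw [duhamelInt, duhamelInt]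
  congr 1
  have h2 := fun x => integral_prod _ (hF.integrable_duhamelInt a t x)
  simp only [integral_const_mul] at h2
  refine (h2 x).trans (Eq.trans ?_ (h2 y).symm)
  congr 1
  ext t'
  congr 1
  have hr : IsRadial fun ξ : Ed d =>
      Complex.exp (-I * (((t - t') * ‖ξ‖ ^ a : ℝ) : ℂ)) * FT (F t') ξ := fun ξ η h => by
    simp only [h, FT_eq_of_norm_eq (hF.radial t') h]
  have e1 : ∀ z : Ed d, ∫ ξ : Ed d, Complex.exp (I * ((⟪z, ξ⟫ : ℝ) : ℂ)) *
      (Complex.exp (-I * (((t - t') * ‖ξ‖ ^ a : ℝ) : ℂ)) * FT (F t') ξ) =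
      FT (fun ξ : Ed d => Complex.exp (-I * (((t - t') * ‖ξ‖ ^ a : ℝ) : ℂ)) * FT (F t') ξ)
        (-z) := fun z => by
    rw [FT]
    congr 1
    ext ξ
    rw [inner_neg_right, real_inner_comm]
    push_cast
    ring_nf
  rw [e1, e1]
  exact FT_eq_of_norm_eq hr (by rw [norm_neg, norm_neg, hxy])

theorem conj_FT (f : Ed d → ℂ) (ξ : Ed d) : (starRingEnd ℂ) (FT f ξ) =
    ∫ x, Complex.exp (I * ((⟪x, ξ⟫ : ℝ) : ℂ)) * (starRingEnd ℂ) (f x) := by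
  rw [FT, ← integral_conj]
  congr 1
  ext x
  rw [map_mul, ← Complex.exp_conj, map_mul, map_neg, Complex.conj_I, Complex.conj_ofReal, neg_neg]

theorem RadialSource.integral_duhamelInt_mul_conj (hF : RadialSource F) (hG : SpaceTimeTest G)
    (a t : ℝ) :
    ∫ x, duhamelInt a F t x * (starRingEnd ℂ) (G t x) = (((2 * Real.pi) ^ (-(d : ℝ)) : ℝ) : ℂ) *
      ∫ p : ℝ × Ed d, pairing a F G ((p.1, t), p.2) := by
  have hGi := (hG.space t).integrable
  have hconj : Measurable (starRingEnd ℂ) := Complex.continuous_conj.measurable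
  have hInt : Integrable (fun q : Ed d × (ℝ × Ed d) => duhamel (q.2.1, t) *
      (Complex.exp (I * ((⟪q.1, q.2.2⟫ : ℝ) : ℂ)) *
      (Complex.exp (-I * (((t - q.2.1) * ‖q.2.2‖ ^ a : ℝ) : ℂ)) * FT (F q.2.1) q.2.2)) *
      (starRingEnd ℂ) (G t q.1)) (volume.prod volume) := by
    obtain ⟨T, g, hT0, hg, hT⟩ := hF.domFT
    refine (hGi.norm.mul_prod ((integrable_indicator_Icc 1 T).mul_prod hg)).mono'
      (Measurable.aestronglyMeasurable ?_) (Filter.Eventually.of_forall fun q => ?_)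
    · have h1 : Measurable fun q : Ed d × (ℝ × Ed d) => duhamel (q.2.1, t) :=
        measurable_duhamel.comp (f := fun q : Ed d × (ℝ × Ed d) => (q.2.1, t)) (by fun_prop)
      have h2 : Measurable fun q : Ed d × (ℝ × Ed d) => FT (F q.2.1) q.2.2 :=
        (measurable_FT_of_measurable_uncurry hF.meas).comp measurable_snd
      have h3 : Measurable fun q : Ed d × (ℝ × Ed d) => (starRingEnd ℂ) (G t q.1) :=
        hconj.comp ((hG.space t).meas.comp measurable_fst)
      exact (h1.mul (Measurable.mul (by fun_prop) (Measurable.mul (by fun_prop) h2))).mul h3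
    · rw [norm_mul, norm_mul, norm_mul, norm_mul, norm_exp_I_mul, norm_exp_negI_mul, one_mul,
        one_mul, RCLike.norm_conj, mul_comm]
      exact mul_le_mul_of_nonneg_left ((mul_le_of_le_one_left (norm_nonneg _)
        (norm_duhamel_le _)).trans (hT _ _)) (norm_nonneg _)
  simp only [duhamelInt, mul_assoc ((((2 * Real.pi) ^ (-(d : ℝ)) : ℝ) : ℂ))]
  rw [integral_const_mul]
  congr 1
  simp only [← integral_mul_const]
  rw [integral_integral_swap (by exact hInt)]
  congr 1
  ext p
  rw [pairing, conj_FT, ← integral_const_mul, ← integral_const_mul, ← integral_const_mul]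
  congr 1
  ext x
  ring

theorem RadialSource.integral_integral_duhamelInt (hF : RadialSource F) (hG : SpaceTimeTest G)
    (a : ℝ) :
    ∫ t, (∫ x, duhamelInt a F t x * (starRingEnd ℂ) (G t x)) =
      (((2 * Real.pi) ^ (-(d : ℝ)) : ℝ) : ℂ) * ∫ w : (ℝ × ℝ) × Ed d, pairing a F G w := by
  simp only [hF.integral_duhamelInt_mul_conj hG]
  rw [integral_const_mul]
  congr 1
  have hi := hF.integrable_pairing hG a
  have h1 := integral_prod _ hi
  have h2 := integral_prod_symm _ hi.integral_prod_left
  refine Eq.trans ?_ (h1.trans h2).symm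
  congr 1
  ext t
  refine integral_prod (fun p : ℝ × Ed d => pairing a F G ((p.1, t), p.2)) ?_
  obtain ⟨T, g, hT0, hg, hT⟩ := hF.domFT
  obtain ⟨M', T', hM0', hM'⟩ := hG.exists_norm_FT_le
  refine (((integrable_indicator_Icc 1 T).mul_prod hg).mul_const M').mono'
    ((measurable_pairing a hF.meas hG.meas).comp
      (f := fun p : ℝ × Ed d => ((p.1, t), p.2)) (by fun_prop)).aestronglyMeasurable
    (Filter.Eventually.of_forall fun p => (norm_pairing_le _ _ _ _).trans ?_)
  have h3 : ‖FT (G t) p.2‖ ≤ M' :=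
    (hM' t p.2).trans (Set.indicator_le_self' (fun _ _ => hM0') t)
  have h4 := hT p.1 p.2
  exact mul_le_mul h4 h3 (norm_nonneg _) ((norm_nonneg _).trans h4)

/-- The inhomogeneous Strichartz estimate in dual form. -/
theorem exists_norm_integral_duhamelInt_le (hd : 2 ≤ d) {a : ℝ} (ha1 : 1 < a) (ha2 : a < 2)
    (had : 2 * (d : ℝ) / (2 * d - 1) < a) {e e' : ℝ} (he : 0 ≤ e) (he2 : e ≤ 1 / 2)
    (he' : 0 ≤ e') (he2' : e' ≤ 1 / 2) :
    ∃ C : ℝ, 0 < C ∧ ∀ F G : ℝ → Ed d → ℂ, RadialSource F → SpaceTimeTest G →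
      stN e (spExp d a e) F ≠ ∞ →
      ‖∫ t, (∫ x, duhamelInt a F t x * (starRingEnd ℂ) (G t x))‖ ≤
        C * (stN e (spExp d a e) F).toReal * nrm a e' G := by
  obtain ⟨C, hC, h⟩ := exists_norm_integral_pairing_le hd ha1 ha2 had he he2 he' he2'
  have hc : 0 < (2 * Real.pi) ^ (-(d : ℝ)) := by positivity
  refine ⟨(2 * Real.pi) ^ (-(d : ℝ)) * C, by positivity, fun F G hF hG hfin => ?_⟩
  rw [hF.integral_integral_duhamelInt hG, norm_mul, Complex.norm_real, Real.norm_of_nonneg hc.le]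
  have := mul_le_mul_of_nonneg_left (h F G hF hG hfin) hc.le
  linarith

end DuhamelIntegral


section Duality

variable {d : ℕ} {U u : ℝ → Ed d → ℂ}

theorem norm_mul_norm_rpow (z : ℂ) {r : ℝ} (hr : 2 ≤ r) :
    ‖z * ((‖z‖ ^ (r - 2) : ℝ) : ℂ)‖ = ‖z‖ ^ (r - 1) := by
  rw [norm_mul, Complex.norm_real, Real.norm_of_nonneg (by positivity)]
  rcases eq_or_ne z 0 with rfl | hz
  · rw [norm_zero, zero_mul, Real.zero_rpow (by linarith)]
  · have : 0 < ‖z‖ := norm_pos_iff.2 hz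
    nth_rewrite 1 [← Real.rpow_one ‖z‖]
    rw [← Real.rpow_add this]
    congr 1
    ring

theorem SpaceTimeTest.dual (hU : SpaceTimeTest U) {r : ℝ} (hr : 2 ≤ r) :
    SpaceTimeTest fun t x => U t x * ((‖U t x‖ ^ (r - 2) : ℝ) : ℂ) := by
  obtain ⟨M, hM⟩ := hU.bdd
  obtain ⟨T, hT0, hT⟩ := hU.supp
  have hm : Measurable fun p : ℝ × Ed d => U p.1 p.2 := hU.meas
  refine ⟨?_, ⟨M ^ (r - 1), fun t x => ?_⟩, ⟨T, hT0, fun t x hx => hT t x (left_ne_zero_of_mul hx)⟩,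
    fun t x y h => ?_⟩
  · have : Measurable fun p : ℝ × Ed d => U p.1 p.2 * ((‖U p.1 p.2‖ ^ (r - 2) : ℝ) : ℂ) := by
      fun_prop
    exact this
  · rw [norm_mul_norm_rpow _ hr]
    exact Real.rpow_le_rpow (norm_nonneg _) (hM t x) (by linarith)
  · simp only [hU.radial t x y h]

theorem SpaceTest.spN_toReal_rpow {f : Ed d → ℂ} (hf : SpaceTest f) {r : ℝ} (hr : 0 < r) :
    (spN r f).toReal ^ r = ∫ x, ‖f x‖ ^ r := by
  have h0 : 0 ≤ ∫ x, ‖f x‖ ^ r := integral_nonneg fun x => by positivity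
  rw [hf.spN_eq hr, ENNReal.toReal_ofReal (by positivity), ← Real.rpow_mul h0,
    one_div_mul_cancel hr.ne', Real.rpow_one]

theorem SpaceTest.spN_dual {f : Ed d → ℂ} (hf : SpaceTest f) {r ρ c : ℝ} (hr : 2 ≤ r)
    (hρ : 0 < ρ) (h : ρ * (r - 1) = r) (hc : 0 ≤ c) :
    spN ρ (fun x => (c : ℂ) * (f x * ((‖f x‖ ^ (r - 2) : ℝ) : ℂ))) =
      ENNReal.ofReal (c * (spN r f).toReal ^ (r - 1)) := by
  have h0 : 0 ≤ ∫ x, ‖f x‖ ^ r := integral_nonneg fun x => by positivity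
  have hr0 : 0 < r := by linarith
  have e1 : ∀ x, ‖(c : ℂ) * (f x * ((‖f x‖ ^ (r - 2) : ℝ) : ℂ))‖ₑ ^ ρ =
      ENNReal.ofReal (c ^ ρ * ‖f x‖ ^ r) := fun x => by
    rw [← ofReal_norm, norm_mul, norm_mul_norm_rpow _ hr, Complex.norm_real,
      Real.norm_of_nonneg hc, ENNReal.ofReal_rpow_of_nonneg (by positivity) hρ.le,
      Real.mul_rpow hc (by positivity), ← Real.rpow_mul (norm_nonneg _), mul_comm (r - 1), h]
  rw [spN]
  simp only [e1]
  rw [← ofReal_integral_eq_lintegral_ofReal ((hf.integrable_rpow hr0).const_mul _)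
    (Filter.Eventually.of_forall fun x => by positivity), integral_const_mul,
    ENNReal.ofReal_rpow_of_nonneg (by positivity) (by positivity),
    Real.mul_rpow (by positivity) h0, ← Real.rpow_mul hc, mul_one_div_cancel hρ.ne', Real.rpow_one,
    hf.spN_eq hr0, ENNReal.toReal_ofReal (by positivity), ← Real.rpow_mul h0]
  congr 3
  field_simp
  linarith

/-- Testing against the dual function of `U`, weighted by `c` in time. -/
theorem integral_mul_spN_rpow_le {a e r K : ℝ} (ha : 0 ≤ a) (he : 0 ≤ e)
    (hr : 2 ≤ r) (hρr : spExp d a e * (r - 1) = r)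
    (hu : ∀ G : ℝ → Ed d → ℂ, SpaceTimeTest G →
      ‖∫ t, (∫ x, u t x * (starRingEnd ℂ) (G t x))‖ ≤ K * nrm a e G)
    (hU : SpaceTimeTest U) (hUu : ∀ t x, U t x ≠ 0 → U t x = u t x) {c : ℝ → ℝ}
    (hc : Measurable c) (hc0 : ∀ t, 0 ≤ c t) {B : ℝ} (hB : ∀ t, c t ≤ B) :
    ∫ t, c t * (spN r (U t)).toReal ^ r ≤
      K * ((∫⁻ t, ENNReal.ofReal (c t * (spN r (U t)).toReal ^ (r - 1)) ^ (1 - e)⁻¹) ^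
        (1 - e)).toReal := by
  have hG : SpaceTimeTest fun t x => (c t : ℂ) * (U t x * ((‖U t x‖ ^ (r - 2) : ℝ) : ℂ)) :=
    (hU.dual hr).time_mul (c := fun t => (c t : ℂ)) (by fun_prop) (K := B) fun t => by
      rw [Complex.norm_real, Real.norm_of_nonneg (hc0 t)]
      exact hB t
  have h1 := hu _ hG
  have e1 : ∀ t x, u t x * (starRingEnd ℂ) ((c t : ℂ) * (U t x * ((‖U t x‖ ^ (r - 2) : ℝ) : ℂ))) =
      ((c t * ‖U t x‖ ^ r : ℝ) : ℂ) := fun t x => by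
    by_cases h0 : U t x = 0
    · simp [h0, Real.zero_rpow (by linarith : r ≠ 0)]
    rw [← hUu t x h0, map_mul, map_mul, Complex.conj_ofReal, Complex.conj_ofReal]
    have h2 : U t x * ((c t : ℂ) * ((starRingEnd ℂ) (U t x) * ((‖U t x‖ ^ (r - 2) : ℝ) : ℂ))) =
        (c t : ℂ) * ((U t x * (starRingEnd ℂ) (U t x)) * ((‖U t x‖ ^ (r - 2) : ℝ) : ℂ)) := by ring
    rw [h2, Complex.mul_conj, Complex.normSq_eq_norm_sq, ← Complex.ofReal_mul,
      ← Complex.ofReal_mul, ← Real.rpow_natCast, ← Real.rpow_add (norm_pos_iff.2 h0)]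
    congr 3
    push_cast
    ring
  simp only [e1, integral_complex_ofReal, integral_const_mul,
    ← (hU.space _).spN_toReal_rpow (by linarith : 0 < r)] at h1
  rw [Complex.norm_real] at h1
  refine (Real.le_norm_self _).trans (h1.trans (le_of_eq ?_))
  rw [nrm, stN]
  simp only [(hU.space _).spN_dual hr (spExp_pos ha he) hρr (hc0 _)]

end Duality


section LevelSets

variable {d : ℕ} {U u : ℝ → Ed d → ℂ}

theorem rpow_le_of_mem_Icc {ε M v σ : ℝ} (hε : 0 < ε) (h1 : ε ≤ v) (h2 : v ≤ M) :
    v ^ σ ≤ ε ^ σ + M ^ σ := by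
  have hv : 0 < v := hε.trans_le h1
  have hM : 0 < M := hv.trans_le h2
  rcases le_total 0 σ with h | h
  · have h3 := Real.rpow_le_rpow hv.le h2 h
    have h4 : 0 ≤ ε ^ σ := by positivity
    linarith
  · have h3 := Real.rpow_le_rpow_of_nonpos hε h1 h
    have h4 : 0 ≤ M ^ σ := by positivity
    linarith

theorem SpaceTimeTest.exists_spN_toReal_le (hU : SpaceTimeTest U) {r : ℝ} (hr : 0 < r) :
    ∃ M T : ℝ, 0 ≤ M ∧
      ∀ t, (spN r (U t)).toReal ≤ (Set.Icc (-T) T).indicator (fun _ => M) t := by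
  obtain ⟨M, T, hM, h⟩ := hU.exists_spN_le hr
  refine ⟨M.toReal, T, ENNReal.toReal_nonneg, fun t => ?_⟩
  have h1 := h t
  by_cases ht : t ∈ Set.Icc (-T) T
  · rw [Set.indicator_of_mem ht] at h1 ⊢
    exact ENNReal.toReal_mono hM h1
  · rw [Set.indicator_of_notMem ht] at h1 ⊢
    rw [nonpos_iff_eq_zero.1 h1, ENNReal.toReal_zero]

theorem integrable_indicator_level {V : ℝ → ℝ} (hV : Measurable V) {M T : ℝ} (hM : 0 ≤ M)
    (hVM : ∀ t, V t ≤ (Set.Icc (-T) T).indicator (fun _ => M) t) {ε : ℝ} (hε : 0 < ε) (σ : ℝ) :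
    Integrable ({t | ε ≤ V t}.indicator fun t => V t ^ σ) := by
  refine (integrable_indicator_Icc (ε ^ σ + M ^ σ) T).mono' (Measurable.aestronglyMeasurable ?_)
    (Filter.Eventually.of_forall fun t => ?_)
  · exact (hV.pow_const σ).indicator (measurableSet_le measurable_const hV)
  · by_cases ht : t ∈ {t | ε ≤ V t}
    · rw [Set.indicator_of_mem ht]
      have h0 : 0 < V t := hε.trans_le ht
      have hmem : t ∈ Set.Icc (-T) T := by
        by_contra h
        have := hVM t
        rw [Set.indicator_of_notMem h] at this
        linarith
      have h1 := hVM t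
      rw [Set.indicator_of_mem hmem] at h1 ⊢
      rw [Real.norm_of_nonneg (by positivity)]
      exact rpow_le_of_mem_Icc hε ht h1
    · rw [Set.indicator_of_notMem ht, norm_zero]
      exact Set.indicator_nonneg (fun _ _ => by positivity) _

theorem indicator_level_mul {V : ℝ → ℝ} {ε : ℝ} (hε : 0 < ε) (σ τ : ℝ) (t : ℝ) :
    {t | ε ≤ V t}.indicator (fun t => V t ^ σ) t * V t ^ τ =
      {t | ε ≤ V t}.indicator (fun t => V t ^ (σ + τ)) t := by
  by_cases ht : t ∈ {t | ε ≤ V t}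
  · rw [Set.indicator_of_mem ht, Set.indicator_of_mem ht, Real.rpow_add (hε.trans_le ht)]
  · rw [Set.indicator_of_notMem ht, Set.indicator_of_notMem ht, zero_mul]

theorem integral_level_le {a e r K : ℝ} (ha : 0 ≤ a) (he : 0 ≤ e)
    (hr : 2 ≤ r) (hρr : spExp d a e * (r - 1) = r)
    (hu : ∀ G : ℝ → Ed d → ℂ, SpaceTimeTest G →
      ‖∫ t, (∫ x, u t x * (starRingEnd ℂ) (G t x))‖ ≤ K * nrm a e G)
    (hU : SpaceTimeTest U) (hUu : ∀ t x, U t x ≠ 0 → U t x = u t x) {ε : ℝ} (hε : 0 < ε) (σ : ℝ) :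
    ∫ t, {t | ε ≤ (spN r (U t)).toReal}.indicator (fun t => (spN r (U t)).toReal ^ σ) t ≤
      K * ((∫⁻ t, ENNReal.ofReal ({t | ε ≤ (spN r (U t)).toReal}.indicator
        (fun t => (spN r (U t)).toReal ^ (σ - 1)) t) ^ (1 - e)⁻¹) ^ (1 - e)).toReal := by
  obtain ⟨M, T, hM, hVM⟩ := hU.exists_spN_toReal_le (r := r) (by linarith)
  have hV : Measurable fun t => (spN r (U t)).toReal := (hU.measurable_spN r).ennreal_toReal
  have h := integral_mul_spN_rpow_le ha he hr hρr hu hU hUu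
    (c := {t | ε ≤ (spN r (U t)).toReal}.indicator fun t => (spN r (U t)).toReal ^ (σ - r))
    ((hV.pow_const _).indicator (measurableSet_le measurable_const hV))
    (fun t => Set.indicator_nonneg (fun _ _ => by positivity) _)
    (B := ε ^ (σ - r) + M ^ (σ - r)) fun t => by
      by_cases ht : t ∈ {t | ε ≤ (spN r (U t)).toReal}
      · rw [Set.indicator_of_mem ht]
        exact rpow_le_of_mem_Icc hε ht
          ((hVM t).trans (Set.indicator_le_self' (fun _ _ => hM) t))
      · rw [Set.indicator_of_notMem ht]
        positivity
  have e1 := indicator_level_mul (V := fun t => (spN r (U t)).toReal) hε (σ - r) r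
  have e2 := indicator_level_mul (V := fun t => (spN r (U t)).toReal) hε (σ - r) (r - 1)
  simp only [e1, e2] at h
  convert h using 3
  · rw [sub_add_cancel]
  · ring_nf

theorem lintegral_level_rpow_le {a e r K : ℝ} (ha : 0 ≤ a) (he : 0 < e) (he1 : e < 1)
    (hr : 2 ≤ r) (hρr : spExp d a e * (r - 1) = r) (hK : 0 ≤ K)
    (hu : ∀ G : ℝ → Ed d → ℂ, SpaceTimeTest G →
      ‖∫ t, (∫ x, u t x * (starRingEnd ℂ) (G t x))‖ ≤ K * nrm a e G)
    (hU : SpaceTimeTest U) (hUu : ∀ t x, U t x ≠ 0 → U t x = u t x) {ε : ℝ} (hε : 0 < ε) :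
    ∫⁻ t, ENNReal.ofReal ({t | ε ≤ (spN r (U t)).toReal}.indicator
      (fun t => (spN r (U t)).toReal ^ e⁻¹) t) ≤ ENNReal.ofReal (K ^ e⁻¹) := by
  obtain ⟨M, T, hM, hVM⟩ := hU.exists_spN_toReal_le (r := r) (by linarith)
  have hV : Measurable fun t => (spN r (U t)).toReal := (hU.measurable_spN r).ennreal_toReal
  have h := integral_level_le ha he.le hr hρr hu hU hUu hε e⁻¹
  have hi := integrable_indicator_level hV hM hVM hε e⁻¹
  have hnn : ∀ t, 0 ≤ {t | ε ≤ (spN r (U t)).toReal}.indicator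
      (fun t => (spN r (U t)).toReal ^ e⁻¹) t := fun t =>
    Set.indicator_nonneg (fun _ _ => by positivity) _
  have h1e : 0 < 1 - e := by linarith
  have e1 : ∀ t, ENNReal.ofReal ({t | ε ≤ (spN r (U t)).toReal}.indicator
        (fun t => (spN r (U t)).toReal ^ (e⁻¹ - 1)) t) ^ (1 - e)⁻¹ =
      ENNReal.ofReal ({t | ε ≤ (spN r (U t)).toReal}.indicator
        (fun t => (spN r (U t)).toReal ^ e⁻¹) t) := fun t => by
    by_cases ht : t ∈ {t | ε ≤ (spN r (U t)).toReal}
    · rw [Set.indicator_of_mem ht, Set.indicator_of_mem ht,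
        ENNReal.ofReal_rpow_of_nonneg (by positivity) (by positivity),
        ← Real.rpow_mul ENNReal.toReal_nonneg]
      congr 2
      field_simp
    · rw [Set.indicator_of_notMem ht, Set.indicator_of_notMem ht, ENNReal.ofReal_zero,
        ENNReal.zero_rpow_of_pos (by positivity)]
  simp only [e1] at h
  rw [← ofReal_integral_eq_lintegral_ofReal hi (Filter.Eventually.of_forall hnn)] at h ⊢
  set Y := ∫ t, {t | ε ≤ (spN r (U t)).toReal}.indicator
      (fun t => (spN r (U t)).toReal ^ e⁻¹) t
  have hY : 0 ≤ Y := integral_nonneg hnn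
  rw [ENNReal.ofReal_rpow_of_nonneg hY h1e.le, ENNReal.toReal_ofReal (by positivity)] at h
  refine ENNReal.ofReal_le_ofReal ?_
  rcases hY.eq_or_lt with h0 | h0
  · rw [← h0]
    positivity
  have h2 : Y ^ e ≤ K := by
    have h3 : Y = Y ^ e * Y ^ (1 - e) := by
      rw [← Real.rpow_add h0, add_sub_cancel, Real.rpow_one]
    have h4 : 0 < Y ^ (1 - e) := by positivity
    rw [h3] at h
    refine le_of_mul_le_mul_right (h.trans (le_of_eq ?_)) h4
    rw [← h3]
  calc Y = (Y ^ e) ^ e⁻¹ := by rw [← Real.rpow_mul hY, mul_inv_cancel₀ he.ne', Real.rpow_one]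
    _ ≤ K ^ e⁻¹ := Real.rpow_le_rpow (by positivity) h2 (by positivity)

theorem ae_spN_toReal_le {a r K : ℝ} (ha : 0 ≤ a)
    (hr : 2 ≤ r) (hρr : spExp d a 0 * (r - 1) = r) (hK : 0 ≤ K)
    (hu : ∀ G : ℝ → Ed d → ℂ, SpaceTimeTest G →
      ‖∫ t, (∫ x, u t x * (starRingEnd ℂ) (G t x))‖ ≤ K * nrm a 0 G)
    (hU : SpaceTimeTest U) (hUu : ∀ t x, U t x ≠ 0 → U t x = u t x) :
    ∀ᵐ t, (spN r (U t)).toReal ≤ K := by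
  obtain ⟨M, T, hM, hVM⟩ := hU.exists_spN_toReal_le (r := r) (by linarith)
  have hV : Measurable fun t => (spN r (U t)).toReal := (hU.measurable_spN r).ennreal_toReal
  have key : ∀ n : ℕ, ∀ᵐ t, (spN r (U t)).toReal < K + ((n : ℝ) + 1)⁻¹ := fun n => by
    have hε' : 0 < ((n : ℝ) + 1)⁻¹ := by positivity
    have hε : 0 < K + ((n : ℝ) + 1)⁻¹ := by positivity
    have h := integral_level_le ha le_rfl hr hρr hu hU hUu hε 1
    have hi1 := integrable_indicator_level hV hM hVM hε 1
    have hi0 := integrable_indicator_level hV hM hVM hε 0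
    simp only [sub_zero, inv_one, ENNReal.rpow_one, sub_self] at h
    rw [← ofReal_integral_eq_lintegral_ofReal hi0 (Filter.Eventually.of_forall fun t =>
      Set.indicator_nonneg (fun _ _ => by positivity) _), ENNReal.toReal_ofReal
      (integral_nonneg fun t => Set.indicator_nonneg (fun _ _ => by positivity) _)] at h
    have hle : (K + ((n : ℝ) + 1)⁻¹) * ∫ t, {t | K + ((n : ℝ) + 1)⁻¹ ≤
        (spN r (U t)).toReal}.indicator (fun t => (spN r (U t)).toReal ^ (0 : ℝ)) t ≤
        ∫ t, {t | K + ((n : ℝ) + 1)⁻¹ ≤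
        (spN r (U t)).toReal}.indicator (fun t => (spN r (U t)).toReal ^ (1 : ℝ)) t := by
      rw [← integral_const_mul]
      refine integral_mono (hi0.const_mul _) hi1 fun t => ?_
      by_cases ht : t ∈ {t | K + ((n : ℝ) + 1)⁻¹ ≤ (spN r (U t)).toReal}
      · simp only [Set.indicator_of_mem ht, Real.rpow_zero, Real.rpow_one, mul_one]
        exact ht
      · simp only [Set.indicator_of_notMem ht, mul_zero, le_refl]
    set Z := ∫ t, {t | K + ((n : ℝ) + 1)⁻¹ ≤
        (spN r (U t)).toReal}.indicator (fun t => (spN r (U t)).toReal ^ (0 : ℝ)) t with hZ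
    have hZ0 : Z = 0 := by
      have h0 : 0 ≤ Z := integral_nonneg fun t => Set.indicator_nonneg (fun _ _ => by positivity) _
      nlinarith
    rw [hZ, integral_eq_zero_iff_of_nonneg (fun t =>
      Set.indicator_nonneg (fun _ _ => by positivity) _) hi0] at hZ0
    filter_upwards [hZ0] with t ht
    by_contra hlt
    push Not at hlt
    have hmem : t ∈ {t | K + ((n : ℝ) + 1)⁻¹ ≤ (spN r (U t)).toReal} := hlt
    rw [Set.indicator_of_mem hmem, Real.rpow_zero] at ht
    simp at ht
  filter_upwards [ae_all_iff.2 key] with t ht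
  have hlim : Filter.Tendsto (fun n : ℕ => K + ((n : ℝ) + 1)⁻¹) Filter.atTop (nhds (K + 0)) := by
    refine tendsto_const_nhds.add ?_
    simpa only [one_div] using tendsto_one_div_add_atTop_nhds_zero_nat (𝕜 := ℝ)
  rw [add_zero] at hlim
  exact ge_of_tendsto hlim (Filter.Eventually.of_forall fun n => (ht n).le)

end LevelSets


section Exhaustion

variable {d : ℕ} {u : ℝ → Ed d → ℂ}

/-- Restriction to a bounded time interval and an annulus in space. -/
def window (n : ℕ) (u : ℝ → Ed d → ℂ) (t : ℝ) (x : Ed d) : ℂ :=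
  if |t| ≤ (n : ℝ) + 1 then cutoff ((n : ℝ) + 1) u t x else 0

theorem window_eq_of_ne_zero {n : ℕ} {t : ℝ} {x : Ed d} (h : window n u t x ≠ 0) :
    (|t| ≤ (n : ℝ) + 1 ∧ ((n : ℝ) + 1)⁻¹ ≤ ‖x‖ ∧ ‖x‖ ≤ (n : ℝ) + 1) ∧ window n u t x = u t x := by
  unfold window cutoff at *
  split_ifs at h ⊢ with h1 h2
  · exact ⟨⟨h1, h2⟩, rfl⟩
  · exact absurd rfl h
  · exact absurd rfl h

theorem spaceTimeTest_window (hm : Measurable (Function.uncurry u)) {M : ℝ}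
    (hM : ∀ t x, ‖u t x‖ ≤ M) (hr : ∀ t, IsRadial (u t)) (n : ℕ) :
    SpaceTimeTest (window n u) := by
  refine ⟨?_, ⟨M, fun t x => ?_⟩, ⟨(n : ℝ) + 1, by positivity, fun t x hx =>
    (window_eq_of_ne_zero hx).1⟩, fun t x y h => ?_⟩
  · have hs : MeasurableSet {p : ℝ × Ed d | |p.1| ≤ (n : ℝ) + 1} := by
      have hn : Measurable fun p : ℝ × Ed d => |p.1| := by fun_prop
      exact measurableSet_le hn measurable_const
    exact Measurable.ite hs (measurable_cutoff _ hm) measurable_const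
  · by_cases h : window n u t x = 0
    · rw [h, norm_zero]
      exact (norm_nonneg _).trans (hM t x)
    · rw [(window_eq_of_ne_zero h).2]
      exact hM t x
  · unfold window
    rw [isRadial_cutoff _ (hr t) x y h]

theorem monotone_norm_window (t : ℝ) (x : Ed d) : Monotone fun n : ℕ => ‖window n u t x‖ₑ := by
  intro m n hmn
  have hmn' : (m : ℝ) ≤ n := by exact_mod_cast hmn
  by_cases h : window m u t x = 0
  · simp [h]
  · obtain ⟨⟨h1, h2, h3⟩, h4⟩ := window_eq_of_ne_zero h
    have h5 : window n u t x = u t x := by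
      have h6 : ((n : ℝ) + 1)⁻¹ ≤ ((m : ℝ) + 1)⁻¹ := inv_anti₀ (by positivity) (by linarith)
      rw [window, if_pos (by linarith), cutoff, if_pos ⟨h6.trans h2, by linarith⟩]
    simp only [h4, h5, le_refl]

theorem tendsto_window (t : ℝ) {x : Ed d} (hx : x ≠ 0) :
    Filter.Tendsto (fun n : ℕ => window n u t x) Filter.atTop (nhds (u t x)) := by
  refine (tendsto_cutoff u t hx).congr' ?_
  obtain ⟨N, hN⟩ := exists_nat_ge |t|
  filter_upwards [Filter.eventually_ge_atTop N] with n hn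
  have : (N : ℝ) ≤ n := by exact_mod_cast hn
  rw [window, if_pos (by linarith)]

theorem tendsto_spN_window (hd : 2 ≤ d) (hm : Measurable (Function.uncurry u)) {r : ℝ} (hr : 0 < r)
    (t : ℝ) :
    Filter.Tendsto (fun n : ℕ => spN r (window n u t)) Filter.atTop (nhds (spN r (u t))) := by
  have : NeZero d := ⟨by omega⟩
  unfold spN
  refine Filter.Tendsto.ennrpow_const _ (lintegral_tendsto_of_tendsto_of_monotone (fun n => ?_)
    (Filter.Eventually.of_forall fun x m n hmn =>
      ENNReal.rpow_le_rpow (monotone_norm_window t x hmn) hr.le) ?_)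
  · have hc : Measurable (cutoff ((n : ℝ) + 1) u t) := (measurable_cutoff _ hm).of_uncurry_left
    have hw : Measurable (window n u t) := by
      unfold window
      split_ifs
      · exact hc
      · exact measurable_const
    exact (hw.enorm.pow_const r).aemeasurable
  · have h0 : ∀ᵐ x : Ed d, x ≠ 0 := Measure.ae_ne volume 0
    filter_upwards [h0] with x hx
    exact Filter.Tendsto.ennrpow_const _ (tendsto_window t hx).enorm

theorem ae_spN_le_of_dual (hd : 2 ≤ d) {a r K : ℝ} (ha : 0 ≤ a)
    (hr : 2 ≤ r) (hρr : spExp d a 0 * (r - 1) = r) (hK : 0 ≤ K)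
    (hm : Measurable (Function.uncurry u)) {M : ℝ} (hM : ∀ t x, ‖u t x‖ ≤ M)
    (hrad : ∀ t, IsRadial (u t))
    (hu : ∀ G : ℝ → Ed d → ℂ, SpaceTimeTest G →
      ‖∫ t, (∫ x, u t x * (starRingEnd ℂ) (G t x))‖ ≤ K * nrm a 0 G) :
    ∀ᵐ t, spN r (u t) ≤ ENNReal.ofReal K := by
  have hW := spaceTimeTest_window hm hM hrad
  have h1 : ∀ᵐ t, ∀ n : ℕ, (spN r (window n u t)).toReal ≤ K := ae_all_iff.2 fun n =>
    ae_spN_toReal_le ha hr hρr hK hu (hW n) fun t x hx => (window_eq_of_ne_zero hx).2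
  filter_upwards [h1] with t ht
  refine le_of_tendsto (tendsto_spN_window hd hm (by linarith) t) (Filter.Eventually.of_forall
    fun n => ?_)
  rw [← ENNReal.ofReal_toReal ((hW n).spN_ne_top (by linarith) t)]
  exact ENNReal.ofReal_le_ofReal (ht n)

theorem lintegral_spN_rpow_le_of_dual (hd : 2 ≤ d) {a e r K : ℝ} (ha : 0 ≤ a) (he : 0 < e)
    (he1 : e < 1) (hr : 2 ≤ r) (hρr : spExp d a e * (r - 1) = r) (hK : 0 ≤ K)
    (hm : Measurable (Function.uncurry u)) {M : ℝ} (hM : ∀ t x, ‖u t x‖ ≤ M)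
    (hrad : ∀ t, IsRadial (u t))
    (hu : ∀ G : ℝ → Ed d → ℂ, SpaceTimeTest G →
      ‖∫ t, (∫ x, u t x * (starRingEnd ℂ) (G t x))‖ ≤ K * nrm a e G) :
    ∫⁻ t, spN r (u t) ^ e⁻¹ ≤ ENNReal.ofReal (K ^ e⁻¹) := by
  have hW := spaceTimeTest_window hm hM hrad
  have hr0 : 0 < r := by linarith
  have hei : 0 < e⁻¹ := by positivity
  set h : ℕ → ℝ → ℝ≥0∞ := fun n t => ENNReal.ofReal
    ({t | ((n : ℝ) + 1)⁻¹ ≤ (spN r (window n u t)).toReal}.indicator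
      (fun t => (spN r (window n u t)).toReal ^ e⁻¹) t) with hh
  have hle : ∀ n, ∫⁻ t, h n t ≤ ENNReal.ofReal (K ^ e⁻¹) := fun n =>
    lintegral_level_rpow_le ha he he1 hr hρr hK hu (hW n)
      (fun t x hx => (window_eq_of_ne_zero hx).2) (by positivity)
  have hmeas : ∀ n, Measurable (h n) := fun n => by
    have hV : Measurable fun t => (spN r (window n u t)).toReal :=
      ((hW n).measurable_spN r).ennreal_toReal
    exact ((hV.pow_const _).indicator (measurableSet_le measurable_const hV)).ennreal_ofReal
  have hlim : ∀ t, Filter.Tendsto (fun n => h n t) Filter.atTop (nhds (spN r (u t) ^ e⁻¹)) := by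
    intro t
    have hv := tendsto_spN_window hd hm hr0 t
    have hv' : Filter.Tendsto (fun n : ℕ => spN r (window n u t) ^ e⁻¹) Filter.atTop
        (nhds (spN r (u t) ^ e⁻¹)) := Filter.Tendsto.ennrpow_const _ hv
    have e1 : ∀ n : ℕ, ((n : ℝ) + 1)⁻¹ ≤ (spN r (window n u t)).toReal →
        h n t = spN r (window n u t) ^ e⁻¹ := fun n hn => by
      have hmem : t ∈ {t | ((n : ℝ) + 1)⁻¹ ≤ (spN r (window n u t)).toReal} := hn
      simp only [hh]
      rw [Set.indicator_of_mem hmem, ← ENNReal.ofReal_rpow_of_nonneg ENNReal.toReal_nonneg hei.le,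
        ENNReal.ofReal_toReal ((hW n).spN_ne_top hr0 t)]
    have e2 : ∀ n, h n t ≤ spN r (window n u t) ^ e⁻¹ := fun n => by
      by_cases hn : ((n : ℝ) + 1)⁻¹ ≤ (spN r (window n u t)).toReal
      · exact (e1 n hn).le
      · have hmem : t ∉ {t | ((n : ℝ) + 1)⁻¹ ≤ (spN r (window n u t)).toReal} := hn
        simp only [hh]
        rw [Set.indicator_of_notMem hmem, ENNReal.ofReal_zero]
        exact zero_le
    rcases eq_or_ne (spN r (u t)) 0 with h0 | h0
    · rw [h0, ENNReal.zero_rpow_of_pos hei] at hv' ⊢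
      exact tendsto_of_tendsto_of_tendsto_of_le_of_le tendsto_const_nhds hv'
        (fun n => zero_le) e2
    · refine hv'.congr' ?_
      obtain ⟨δ, hδ0, hδ⟩ := exists_between (pos_iff_ne_zero.2 h0)
      have hδt : δ ≠ ∞ := (hδ.trans_le le_top).ne
      have h3 : Filter.Tendsto (fun n : ℕ => ((n : ℝ) + 1)⁻¹) Filter.atTop (nhds 0) := by
        simpa only [one_div] using tendsto_one_div_add_atTop_nhds_zero_nat (𝕜 := ℝ)
      filter_upwards [hv.eventually (lt_mem_nhds hδ),
        h3.eventually (gt_mem_nhds (ENNReal.toReal_pos hδ0.ne' hδt))] with n hn1 hn2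
      exact (e1 n (hn2.le.trans (ENNReal.toReal_mono ((hW n).spN_ne_top hr0 t) hn1.le))).symm
  calc ∫⁻ t, spN r (u t) ^ e⁻¹ = ∫⁻ t, Filter.liminf (fun n => h n t) Filter.atTop :=
        lintegral_congr fun t => (hlim t).liminf_eq.symm
    _ ≤ Filter.liminf (fun n => ∫⁻ t, h n t) Filter.atTop := lintegral_liminf_le hmeas
    _ ≤ Filter.liminf (fun _ : ℕ => ENNReal.ofReal (K ^ e⁻¹)) Filter.atTop :=
        Filter.liminf_le_liminf (Filter.Eventually.of_forall hle)
    _ = _ := Filter.liminf_const _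

end Exhaustion


section Assembly

variable {d : ℕ}

theorem eLpNorm_ofReal_eq_spN (f : Ed d → ℂ) {p : ℝ} (hp : 0 < p) :
    eLpNorm f (ENNReal.ofReal p) volume = spN p f := by
  rw [eLpNorm_eq_lintegral_rpow_enorm_toReal (by simpa using hp) ENNReal.ofReal_ne_top,
    ENNReal.toReal_ofReal hp.le, spN]

theorem enorm_toReal_le_self (x : ℝ≥0∞) : ‖x.toReal‖ₑ ≤ x := by
  rw [Real.enorm_of_nonneg ENNReal.toReal_nonneg]
  exact ENNReal.ofReal_toReal_le

/-- The exponents of an admissible pair in terms of the reciprocal time exponent. -/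
theorem admissible_exponents (hd : 2 ≤ d) {s : ℝ} (hs0 : 0 < s) {q r : ℝ≥0∞} (hq : 2 ≤ q)
    (hr : 2 ≤ r) (hadm : ENNReal.ofReal (2 * s) * q⁻¹ = (d : ℝ≥0∞) * (2⁻¹ - r⁻¹)) :
    0 ≤ (q⁻¹).toReal ∧ (q⁻¹).toReal ≤ 1 / 2 ∧ q⁻¹ = ENNReal.ofReal (q⁻¹).toReal ∧
      r⁻¹ = ENNReal.ofReal ((1 - thetaOf d (2 * s) (q⁻¹).toReal) / 2) := by
  have hd' : (2 : ℝ) ≤ d := by exact_mod_cast hd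
  have h2 : (2⁻¹ : ℝ≥0∞) ≠ ∞ := by simp
  have hqi : q⁻¹ ≤ 2⁻¹ := ENNReal.inv_le_inv.2 hq
  have hri : r⁻¹ ≤ 2⁻¹ := ENNReal.inv_le_inv.2 hr
  have hqt : q⁻¹ ≠ ∞ := (hqi.trans_lt h2.lt_top).ne
  have hrt : r⁻¹ ≠ ∞ := (hri.trans_lt h2.lt_top).ne
  have h := congrArg ENNReal.toReal hadm
  rw [ENNReal.toReal_mul, ENNReal.toReal_mul, ENNReal.toReal_ofReal (by linarith),
    ENNReal.toReal_sub_of_le hri h2, ENNReal.toReal_natCast] at h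
  have h3 : (2⁻¹ : ℝ≥0∞).toReal = 1 / 2 := by simp
  rw [h3] at h
  refine ⟨ENNReal.toReal_nonneg, ?_, (ENNReal.ofReal_toReal hqt).symm, ?_⟩
  · exact (ENNReal.toReal_mono h2 hqi).trans_eq h3
  · rw [← ENNReal.ofReal_toReal hrt]
    congr 1
    have h4 : thetaOf d (2 * s) (q⁻¹).toReal = 1 - 2 * (r⁻¹).toReal := by
      rw [thetaOf, div_eq_iff (by linarith)]
      linarith
    rw [h4]
    ring

theorem eq_ofReal_of_inv_eq {x : ℝ≥0∞} {y : ℝ} (hy : 0 < y) (h : x⁻¹ = ENNReal.ofReal y) :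
    x = ENNReal.ofReal y⁻¹ := by
  rw [ENNReal.ofReal_inv_of_pos hy, ← h, inv_inv]

theorem mixedNorm_eq_stN {e p : ℝ} (he1 : e < 1) (hp : 0 < p) {F : ℝ → Ed d → ℂ}
    (hF : ∀ t, spN p (F t) ≠ ∞) :
    mixedNorm (ENNReal.ofReal (1 - e)⁻¹) (ENNReal.ofReal p) F = stN e p F := by
  have h1 : 0 < 1 - e := by linarith
  have h2 : 0 < (1 - e)⁻¹ := by positivity
  rw [mixedNorm, eLpNorm_eq_lintegral_rpow_enorm_toReal (by simpa using h1)
    ENNReal.ofReal_ne_top, ENNReal.toReal_ofReal h2.le, stN, one_div, inv_inv]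
  congr 2
  ext t
  rw [eLpNorm_ofReal_eq_spN _ hp, Real.enorm_of_nonneg ENNReal.toReal_nonneg,
    ENNReal.ofReal_toReal (hF t)]

end Assembly


section MixedNormBound

variable {d : ℕ} {u : ℝ → Ed d → ℂ}

theorem spExp_mul_sub_one {a e : ℝ} (h0 : 0 ≤ thetaOf d a e) (h1 : thetaOf d a e < 1) :
    spExp d a e * (((1 - thetaOf d a e) / 2)⁻¹ - 1) = ((1 - thetaOf d a e) / 2)⁻¹ := by
  have h2 : 1 - thetaOf d a e ≠ 0 := by linarith
  have h3 : 1 + thetaOf d a e ≠ 0 := by linarith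
  rw [spExp]
  field_simp
  ring

theorem mixedNorm_le_of_dual (hd : 2 ≤ d) {a e r K : ℝ} {q : ℝ≥0∞} (ha : 0 ≤ a) (he : 0 ≤ e)
    (he1 : e < 1) (hq : q⁻¹ = ENNReal.ofReal e) (hr : 2 ≤ r)
    (hρr : spExp d a e * (r - 1) = r) (hK : 0 ≤ K)
    (hm : Measurable (Function.uncurry u)) {M : ℝ} (hM : ∀ t x, ‖u t x‖ ≤ M)
    (hrad : ∀ t, IsRadial (u t))
    (hu : ∀ G : ℝ → Ed d → ℂ, SpaceTimeTest G →
      ‖∫ t, (∫ x, u t x * (starRingEnd ℂ) (G t x))‖ ≤ K * nrm a e G) :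
    mixedNorm q (ENNReal.ofReal r) u ≤ ENNReal.ofReal K := by
  simp only [mixedNorm, eLpNorm_ofReal_eq_spN _ (show 0 < r by linarith)]
  rcases he.eq_or_lt with rfl | he0
  · have hq' : q = ∞ := by simpa using hq
    rw [hq', eLpNorm_exponent_top]
    refine eLpNormEssSup_le_of_ae_enorm_bound ?_
    filter_upwards [ae_spN_le_of_dual hd ha hr hρr hK hm hM hrad hu] with t ht
    exact (enorm_toReal_le_self _).trans ht
  · have hei : 0 < e⁻¹ := by positivity
    rw [eq_ofReal_of_inv_eq he0 hq, eLpNorm_eq_lintegral_rpow_enorm_toReal (by simpa using he0)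
      ENNReal.ofReal_ne_top, ENNReal.toReal_ofReal hei.le]
    calc _ ≤ (ENNReal.ofReal (K ^ e⁻¹)) ^ (1 / e⁻¹) := by
          gcongr
          refine (lintegral_mono fun t => ?_).trans
            (lintegral_spN_rpow_le_of_dual hd ha he0 he1 hr hρr hK hm hM hrad hu)
          exact ENNReal.rpow_le_rpow (enorm_toReal_le_self _) hei.le
      _ = ENNReal.ofReal K := by
          rw [← ENNReal.ofReal_rpow_of_nonneg hK hei.le, ← ENNReal.rpow_mul,
            mul_one_div_cancel hei.ne', ENNReal.rpow_one]

end MixedNormBound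

theorem stmt3 (d : ℕ) (hd : 2 ≤ d) (s : ℝ) (hs : (d : ℝ) / (2 * d - 1) < s) (hs1 : s < 1)
    (q r tq tr tq' tr' : ℝ≥0∞) (hq : 2 ≤ q) (hr : 2 ≤ r) (htq : 2 ≤ tq) (htr : 2 ≤ tr)
    (hadm : ENNReal.ofReal (2 * s) * q⁻¹ = (d : ℝ≥0∞) * (2⁻¹ - r⁻¹))
    (hadm' : ENNReal.ofReal (2 * s) * tq⁻¹ = (d : ℝ≥0∞) * (2⁻¹ - tr⁻¹))
    (hconjq : tq⁻¹ + tq'⁻¹ = 1) (hconjr : tr⁻¹ + tr'⁻¹ = 1) :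
    ∃ C : ℝ, 0 < C ∧ ∀ F : ℝ → SchwartzMap (Ed d) ℂ,
      Continuous F → HasCompactSupport F → (∀ t : ℝ, IsRadial (⇑(F t))) →
      mixedNorm q r (fun t x => ∫ t' in (0:ℝ)..t, fprop s (t - t') (⇑(F t')) x)
        ≤ ENNReal.ofReal C * mixedNorm tq' tr' (fun t => ⇑(F t)) := by
  have hd' : (2 : ℝ) ≤ d := by exact_mod_cast hd
  have hs2 : 1 / 2 < s := by
    refine lt_trans ?_ hs
    rw [lt_div_iff₀ (by linarith)]
    linarith
  have ha0 : 0 ≤ 2 * s := by linarith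
  have had : 2 * (d : ℝ) / (2 * d - 1) < 2 * s := by
    rw [mul_div_assoc]
    linarith
  obtain ⟨he, he2, hqe, hre⟩ := admissible_exponents hd (by linarith) hq hr hadm
  obtain ⟨hte, hte2, htqe, htre⟩ := admissible_exponents hd (by linarith) htq htr hadm'
  set e := (q⁻¹).toReal
  set te := (tq⁻¹).toReal
  have hθ0 := thetaOf_nonneg (d := d) ha0 he
  have hθ1 := thetaOf_lt_one (a := 2 * s) hd (by linarith) (by linarith) he2
  have htθ1 := thetaOf_lt_one (a := 2 * s) hd (by linarith) (by linarith) hte2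
  have hp := spExp_pos (d := d) ha0 hte
  have htq' : tq' = ENNReal.ofReal (1 - te)⁻¹ := by
    refine eq_ofReal_of_inv_eq (by linarith) ?_
    rw [ENNReal.ofReal_sub _ hte, ENNReal.ofReal_one, ← htqe, ← hconjq,
      ENNReal.add_sub_cancel_left (htqe ▸ ENNReal.ofReal_ne_top)]
  have htr' : tr' = ENNReal.ofReal (spExp d (2 * s) te) := by
    rw [← inv_inv (spExp d (2 * s) te)]
    refine eq_ofReal_of_inv_eq (by positivity) ?_
    rw [← one_div (spExp _ _ _), inv_spExp, ENNReal.ofReal_sub _ (by linarith),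
      ENNReal.ofReal_one, ← htre, ← hconjr, ENNReal.add_sub_cancel_left (htre ▸ ENNReal.ofReal_ne_top)]
  obtain ⟨C, hC, h⟩ := exists_norm_integral_duhamelInt_le hd (show 1 < 2 * s by linarith)
    (by linarith) had hte hte2 he he2
  refine ⟨C, hC, fun F hFc hFs hFr => ?_⟩
  have hF := radialSource_of_schwartz hFc hFs hFr
  have hfin : ∀ t, spN (spExp d (2 * s) te) (F t) ≠ ∞ := fun t => by
    rw [← eLpNorm_ofReal_eq_spN _ hp]
    exact ((F t).memLp _ _).2.ne
  rw [htq', htr', mixedNorm_eq_stN (by linarith) hp hfin]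
  by_cases hN : stN te (spExp d (2 * s) te) (fun t => ⇑(F t)) = ∞
  · rw [hN, ENNReal.mul_top (by simpa using hC)]
    exact le_top
  have hu : (fun t x => ∫ t' in (0:ℝ)..t, fprop s (t - t') (⇑(F t')) x) =
      duhamelInt (2 * s) fun t => ⇑(F t) :=
    funext fun t => funext fun x => hF.intervalIntegral_fprop s t x
  obtain ⟨M, hM⟩ := hF.exists_norm_duhamelInt_le (2 * s)
  have hR : 2 ≤ ((1 - thetaOf d (2 * s) e) / 2)⁻¹ := by
    rw [le_inv_comm₀ (by norm_num) (by linarith)]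
    linarith
  rw [hu, eq_ofReal_of_inv_eq (by linarith) hre]
  refine (mixedNorm_le_of_dual hd ha0 he (by linarith) hqe hR (spExp_mul_sub_one hθ0 hθ1)
    (mul_nonneg hC.le ENNReal.toReal_nonneg) (hF.measurable_duhamelInt _) hM
    (hF.isRadial_duhamelInt _) fun G hG => h _ G hF hG hN).trans_eq ?_
  rw [ENNReal.ofReal_mul hC.le, ENNReal.ofReal_toReal hN]

end
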